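/- Suppose conditions (★) hold, and in addition d_1 = d_2 = ⋯ = d_n = d̄ (the degree sequence is regular). Then, as n → ∞: num(d,X) = exp( 1/4 + λ(X²−H)/((1−λ)n²) + O(n^{−b}) ); miss(d,X) = exp( λX/((1−λ)n) − λX₂/(2(1−λ)n) − λ(2−λ)X₃/(6(1−λ)²n²) + λX²/((1−λ)n²) − λH/((1−λ)n²) + O(n^{−b}) ); and hit(d,X) = exp( (1−λ)X/(λn) − (1−λ)X₂/(2λn) − (1−λ²)X₃/(6λ²n²) + (1−λ)X²/(λn²) − (1−λ)H/(λn²) + O(n^{−b}) ). -/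

import Mathlib

open Filter Finset Asymptotics MeasureTheory
open scoped Classical Topology

noncomputable section

/-- The number of simple graphs on `Fin n` with degree sequence `d` having
no edge in common with the graph `X`. -/
def gCount {n : ℕ} (d : Fin n → ℕ) (X : SimpleGraph (Fin n)) : ℕ :=
  Nat.card {H : SimpleGraph (Fin n) //
    (∀ v, Nat.card (H.neighborSet v) = d v) ∧ Disjoint H.edgeSet X.edgeSet}

/-- The degree `x_j` of vertex `j` in the graph `X`. -/
def xDeg {n : ℕ} (X : SimpleGraph (Fin n)) (j : Fin n) : ℕ :=
  Nat.card (X.neighborSet j)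

/-- The number of edges of `X`. -/
def xEdges {n : ℕ} (X : SimpleGraph (Fin n)) : ℕ := Nat.card X.edgeSet

/-- The average degree `d̄ = 2E/n`. -/
def dBar {n : ℕ} (d : Fin n → ℕ) : ℝ := (∑ j, (d j : ℝ)) / n

/-- The density `λ = d̄/(n-1)`. -/
def lamb {n : ℕ} (d : Fin n → ℕ) : ℝ := dBar d / ((n : ℝ) - 1)

/-- `A = λ(1-λ)/2`. -/
def aPar {n : ℕ} (d : Fin n → ℕ) : ℝ := lamb d * (1 - lamb d) / 2

/-- `δ_j = d_j - d̄ + λ x_j`. -/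
def deltaPar {n : ℕ} (d : Fin n → ℕ) (X : SimpleGraph (Fin n)) (j : Fin n) : ℝ :=
  (d j : ℝ) - dBar d + lamb d * (xDeg X j : ℝ)

/-- The sum over unordered pairs `{j,k}` with `X.Adj j k` of `f j * f k`. -/
def pairSum {n : ℕ} (X : SimpleGraph (Fin n)) (f : Fin n → ℝ) : ℝ :=
  (∑ j, ∑ k, if X.Adj j k then f j * f k else 0) / 2

/-- `R = Σ_j (d_j - d̄)²`. -/
def rPar {n : ℕ} (d : Fin n → ℕ) : ℝ := ∑ j, ((d j : ℝ) - dBar d)^2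

/-- The naive estimate `Ĝ(d,X)`. -/
def gHat {n : ℕ} (d : Fin n → ℕ) (X : SimpleGraph (Fin n)) : ℝ :=
  (1 - lamb d) ^ (-(xEdges X : ℝ)) *
  (lamb d ^ lamb d * (1 - lamb d) ^ (1 - lamb d)) ^ n.choose 2 *
  ∏ j, ((n - 1 - xDeg X j).choose (d j) : ℝ)

/-- `X_ℓ = Σ_j x_j^ℓ`. -/
def xPow {n : ℕ} (X : SimpleGraph (Fin n)) (ℓ : ℕ) : ℝ := ∑ j, (xDeg X j : ℝ)^ℓ

/-- `C_{ℓ,m} = Σ_j δ_j^ℓ x_j^m`. -/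
def cPar {n : ℕ} (d : Fin n → ℕ) (X : SimpleGraph (Fin n)) (ℓ m : ℕ) : ℝ :=
  ∑ j, (deltaPar d X j)^ℓ * (xDeg X j : ℝ)^m

/-- `miss(d,X) = G(d,X) / ((1-λ)^X G(d))`. -/
def missPar {n : ℕ} (d : Fin n → ℕ) (X : SimpleGraph (Fin n)) : ℝ :=
  (gCount d X : ℝ) / ((1 - lamb d) ^ xEdges X * (gCount d ⊥ : ℝ))

/-- `hit(d,X) = G(d-x,X) / (λ^X G(d))`. -/
def hitPar {n : ℕ} (d : Fin n → ℕ) (X : SimpleGraph (Fin n)) : ℝ :=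
  (gCount (fun j => d j - xDeg X j) X : ℝ) / (lamb d ^ xEdges X * (gCount d ⊥ : ℝ))

/-- `num(d,X) = G(d,X) / (√2 Ĝ(d,X))`, the exponential factor in the main theorem. -/
def numPar {n : ℕ} (d : Fin n → ℕ) (X : SimpleGraph (Fin n)) : ℝ :=
  (gCount d X : ℝ) / (Real.sqrt 2 * gHat d X)

namespace DegEnum

/-- `1 - cos θ` for the unit complex number `e = exp(iθ)`. -/
def gap (e : ℂ) : ℝ := 1 - e.re

/-- The characteristic function `1 - l + l e` of a Bernoulli variable. -/
def bern (l : ℝ) (e : ℂ) : ℂ := 1 + l * (e - 1)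

/-- The normalised increment `(e - 1) / (1 - l + l e)`. -/
def incr (l : ℝ) (e : ℂ) : ℂ := (e - 1) / bern l e

lemma unit_sq {e : ℂ} (he : ‖e‖ = 1) : e.re ^ 2 + e.im ^ 2 = 1 := by
  have h := Complex.sq_norm e
  rw [he, Complex.normSq_apply] at h
  linarith

lemma gap_nonneg {e : ℂ} (he : ‖e‖ = 1) : 0 ≤ gap e := by
  unfold gap; nlinarith [unit_sq he, sq_nonneg e.im]

lemma gap_le_two {e : ℂ} (he : ‖e‖ = 1) : gap e ≤ 2 := by
  unfold gap; nlinarith [unit_sq he, sq_nonneg e.im]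

lemma norm_sub_one_sq {e : ℂ} (he : ‖e‖ = 1) : ‖e - 1‖ ^ 2 = 2 * gap e := by
  rw [Complex.sq_norm, Complex.normSq_apply]
  simp only [Complex.sub_re, Complex.sub_im, Complex.one_re, Complex.one_im, gap]
  linarith [unit_sq he]

lemma norm_bern_sq (l : ℝ) {e : ℂ} (he : ‖e‖ = 1) :
    ‖bern l e‖ ^ 2 = 1 - 2 * (l * (1 - l)) * gap e := by
  rw [Complex.sq_norm, Complex.normSq_apply]
  simp only [bern, gap, Complex.add_re, Complex.add_im, Complex.mul_re, Complex.mul_im,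
    Complex.sub_re, Complex.sub_im, Complex.one_re, Complex.one_im, Complex.ofReal_re,
    Complex.ofReal_im]
  linear_combination l ^ 2 * unit_sq he

lemma norm_bern_le (l : ℝ) {e : ℂ} (he : ‖e‖ = 1) :
    ‖bern l e‖ ≤ Real.exp (-(l * (1 - l) * gap e)) := by
  refine (sq_le_sq₀ (norm_nonneg _) (Real.exp_nonneg _)).1 ?_
  rw [norm_bern_sq l he, ← Real.exp_nat_mul]
  have := Real.add_one_le_exp (((2 : ℕ) : ℝ) * (-(l * (1 - l) * gap e)))
  push_cast at this ⊢
  linarith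

lemma norm_bern_pow_le (l : ℝ) {e : ℂ} (he : ‖e‖ = 1) (N : ℕ) :
    ‖bern l e ^ N‖ ≤ Real.exp (-(N * (l * (1 - l)) * gap e)) := by
  rw [norm_pow]
  refine (pow_le_pow_left₀ (norm_nonneg _) (norm_bern_le l he) N).trans ?_
  rw [← Real.exp_nat_mul]
  apply le_of_eq; congr 1; ring

lemma quarter (l : ℝ) : l * (1 - l) ≤ 1 / 4 := by nlinarith [sq_nonneg (l - 1 / 2)]

lemma half_le_norm_bern_sq (l : ℝ) {e : ℂ} (hc : 0 ≤ gap e) (h1 : gap e ≤ 1) :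
    1 / 2 ≤ 1 - 2 * (l * (1 - l)) * gap e := by
  nlinarith [quarter l]

lemma bern_ne_zero (l : ℝ) {e : ℂ} (he : ‖e‖ = 1) (h1 : gap e ≤ 1) : bern l e ≠ 0 := by
  intro h
  have := norm_bern_sq l he
  rw [h] at this
  have := half_le_norm_bern_sq l (gap_nonneg he) h1
  simp at *; linarith

lemma norm_incr_sq (l : ℝ) {e : ℂ} (he : ‖e‖ = 1) :
    ‖incr l e‖ ^ 2 = 2 * gap e / (1 - 2 * (l * (1 - l)) * gap e) := by
  rw [incr, norm_div, div_pow, norm_sub_one_sq he, norm_bern_sq l he]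

lemma norm_incr_sq_le (l : ℝ) {e : ℂ} (he : ‖e‖ = 1) (h1 : gap e ≤ 1) :
    ‖incr l e‖ ^ 2 ≤ 4 * gap e := by
  have h0 := gap_nonneg he
  have := half_le_norm_bern_sq l h0 h1
  rw [norm_incr_sq l he, div_le_iff₀ (by linarith)]
  nlinarith

lemma incr_eq (l : ℝ) {e : ℂ} (he : ‖e‖ = 1) :
    incr l e = ((-(1 - 2 * l) * gap e / (1 - 2 * (l * (1 - l)) * gap e) : ℝ) : ℂ) +
      ((e.im / (1 - 2 * (l * (1 - l)) * gap e) : ℝ) : ℂ) * Complex.I := by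
  have key : incr l e = (e - 1) * (starRingEnd ℂ) (bern l e) / ((‖bern l e‖ ^ 2 : ℝ) : ℂ) := by
    by_cases h : bern l e = 0
    · simp [incr, h]
    · have h2 : (starRingEnd ℂ) (bern l e) ≠ 0 := by simpa using h
      have h3 : ((‖bern l e‖ ^ 2 : ℝ) : ℂ) = bern l e * (starRingEnd ℂ) (bern l e) := by
        rw [Complex.mul_conj, Complex.normSq_eq_norm_sq]
      rw [h3, incr]; field_simp
  have h4 : (e - 1) * (starRingEnd ℂ) (bern l e) =
      ((-(1 - 2 * l) * gap e : ℝ) : ℂ) + ((e.im : ℝ) : ℂ) * Complex.I := by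
    have := unit_sq he
    apply Complex.ext
    · simp [bern, gap]
      linear_combination l * this
    · simp [bern, gap]; ring
  rw [key, h4, norm_bern_sq l he]
  push_cast
  ring

lemma incr_re (l : ℝ) {e : ℂ} (he : ‖e‖ = 1) :
    (incr l e).re = -(1 - 2 * l) * gap e / (1 - 2 * (l * (1 - l)) * gap e) := by
  rw [incr_eq l he]; simp [-Complex.ofReal_div]

lemma abs_incr_re_le' {l : ℝ} (hl0 : 0 ≤ l) (hl1 : l ≤ 1) {e : ℂ} (he : ‖e‖ = 1)
    (h1 : gap e ≤ 1) : |(incr l e).re| ≤ gap e / (1 - 2 * (l * (1 - l)) * gap e) := by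
  have h0 := gap_nonneg he
  have := half_le_norm_bern_sq l h0 h1
  rw [incr_re l he, abs_div, abs_of_pos (show 0 < 1 - 2 * (l * (1 - l)) * gap e by linarith)]
  gcongr
  rw [abs_mul, abs_of_nonneg h0, abs_neg]
  have : |1 - 2 * l| ≤ 1 := abs_le.2 ⟨by linarith, by linarith⟩
  nlinarith

lemma abs_incr_re_le {l : ℝ} (hl0 : 0 ≤ l) (hl1 : l ≤ 1) {e : ℂ} (he : ‖e‖ = 1)
    (h1 : gap e ≤ 1) : |(incr l e).re| ≤ 2 * gap e := by
  have h0 := gap_nonneg he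
  have := half_le_norm_bern_sq l h0 h1
  refine (abs_incr_re_le' hl0 hl1 he h1).trans ?_
  rw [div_le_iff₀ (by linarith)]
  nlinarith

lemma norm_incr_sq_add_le {l : ℝ} (hl0 : 0 ≤ l) (hl1 : l ≤ 1) {e : ℂ} (he : ‖e‖ = 1)
    (h1 : gap e ≤ 1) : ‖incr l e ^ 2 + 2 * gap e‖ ≤ 18 * (gap e * Real.sqrt (gap e)) := by
  have h0 := gap_nonneg he
  have hD := half_le_norm_bern_sq l h0 h1
  set x := (incr l e).re
  set y := (incr l e).im
  set s := Real.sqrt (gap e)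
  have hs : s ^ 2 = gap e := Real.sq_sqrt h0
  have hs0 : 0 ≤ s := Real.sqrt_nonneg _
  have hs1 : s ≤ 1 := Real.sqrt_le_one.2 h1
  have hx : |x| ≤ 2 * gap e := abs_incr_re_le hl0 hl1 he h1
  have hn : ‖incr l e‖ ^ 2 = x ^ 2 + y ^ 2 := by
    rw [Complex.sq_norm, Complex.normSq_apply]; ring
  have hy : |y| ≤ 2 * s := by
    refine abs_le_of_sq_le_sq ?_ (by positivity)
    have := norm_incr_sq_le l he h1
    nlinarith [sq_nonneg x]
  have e1 : incr l e ^ 2 + 2 * gap e =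
      ((2 * x ^ 2 - (‖incr l e‖ ^ 2 - 2 * gap e) : ℝ) : ℂ) + ((2 * x * y : ℝ) : ℂ) * Complex.I := by
    have : incr l e = (x : ℂ) + (y : ℂ) * Complex.I := (Complex.re_add_im _).symm
    rw [hn]
    nth_rewrite 1 [this]
    push_cast
    linear_combination (y : ℂ) ^ 2 * Complex.I_sq
  have hd : |‖incr l e‖ ^ 2 - 2 * gap e| ≤ 2 * gap e ^ 2 := by
    rw [norm_incr_sq l he]
    have : 2 * gap e / (1 - 2 * (l * (1 - l)) * gap e) - 2 * gap e =
        4 * (l * (1 - l)) * gap e ^ 2 / (1 - 2 * (l * (1 - l)) * gap e) := by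
      have : 1 - 2 * (l * (1 - l)) * gap e ≠ 0 := by linarith
      rw [eq_div_iff this, sub_mul, div_mul_cancel₀ _ this]; ring
    have hl : 0 ≤ l * (1 - l) := mul_nonneg hl0 (by linarith)
    rw [this, abs_of_nonneg (div_nonneg (by positivity) (by linarith)), div_le_iff₀ (by linarith)]
    nlinarith [quarter l, sq_nonneg (gap e)]
  rw [e1]
  refine (norm_add_le _ _).trans ?_
  rw [norm_mul, Complex.norm_I, Complex.norm_real, Complex.norm_real, mul_one, Real.norm_eq_abs,
    Real.norm_eq_abs]
  have h3 : |2 * x ^ 2 - (‖incr l e‖ ^ 2 - 2 * gap e)| ≤ 10 * gap e ^ 2 := by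
    refine (abs_sub _ _).trans ?_
    rw [abs_of_nonneg (by positivity)]
    have : x ^ 2 ≤ (2 * gap e) ^ 2 := sq_le_sq' (abs_le.1 hx).1 (abs_le.1 hx).2
    nlinarith
  have h4 : |2 * x * y| ≤ 8 * (gap e * s) := by
    rw [abs_mul, abs_mul, abs_two]
    have := mul_le_mul hx hy (abs_nonneg _) (by positivity)
    linarith
  have h5 : gap e ^ 2 ≤ gap e * s := by
    rw [← hs]; have := mul_le_mul_of_nonneg_left hs1 (pow_nonneg hs0 3); nlinarith
  linarith

lemma incr_conj (l : ℝ) (e : ℂ) :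
    incr l ((starRingEnd ℂ) e) = (starRingEnd ℂ) (incr l e) := by
  simp [incr, bern]

lemma gap_conj (e : ℂ) : gap ((starRingEnd ℂ) e) = gap e := by simp [gap]

/-- The factor attached to a pair in the modified generating function; `s` plays the role of
`√(p(1-p))`. -/
lemma pair_identity {l l' p s : ℝ} (hs : s ^ 2 = p * (1 - p)) (hp : p ≠ 0) (hp1 : 1 - p ≠ 0)
    (e e' : ℂ) (hA : bern l e ≠ 0) (hA' : bern l' e' ≠ 0) :
    bern l e * bern l' e' * (1 + (((l - p) / s : ℝ) + ((l * (1 - l) / s : ℝ) : ℂ) * incr l e) *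
      (((l' - p) / s : ℝ) + ((l' * (1 - l') / s : ℝ) : ℂ) * incr l' e')) =
    (((1 - l) * (1 - l') / (1 - p) : ℝ) : ℂ) + ((l * l' / p : ℝ) : ℂ) * (e * e') := by
  have hs0 : s ≠ 0 := by
    rintro rfl
    exact mul_ne_zero hp hp1 (by rw [← hs]; ring)
  have key : ∀ (l : ℝ) (e : ℂ), bern l e ≠ 0 →
      bern l e * (((l - p) / s : ℝ) + ((l * (1 - l) / s : ℝ) : ℂ) * incr l e) =
      (l * (1 - p) * e - p * (1 - l)) / s := by
    intro l e h
    have hs0' : (s : ℂ) ≠ 0 := by exact_mod_cast hs0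
    rw [incr]; push_cast; field_simp; rw [bern]; ring
  have h1 := key l e hA
  have h2 := key l' e' hA'
  have hsC : (s : ℂ) ^ 2 = p * (1 - p) := by exact_mod_cast hs
  have hpC : (p : ℂ) ≠ 0 := by exact_mod_cast hp
  have hp1C : (1 - p : ℂ) ≠ 0 := by exact_mod_cast hp1
  have hs0' : (s : ℂ) ≠ 0 := by exact_mod_cast hs0
  calc _ = bern l e * bern l' e' + (bern l e * (((l - p) / s : ℝ) +
        ((l * (1 - l) / s : ℝ) : ℂ) * incr l e)) * (bern l' e' * (((l' - p) / s : ℝ) +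
        ((l' * (1 - l') / s : ℝ) : ℂ) * incr l' e')) := by ring
    _ = _ := by
      rw [h1, h2, bern, bern]
      push_cast
      rw [div_mul_div_comm, ← sq, hsC]
      field_simp
      ring

/-- Average of a function over a finite type. -/
def avg {ι K : Type*} [Fintype ι] [Field K] (f : ι → K) : K :=
  (∑ i, f i) / (Fintype.card ι : K)

section avg

variable {ι : Type*} [Fintype ι]

lemma avg_add {K : Type*} [Field K] (f g : ι → K) :
    avg (fun i => f i + g i) = avg f + avg g := by
  simp [avg, sum_add_distrib, add_div]

lemma avg_sub {K : Type*} [Field K] (f g : ι → K) :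
    avg (fun i => f i - g i) = avg f - avg g := by
  simp [avg, sum_sub_distrib, sub_div]

lemma avg_const_mul {K : Type*} [Field K] (c : K) (f : ι → K) :
    avg (fun i => c * f i) = c * avg f := by
  simp [avg, ← mul_sum, mul_div_assoc]

lemma avg_mul_const {K : Type*} [Field K] (c : K) (f : ι → K) :
    avg (fun i => f i * c) = avg f * c := by
  simp [avg, ← sum_mul, div_mul_eq_mul_div]

lemma avg_const {K : Type*} [Field K] [CharZero K] [Nonempty ι] (c : K) :
    avg (fun _ : ι => c) = c := by
  have : (Fintype.card ι : K) ≠ 0 := by exact_mod_cast Fintype.card_ne_zero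
  simp [avg]

lemma avg_sum {κ K : Type*} [Field K] (s : Finset κ) (f : κ → ι → K) :
    avg (fun i => ∑ k ∈ s, f k i) = ∑ k ∈ s, avg (f k) := by
  simp only [avg]
  rw [sum_comm, sum_div]

lemma avg_equiv {K : Type*} [Field K] (σ : ι ≃ ι) (f : ι → K) :
    avg (fun i => f (σ i)) = avg f := by
  simp only [avg]; rw [Equiv.sum_comp σ f]

lemma avg_mono {f g : ι → ℝ} (h : ∀ i, f i ≤ g i) : avg f ≤ avg g := by
  unfold avg
  gcongr with i
  exact h i

lemma avg_nonneg {f : ι → ℝ} (h : ∀ i, 0 ≤ f i) : 0 ≤ avg f := by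
  unfold avg
  exact div_nonneg (sum_nonneg fun i _ => h i) (by positivity)

lemma norm_avg_le (f : ι → ℂ) : ‖avg f‖ ≤ avg (fun i => ‖f i‖) := by
  unfold avg
  rw [norm_div, Complex.norm_natCast]
  gcongr
  exact norm_sum_le _ _

lemma avg_prod {K : Type*} [Field K] {n : ℕ} (f : Fin n → ι → K) :
    avg (fun θ : Fin n → ι => ∏ j, f j (θ j)) = ∏ j, avg (f j) := by
  simp only [avg, prod_div_distrib, prod_const, Fintype.card_fun, card_univ, Fintype.card_fin]
  rw [Finset.prod_univ_sum, Fintype.piFinset_univ]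
  push_cast
  rfl

end avg

/-- The values of the standard additive character, `exp (2πil/M)`. -/
def root {M : ℕ} [NeZero M] (l : ZMod M) : ℂ := ZMod.stdAddChar l

section root

variable {M : ℕ} [NeZero M]

lemma norm_root (l : ZMod M) : ‖root l‖ = 1 := by
  simp [root]

lemma root_ne_zero (l : ZMod M) : root l ≠ 0 := by
  intro h; have := norm_root l; simp [h] at this

lemma root_inv (l : ZMod M) : (root l)⁻¹ = (starRingEnd ℂ) (root l) := by
  rw [Complex.inv_def, Complex.normSq_eq_norm_sq, norm_root]; simp

lemma root_neg (l : ZMod M) : root (-l) = (starRingEnd ℂ) (root l) := by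
  rw [← root_inv, root, root, AddChar.map_neg_eq_inv]

lemma root_add (l l' : ZMod M) : root (l + l') = root l * root l' := by
  simp [root, AddChar.map_add_eq_mul]

lemma avg_root_pow {k d : ℕ} (hk : k < M) (hd : d < M) :
    avg (fun l : ZMod M => root l ^ k * (root l)⁻¹ ^ d) = if k = d then 1 else 0 := by
  have h1 : ∀ l : ZMod M, root l ^ k * (root l)⁻¹ ^ d =
      ZMod.stdAddChar (l * ((k : ZMod M) - (d : ZMod M))) := by
    intro l
    have e1 : l * ((k : ZMod M) - (d : ZMod M)) = k • l - d • l := by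
      simp [nsmul_eq_mul]; ring
    rw [e1, AddChar.map_sub_eq_div, AddChar.map_nsmul_eq_pow, AddChar.map_nsmul_eq_pow,
      inv_pow, div_eq_mul_inv]
    rfl
  simp only [h1, avg]
  have h2 := AddChar.sum_mulShift (ψ := (ZMod.stdAddChar : AddChar (ZMod M) ℂ))
    ((k : ZMod M) - (d : ZMod M)) (ZMod.isPrimitive_stdAddChar M)
  rw [h2]
  have h3 : ((k : ZMod M) - (d : ZMod M) = 0) ↔ k = d := by
    rw [sub_eq_zero, ZMod.natCast_eq_natCast_iff']
    rw [Nat.mod_eq_of_lt hk, Nat.mod_eq_of_lt hd]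
  simp only [h3]
  split_ifs
  · simp
  · simp

/-- The binomial weight. -/
def binW (N : ℕ) (l : ℝ) (d : ℕ) : ℝ := N.choose d * l ^ d * (1 - l) ^ (N - d)

lemma avg_bern_pow (N d : ℕ) (l : ℝ) (hN : N < M) (hd : d < M) :
    avg (fun θ : ZMod M => bern l (root θ) ^ N * (root θ)⁻¹ ^ d) = (binW N l d : ℂ) := by
  have h1 : ∀ θ : ZMod M, bern l (root θ) ^ N * (root θ)⁻¹ ^ d =
      ∑ k ∈ range (N + 1), (binW N l k : ℂ) * (root θ ^ k * (root θ)⁻¹ ^ d) := by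
    intro θ
    have : bern l (root θ) = l * root θ + (1 - l) := by rw [bern]; ring
    rw [this, add_pow, sum_mul]
    refine sum_congr rfl fun k _ => ?_
    simp only [binW]; push_cast; ring
  simp only [h1]
  rw [avg_sum]
  have h2 : ∀ k ∈ range (N + 1), avg (fun θ : ZMod M => (binW N l k : ℂ) *
      (root θ ^ k * (root θ)⁻¹ ^ d)) = if k = d then (binW N l d : ℂ) else 0 := by
    intro k hk
    rw [avg_const_mul, avg_root_pow (by simp at hk; omega) hd]
    split_ifs with h <;> simp [h]
  rw [sum_congr rfl h2, sum_ite_eq']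
  split_ifs with h
  · rfl
  · have : N < d := by simpa using h
    simp [binW, Nat.choose_eq_zero_of_lt this]

lemma bern_pow_mul_incr (l : ℝ) (e : ℂ) (N : ℕ) :
    bern l e ^ (N + 2) * incr l e = bern l e ^ (N + 1) * (e - 1) := by
  by_cases h : bern l e = 0
  · simp [h]
  · rw [incr]; field_simp; ring

lemma bern_pow_mul_incr_sq (l : ℝ) (e : ℂ) (N : ℕ) :
    bern l e ^ (N + 3) * incr l e ^ 2 = bern l e ^ (N + 1) * (e - 1) ^ 2 := by
  by_cases h : bern l e = 0
  · simp [h]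
  · rw [incr]; field_simp; ring

lemma cast_choose' (a b : ℕ) : (((a + b).choose a : ℕ) : ℝ) = (a + b).factorial /
    (a.factorial * b.factorial) := by
  rw [Nat.cast_add_choose]

/-- The first moment of the increment vanishes at the mean. -/
lemma avg_incr (D F : ℕ) (l : ℝ) (hl : l * (D + F + 4 : ℕ) = (D + 2 : ℕ)) (hM : D + F + 4 < M) :
    avg (fun θ : ZMod M => bern l (root θ) ^ (D + F + 4) * (root θ)⁻¹ ^ (D + 2) *
      incr l (root θ)) = 0 := by
  have h1 : ∀ θ : ZMod M, bern l (root θ) ^ (D + F + 4) * (root θ)⁻¹ ^ (D + 2) *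
      incr l (root θ) = bern l (root θ) ^ (D + F + 3) * (root θ)⁻¹ ^ (D + 1) -
        bern l (root θ) ^ (D + F + 3) * (root θ)⁻¹ ^ (D + 2) := by
    intro θ
    have := bern_pow_mul_incr l (root θ) (D + F + 2)
    rw [mul_right_comm, this]
    have h0 := mul_inv_cancel₀ (root_ne_zero θ)
    linear_combination bern l (root θ) ^ (D + F + 3) * (root θ)⁻¹ ^ (D + 1) * h0
  simp only [h1]
  rw [avg_sub, avg_bern_pow _ _ _ (by omega) (by omega), avg_bern_pow _ _ _ (by omega) (by omega),
    ← Complex.ofReal_sub]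
  norm_cast
  have e1 : D + F + 3 - (D + 1) = F + 2 := by omega
  have e2 : D + F + 3 - (D + 2) = F + 1 := by omega
  have e3 : D + F + 3 = (D + 1) + (F + 2) := by omega
  have e4 : D + F + 3 = (D + 2) + (F + 1) := by omega
  have c1 : ((D + F + 3).choose (D + 1) : ℝ) = (D + F + 3).factorial /
    ((D + 1).factorial * (F + 2).factorial) := by rw [e3, cast_choose']
  have c2 : ((D + F + 3).choose (D + 2) : ℝ) = (D + F + 3).factorial /
    ((D + 2).factorial * (F + 1).factorial) := by rw [e4, cast_choose']
  have hl' : l = (D + 2) / (D + F + 4) := by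
    push_cast at hl; rw [eq_div_iff (by positivity), hl]
  have hl1 : 1 - l = (F + 2) / (D + F + 4) := by rw [hl']; field_simp; ring
  simp only [binW, e1, e2, c1, c2, pow_succ, Nat.factorial_succ]
  rw [hl1]
  generalize ((F + 2 : ℝ) / (D + F + 4)) ^ F = R
  generalize l ^ D = L
  rw [hl']
  push_cast
  have := Nat.factorial_pos D
  have := Nat.factorial_pos F
  field_simp
  ring

/-- The second moment of the increment. -/
lemma avg_incr_sq (D F : ℕ) (l : ℝ) (hl : l * (D + F + 4 : ℕ) = (D + 2 : ℕ))
    (hM : D + F + 4 < M) :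
    avg (fun θ : ZMod M => bern l (root θ) ^ (D + F + 4) * (root θ)⁻¹ ^ (D + 2) *
      incr l (root θ) ^ 2) =
      ((-(binW (D + F + 4) l (D + 2)) / (l * (1 - l) * (D + F + 3 : ℕ)) : ℝ) : ℂ) := by
  have h1 : ∀ θ : ZMod M, bern l (root θ) ^ (D + F + 4) * (root θ)⁻¹ ^ (D + 2) *
      incr l (root θ) ^ 2 = bern l (root θ) ^ (D + F + 2) * (root θ)⁻¹ ^ D -
        2 * (bern l (root θ) ^ (D + F + 2) * (root θ)⁻¹ ^ (D + 1)) +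
        bern l (root θ) ^ (D + F + 2) * (root θ)⁻¹ ^ (D + 2) := by
    intro θ
    have := bern_pow_mul_incr_sq l (root θ) (D + F + 1)
    rw [mul_right_comm, this]
    have h0 := mul_inv_cancel₀ (root_ne_zero θ)
    linear_combination bern l (root θ) ^ (D + F + 2) * (root θ)⁻¹ ^ D *
      (root θ * (root θ)⁻¹ + 1 - 2 * (root θ)⁻¹) * h0
  simp only [h1]
  rw [avg_add, avg_sub, avg_const_mul, avg_bern_pow _ _ _ (by omega) (by omega),
    avg_bern_pow _ _ _ (by omega) (by omega), avg_bern_pow _ _ _ (by omega) (by omega)]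
  norm_cast
  have e1 : D + F + 2 - D = F + 2 := by omega
  have e2 : D + F + 2 - (D + 1) = F + 1 := by omega
  have e3 : D + F + 2 - (D + 2) = F := by omega
  have e4 : D + F + 4 - (D + 2) = F + 2 := by omega
  have c1 : ((D + F + 2).choose D : ℝ) = (D + F + 2).factorial /
    (D.factorial * (F + 2).factorial) := by rw [show D + F + 2 = D + (F + 2) by omega, cast_choose']
  have c2 : ((D + F + 2).choose (D + 1) : ℝ) = (D + F + 2).factorial /
    ((D + 1).factorial * (F + 1).factorial) := by
    rw [show D + F + 2 = (D + 1) + (F + 1) by omega, cast_choose']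
  have c3 : ((D + F + 2).choose (D + 2) : ℝ) = (D + F + 2).factorial /
    ((D + 2).factorial * F.factorial) := by rw [show D + F + 2 = (D + 2) + F by omega, cast_choose']
  have c4 : ((D + F + 4).choose (D + 2) : ℝ) = (D + F + 4).factorial /
    ((D + 2).factorial * (F + 2).factorial) := by
    rw [show D + F + 4 = (D + 2) + (F + 2) by omega, cast_choose']
  have hl' : l = (D + 2) / (D + F + 4) := by
    push_cast at hl; rw [eq_div_iff (by positivity), hl]
  have hl1 : 1 - l = (F + 2) / (D + F + 4) := by rw [hl']; field_simp; ring
  simp only [binW, e1, e2, e3, e4, c1, c2, c3, c4, pow_succ, Nat.factorial_succ]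
  rw [hl1]
  generalize ((F + 2 : ℝ) / (D + F + 4)) ^ F = R
  generalize l ^ D = L
  rw [hl']
  push_cast
  have := Nat.factorial_pos D
  have := Nat.factorial_pos F
  field_simp
  ring

end root

section pairs

variable {n : ℕ}

/-- The edges of a graph, as increasing ordered pairs. -/
def prs (H : SimpleGraph (Fin n)) : Finset (Fin n × Fin n) :=
  univ.filter fun p => p.1 < p.2 ∧ H.Adj p.1 p.2

lemma mem_prs {H : SimpleGraph (Fin n)} {p : Fin n × Fin n} :
    p ∈ prs H ↔ p.1 < p.2 ∧ H.Adj p.1 p.2 := by simp [prs]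

lemma xDeg_eq (H : SimpleGraph (Fin n)) (j : Fin n) :
    xDeg H j = (univ.filter fun k => H.Adj j k).card := by
  rw [xDeg, Nat.card_eq_fintype_card, ← Set.toFinset_card]
  congr 1; ext k; simp

lemma sum_prs_add {A : Type*} [AddCommMonoid A] (H : SimpleGraph (Fin n))
    (g : Fin n → Fin n → A) :
    ∑ p ∈ prs H, (g p.1 p.2 + g p.2 p.1) = ∑ j, ∑ k, if H.Adj j k then g j k else 0 := by
  rw [sum_add_distrib]
  have h1 : ∑ p ∈ prs H, g p.1 p.2 = ∑ j, ∑ k, if j < k ∧ H.Adj j k then g j k else 0 := by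
    rw [prs, sum_filter, Fintype.sum_prod_type]
  have h2 : ∑ p ∈ prs H, g p.2 p.1 = ∑ j, ∑ k, if k < j ∧ H.Adj j k then g j k else 0 := by
    rw [prs, sum_filter, Fintype.sum_prod_type, sum_comm]
    simp only [H.adj_comm]
  rw [h1, h2, ← sum_add_distrib]
  refine sum_congr rfl fun j _ => ?_
  rw [← sum_add_distrib]
  refine sum_congr rfl fun k _ => ?_
  by_cases h : H.Adj j k
  · rcases lt_trichotomy j k with hlt | rfl | hlt
    · simp [h, hlt, hlt.not_gt]
    · exact absurd h (H.loopless.irrefl j)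
    · simp [h, hlt, hlt.not_gt]
  · simp [h]

lemma prod_prs {A : Type*} [CommMonoid A] (H : SimpleGraph (Fin n)) (f : Fin n → A) :
    ∏ p ∈ prs H, (f p.1 * f p.2) = ∏ j, f j ^ xDeg H j := by
  have := sum_prs_add (A := Additive A) H (fun j _ => Additive.ofMul (f j))
  have h2 : ∏ p ∈ prs H, (f p.1 * f p.2) = ∏ j, ∏ k, if H.Adj j k then f j else 1 := this
  rw [h2]
  refine prod_congr rfl fun j _ => ?_
  rw [xDeg_eq, ← prod_filter, prod_const]

lemma sum_prs_symm (H : SimpleGraph (Fin n)) (f : Fin n → ℝ) :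
    ∑ p ∈ prs H, (f p.1 + f p.2) = ∑ j, xDeg H j * f j := by
  rw [sum_prs_add H (fun j _ => f j)]
  refine sum_congr rfl fun j _ => ?_
  rw [← sum_filter, sum_const, ← xDeg_eq, nsmul_eq_mul]

lemma sum_prs_mul {A : Type*} [CommRing A] (H : SimpleGraph (Fin n)) (f : Fin n → A) :
    2 * ∑ p ∈ prs H, f p.1 * f p.2 = ∑ j, ∑ k, if H.Adj j k then f j * f k else 0 := by
  rw [← sum_prs_add H (fun j k => f j * f k), mul_sum]
  refine sum_congr rfl fun p _ => ?_
  ring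

lemma card_prs (H : SimpleGraph (Fin n)) : 2 * (prs H).card = ∑ j, xDeg H j := by
  have := sum_prs_add (A := ℕ) H (fun _ _ => 1)
  simp only [sum_const, smul_eq_mul] at this
  rw [mul_comm, this]
  refine sum_congr rfl fun j _ => ?_
  rw [xDeg_eq, card_filter]

lemma xEdges_eq (H : SimpleGraph (Fin n)) : xEdges H = (prs H).card := by
  have h1 : xEdges H = H.edgeFinset.card := by
    rw [xEdges, Nat.card_eq_fintype_card, SimpleGraph.edgeFinset_card]
  have h2 := H.sum_degrees_eq_twice_card_edges
  have h3 : ∀ j, H.degree j = xDeg H j := by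
    intro j; rw [xDeg, Nat.card_eq_fintype_card, SimpleGraph.card_neighborSet_eq_degree]
  simp only [h3] at h2
  have h4 := card_prs H
  omega

lemma xDeg_compl (X : SimpleGraph (Fin n)) (j : Fin n) : xDeg Xᶜ j = n - 1 - xDeg X j := by
  have h3 : ∀ (H : SimpleGraph (Fin n)) j, xDeg H j = H.degree j := by
    intro H j; rw [xDeg, Nat.card_eq_fintype_card, SimpleGraph.card_neighborSet_eq_degree]
  rw [h3, h3]
  have := SimpleGraph.degree_compl X j
  rw [Fintype.card_fin] at this
  rw [← this]
  congr!

/-- The graph with the given set of pairs as edges. -/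
def ofPrs (T : Finset (Fin n × Fin n)) : SimpleGraph (Fin n) :=
  SimpleGraph.fromRel fun j k => (j, k) ∈ T

lemma prs_ofPrs {T : Finset (Fin n × Fin n)} (hT : ∀ p ∈ T, p.1 < p.2) : prs (ofPrs T) = T := by
  ext ⟨j, k⟩
  simp only [mem_prs, ofPrs, SimpleGraph.fromRel_adj]
  constructor
  · rintro ⟨h1, _, h | h⟩
    · exact h
    · exact absurd (hT _ h) h1.not_gt
  · intro h
    have := hT _ h
    exact ⟨this, this.ne, Or.inl h⟩

lemma ofPrs_prs (H : SimpleGraph (Fin n)) : ofPrs (prs H) = H := by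
  ext j k
  simp only [mem_prs, ofPrs, SimpleGraph.fromRel_adj]
  constructor
  · rintro ⟨_, ⟨_, h⟩ | ⟨_, h⟩⟩
    · exact h
    · exact h.symm
  · intro h
    refine ⟨h.ne, ?_⟩
    rcases lt_or_gt_of_ne h.ne with hl | hl
    · exact Or.inl ⟨hl, h⟩
    · exact Or.inr ⟨hl, h.symm⟩

lemma prs_subset_compl {H X : SimpleGraph (Fin n)} :
    prs H ⊆ prs Xᶜ ↔ Disjoint H.edgeSet X.edgeSet := by
  rw [SimpleGraph.disjoint_edgeSet]
  rw [← le_compl_iff_disjoint_right]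
  constructor
  · intro h j k hjk
    rcases lt_or_gt_of_ne hjk.ne with hl | hl
    · exact (mem_prs.1 (h ((mem_prs (p := (j, k))).2 ⟨hl, hjk⟩))).2
    · exact ((mem_prs.1 (h ((mem_prs (p := (k, j))).2 ⟨hl, hjk.symm⟩))).2).symm
  · intro h p hp
    rw [mem_prs] at hp ⊢
    exact ⟨hp.1, h hp.2⟩

lemma gCount_eq (d : Fin n → ℕ) (X : SimpleGraph (Fin n)) :
    gCount d X = ((prs Xᶜ).powerset.filter fun T => ∀ j, xDeg (ofPrs T) j = d j).card := by
  rw [gCount, Nat.card_eq_fintype_card, ← Fintype.card_coe]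
  refine Fintype.card_congr ⟨fun H => ⟨prs H.1, ?_⟩, fun T => ⟨ofPrs T.1, ?_⟩, ?_, ?_⟩
  · simp only [mem_filter, mem_powerset, ofPrs_prs]
    exact ⟨prs_subset_compl.2 H.2.2, H.2.1⟩
  · have h := T.2
    simp only [mem_filter, mem_powerset] at h
    refine ⟨h.2, prs_subset_compl.1 ?_⟩
    rw [prs_ofPrs]
    · exact h.1
    · exact fun p hp => (mem_prs.1 (h.1 hp)).1
  · intro H; exact Subtype.ext (ofPrs_prs H.1)
  · intro T
    have h := T.2
    simp only [mem_filter, mem_powerset] at h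
    apply Subtype.ext
    exact prs_ofPrs fun p hp => (mem_prs.1 (h.1 hp)).1

/-- The Fourier-inversion formula for the number of graphs. -/
lemma avg_gen_fun {M : ℕ} [NeZero M] (hM : n < M) (d : Fin n → ℕ) (X : SimpleGraph (Fin n))
    (hd : ∀ j, d j < M) (a b : Fin n → ℂ) :
    avg (fun θ : Fin n → ZMod M =>
      (∏ p ∈ prs Xᶜ, (a p.1 * a p.2 + b p.1 * b p.2 * (root (θ p.1) * root (θ p.2)))) *
        ∏ j, (root (θ j))⁻¹ ^ d j) =
    gCount d X * ∏ j, (a j ^ (n - 1 - xDeg X j - d j) * b j ^ d j) := by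
  have hdeg : ∀ T ∈ (prs Xᶜ).powerset, ∀ f : Fin n → ℂ,
      ∏ p ∈ T, (f p.1 * f p.2) = ∏ j, f j ^ xDeg (ofPrs T) j := by
    intro T hT f
    rw [← prod_prs, prs_ofPrs fun p hp => (mem_prs.1 ((mem_powerset.1 hT) hp)).1]
  have hsum : ∀ T ∈ (prs Xᶜ).powerset, ∀ j,
      xDeg (ofPrs T) j + xDeg (ofPrs (prs Xᶜ \ T)) j = n - 1 - xDeg X j := by
    intro T hT j
    rw [← xDeg_compl, xDeg_eq, xDeg_eq, xDeg_eq, ← card_union_of_disjoint]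
    · congr 1
      ext k
      simp only [mem_union, mem_filter, mem_univ, true_and]
      have hT' := mem_powerset.1 hT
      constructor
      · rintro (h | h) <;>
        · simp only [ofPrs, SimpleGraph.fromRel_adj] at h
          obtain ⟨_, h | h⟩ := h
          · first
            | exact (mem_prs.1 (hT' h)).2
            | exact (mem_prs.1 (Finset.mem_sdiff.1 h).1).2
          · first
            | exact (mem_prs.1 (hT' h)).2.symm
            | exact (mem_prs.1 (Finset.mem_sdiff.1 h).1).2.symm
      · intro h
        have h' : (ofPrs (prs Xᶜ)).Adj j k := by rw [ofPrs_prs]; exact h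
        simp only [ofPrs, SimpleGraph.fromRel_adj] at h' ⊢
        simp only [Finset.mem_sdiff]
        tauto
    · rw [disjoint_left]
      intro k h1 h2
      simp only [mem_filter, mem_univ, true_and, ofPrs, SimpleGraph.fromRel_adj,
        Finset.mem_sdiff] at h1 h2
      have hT' := mem_powerset.1 hT
      obtain ⟨hne, h1 | h1⟩ := h1 <;> obtain ⟨_, h2 | h2⟩ := h2
      · exact h2.2 h1
      · exact absurd (mem_prs.1 h2.1).1 ((mem_prs.1 (hT' h1)).1).not_gt
      · exact absurd (mem_prs.1 h2.1).1 ((mem_prs.1 (hT' h1)).1).not_gt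
      · exact h2.2 h1
  have hexp : ∀ θ : Fin n → ZMod M,
      (∏ p ∈ prs Xᶜ, (a p.1 * a p.2 + b p.1 * b p.2 * (root (θ p.1) * root (θ p.2)))) *
        ∏ j, (root (θ j))⁻¹ ^ d j =
      ∑ T ∈ (prs Xᶜ).powerset, (∏ j, (b j ^ xDeg (ofPrs T) j *
        a j ^ (n - 1 - xDeg X j - xDeg (ofPrs T) j))) *
        ∏ j, (root (θ j) ^ xDeg (ofPrs T) j * (root (θ j))⁻¹ ^ d j) := by
    intro θ
    have : ∀ p ∈ prs Xᶜ, (a p.1 * a p.2 + b p.1 * b p.2 * (root (θ p.1) * root (θ p.2))) =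
        (b p.1 * root (θ p.1)) * (b p.2 * root (θ p.2)) + a p.1 * a p.2 := by
      intro p _; ring
    rw [prod_congr rfl this, prod_add, sum_mul]
    refine sum_congr rfl fun T hT => ?_
    rw [hdeg T hT (fun j => b j * root (θ j)),
      hdeg (prs Xᶜ \ T) (mem_powerset.2 sdiff_subset) a, ← prod_mul_distrib, ← prod_mul_distrib,
      ← prod_mul_distrib]
    refine prod_congr rfl fun j _ => ?_
    rw [← hsum T hT j, Nat.add_sub_cancel_left, mul_pow]
    ring
  simp only [hexp]
  rw [avg_sum]
  have hterm : ∀ T ∈ (prs Xᶜ).powerset, avg (fun θ : Fin n → ZMod M =>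
      (∏ j, (b j ^ xDeg (ofPrs T) j * a j ^ (n - 1 - xDeg X j - xDeg (ofPrs T) j))) *
        ∏ j, (root (θ j) ^ xDeg (ofPrs T) j * (root (θ j))⁻¹ ^ d j)) =
      if ∀ j, xDeg (ofPrs T) j = d j then
        ∏ j, (a j ^ (n - 1 - xDeg X j - d j) * b j ^ d j) else 0 := by
    intro T hT
    rw [avg_const_mul, avg_prod (fun j (l : ZMod M) => root l ^ xDeg (ofPrs T) j *
      (root l)⁻¹ ^ d j)]
    have hlt : ∀ j, xDeg (ofPrs T) j < M := by
      intro j; have := hsum T hT j; omega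
    simp only [avg_root_pow (hlt _) (hd _)]
    split_ifs with h
    · simp only [h, if_true, prod_const_one, mul_one]
      exact prod_congr rfl fun j _ => mul_comm _ _
    · push Not at h
      obtain ⟨j, hj⟩ := h
      rw [prod_eq_zero (f := fun j => if xDeg (ofPrs T) j = d j then (1 : ℂ) else 0)
        (mem_univ j) (if_neg hj), mul_zero]
  rw [sum_congr rfl hterm, ← sum_filter, sum_const, gCount_eq, nsmul_eq_mul]

end pairs

section stirling

open Stirling in
lemma log_stirlingSeq_sub_le (m : ℕ) :
    Real.log (stirlingSeq (m + 1)) - Real.log (stirlingSeq (m + 2)) ≤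
      1 / (12 * ((m : ℝ) + 1)) - 1 / (12 * ((m : ℝ) + 2)) := by
  have h := log_stirlingSeq_sdiff_hasSum m
  set r : ℝ := (1 / (2 * ((m + 1 : ℕ) : ℝ) + 1)) ^ 2 with hr
  have hr0 : 0 < r := by positivity
  have hr1 : r < 1 := by
    rw [hr]
    refine pow_lt_one₀ (by positivity) ?_ (by norm_num)
    rw [div_lt_one (by positivity)]; push_cast; linarith [Nat.cast_nonneg (α := ℝ) m]
  have hg : HasSum (fun k : ℕ => (1 / 3 : ℝ) * (r * r ^ k)) ((1 / 3) * (r * (1 - r)⁻¹)) :=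
    ((hasSum_geometric_of_lt_one hr0.le hr1).mul_left r).mul_left _
  have h2 := hasSum_le (fun k => ?_) h hg
  · refine h2.trans (le_of_eq ?_)
    rw [hr]
    have h1 : (1 - (1 / (2 * ((m + 1 : ℕ) : ℝ) + 1)) ^ 2) ≠ 0 := by rw [← hr]; linarith
    have h3 : (2 * ((m + 1 : ℕ) : ℝ) + 1) ≠ 0 := by positivity
    have h4 : 1 - (1 / (2 * ((m + 1 : ℕ) : ℝ) + 1)) ^ 2 =
      4 * ((m : ℝ) + 1) * (m + 2) / (2 * ((m + 1 : ℕ) : ℝ) + 1) ^ 2 := by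
      field_simp; push_cast; ring
    rw [h4]
    push_cast
    field_simp
    ring
  · rw [pow_succ, mul_comm (r ^ k)]
    gcongr
    push_cast; linarith [Nat.cast_nonneg (α := ℝ) k]

open Stirling in
lemma stirlingSeq_le (n : ℕ) :
    stirlingSeq (n + 1) ≤ √Real.pi * Real.exp (1 / (12 * ((n : ℝ) + 1))) := by
  have hmono : Monotone fun m : ℕ => Real.log (stirlingSeq (m + 1)) - 1 / (12 * ((m : ℝ) + 1)) := by
    refine monotone_nat_of_le_succ fun m => ?_
    have := log_stirlingSeq_sub_le m
    push_cast
    rw [add_assoc (m : ℝ) 1 1, one_add_one_eq_two]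
    linarith
  have hlim : Tendsto (fun m : ℕ => Real.log (stirlingSeq (m + 1)) - 1 / (12 * ((m : ℝ) + 1)))
      atTop (𝓝 (Real.log (√Real.pi) - 0)) := by
    refine Tendsto.sub ?_ ?_
    · refine (Real.continuousAt_log (by positivity)).tendsto.comp ?_
      exact (tendsto_add_atTop_iff_nat 1).2 tendsto_stirlingSeq_sqrt_pi
    · have := (tendsto_one_div_add_atTop_nhds_zero_nat (𝕜 := ℝ)).const_mul (1 / 12)
      rw [mul_zero] at this
      refine this.congr fun m => ?_
      field_simp
  have := hmono.ge_of_tendsto hlim n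
  have hp : 0 < stirlingSeq (n + 1) := stirlingSeq'_pos n
  rw [← Real.exp_log hp, ← Real.exp_log (show 0 < √Real.pi by positivity), ← Real.exp_add]
  exact Real.exp_le_exp.2 (by linarith)

open Stirling in
/-- Robbins' upper bound for the factorial. -/
lemma factorial_le {n : ℕ} (hn : 1 ≤ n) :
    (n.factorial : ℝ) ≤ √(2 * Real.pi * n) * (n / Real.exp 1) ^ n * Real.exp (1 / (12 * n)) := by
  obtain ⟨m, rfl⟩ : ∃ m, n = m + 1 := ⟨n - 1, by omega⟩
  have h := stirlingSeq_le m
  rw [stirlingSeq, div_le_iff₀ (by positivity)] at h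
  refine h.trans (le_of_eq ?_)
  have : √(2 * Real.pi * ((m + 1 : ℕ) : ℝ)) = √Real.pi * √(2 * ((m + 1 : ℕ) : ℝ)) := by
    rw [← Real.sqrt_mul (by positivity)]; congr 1; ring
  rw [this]
  push_cast
  ring

/-- Lower bound for the modal value of the binomial distribution. -/
lemma binW_ge {N d : ℕ} (hd : 1 ≤ d) (hdN : d + 1 ≤ N) {l : ℝ} (hl : l * N = d) :
    1 / √(2 * Real.pi * (N * (l * (1 - l)))) * Real.exp (-(1 / (12 * (N * (l * (1 - l)))))) ≤
      binW N l d := by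
  obtain ⟨f, rfl⟩ : ∃ f, N = d + f := ⟨N - d, by omega⟩
  have hf : 1 ≤ f := by omega
  have hdr : (0 : ℝ) < d := by exact_mod_cast hd
  have hfr : (0 : ℝ) < f := by exact_mod_cast hf
  have hN : (0 : ℝ) < d + f := by positivity
  have hl' : l = d / (d + f) := by
    push_cast at hl; rw [eq_div_iff hN.ne', hl]
  have hl1 : 1 - l = f / (d + f) := by rw [hl']; field_simp; ring
  have ha : ((d + f : ℕ) : ℝ) * (l * (1 - l)) = d * f / (d + f) := by
    rw [hl1, hl']; push_cast; field_simp
  rw [ha, binW, Nat.add_sub_cancel_left, Nat.cast_add_choose, hl1, hl', div_pow, div_pow]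
  have h1 := Stirling.le_factorial_stirling (d + f)
  have h2 := factorial_le hd
  have h3 := factorial_le hf
  have e0 := Real.exp_pos 1
  have key : 1 / √(2 * Real.pi * (d * f / (d + f))) *
      Real.exp (-(1 / (12 * (d * f / (d + f) : ℝ)))) =
      (√(2 * Real.pi * ((d + f : ℕ) : ℝ)) * (((d + f : ℕ) : ℝ) / Real.exp 1) ^ (d + f)) /
      ((√(2 * Real.pi * d) * (d / Real.exp 1) ^ d * Real.exp (1 / (12 * d))) *
      (√(2 * Real.pi * f) * (f / Real.exp 1) ^ f * Real.exp (1 / (12 * f)))) *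
      ((d : ℝ) ^ d / (d + f) ^ d) * ((f : ℝ) ^ f / (d + f) ^ f) := by
    have s1 : √(2 * Real.pi * d) * √(2 * Real.pi * f) =
        √(2 * Real.pi * (d * f / (d + f))) * √(2 * Real.pi * ((d + f : ℕ) : ℝ)) := by
      rw [← Real.sqrt_mul (by positivity), ← Real.sqrt_mul (by positivity)]
      congr 1; push_cast; field_simp
    have s2 : Real.exp (-(1 / (12 * (d * f / (d + f) : ℝ)))) =
        1 / (Real.exp (1 / (12 * d)) * Real.exp (1 / (12 * f))) := by
      rw [← Real.exp_add, one_div (Real.exp _), ← Real.exp_neg]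
      congr 2; field_simp; ring
    have p1 : 0 < √(2 * Real.pi * (d * f / (d + f) : ℝ)) := by positivity
    have p2 : 0 < √(2 * Real.pi * ((d + f : ℕ) : ℝ)) := by positivity
    have s3 : √(2 * Real.pi * d) * (d / Real.exp 1) ^ d * Real.exp (1 / (12 * d)) *
      (√(2 * Real.pi * f) * (f / Real.exp 1) ^ f * Real.exp (1 / (12 * f))) =
      (√(2 * Real.pi * (d * f / (d + f))) * √(2 * Real.pi * ((d + f : ℕ) : ℝ))) *
      ((d / Real.exp 1) ^ d * (f / Real.exp 1) ^ f) *
      (Real.exp (1 / (12 * d)) * Real.exp (1 / (12 * f))) := by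
      rw [← s1]; ring
    rw [s2, s3]
    generalize Real.exp (1 / (12 * d)) * Real.exp (1 / (12 * f)) = R
    generalize √(2 * Real.pi * (d * f / (d + f) : ℝ)) = A at *
    generalize √(2 * Real.pi * ((d + f : ℕ) : ℝ)) = B at *
    simp only [div_pow, pow_add]
    push_cast
    field_simp
  rw [key]
  gcongr

end stirling

section gaussian

lemma gauss_moment {b : ℝ} (hb : 0 < b) (k : ℕ) :
    ∫ x in Set.Ioi (0 : ℝ), x ^ (2 * k) * Real.exp (-b * x ^ 2) =
      Nat.doubleFactorial (2 * k - 1) * √Real.pi / (2 ^ (k + 1) * b ^ k * √b) := by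
  have h := integral_rpow_mul_exp_neg_mul_rpow (p := 2) (q := (2 * k : ℕ)) (b := b) (by norm_num)
    (by have : (0 : ℝ) ≤ (2 * k : ℕ) := by positivity
        linarith) hb
  simp only [Real.rpow_natCast, Real.rpow_ofNat] at h
  rw [h]
  have e1 : (((2 * k : ℕ) : ℝ) + 1) / 2 = k + 1 / 2 := by push_cast; ring
  rw [neg_div, e1, Real.Gamma_nat_add_half, Real.rpow_neg hb.le, Real.rpow_add hb,
    Real.rpow_natCast, ← Real.sqrt_eq_rpow]
  field_simp
  ring

lemma gauss_moment_integrable {b : ℝ} (hb : 0 < b) (k : ℕ) :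
    IntegrableOn (fun x : ℝ => x ^ (2 * k) * Real.exp (-b * x ^ 2)) (Set.Ioi 0) := by
  have := (integrable_rpow_mul_exp_neg_mul_sq (b := b) hb (s := (2 * k : ℕ))
    (by have : (0 : ℝ) ≤ (2 * k : ℕ) := by positivity
        linarith)).integrableOn (s := Set.Ioi 0)
  simpa only [Real.rpow_natCast] using this

lemma one_sub_cos_ge {x : ℝ} (h0 : 0 ≤ x) (h2 : x ≤ 2) :
    x ^ 2 / 2 - x ^ 4 / 24 ≤ 1 - Real.cos x := by
  have h := Real.sin_ge_sub_cube (x := x / 2) (by linarith)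
  have h3 : 0 ≤ x / 2 - (x / 2) ^ 3 / 6 := by
    have : x ^ 2 ≤ 4 := by nlinarith
    have : x ^ 3 ≤ 4 * x := by nlinarith
    nlinarith
  have h4 : (x / 2 - (x / 2) ^ 3 / 6) ^ 2 ≤ Real.sin (x / 2) ^ 2 := pow_le_pow_left₀ h3 h 2
  have h5 : Real.cos x = 1 - 2 * Real.sin (x / 2) ^ 2 := by
    have := Real.cos_two_mul (x / 2)
    have h6 := Real.sin_sq_add_cos_sq (x / 2)
    rw [show 2 * (x / 2) = x by ring] at this
    linarith
  rw [h5]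
  have : 0 ≤ x ^ 6 := by positivity
  nlinarith

lemma exp_gap_le {a : ℝ} (ha : 1 ≤ a) {x : ℝ} (h0 : 0 ≤ x) (hpi : x ≤ Real.pi) :
    Real.exp (-a * (1 - Real.cos x)) ≤ x ^ (2 * 0) * Real.exp (-(a / 2) * x ^ 2) +
      a / 24 * (x ^ (2 * 2) * Real.exp (-(a / 2) * x ^ 2)) +
      2 * a ^ 2 * (x ^ (2 * 4) * Real.exp (-(a / 5) * x ^ 2)) := by
  have ha0 : 0 < a := by linarith
  rcases le_total x 1 with h1 | h1
  · have hc := one_sub_cos_ge h0 (by linarith : x ≤ 2)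
    have hx42 : x ^ 4 ≤ x ^ 2 := pow_le_pow_of_le_one h0 h1 (by norm_num)
    set t := a * x ^ 4 / 24 with ht
    have ht0 : 0 ≤ t := by positivity
    have hexp : Real.exp t ≤ 1 + t + t ^ 2 * Real.exp t := by
      have := Real.add_one_le_exp (-t)
      have h2 : Real.exp t * Real.exp (-t) = 1 := by rw [← Real.exp_add]; simp
      have h3 := Real.exp_pos t
      nlinarith [mul_nonneg ht0 ht0, mul_le_mul_of_nonneg_left this h3.le,
        mul_le_mul_of_nonneg_left (mul_le_mul_of_nonneg_left this h3.le) ht0]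
    have hle : Real.exp (-a * (1 - Real.cos x)) ≤ Real.exp (-(a / 2) * x ^ 2) * Real.exp t := by
      rw [← Real.exp_add]; apply Real.exp_le_exp.2; rw [ht]; nlinarith
    have hlast : Real.exp (-(a / 2) * x ^ 2) * Real.exp t ≤ Real.exp (-(a / 5) * x ^ 2) := by
      rw [← Real.exp_add]; apply Real.exp_le_exp.2; rw [ht]; nlinarith
    have h4 := mul_le_mul_of_nonneg_left hexp (Real.exp_pos (-(a / 2) * x ^ 2)).le
    have h5 := mul_le_mul_of_nonneg_left hlast (sq_nonneg t)
    have h6 : t ^ 2 * Real.exp (-(a / 5) * x ^ 2) ≤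
        2 * a ^ 2 * (x ^ (2 * 4) * Real.exp (-(a / 5) * x ^ 2)) := by
      rw [← mul_assoc]
      refine mul_le_mul_of_nonneg_right ?_ (Real.exp_nonneg _)
      rw [ht]
      have : 0 ≤ a ^ 2 * x ^ 8 := by positivity
      norm_num
      nlinarith
    have h7 : a / 24 * (x ^ (2 * 2) * Real.exp (-(a / 2) * x ^ 2)) =
        t * Real.exp (-(a / 2) * x ^ 2) := by rw [ht]; ring
    rw [h7]
    simp only [mul_zero, pow_zero, one_mul]
    nlinarith
  · have hc : Real.cos x ≤ 1 - 2 / Real.pi ^ 2 * x ^ 2 :=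
      Real.cos_le_one_sub_mul_cos_sq (abs_le.2 ⟨by linarith, hpi⟩)
    have hpi2 : (1 / 5 : ℝ) ≤ 2 / Real.pi ^ 2 := by
      rw [le_div_iff₀ (by positivity)]
      have := Real.pi_lt_d2
      nlinarith [Real.pi_gt_three]
    have h2 : Real.exp (-a * (1 - Real.cos x)) ≤ Real.exp (-(a / 5) * x ^ 2) := by
      apply Real.exp_le_exp.2
      have : 1 / 5 * x ^ 2 ≤ 2 / Real.pi ^ 2 * x ^ 2 := by gcongr
      nlinarith
    have h3 : (1 : ℝ) ≤ 2 * a ^ 2 * x ^ (2 * 4) := by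
      have := one_le_pow₀ h1 (n := 2 * 4)
      nlinarith
    have h4 : 0 ≤ x ^ (2 * 0) * Real.exp (-(a / 2) * x ^ 2) := by positivity
    have h5 : 0 ≤ a / 24 * (x ^ (2 * 2) * Real.exp (-(a / 2) * x ^ 2)) := by positivity
    have h6 : Real.exp (-(a / 5) * x ^ 2) ≤
        2 * a ^ 2 * (x ^ (2 * 4) * Real.exp (-(a / 5) * x ^ 2)) := by
      rw [← mul_assoc]
      exact le_mul_of_one_le_left (Real.exp_nonneg _) h3
    linarith

lemma integral_exp_gap_le {a : ℝ} (ha : 1 ≤ a) :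
    ∫ x in (0 : ℝ)..Real.pi, Real.exp (-a * (1 - Real.cos x)) ≤
      Real.pi / √(2 * Real.pi * a) * (1 + 1 / (8 * a) + 18000 / a ^ 2) := by
  have ha0 : 0 < a := by linarith
  set g : ℝ → ℝ := fun x => x ^ (2 * 0) * Real.exp (-(a / 2) * x ^ 2) +
      a / 24 * (x ^ (2 * 2) * Real.exp (-(a / 2) * x ^ 2)) +
      2 * a ^ 2 * (x ^ (2 * 4) * Real.exp (-(a / 5) * x ^ 2)) with hg
  have i1 := gauss_moment_integrable (half_pos ha0) 0
  have i2 := (gauss_moment_integrable (half_pos ha0) 2).const_mul (a / 24)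
  have i3 := (gauss_moment_integrable (show 0 < a / 5 by positivity) 4).const_mul (2 * a ^ 2)
  have hgi : IntegrableOn g (Set.Ioi 0) := (i1.add i2).add i3
  have h1 : ∫ x in (0 : ℝ)..Real.pi, Real.exp (-a * (1 - Real.cos x)) ≤
      ∫ x in Set.Ioi (0 : ℝ), g x := by
    rw [intervalIntegral.integral_of_le Real.pi_pos.le]
    refine (setIntegral_mono_on (g := g) ?_ (hgi.mono_set Set.Ioc_subset_Ioi_self) measurableSet_Ioc
      fun x hx => exp_gap_le ha hx.1.le hx.2).trans ?_
    · exact (Continuous.intervalIntegrable (by fun_prop) 0 Real.pi).1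
    · refine setIntegral_mono_set hgi ?_ (Set.Ioc_subset_Ioi_self.eventuallyLE)
      refine ae_of_all _ fun x => ?_
      simp only [hg, Pi.zero_apply]
      have : ∀ k, 0 ≤ x ^ (2 * k) := fun k => by rw [pow_mul]; positivity
      have t0 := this 0
      have t2 := this 2
      have t4 := this 4
      positivity
  refine h1.trans ?_
  have h2 : ∫ x in Set.Ioi (0 : ℝ), g x = 1 * √Real.pi / (2 ^ (0 + 1) * (a / 2) ^ 0 * √(a / 2)) +
      a / 24 * (3 * √Real.pi / (2 ^ (2 + 1) * (a / 2) ^ 2 * √(a / 2))) +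
      2 * a ^ 2 * (105 * √Real.pi / (2 ^ (4 + 1) * (a / 5) ^ 4 * √(a / 5))) := by
    have e1 : ∫ x in Set.Ioi (0 : ℝ), g x = _ := integral_add (i1.add i2) i3
    have e2 := integral_add i1 i2
    rw [e1, e2, integral_const_mul, integral_const_mul,
      gauss_moment (half_pos ha0), gauss_moment (half_pos ha0),
      gauss_moment (show 0 < a / 5 by positivity)]
    norm_num [Nat.doubleFactorial]
  rw [h2]
  set s := √(a / 2) with hs
  have hs0 : 0 < s := by positivity
  have h5 : s / 2 ≤ √(a / 5) := by
    rw [hs]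
    apply Real.le_sqrt_of_sq_le
    rw [div_pow, Real.sq_sqrt (by positivity)]; linarith
  have h6 : √(2 * Real.pi * a) = 2 * √Real.pi * s := by
    rw [hs, show 2 * Real.pi * a = 2 ^ 2 * (Real.pi * (a / 2)) by ring,
      Real.sqrt_mul (by positivity), Real.sqrt_sq (by norm_num), Real.sqrt_mul (by positivity)]
    ring
  have hpi : √Real.pi * √Real.pi = Real.pi := Real.mul_self_sqrt Real.pi_pos.le
  have hpi0 : 0 < √Real.pi := by positivity
  have h7 : Real.pi / √(2 * Real.pi * a) = √Real.pi / (2 * s) := by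
    rw [h6, div_eq_div_iff (by positivity) (by positivity)]; linear_combination (-2 * s) * hpi
  rw [h7]
  have h8 : 105 * √Real.pi / (2 ^ (4 + 1) * (a / 5) ^ 4 * √(a / 5)) ≤
      105 * √Real.pi / (2 ^ (4 + 1) * (a / 5) ^ 4 * (s / 2)) := by gcongr
  have h9 := mul_le_mul_of_nonneg_left h8 (show 0 ≤ 2 * a ^ 2 by positivity)
  refine (add_le_add_right h9 _).trans ?_
  generalize √Real.pi = w at *
  have : 0 < w / (2 * s) := by positivity
  have e1 : 1 * w / (2 ^ (0 + 1) * (a / 2) ^ 0 * s) +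
      a / 24 * (3 * w / (2 ^ (2 + 1) * (a / 2) ^ 2 * s)) +
      2 * a ^ 2 * (105 * w / (2 ^ (4 + 1) * (a / 5) ^ 4 * (s / 2))) =
      w / (2 * s) * (1 + 1 / (8 * a) + 16406.25 / a ^ 2) := by
    field_simp; ring
  rw [e1]
  gcongr
  norm_num

end gaussian

section riemann

variable {m : ℕ} [NeZero (2 * m)]

lemma sum_zmod {A : Type*} [AddCommMonoid A] {M : ℕ} [NeZero M] (F : ZMod M → A) :
    ∑ l, F l = ∑ k ∈ range M, F (k : ZMod M) := by
  refine sum_nbij' (fun l => l.val) (fun k => (k : ZMod M)) ?_ ?_ ?_ ?_ ?_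
  · intro l _; exact mem_range.2 (ZMod.val_lt l)
  · intro k _; exact mem_univ _
  · intro l _; exact ZMod.natCast_zmod_val l
  · intro k hk; exact ZMod.val_cast_of_lt (mem_range.1 hk)
  · intro l _; rw [ZMod.natCast_zmod_val]

lemma gap_root {M : ℕ} [NeZero M] (k : ℕ) :
    gap (root (k : ZMod M)) = 1 - Real.cos (2 * Real.pi * k / M) := by
  have : root (k : ZMod M) = Complex.exp (((2 * Real.pi * k / M : ℝ) : ℂ) * Complex.I) := by
    have := ZMod.stdAddChar_coe (N := M) (k : ℤ)
    rw [root, show ((k : ℕ) : ZMod M) = ((k : ℤ) : ZMod M) by simp, this]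
    congr 1; push_cast; ring
  rw [gap, this, Complex.exp_ofReal_mul_I_re]

/-- Average of `exp (-a (1 - cos θ))` over the roots of unity, compared with the Gaussian. -/
lemma avg_exp_gap_le {a : ℝ} (ha : 1 ≤ a) (hm : a ^ 3 ≤ m) :
    avg (fun l : ZMod (2 * m) => Real.exp (-(a * gap (root l)))) ≤
      1 / √(2 * Real.pi * a) * Real.exp (1 / (8 * a) + 20000 / a ^ 2) := by
  have ha0 : 0 < a := by linarith
  have hm0 : (0 : ℝ) < m := lt_of_lt_of_le (by positivity) hm
  set f : ℝ → ℝ := fun x => Real.exp (-a * (1 - Real.cos (x * (Real.pi / m)))) with hf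
  have hsum : ∑ l : ZMod (2 * m), Real.exp (-(a * gap (root l))) = ∑ k ∈ range (m + m), f k := by
    rw [sum_zmod]
    refine sum_congr (by rw [two_mul]) fun k _ => ?_
    rw [gap_root]
    simp only [hf, neg_mul]
    congr 5
    push_cast; field_simp
  have h1 : ∑ k ∈ range m, f (m + k : ℕ) = ∑ k ∈ range m, f ((0 : ℝ) + (k + 1 : ℕ)) := by
    rw [← sum_range_reflect]
    refine sum_congr rfl fun k hk => ?_
    have hk' := mem_range.1 hk
    have e1 : ((m + (m - 1 - k) : ℕ) : ℝ) = 2 * m - (k + 1) := by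
      have : m + (m - 1 - k) + (k + 1) = 2 * m := by omega
      rw [eq_sub_iff_add_eq]; exact_mod_cast this
    simp only [hf, e1]
    congr 3
    rw [show (2 * m - ((k : ℝ) + 1)) * (Real.pi / m) = 2 * Real.pi - (k + 1) * (Real.pi / m) by
      field_simp, Real.cos_two_pi_sub]
    push_cast; ring_nf
  have h2 : ∑ k ∈ range m, f k ≤ 1 + ∑ k ∈ range m, f ((0 : ℝ) + (k + 1 : ℕ)) := by
    have e := sum_range_succ (fun k : ℕ => f k) m
    have e' := sum_range_succ' (fun k : ℕ => f k) m
    have h0 : f ((0 : ℕ) : ℝ) = 1 := by simp [hf]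
    have hp : 0 ≤ f m := Real.exp_nonneg _
    simp only [zero_add]
    rw [h0] at e'
    linarith
  have hanti : AntitoneOn f (Set.Icc 0 (0 + m)) := by
    intro x hx y hy hxy
    simp only [hf]
    apply Real.exp_le_exp.2
    have hmul : ∀ z : ℝ, z ∈ Set.Icc (0 : ℝ) (0 + m) → z * (Real.pi / m) ≤ Real.pi := by
      intro z hz
      have : z ≤ m := by simpa using hz.2
      calc z * (Real.pi / m) ≤ m * (Real.pi / m) := by
            have := Real.pi_pos; gcongr
        _ = Real.pi := by field_simp
    have : Real.cos (y * (Real.pi / m)) ≤ Real.cos (x * (Real.pi / m)) :=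
      Real.cos_le_cos_of_nonneg_of_le_pi (mul_nonneg hx.1 (by positivity)) (hmul y hy) (by gcongr)
    nlinarith
  have h3 := hanti.sum_le_integral
  have h4 : ∫ x in (0 : ℝ)..0 + m, f x =
      m / Real.pi * ∫ x in (0 : ℝ)..Real.pi, Real.exp (-a * (1 - Real.cos x)) := by
    have := intervalIntegral.integral_comp_mul_right (a := 0) (b := 0 + m)
      (fun x => Real.exp (-a * (1 - Real.cos x))) (c := Real.pi / m) (by positivity)
    rw [hf, this, smul_eq_mul, inv_div, zero_mul, zero_add]
    congr 2; field_simp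
  have h5 := integral_exp_gap_le ha
  have hcard : (Fintype.card (ZMod (2 * m)) : ℝ) = 2 * m := by simp [ZMod.card]
  rw [avg, hcard, hsum, sum_range_add, h1, div_le_iff₀ (by positivity)]
  have h6 : m / Real.pi * ∫ x in (0 : ℝ)..Real.pi, Real.exp (-a * (1 - Real.cos x)) ≤
      m * (1 / √(2 * Real.pi * a) * (1 + 1 / (8 * a) + 18000 / a ^ 2)) := by
    refine (mul_le_mul_of_nonneg_left h5 (by positivity)).trans (le_of_eq ?_)
    have := Real.pi_pos
    field_simp
  have h7 : (1 : ℝ) ≤ 2 * m * (1 / √(2 * Real.pi * a) * (2000 / a ^ 2)) := by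
    have h8 : √(2 * Real.pi * a) ≤ 3 * a := by
      rw [Real.sqrt_le_left (by positivity)]
      nlinarith [Real.pi_lt_d2]
    have h9 : 1 / (3 * a) ≤ 1 / √(2 * Real.pi * a) := by gcongr
    calc (1 : ℝ) ≤ 2 * a ^ 3 * (1 / (3 * a) * (2000 / a ^ 2)) := by
          field_simp; norm_num
      _ ≤ _ := by gcongr
  have h10 := Real.add_one_le_exp (1 / (8 * a) + 20000 / a ^ 2)
  have h11 : 1 + 1 / (8 * a) + 18000 / a ^ 2 + 2000 / a ^ 2 ≤
      Real.exp (1 / (8 * a) + 20000 / a ^ 2) := by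
    refine le_trans (le_of_eq ?_) h10
    ring
  have h12 := mul_le_mul_of_nonneg_left h11
    (show 0 ≤ 2 * m * (1 / √(2 * Real.pi * a)) by positivity)
  rw [h4] at h3
  nlinarith

end riemann

section setup

/-- Quantitative form of the hypotheses for one regular degree and one forbidden graph: `q` plays
the role of a small power of `n`. -/
structure Setup (n d : ℕ) (X : SimpleGraph (Fin n)) (q : ℝ) : Prop where
  hq : 1000 ≤ q
  hqn : q ^ 200 ≤ √(n : ℝ)
  hlog : Real.log n ≤ q
  lo : (n : ℝ) / q ≤ d
  hi : (d : ℝ) + n / q ≤ n - 1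
  hx : ∀ j, (xDeg X j : ℝ) ≤ √(n : ℝ) * q
  hX : ∑ j, (xDeg X j : ℝ) ≤ n * q
  even : Even (n * d)

/-- Number of places available in row `j`. -/
def nn {n : ℕ} (X : SimpleGraph (Fin n)) (j : Fin n) : ℕ := n - 1 - xDeg X j

/-- Density of row `j`. -/
def rl {n : ℕ} (d : ℕ) (X : SimpleGraph (Fin n)) (j : Fin n) : ℝ := d / nn X j

/-- Average number of available places in a row. -/
def nbar {n : ℕ} (X : SimpleGraph (Fin n)) : ℝ := (∑ j, (nn X j : ℝ)) / n

/-- Overall density among available places. -/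
def rp {n : ℕ} (d : ℕ) (X : SimpleGraph (Fin n)) : ℝ := d / nbar X

def rK {n : ℕ} (d : ℕ) (X : SimpleGraph (Fin n)) (j : Fin n) : ℝ := rl d X j * (1 - rl d X j)

def rk {n : ℕ} (d : ℕ) (X : SimpleGraph (Fin n)) : ℝ := rp d X * (1 - rp d X)

def rm {n : ℕ} (d : ℕ) (X : SimpleGraph (Fin n)) (j : Fin n) : ℝ :=
  (rl d X j - rp d X) / √(rk d X)

def ra {n : ℕ} (d : ℕ) (X : SimpleGraph (Fin n)) (j : Fin n) : ℝ := nn X j * rK d X j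

/-- Product of the binomial point masses of the rows. -/
def rP {n : ℕ} (d : ℕ) (X : SimpleGraph (Fin n)) : ℝ := ∏ j, binW (nn X j) (rl d X j) d

def uu {n : ℕ} (X : SimpleGraph (Fin n)) (q : ℝ) (j : Fin n) : ℝ := xDeg X j + q

lemma mul_qpow {q c : ℝ} (hq : 1000 ≤ q) (m k : ℕ) (hc : c ≤ 1000 ^ m) :
    c * q ^ k ≤ q ^ (k + m) := by
  rw [pow_add, mul_comm (q ^ k)]
  gcongr
  exact hc.trans (by gcongr)

variable {n d : ℕ} {X : SimpleGraph (Fin n)} {q : ℝ}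

namespace Setup

lemma q0 (S : Setup n d X q) : 0 < q := by linarith [S.hq]

lemma qle (S : Setup n d X q) (k : ℕ) (hk : k ≤ 200 := by norm_num) : q ^ k ≤ √(n : ℝ) :=
  (pow_le_pow_right₀ (by linarith [S.hq]) hk).trans S.hqn

lemma s0 (S : Setup n d X q) : 0 < √(n : ℝ) := lt_of_lt_of_le (pow_pos S.q0 _) S.hqn

lemma sq (_ : Setup n d X q) : √(n : ℝ) ^ 2 = n := Real.sq_sqrt (Nat.cast_nonneg n)

lemma n0 (S : Setup n d X q) : (0 : ℝ) < n := by rw [← S.sq]; exact pow_pos S.s0 2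

lemma s1000 (S : Setup n d X q) : 1000 ≤ √(n : ℝ) := by
  have := S.qle 1; have := S.hq; linarith [pow_one q]

lemma sle (S : Setup n d X q) : √(n : ℝ) ≤ n := by
  have := S.s1000; have := S.sq; nlinarith

lemma npos (S : Setup n d X q) : 0 < n := by exact_mod_cast S.n0

lemma cast_nn (_ : Setup n d X q) (j : Fin n) : (nn X j : ℝ) = n - 1 - xDeg X j := by
  have h : xDeg X j + 1 ≤ n := by
    rw [xDeg, Nat.card_eq_fintype_card, SimpleGraph.card_neighborSet_eq_degree]
    have := X.degree_lt_card_verts j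
    rwa [Fintype.card_fin] at this
  have : nn X j + 1 + xDeg X j = n := by unfold nn; omega
  have h2 : (nn X j : ℝ) + 1 + xDeg X j = n := by exact_mod_cast this
  linarith

lemma nn_le (S : Setup n d X q) (j : Fin n) : (nn X j : ℝ) ≤ n := by
  rw [S.cast_nn]; have : (0 : ℝ) ≤ xDeg X j := by positivity
  linarith

lemma nn_ge (S : Setup n d X q) (j : Fin n) : n - 2 * (√n * q) ≤ (nn X j : ℝ) := by
  rw [S.cast_nn]; have := S.hx j; have := S.hq; have := S.s1000
  nlinarith

lemma sq_le (S : Setup n d X q) {k : ℕ} (hk : k ≤ 199 := by norm_num) :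
    √(n : ℝ) * q ^ k ≤ n / q := by
  rw [le_div_iff₀ S.q0, mul_assoc, ← pow_succ]
  calc √(n : ℝ) * q ^ (k + 1) ≤ √(n : ℝ) * √n := by
        gcongr
        · exact S.qle _ (by omega)
    _ = n := by rw [← pow_two, S.sq]

lemma half_le (S : Setup n d X q) (j : Fin n) : (n : ℝ) / 2 ≤ nn X j := by
  have h := S.nn_ge j
  have h2 : √(n : ℝ) * q ^ 1 ≤ n / q := S.sq_le
  have h3 : (n : ℝ) / q ≤ n / 1000 := by
    have := S.hq; have := S.n0; gcongr
  have := S.n0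
  rw [pow_one] at h2; linarith

lemma nn0 (S : Setup n d X q) (j : Fin n) : (0 : ℝ) < nn X j := by
  linarith [S.half_le j, S.n0]

lemma nbar_eq (S : Setup n d X q) : nbar X = n - 1 - (∑ j, (xDeg X j : ℝ)) / n := by
  have := S.n0
  rw [nbar, sum_congr rfl fun j _ => S.cast_nn j, sum_sub_distrib]
  simp
  field_simp

lemma sx_nonneg (_ : Setup n d X q) : 0 ≤ ∑ j, (xDeg X j : ℝ) :=
  sum_nonneg fun _ _ => by positivity

lemma sx_div (S : Setup n d X q) : (∑ j, (xDeg X j : ℝ)) / n ≤ q := by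
  rw [div_le_iff₀ S.n0, mul_comm]; exact S.hX

lemma nbar_le (S : Setup n d X q) : nbar X ≤ n := by
  rw [S.nbar_eq]; have := div_nonneg S.sx_nonneg S.n0.le; linarith

lemma nbar_ge (S : Setup n d X q) : n - 2 * q ≤ nbar X := by
  rw [S.nbar_eq]; have := S.sx_div; have := S.hq; linarith

lemma half_nbar (S : Setup n d X q) : (n : ℝ) / 2 ≤ nbar X := by
  have := S.nbar_ge; have h2 := S.qle 2; have := S.hq
  have := S.sle; nlinarith

lemma nbar0 (S : Setup n d X q) : 0 < nbar X := by linarith [S.half_nbar, S.n0]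

lemma rl_ge (S : Setup n d X q) (j : Fin n) : 1 / q ≤ rl d X j := by
  rw [rl, le_div_iff₀ (S.nn0 j)]
  have := S.lo; have h := S.nn_le j
  calc 1 / q * (nn X j : ℝ) ≤ 1 / q * n := by have := S.q0; gcongr
    _ ≤ d := by rw [one_div_mul_eq_div]; exact this

lemma one_sub_rl_ge (S : Setup n d X q) (j : Fin n) : 1 / (2 * q) ≤ 1 - rl d X j := by
  have hn := S.nn0 j
  have : 1 - rl d X j = (nn X j - d) / nn X j := by rw [rl]; field_simp
  rw [this, le_div_iff₀ hn]
  have h1 : 1 / (2 * q) * (nn X j : ℝ) ≤ 1 / (2 * q) * n := by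
    have := S.q0; have := S.nn_le j; gcongr
  have h2 : √(n : ℝ) * q ^ 2 ≤ n / q := S.sq_le
  have h3 : 1 / (2 * q) * (n : ℝ) = n / q / 2 := by have := S.q0; field_simp
  have h4 := S.hi; have h5 := S.hx j; have := S.hq; have := S.s0
  rw [S.cast_nn] at h1 ⊢
  nlinarith

lemma rp_ge (S : Setup n d X q) : 1 / q ≤ rp d X := by
  rw [rp, le_div_iff₀ S.nbar0]
  calc 1 / q * nbar X ≤ 1 / q * n := by have := S.q0; have := S.nbar_le; gcongr
    _ ≤ d := by rw [one_div_mul_eq_div]; exact S.lo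

lemma one_sub_rp_ge (S : Setup n d X q) : 1 / (2 * q) ≤ 1 - rp d X := by
  have hn := S.nbar0
  have : 1 - rp d X = (nbar X - d) / nbar X := by rw [rp]; field_simp
  rw [this, le_div_iff₀ hn]
  have h1 : 1 / (2 * q) * nbar X ≤ 1 / (2 * q) * n := by
    have := S.q0; have := S.nbar_le; gcongr
  have h2 : √(n : ℝ) * q ^ 2 ≤ n / q := S.sq_le
  have h3 : 1 / (2 * q) * (n : ℝ) = n / q / 2 := by have := S.q0; field_simp
  have h4 := S.hi; have h5 := S.nbar_eq; have h6 := S.sx_div; have := S.hq; have := S.s1000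
  have h7 : 2 * q ≤ √(n : ℝ) * q ^ 2 := by nlinarith
  linarith

lemma mul_one_sub_ge {x : ℝ} (S : Setup n d X q) (h1 : 1 / q ≤ x) (h2 : 1 / (2 * q) ≤ 1 - x) :
    1 / (4 * q) ≤ x * (1 - x) := by
  have h0 : 0 < 1 / (2 * q) := by have := S.q0; positivity
  have e1 : 1 / q = 2 * (1 / (2 * q)) := by field_simp
  have e2 : 1 / (4 * q) = (1 / (2 * q)) / 2 := by field_simp; norm_num
  rw [e2]; rw [e1] at h1
  rcases le_total x (1 / 2) with h | h <;> nlinarith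

lemma rK_ge (S : Setup n d X q) (j : Fin n) : 1 / (4 * q) ≤ rK d X j :=
  S.mul_one_sub_ge (S.rl_ge j) (S.one_sub_rl_ge j)

lemma rk_ge (S : Setup n d X q) : 1 / (4 * q) ≤ rk d X :=
  S.mul_one_sub_ge S.rp_ge S.one_sub_rp_ge

lemma rl0 (S : Setup n d X q) (j : Fin n) : 0 < rl d X j :=
  lt_of_lt_of_le (by have := S.q0; positivity) (S.rl_ge j)

lemma rl1 (S : Setup n d X q) (j : Fin n) : rl d X j < 1 := by
  have := S.one_sub_rl_ge j
  have : 0 < 1 / (2 * q) := by have := S.q0; positivity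
  linarith

lemma rp0 (S : Setup n d X q) : 0 < rp d X :=
  lt_of_lt_of_le (by have := S.q0; positivity) S.rp_ge

lemma rp1 (S : Setup n d X q) : rp d X < 1 := by
  have := S.one_sub_rp_ge
  have : 0 < 1 / (2 * q) := by have := S.q0; positivity
  linarith

lemma rK0 (S : Setup n d X q) (j : Fin n) : 0 < rK d X j :=
  lt_of_lt_of_le (by have := S.q0; positivity) (S.rK_ge j)

lemma rk0 (S : Setup n d X q) : 0 < rk d X :=
  lt_of_lt_of_le (by have := S.q0; positivity) S.rk_ge

lemma rK_le (_ : Setup n d X q) (j : Fin n) : rK d X j ≤ 1 / 4 := by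
  rw [rK]; nlinarith [sq_nonneg (rl d X j - 1 / 2)]

lemma rk_le (_ : Setup n d X q) : rk d X ≤ 1 / 4 := by
  rw [rk]; nlinarith [sq_nonneg (rp d X - 1 / 2)]

lemma inv_rk_le (S : Setup n d X q) : 1 / rk d X ≤ 4 * q := by
  rw [div_le_iff₀ S.rk0]
  have := S.rk_ge
  have h := S.q0
  rw [div_le_iff₀ (by positivity)] at this; linarith

lemma uu0 (S : Setup n d X q) (j : Fin n) : 0 < uu X q j := by
  have := S.q0; unfold uu; positivity

lemma uu_le (S : Setup n d X q) (j : Fin n) : uu X q j ≤ 2 * (√n * q) := by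
  have := S.hx j; have := S.s1000; have := S.hq; unfold uu; nlinarith

lemma x_le_uu (S : Setup n d X q) (j : Fin n) : (xDeg X j : ℝ) ≤ uu X q j := by
  have := S.q0; unfold uu; linarith

lemma sum_uu (S : Setup n d X q) : ∑ j, uu X q j ≤ 2 * (n * q) := by
  have := S.hX; simp only [uu, sum_add_distrib]; simp; linarith

lemma sum_uu_sq (S : Setup n d X q) : ∑ j, uu X q j ^ 2 ≤ 4 * (√n * n * q ^ 2) := by
  calc ∑ j, uu X q j ^ 2 ≤ ∑ j, 2 * (√n * q) * uu X q j := by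
        refine sum_le_sum fun j _ => ?_
        have := S.uu_le j; have := S.uu0 j; nlinarith
    _ = 2 * (√n * q) * ∑ j, uu X q j := by rw [mul_sum]
    _ ≤ 2 * (√n * q) * (2 * (n * q)) := by have := S.q0; have := S.sum_uu; gcongr
    _ = _ := by ring

lemma abs_nbar_sub (S : Setup n d X q) (j : Fin n) : |nbar X - nn X j| ≤ uu X q j := by
  rw [S.nbar_eq, S.cast_nn, uu, abs_le]
  have := S.sx_div; have := div_nonneg S.sx_nonneg S.n0.le
  have : (0 : ℝ) ≤ xDeg X j := by positivity
  have := S.q0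
  constructor <;> linarith

lemma abs_rl_sub (S : Setup n d X q) (j : Fin n) : |rl d X j - rp d X| ≤ 2 * uu X q j / n := by
  have h1 := S.nn0 j; have h2 := S.nbar0
  have e : rl d X j - rp d X = rp d X * ((nbar X - nn X j) / nn X j) := by
    rw [rl, rp]; field_simp
  rw [e, abs_mul, abs_of_pos S.rp0, abs_div, abs_of_pos h1]
  have h3 : |nbar X - nn X j| / nn X j ≤ uu X q j / (n / 2) := by
    have := S.n0; have := S.half_le j; have := S.abs_nbar_sub j; have := S.uu0 j; gcongr
  calc rp d X * (|nbar X - nn X j| / nn X j) ≤ 1 * (uu X q j / (n / 2)) := by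
        have := S.rp1; gcongr
    _ = _ := by have := S.n0; field_simp

lemma abs_rK_sub (S : Setup n d X q) (j : Fin n) : |rK d X j - rk d X| ≤ 2 * uu X q j / n := by
  have e : rK d X j - rk d X = (rl d X j - rp d X) * (1 - rl d X j - rp d X) := by
    rw [rK, rk]; ring
  rw [e, abs_mul]
  have h : |1 - rl d X j - rp d X| ≤ 1 := by
    rw [abs_le]; have := S.rl0 j; have := S.rl1 j; have := S.rp0; have := S.rp1
    constructor <;> linarith
  calc _ ≤ 2 * uu X q j / n * 1 := by
        have := S.abs_rl_sub j
        gcongr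
        · exact (abs_nonneg _).trans this
    _ = _ := mul_one _

lemma abs_rK_div (S : Setup n d X q) (j : Fin n) :
    |rK d X j / rk d X - 1| ≤ 8 * q * uu X q j / n := by
  have h := S.rk0
  have e : rK d X j / rk d X - 1 = (rK d X j - rk d X) * (1 / rk d X) := by field_simp
  rw [e, abs_mul, abs_of_pos (by positivity : 0 < 1 / rk d X)]
  calc _ ≤ 2 * uu X q j / n * (4 * q) := by
        have h1 := S.abs_rK_sub j; have h2 := S.inv_rk_le
        gcongr
        exact (abs_nonneg _).trans h1
    _ = _ := by ring

lemma sqrt_rk_ge (S : Setup n d X q) : 1 / q ≤ √(rk d X) := by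
  apply Real.le_sqrt_of_sq_le
  refine le_trans ?_ S.rk_ge
  have := S.q0; have := S.hq
  rw [div_pow, one_pow]
  apply one_div_le_one_div_of_le (by positivity)
  nlinarith

lemma sqrt_rk0 (S : Setup n d X q) : 0 < √(rk d X) := Real.sqrt_pos.2 S.rk0

lemma sqrt_rk_le (S : Setup n d X q) : √(rk d X) ≤ 1 / 2 := by
  rw [Real.sqrt_le_left (by norm_num)]; have := S.rk_le; linarith

lemma sqrt_rk_sq (S : Setup n d X q) : √(rk d X) ^ 2 = rk d X := Real.sq_sqrt S.rk0.le

lemma abs_rm_le (S : Setup n d X q) (j : Fin n) : |rm d X j| ≤ 2 * q * uu X q j / n := by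
  rw [rm, abs_div, abs_of_pos S.sqrt_rk0, div_le_iff₀ S.sqrt_rk0]
  have h1 := S.abs_rl_sub j
  have h2 : 1 ≤ q * √(rk d X) := by
    have := S.sqrt_rk_ge; rw [div_le_iff₀ S.q0] at this; linarith
  refine h1.trans ?_
  have h3 : 0 ≤ 2 * uu X q j / n := by have := S.uu0 j; have := S.n0; positivity
  calc _ = 2 * uu X q j / n * 1 := (mul_one _).symm
    _ ≤ 2 * uu X q j / n * (q * √(rk d X)) := by gcongr
    _ = _ := by ring

lemma uu_div_le (S : Setup n d X q) (j : Fin n) : uu X q j / n ≤ 2 * q / √n := by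
  have := S.s0
  rw [div_le_div_iff₀ S.n0 this]
  have h1 := S.uu_le j; have h2 := S.sq; have := S.q0
  nlinarith

lemma abs_rm_le' (S : Setup n d X q) (j : Fin n) : |rm d X j| ≤ q ^ 3 / √n := by
  refine (S.abs_rm_le j).trans ?_
  calc 2 * q * uu X q j / n = 2 * q * (uu X q j / n) := by ring
    _ ≤ 2 * q * (2 * q / √n) := by have := S.q0; have := S.uu_div_le j; gcongr
    _ = 4 * q ^ 2 / √n := by ring
    _ ≤ q ^ 3 / √n := by
        have := S.s0; gcongr; exact mul_qpow S.hq 1 2 (by norm_num)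

lemma abs_sum_rm_le (S : Setup n d X q) : |∑ j, rm d X j| ≤ q ^ 4 / √n := by
  have hn := S.n0; have hs := S.s0; have hb := S.nbar0; have hq := S.q0
  have h0 : ∑ j, (nn X j : ℝ) * (rl d X j - rp d X) = 0 := by
    have e1 : ∀ j, (nn X j : ℝ) * (rl d X j - rp d X) = d - rp d X * nn X j := by
      intro j; have := S.nn0 j; rw [rl]; field_simp
    rw [sum_congr rfl fun j _ => e1 j, sum_sub_distrib, ← mul_sum]
    have : ∑ j, (nn X j : ℝ) = nbar X * n := by rw [nbar]; field_simp
    rw [this, rp]; simp; field_simp; ring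
  have h1 : ∑ j, (rl d X j - rp d X) = (∑ j, (nbar X - nn X j) * (rl d X j - rp d X)) / nbar X := by
    have e2 : ∑ j, (nbar X - nn X j) * (rl d X j - rp d X) =
        ∑ j, nbar X * (rl d X j - rp d X) - ∑ j, (nn X j : ℝ) * (rl d X j - rp d X) := by
      rw [← sum_sub_distrib]; exact sum_congr rfl fun j _ => sub_mul _ _ _
    rw [eq_div_iff hb.ne', e2, h0, sub_zero, ← mul_sum, mul_comm]
  have h2 : |∑ j, (nbar X - nn X j) * (rl d X j - rp d X)| ≤ 8 * (√n * q ^ 2) := by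
    calc _ ≤ ∑ j, |(nbar X - nn X j) * (rl d X j - rp d X)| := abs_sum_le_sum_abs _ _
      _ ≤ ∑ j, 2 / n * uu X q j ^ 2 := by
          refine sum_le_sum fun j _ => ?_
          rw [abs_mul]
          calc _ ≤ uu X q j * (2 * uu X q j / n) :=
                mul_le_mul (S.abs_nbar_sub j) (S.abs_rl_sub j) (abs_nonneg _) (S.uu0 j).le
            _ = _ := by ring
      _ ≤ 2 / n * (4 * (√n * n * q ^ 2)) := by rw [← mul_sum]; have := S.sum_uu_sq; gcongr
      _ = _ := by field_simp; ring
  have e : ∑ j, rm d X j = (∑ j, (nbar X - nn X j) * (rl d X j - rp d X)) / nbar X / √(rk d X) := by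
    rw [← h1, sum_div]; rfl
  rw [e, abs_div, abs_div, abs_of_pos hb, abs_of_pos S.sqrt_rk0, div_div,
    div_le_div_iff₀ (mul_pos hb S.sqrt_rk0) hs]
  have h3 : n / (2 * q) ≤ nbar X * √(rk d X) := by
    calc (n : ℝ) / (2 * q) = n / 2 * (1 / q) := by field_simp
      _ ≤ _ := mul_le_mul S.half_nbar S.sqrt_rk_ge (by positivity) hb.le
  calc _ ≤ 8 * (√n * q ^ 2) * √n := by gcongr
    _ = 16 * q ^ 3 * (n / (2 * q)) := by
        have := S.sq; field_simp; rw [this]; ring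
    _ ≤ q ^ 4 * (nbar X * √(rk d X)) := by
        have := mul_qpow S.hq 1 3 (show (16 : ℝ) ≤ _ by norm_num)
        gcongr

lemma cast_nn_mul_rl (S : Setup n d X q) (j : Fin n) : rl d X j * nn X j = d := by
  have := S.nn0 j; rw [rl]; field_simp

lemma ra0 (S : Setup n d X q) (j : Fin n) : 0 < ra d X j := mul_pos (S.nn0 j) (S.rK0 j)

lemma ra_ge (S : Setup n d X q) (j : Fin n) : n / (8 * q) ≤ ra d X j := by
  have := S.n0; have := S.q0
  calc (n : ℝ) / (8 * q) = n / 2 * (1 / (4 * q)) := by field_simp; norm_num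
    _ ≤ _ := mul_le_mul (S.half_le j) (S.rK_ge j) (by positivity) (S.nn0 j).le

lemma ra_le (S : Setup n d X q) (j : Fin n) : ra d X j ≤ n / 4 := by
  have := S.n0
  calc ra d X j ≤ n * (1 / 4) :=
        mul_le_mul (S.nn_le j) (S.rK_le j) (S.rK0 j).le this.le
    _ = _ := by ring

lemma abs_ra_sub (S : Setup n d X q) (j : Fin n) : |ra d X j - n * rk d X| ≤ 4 * uu X q j := by
  have e : ra d X j - n * rk d X = (nn X j - n) * rK d X j + n * (rK d X j - rk d X) := by
    rw [ra]; ring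
  have hn := S.n0
  have h1 : |(nn X j : ℝ) - n| ≤ 2 * uu X q j := by
    rw [S.cast_nn, uu, abs_le]; have := S.hq
    have : (0 : ℝ) ≤ xDeg X j := by positivity
    constructor <;> linarith
  rw [e]
  calc _ ≤ |((nn X j : ℝ) - n) * rK d X j| + |n * (rK d X j - rk d X)| := abs_add_le _ _
    _ ≤ 2 * uu X q j * 1 + n * (2 * uu X q j / n) := by
        rw [abs_mul, abs_mul, abs_of_pos (S.rK0 j), abs_of_pos hn]
        have := S.rK_le j; have := S.rK0 j; have := S.abs_rK_sub j; have := S.uu0 j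
        gcongr; linarith
    _ = _ := by field_simp; ring

/-- The reciprocals `1 / a_j` add up to `1 / κ` up to a small error. -/
lemma abs_inv_ra_sub (S : Setup n d X q) (j : Fin n) :
    |1 / ra d X j - 1 / (n * rk d X)| ≤ q ^ 3 * uu X q j / n ^ 2 := by
  have h1 := S.ra0 j; have h2 := S.rk0; have hn := S.n0; have hq := S.q0
  have e : 1 / ra d X j - 1 / (n * rk d X) =
      (n * rk d X - ra d X j) * ((1 / ra d X j) * ((1 / rk d X) / n)) := by field_simp
  have h3 : 1 / ra d X j ≤ 8 * q / n := by
    have := S.ra_ge j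
    calc 1 / ra d X j ≤ 1 / (n / (8 * q)) := by gcongr
      _ = _ := by field_simp
  rw [e, abs_mul, abs_sub_comm, abs_of_pos (by positivity : 0 < 1 / ra d X j * (1 / rk d X / n))]
  calc _ ≤ 4 * uu X q j * (8 * q / n * (4 * q / n)) := by
        have := S.abs_ra_sub j; have := S.inv_rk_le; have := S.uu0 j; gcongr
    _ = 128 * q ^ 2 * uu X q j / n ^ 2 := by ring
    _ ≤ _ := by
        have := mul_qpow S.hq 1 2 (show (128 : ℝ) ≤ _ by norm_num)
        have := S.uu0 j
        gcongr

lemma inv_ra_le (S : Setup n d X q) (j : Fin n) : 1 / ra d X j ≤ 8 * q / n := by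
  have := S.ra_ge j; have := S.n0; have := S.q0
  calc 1 / ra d X j ≤ 1 / (n / (8 * q)) := by gcongr
    _ = _ := by field_simp

lemma abs_sum_inv_ra_sub (S : Setup n d X q) :
    |∑ j, 1 / ra d X j - 1 / rk d X| ≤ q ^ 5 / n := by
  have hn := S.n0; have h2 := S.rk0; have := S.q0
  have e : ∑ j, 1 / ra d X j - 1 / rk d X = ∑ j, (1 / ra d X j - 1 / (n * rk d X)) := by
    rw [sum_sub_distrib]; congr 1; simp; field_simp
  rw [e]
  calc _ ≤ ∑ j, |1 / ra d X j - 1 / (n * rk d X)| := abs_sum_le_sum_abs _ _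
    _ ≤ ∑ j, q ^ 3 / n ^ 2 * uu X q j :=
        sum_le_sum fun j _ => (S.abs_inv_ra_sub j).trans (le_of_eq (by ring))
    _ ≤ q ^ 3 / n ^ 2 * (2 * (n * q)) := by rw [← mul_sum]; have := S.sum_uu; gcongr
    _ = 2 * q ^ 4 / n := by field_simp
    _ ≤ _ := by
        have := mul_qpow S.hq 1 4 (show (2 : ℝ) ≤ _ by norm_num)
        gcongr

lemma d_nat (S : Setup n d X q) (j : Fin n) : 2 ≤ d ∧ d + 2 ≤ nn X j := by
  have h1 := S.lo; have h2 := S.hi; have hx := S.hx j; have hc := S.cast_nn j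
  have h3 : √(n : ℝ) * q ^ 2 ≤ n / q := S.sq_le
  have h4 := S.s1000; have h5 := S.hq
  have h6 : 1000 * q * √(n : ℝ) ≤ √(n : ℝ) * q ^ 2 := by nlinarith
  have h7 : (1000 : ℝ) ≤ q * √(n : ℝ) := by nlinarith
  constructor
  · have : (2 : ℝ) ≤ d := by nlinarith
    exact_mod_cast this
  · have : (d : ℝ) + 2 ≤ nn X j := by rw [hc]; nlinarith
    exact_mod_cast this

lemma d_lt (S : Setup n d X q) : d < n := by
  have := (S.d_nat ⟨0, S.npos⟩).2
  have h : nn X ⟨0, S.npos⟩ ≤ n := by unfold nn; omega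
  omega

end Setup

end setup

section tail

variable {n d : ℕ} {X : SimpleGraph (Fin n)} {q : ℝ}

namespace Setup

lemma qn (S : Setup n d X q) (k : ℕ) (hk : k ≤ 400 := by norm_num) : q ^ k ≤ n := by
  have h1 : (1 : ℝ) ≤ q := by linarith [S.hq]
  calc q ^ k ≤ q ^ (200 * 2) := pow_le_pow_right₀ h1 (by omega)
    _ = (q ^ 200) ^ 2 := by rw [pow_mul]
    _ ≤ √(n : ℝ) ^ 2 := by have := S.hqn; have := S.q0; gcongr
    _ = n := S.sq

lemma ra_big (S : Setup n d X q) (j : Fin n) : 2 ≤ ra d X j := by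
  refine le_trans ?_ (S.ra_ge j)
  have h := S.qn 2; have := S.hq; have := S.q0
  rw [le_div_iff₀ (by positivity)]; nlinarith

lemma binW_pos (S : Setup n d X q) (j : Fin n) : 0 < binW (nn X j) (rl d X j) d := by
  have h := S.d_nat j
  refine lt_of_lt_of_le ?_ (binW_ge (by omega) (by omega) (S.cast_nn_mul_rl j))
  have : 0 < (nn X j : ℝ) * (rl d X j * (1 - rl d X j)) := S.ra0 j
  have := Real.pi_pos
  positivity

lemma rP0 (S : Setup n d X q) : 0 < rP d X := prod_pos fun j _ => S.binW_pos j

lemma row_le [NeZero (2 * n ^ 3)] (S : Setup n d X q) (j : Fin n) {y : ℝ}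
    (hy : |y| ≤ ra d X j / 2) :
    avg (fun l : ZMod (2 * n ^ 3) => Real.exp (-((ra d X j - y) * gap (root l)))) ≤
      binW (nn X j) (rl d X j) d * Real.exp (5 / 24 * (1 / ra d X j) +
        y / (2 * ra d X j) + 2 * y ^ 2 / ra d X j ^ 2 + 10 ^ 6 / ra d X j ^ 2) := by
  set a := ra d X j with ha
  have ha2 : 2 ≤ a := S.ra_big j
  have ha0 : 0 < a := by linarith
  have hn := S.n0
  obtain ⟨hy1, hy2⟩ := abs_le.1 hy
  have h1 : a / 2 ≤ a - y := by linarith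
  have hay : 0 < a - y := by linarith
  have hpi := Real.pi_pos
  have h2 : (a - y) ^ 3 ≤ (n ^ 3 : ℕ) := by
    push_cast
    have := S.ra_le j
    gcongr; linarith
  have h3 := avg_exp_gap_le (m := n ^ 3) (a := a - y) (by linarith) h2
  have h4 := binW_ge (by have := S.d_nat j; omega) (by have := S.d_nat j; omega)
    (S.cast_nn_mul_rl j)
  change 1 / √(2 * Real.pi * a) * Real.exp (-(1 / (12 * a))) ≤ _ at h4
  refine h3.trans (le_trans ?_ (mul_le_mul_of_nonneg_right h4 (Real.exp_nonneg _)))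
  have h5 : 1 / √(2 * Real.pi * (a - y)) ≤
      1 / √(2 * Real.pi * a) * Real.exp (y / (2 * a) + y ^ 2 / a ^ 2) := by
    have e1 : Real.exp (y / (2 * a) + y ^ 2 / a ^ 2) = √(Real.exp (y / a + 2 * (y / a) ^ 2)) := by
      rw [Real.sqrt_eq_rpow, ← Real.exp_mul]; congr 1; field_simp
    have hz : y / a ≤ 1 / 2 := by rw [div_le_iff₀ ha0]; linarith
    have e2 : 1 ≤ (1 - y / a) * Real.exp (y / a + 2 * (y / a) ^ 2) := by
      have := Real.add_one_le_exp (y / a + 2 * (y / a) ^ 2)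
      have h6 : 0 ≤ 1 - y / a := by linarith
      calc (1 : ℝ) ≤ (1 - y / a) * (y / a + 2 * (y / a) ^ 2 + 1) := by
            nlinarith [mul_nonneg (sq_nonneg (y / a)) (by linarith : (0:ℝ) ≤ 1 - 2 * (y / a))]
        _ ≤ _ := by gcongr
    rw [e1, div_mul_eq_mul_div, one_mul, div_le_div_iff₀ (by positivity) (by positivity), one_mul,
      ← Real.sqrt_mul (Real.exp_nonneg _)]
    apply Real.sqrt_le_sqrt
    have e3 : a = 1 * a := by ring
    calc 2 * Real.pi * a = 2 * Real.pi * a * 1 := by ring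
      _ ≤ 2 * Real.pi * a * ((1 - y / a) * Real.exp (y / a + 2 * (y / a) ^ 2)) := by gcongr
      _ = _ := by field_simp
  calc _ ≤ 1 / √(2 * Real.pi * a) * Real.exp (y / (2 * a) + y ^ 2 / a ^ 2) *
        Real.exp (1 / (8 * (a - y)) + 20000 / (a - y) ^ 2) := by gcongr
    _ ≤ _ := by
      rw [mul_assoc (1 / √(2 * Real.pi * a)), mul_assoc (1 / √(2 * Real.pi * a)), ← Real.exp_add,
        ← Real.exp_add]
      refine mul_le_mul_of_nonneg_left (Real.exp_le_exp.2 ?_) (by positivity)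
      have h7 : 20000 / (a - y) ^ 2 ≤ 80000 / a ^ 2 := by
        calc 20000 / (a - y) ^ 2 ≤ 20000 / (a / 2) ^ 2 := by gcongr
          _ = _ := by field_simp; norm_num
      have h8 : 1 / (8 * (a - y)) ≤ 1 / 8 * (1 / a) + (1 + y ^ 2) / a ^ 2 := by
        have e4 : 1 / (8 * (a - y)) = 1 / 8 * (1 / a) + y / (8 * a * (a - y)) := by
          field_simp; ring
        rw [e4]
        refine add_le_add le_rfl ?_
        calc y / (8 * a * (a - y)) ≤ (1 + y ^ 2) / (8 * a * (a - y)) := by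
              gcongr; nlinarith
          _ ≤ (1 + y ^ 2) / a ^ 2 := by
              gcongr; nlinarith
      have e5 : (1 + y ^ 2) / a ^ 2 = 1 / a ^ 2 + y ^ 2 / a ^ 2 := by ring
      have e6 : 10 ^ 6 / a ^ 2 = 10 ^ 6 * (1 / a ^ 2) := by ring
      have e7 : 80000 / a ^ 2 = 80000 * (1 / a ^ 2) := by ring
      have e8 : 2 * y ^ 2 / a ^ 2 = 2 * (y ^ 2 / a ^ 2) := by ring
      have e9 : 1 / (12 * a) = 1 / 12 * (1 / a) := by field_simp
      have : 0 ≤ 1 / a ^ 2 := by positivity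
      rw [e5] at h8; rw [e7] at h7
      rw [e6, e8, e9]; linarith

/-- Row weights with perturbed exponents, relative to the product of the point masses. -/
lemma tail_le [NeZero (2 * n ^ 3)] (S : Setup n d X q) {y : Fin n → ℝ}
    (hy : ∀ j, |y j| ≤ ra d X j / 2) :
    avg (fun t : Fin n → ZMod (2 * n ^ 3) =>
        Real.exp (-∑ j, (ra d X j - y j) * gap (root (t j)))) ≤
      rP d X * Real.exp (5 / 24 * (1 / rk d X) +
        ∑ j, (y j / (2 * ra d X j) + 2 * y j ^ 2 / ra d X j ^ 2) + 1) := by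
  have e : ∀ t : Fin n → ZMod (2 * n ^ 3),
      Real.exp (-∑ j, (ra d X j - y j) * gap (root (t j))) =
        ∏ j, Real.exp (-((ra d X j - y j) * gap (root (t j)))) := by
    intro t; rw [← sum_neg_distrib, Real.exp_sum]
  simp_rw [e]
  rw [avg_prod (fun j l => Real.exp (-((ra d X j - y j) * gap (root l))))]
  have hq := S.q0; have hn := S.n0
  calc _ ≤ ∏ j, (binW (nn X j) (rl d X j) d * Real.exp (5 / 24 * (1 / ra d X j) +
        y j / (2 * ra d X j) + 2 * y j ^ 2 / ra d X j ^ 2 + 10 ^ 6 / ra d X j ^ 2)) :=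
        prod_le_prod (fun j _ => avg_nonneg fun _ => (Real.exp_nonneg _))
          fun j _ => S.row_le j (hy j)
    _ = rP d X * Real.exp (∑ j, (5 / 24 * (1 / ra d X j) +
        y j / (2 * ra d X j) + 2 * y j ^ 2 / ra d X j ^ 2 + 10 ^ 6 / ra d X j ^ 2)) := by
        rw [prod_mul_distrib, Real.exp_sum, rP]
    _ ≤ _ := by
        have h0 := S.rP0
        gcongr
        have h1 := (abs_le.1 S.abs_sum_inv_ra_sub).2
        have h2 : ∑ j, (10 : ℝ) ^ 6 / ra d X j ^ 2 ≤ 1 / 2 := by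
          calc ∑ j, (10 : ℝ) ^ 6 / ra d X j ^ 2 ≤ ∑ _j : Fin n, q ^ 6 / (n : ℝ) ^ 2 := by
                refine sum_le_sum fun j _ => ?_
                have h3 := S.inv_ra_le j
                have := S.ra0 j
                calc (10 : ℝ) ^ 6 / ra d X j ^ 2 = 10 ^ 6 * (1 / ra d X j) ^ 2 := by ring
                  _ ≤ 10 ^ 6 * (8 * q / n) ^ 2 := by gcongr
                  _ = 64 * 10 ^ 6 * q ^ 2 / n ^ 2 := by ring
                  _ ≤ _ := by
                      have := mul_qpow S.hq 3 2 (show (64 * 10 ^ 6 : ℝ) ≤ _ by norm_num)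
                      gcongr
                      refine this.trans ?_
                      exact pow_le_pow_right₀ (by linarith [S.hq]) (by norm_num)
            _ = q ^ 6 / n := by simp; field_simp
            _ ≤ 1 / 2 := by
                have := S.qn 7; have := S.hq
                rw [div_le_iff₀ hn]
                have : (2 : ℝ) * q ^ 6 ≤ q ^ 7 := mul_qpow S.hq 1 6 (by norm_num)
                linarith
        have h4 : q ^ 5 / n ≤ 1 / 2 := by
          have := S.qn 6
          have : (2 : ℝ) * q ^ 5 ≤ q ^ 6 := mul_qpow S.hq 1 5 (by norm_num)
          rw [div_le_iff₀ hn]; linarith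
        have e2 : ∑ j, (5 / 24 * (1 / ra d X j) + y j / (2 * ra d X j) +
            2 * y j ^ 2 / ra d X j ^ 2 + 10 ^ 6 / ra d X j ^ 2) =
            5 / 24 * ∑ j, 1 / ra d X j + ∑ j, (y j / (2 * ra d X j) + 2 * y j ^ 2 / ra d X j ^ 2)
              + ∑ j, (10 : ℝ) ^ 6 / ra d X j ^ 2 := by
          rw [mul_sum, ← sum_add_distrib, ← sum_add_distrib]
          exact sum_congr rfl fun j _ => by ring
        rw [e2]; linarith

end Setup

end tail

section chernoff

variable {n d : ℕ} {X : SimpleGraph (Fin n)} {q : ℝ}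

/-- Total gap of a point of the torus. -/
def tg {M n : ℕ} [NeZero M] (t : Fin n → ZMod M) : ℝ := ∑ j, gap (root (t j))

lemma gap_root_nonneg {M : ℕ} [NeZero M] (l : ZMod M) : 0 ≤ gap (root l) :=
  gap_nonneg (norm_root l)

lemma gap_root_le_two {M : ℕ} [NeZero M] (l : ZMod M) : gap (root l) ≤ 2 :=
  gap_le_two (norm_root l)

lemma tg_nonneg {M n : ℕ} [NeZero M] (t : Fin n → ZMod M) : 0 ≤ tg t :=
  sum_nonneg fun _ _ => gap_root_nonneg _

namespace Setup

lemma five_inv_rk (S : Setup n d X q) : 5 / 24 * (1 / rk d X) ≤ q := by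
  have := S.inv_rk_le; have := S.q0; linarith

/-- Perturbed row weights on the event that some coordinate is far from the origin. -/
lemma avg_far_le [NeZero (2 * n ^ 3)] (S : Setup n d X q) {y : Fin n → ℝ} {L β : ℝ} (hβ : 0 ≤ β)
    (hy : ∀ j, |y j| ≤ ra d X j / 4)
    (hL : ∑ j, (y j / (2 * ra d X j) + 4 * y j ^ 2 / ra d X j ^ 2) ≤ L) :
    avg (fun t : Fin n → ZMod (2 * n ^ 3) => if ∃ j, β < gap (root (t j)) then
        Real.exp (-∑ j, (ra d X j - y j) * gap (root (t j))) else 0) ≤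
      rP d X * (n * Real.exp (q + L + 2 - n * β / (32 * q))) := by
  set y' : Fin n → Fin n → ℝ := fun k j => y j + if j = k then ra d X j / 4 else 0 with hy'
  have h1 : ∀ k, avg (fun t : Fin n → ZMod (2 * n ^ 3) =>
      Real.exp (-∑ j, (ra d X j - y' k j) * gap (root (t j)))) ≤
      rP d X * Real.exp (q + L + 2) := by
    intro k
    refine (S.tail_le (y := y' k) fun j => ?_).trans ?_
    · have := S.ra0 j
      refine (abs_add_le _ _).trans ?_
      have := hy j
      split_ifs
      · rw [abs_of_pos (by positivity : 0 < ra d X j / 4)]; linarith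
      · rw [abs_zero]; linarith
    · have h0 := S.rP0
      gcongr ?_ * Real.exp ?_
      have h2 : ∀ j, y' k j / (2 * ra d X j) + 2 * y' k j ^ 2 / ra d X j ^ 2 ≤
          (y j / (2 * ra d X j) + 4 * y j ^ 2 / ra d X j ^ 2) + if j = k then 1 / 2 else 0 := by
        intro j
        have ha := S.ra0 j
        simp only [hy']
        split_ifs
        · have e1 : (y j + ra d X j / 4) / (2 * ra d X j) = y j / (2 * ra d X j) + 1 / 8 := by
            field_simp; ring
          have e2 : 4 * y j ^ 2 / ra d X j ^ 2 + 1 / 4 =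
              (4 * y j ^ 2 + ra d X j ^ 2 / 4) / ra d X j ^ 2 := by field_simp
          have e3 : 2 * (y j + ra d X j / 4) ^ 2 / ra d X j ^ 2 ≤
              (4 * y j ^ 2 + ra d X j ^ 2 / 4) / ra d X j ^ 2 := by
            gcongr; nlinarith [sq_nonneg (y j - ra d X j / 4)]
          linarith
        · have : 2 * (y j + 0) ^ 2 / ra d X j ^ 2 ≤ 4 * y j ^ 2 / ra d X j ^ 2 := by
            rw [add_zero]; gcongr; norm_num
          simp only [add_zero] at this ⊢; linarith
      have h3 := (sum_le_sum fun j (_ : j ∈ univ) => h2 j).trans_eq sum_add_distrib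
      rw [sum_ite_eq' univ k] at h3
      simp only [mem_univ, if_true] at h3
      have := S.five_inv_rk
      linarith
  have hn := S.n0; have hq := S.q0
  calc _ ≤ avg (fun t : Fin n → ZMod (2 * n ^ 3) => ∑ k,
        Real.exp (-∑ j, (ra d X j - y' k j) * gap (root (t j))) *
          Real.exp (-(n * β / (32 * q)))) := by
        refine avg_mono fun t => ?_
        split_ifs with h
        · obtain ⟨k, hk⟩ := h
          refine le_trans ?_ (single_le_sum (f := fun k =>
            Real.exp (-∑ j, (ra d X j - y' k j) * gap (root (t j))) *
            Real.exp (-(n * β / (32 * q)))) (fun _ _ => by positivity) (mem_univ k))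
          rw [← Real.exp_add]
          apply Real.exp_le_exp.2
          have e : ∑ j, (ra d X j - y' k j) * gap (root (t j)) =
              ∑ j, (ra d X j - y j) * gap (root (t j)) - ra d X k / 4 * gap (root (t k)) := by
            rw [eq_sub_iff_add_eq]
            have : ra d X k / 4 * gap (root (t k)) =
                ∑ j, if j = k then ra d X j / 4 * gap (root (t j)) else 0 := by simp
            rw [this, ← sum_add_distrib]
            refine sum_congr rfl fun j _ => ?_
            simp only [hy']; split_ifs <;> ring
          rw [e]
          have h3 : n * β / (32 * q) ≤ ra d X k / 4 * gap (root (t k)) := by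
            calc n * β / (32 * q) = n / (8 * q) / 4 * β := by field_simp; ring
              _ ≤ _ := by have := S.ra_ge k; have := S.ra0 k; gcongr
          linarith
        · exact sum_nonneg fun _ _ => by positivity
    _ ≤ ∑ _k : Fin n, rP d X * Real.exp (q + L + 2) * Real.exp (-(n * β / (32 * q))) := by
        rw [avg_sum]
        refine sum_le_sum fun k _ => ?_
        rw [avg_mul_const]
        have := h1 k; gcongr
    _ = _ := by
        rw [sub_eq_add_neg, Real.exp_add (q + L + 2)]; simp; ring

/-- Perturbed row weights on the event that the total gap is atypical. -/
lemma avg_atypical_le [NeZero (2 * n ^ 3)] (S : Setup n d X q) {y : Fin n → ℝ} {L η : ℝ}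
    (hy : ∀ j, |y j| ≤ ra d X j / 4)
    (hL : ∑ j, (y j / (2 * ra d X j) + 4 * y j ^ 2 / ra d X j ^ 2) ≤ L) :
    avg (fun t : Fin n → ZMod (2 * n ^ 3) => if η < |2 * rk d X * tg t - 1| then
        Real.exp (-∑ j, (ra d X j - y j) * gap (root (t j))) else 0) ≤
      rP d X * (2 * Real.exp (q + L + q ^ 3 + 2 - √n * η)) := by
  have hn := S.n0; have hq := S.q0; have hs := S.s0; have hk := S.rk0; have hkl := S.rk_le
  have h1 : ∀ σ : ℝ, σ ^ 2 = 1 → avg (fun t : Fin n → ZMod (2 * n ^ 3) =>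
      Real.exp (-∑ j, (ra d X j - (y j + σ * (2 * rk d X * √n))) * gap (root (t j)))) ≤
      rP d X * Real.exp (q + L + q ^ 3 + 2 + σ * √n) := by
    intro σ hσ
    have hσ' : |σ| = 1 := by
      rw [← sq_eq_sq₀ (abs_nonneg _) zero_le_one, sq_abs, hσ, one_pow]
    refine (S.tail_le (y := fun j => y j + σ * (2 * rk d X * √n)) fun j => ?_).trans ?_
    · refine (abs_add_le _ _).trans ?_
      have := hy j
      have h2 : √(n : ℝ) ≤ ra d X j / 4 := by
        have h3 := S.ra_ge j
        have h4 : √(n : ℝ) * q ^ 1 ≤ n / q := S.sq_le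
        have h5 : (n : ℝ) / (8 * q) = n / q / 8 := by field_simp
        have := S.hq
        nlinarith
      rw [abs_mul, hσ', one_mul, abs_of_pos (by positivity : 0 < 2 * rk d X * √n)]
      nlinarith
    · have h0 := S.rP0
      gcongr ?_ * Real.exp ?_
      have h2 : ∀ j, (y j + σ * (2 * rk d X * √n)) / (2 * ra d X j) +
          2 * (y j + σ * (2 * rk d X * √n)) ^ 2 / ra d X j ^ 2 ≤
          (y j / (2 * ra d X j) + 4 * y j ^ 2 / ra d X j ^ 2) +
            (σ * (rk d X * √n) * (1 / ra d X j) + 64 * q ^ 2 / n) := by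
        intro j
        have ha := S.ra0 j
        have e1 : (y j + σ * (2 * rk d X * √n)) / (2 * ra d X j) =
            y j / (2 * ra d X j) + σ * (rk d X * √n) * (1 / ra d X j) := by field_simp
        have e2 : 2 * (y j + σ * (2 * rk d X * √n)) ^ 2 / ra d X j ^ 2 ≤
            (4 * y j ^ 2 + n) / ra d X j ^ 2 := by
          gcongr
          have h3 : (σ * (2 * rk d X * √n)) ^ 2 ≤ n / 4 := by
            rw [mul_pow, mul_pow, hσ, S.sq]
            have : (2 * rk d X) ^ 2 ≤ 1 / 4 := by nlinarith
            nlinarith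
          nlinarith [sq_nonneg (y j - σ * (2 * rk d X * √n))]
        have e3 : (n : ℝ) / ra d X j ^ 2 ≤ 64 * q ^ 2 / n := by
          have := S.inv_ra_le j
          calc (n : ℝ) / ra d X j ^ 2 = n * (1 / ra d X j) ^ 2 := by ring
            _ ≤ n * (8 * q / n) ^ 2 := by gcongr
            _ = _ := by field_simp; norm_num
        rw [add_div] at e2; linarith
      have h3 := (sum_le_sum fun j (_ : j ∈ univ) => h2 j).trans_eq (sum_add_distrib.trans
        (congrArg _ (sum_add_distrib.trans (congrArg₂ _ (mul_sum _ _ _).symm rfl))))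
      have h4 : ∑ _j : Fin n, 64 * q ^ 2 / (n : ℝ) = 64 * q ^ 2 := by simp; field_simp
      have h5 : σ * (rk d X * √n) * ∑ j, 1 / ra d X j ≤ σ * √n + 1 := by
        have h6 := S.abs_sum_inv_ra_sub
        have e : σ * (rk d X * √n) * ∑ j, 1 / ra d X j = σ * √n +
          σ * (rk d X * √n) * (∑ j, 1 / ra d X j - 1 / rk d X) := by field_simp; ring
        rw [e]
        refine add_le_add le_rfl ((le_abs_self _).trans ?_)
        rw [abs_mul, abs_mul, hσ', one_mul, abs_of_pos (by positivity)]
        calc rk d X * √n * |∑ j, 1 / ra d X j - 1 / rk d X| ≤ 1 * √n * (q ^ 5 / n) := by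
              gcongr; linarith
          _ = q ^ 5 / √n := by
              have := S.sq; field_simp; linarith
          _ ≤ 1 := by rw [div_le_one hs]; exact S.qle 5
      have h6 := S.five_inv_rk
      have h7 : 64 * q ^ 2 ≤ q ^ 3 := mul_qpow S.hq 1 2 (by norm_num)
      linarith
  calc _ ≤ avg (fun t : Fin n → ZMod (2 * n ^ 3) =>
        Real.exp (-∑ j, (ra d X j - (y j + 1 * (2 * rk d X * √n))) * gap (root (t j))) *
          Real.exp (-√n - √n * η) +
        Real.exp (-∑ j, (ra d X j - (y j + -1 * (2 * rk d X * √n))) * gap (root (t j))) *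
          Real.exp (√n - √n * η)) := by
        refine avg_mono fun t => ?_
        have e : ∀ σ : ℝ, ∑ j, (ra d X j - (y j + σ * (2 * rk d X * √n))) * gap (root (t j)) =
            ∑ j, (ra d X j - y j) * gap (root (t j)) - σ * √n * (2 * rk d X * tg t) := by
          intro σ
          rw [tg, mul_sum, mul_sum, ← sum_sub_distrib]
          exact sum_congr rfl fun j _ => by ring
        rw [e, e, ← Real.exp_add, ← Real.exp_add]
        split_ifs with h
        · rcases lt_abs.1 h with h | h
          · refine le_add_of_le_of_nonneg (Real.exp_le_exp.2 ?_) (by positivity)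
            nlinarith
          · refine le_add_of_nonneg_of_le (by positivity) (Real.exp_le_exp.2 ?_)
            nlinarith
        · positivity
    _ ≤ rP d X * Real.exp (q + L + q ^ 3 + 2 + 1 * √n) * Real.exp (-√n - √n * η) +
        rP d X * Real.exp (q + L + q ^ 3 + 2 + -1 * √n) * Real.exp (√n - √n * η) := by
        rw [avg_add, avg_mul_const, avg_mul_const]
        have := h1 1 (by norm_num); have := h1 (-1) (by norm_num)
        gcongr
    _ = _ := by
        rw [mul_assoc, mul_assoc, ← Real.exp_add, ← Real.exp_add, ← mul_add]
        congr 1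
        rw [two_mul]; congr 2 <;> ring

end Setup

end chernoff

section generating

variable {n d : ℕ} {X : SimpleGraph (Fin n)} {q : ℝ}

lemma ite_compl_adj {A : Type*} [AddCommGroup A] (X : SimpleGraph (Fin n)) (j k : Fin n) (a : A) :
    (if Xᶜ.Adj j k then a else 0) =
      a - (if X.Adj j k then a else 0) - if j = k then a else 0 := by
  by_cases h : j = k
  · subst h; simp
  · by_cases h2 : X.Adj j k <;> simp [SimpleGraph.compl_adj, h, h2]

lemma sum_sum_ite_compl {A : Type*} [AddCommGroup A] (X : SimpleGraph (Fin n))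
    (H : SimpleGraph (Fin n)) (hH : H = Xᶜ) (f : Fin n → Fin n → A) :
    (∑ j, ∑ k, if H.Adj j k then f j k else 0) =
      ∑ j, ∑ k, f j k - (∑ j, ∑ k, if X.Adj j k then f j k else 0) - ∑ j, f j j := by
  have h : ∀ j k, (if H.Adj j k then f j k else 0) =
      f j k - (if X.Adj j k then f j k else 0) - if j = k then f j k else 0 := by
    intro j k; subst hH; rw [← ite_compl_adj]; congr
  simp only [h]
  simp only [sum_sub_distrib, sum_ite_eq, mem_univ, if_true]

lemma sum_compl_prs {A : Type*} [CommRing A] (X : SimpleGraph (Fin n)) (f : Fin n → A) :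
    2 * ∑ p ∈ prs Xᶜ, f p.1 * f p.2 =
      (∑ j, f j) ^ 2 - ∑ j, f j ^ 2 - 2 * ∑ p ∈ prs X, f p.1 * f p.2 := by
  rw [sum_prs_mul, sum_prs_mul, sum_sum_ite_compl X _ rfl, pow_two (∑ j, f j), sum_mul_sum]
  simp only [pow_two]; ring

lemma sum_prs_le (H : SimpleGraph (Fin n)) {f : Fin n → ℝ} (hf : ∀ j, 0 ≤ f j) :
    2 * ∑ p ∈ prs H, f p.1 * f p.2 ≤ (∑ j, f j) ^ 2 := by
  rw [sum_prs_mul, pow_two, sum_mul_sum]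
  refine sum_le_sum fun j _ => sum_le_sum fun k _ => ?_
  split_ifs
  · exact le_rfl
  · exact mul_nonneg (hf j) (hf k)

lemma gap_mul_le {e e' : ℂ} (he : ‖e‖ = 1) (he' : ‖e'‖ = 1) :
    gap (e * e') ≤ 2 * (gap e + gap e') := by
  have h1 := unit_sq he; have h2 := unit_sq he'
  simp only [gap, Complex.mul_re]
  nlinarith [sq_nonneg (e.im - e'.im), sq_nonneg (e.im + e'.im), sq_nonneg (e.re + e'.re),
    sq_nonneg (e.re - e'.re), sq_nonneg (e.re - 1), sq_nonneg (e'.re - 1)]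

lemma gap_sq_le {e : ℂ} (he : ‖e‖ = 1) : gap (e * e) ≤ 4 * gap e := by
  have := gap_mul_le he he; linarith

/-- Lower bound for the number of unordered pairs outside `X` whose factor is small. -/
lemma sum_gap_compl_ge (X : SimpleGraph (Fin n)) {e : Fin n → ℂ} (he : ∀ j, ‖e j‖ = 1) :
    (∑ j, gap (e j)) * (n - (∑ j, gap (e j)) / 2 - 2) - 2 * ∑ j, xDeg X j * gap (e j) ≤
      ∑ p ∈ prs Xᶜ, gap (e p.1 * e p.2) := by
  set T := ∑ j, gap (e j) with hT
  have h1 : ∀ H : SimpleGraph (Fin n), 2 * ∑ p ∈ prs H, gap (e p.1 * e p.2) =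
      ∑ j, ∑ k, if H.Adj j k then gap (e j * e k) else 0 := by
    intro H
    rw [← sum_prs_add, mul_sum]
    exact sum_congr rfl fun p _ => by rw [mul_comm (e p.2)]; ring
  have h2 : ∑ j, ∑ k, gap (e j * e k) = n ^ 2 - ((∑ j, e j) ^ 2).re := by
    simp only [gap, sum_sub_distrib]
    rw [pow_two (∑ j, e j), sum_mul_sum]
    simp [pow_two]
  have h3 : ((∑ j, e j) ^ 2).re ≤ (n - T) ^ 2 := by
    have : (∑ j, e j).re = n - T := by simp [hT, gap, sum_sub_distrib]
    rw [pow_two, Complex.mul_re, this]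
    nlinarith [sq_nonneg (∑ j, e j).im]
  have h4 : ∑ p ∈ prs X, gap (e p.1 * e p.2) ≤ 2 * ∑ j, xDeg X j * gap (e j) := by
    rw [← sum_prs_symm, mul_sum]
    exact sum_le_sum fun p _ => gap_mul_le (he _) (he _)
  have h5 : ∑ j, gap (e j * e j) ≤ 4 * T := by
    rw [hT, mul_sum]; exact sum_le_sum fun j _ => gap_sq_le (he j)
  have h6 := h1 Xᶜ
  rw [sum_sum_ite_compl X _ rfl, ← h1, h2] at h6
  nlinarith

lemma norm_factor_le {α β : ℝ} (hα : 0 < α) (hβ : 0 < β) {z : ℂ} (hz : ‖z‖ = 1) :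
    ‖(α : ℂ) + β * z‖ ≤ (α + β) * Real.exp (-(α * β / (α + β) ^ 2 * gap z)) := by
  have h : (α : ℂ) + β * z = ((α + β : ℝ) : ℂ) * bern (β / (α + β)) z := by
    have : (α : ℂ) + β ≠ 0 := by exact_mod_cast (by positivity : α + β ≠ 0)
    rw [bern]; push_cast; field_simp; ring
  rw [h, norm_mul, Complex.norm_real, Real.norm_of_nonneg (by positivity)]
  have h2 := norm_bern_le (β / (α + β)) hz
  have e : β / (α + β) * (1 - β / (α + β)) = α * β / (α + β) ^ 2 := by field_simp; ring
  rw [e] at h2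
  gcongr

/-- Integrand of the Fourier representation. -/
def Fg {M : ℕ} [NeZero M] (d : ℕ) (X : SimpleGraph (Fin n)) (t : Fin n → ZMod M) : ℂ :=
  (∏ p ∈ prs Xᶜ, ((((1 - rl d X p.1) * (1 - rl d X p.2) / (1 - rp d X) : ℝ) : ℂ) +
    ((rl d X p.1 * rl d X p.2 / rp d X : ℝ) : ℂ) * (root (t p.1) * root (t p.2)))) *
    ∏ j, (root (t j))⁻¹ ^ d

def ps0 {M : ℕ} [NeZero M] (d : ℕ) (X : SimpleGraph (Fin n)) (t : Fin n → ZMod M) (j : Fin n) : ℂ :=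
  ((rK d X j / √(rk d X) : ℝ) : ℂ) * incr (rl d X j) (root (t j))

def psi {M : ℕ} [NeZero M] (d : ℕ) (X : SimpleGraph (Fin n)) (t : Fin n → ZMod M) (j : Fin n) : ℂ :=
  (rm d X j : ℂ) + ps0 d X t j

namespace Setup

variable {M : ℕ} [NeZero M]

lemma Fg_eq (S : Setup n d X q) {t : Fin n → ZMod M} (ht : ∀ j, gap (root (t j)) ≤ 1) :
    Fg d X t = (∏ j, bern (rl d X j) (root (t j)) ^ nn X j * (root (t j))⁻¹ ^ d) *
      ∏ p ∈ prs Xᶜ, (1 + psi d X t p.1 * psi d X t p.2) := by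
  have h : ∀ p ∈ prs Xᶜ, ((((1 - rl d X p.1) * (1 - rl d X p.2) / (1 - rp d X) : ℝ) : ℂ) +
      ((rl d X p.1 * rl d X p.2 / rp d X : ℝ) : ℂ) * (root (t p.1) * root (t p.2))) =
      bern (rl d X p.1) (root (t p.1)) * bern (rl d X p.2) (root (t p.2)) *
        (1 + psi d X t p.1 * psi d X t p.2) := by
    intro p _
    rw [← pair_identity (s := √(rk d X)) S.sqrt_rk_sq S.rp0.ne' (by linarith [S.rp1])]
    · rfl
    · exact bern_ne_zero _ (norm_root _) (ht _)
    · exact bern_ne_zero _ (norm_root _) (ht _)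
  rw [Fg, prod_congr rfl h, prod_mul_distrib,
    prod_prs Xᶜ (fun j => bern (rl d X j) (root (t j))), prod_mul_distrib]
  simp_rw [xDeg_compl]
  rw [mul_right_comm]; rfl

lemma factor_add (S : Setup n d X q) (j k : Fin n) :
    (1 - rl d X j) * (1 - rl d X k) / (1 - rp d X) + rl d X j * rl d X k / rp d X =
      1 + rm d X j * rm d X k := by
  have h1 := S.rp0; have h2 : 0 < 1 - rp d X := by linarith [S.rp1]
  have e : rm d X j * rm d X k = (rl d X j - rp d X) * (rl d X k - rp d X) /
    (rp d X * (1 - rp d X)) := by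
    rw [rm, rm, div_mul_div_comm, ← pow_two, S.sqrt_rk_sq, rk]
  rw [e]; field_simp; ring

lemma factor_mul (_ : Setup n d X q) (j k : Fin n) :
    (1 - rl d X j) * (1 - rl d X k) / (1 - rp d X) * (rl d X j * rl d X k / rp d X) =
      rK d X j * rK d X k / rk d X := by
  rw [rK, rK, rk, div_mul_div_comm]; congr 1 <;> ring

lemma abs_rm_mul_le (S : Setup n d X q) (j k : Fin n) :
    |rm d X j * rm d X k| ≤ q ^ 6 / n := by
  have h1 := S.abs_rm_le' j; have h2 := S.abs_rm_le' k
  have := S.s0; have := S.q0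
  rw [abs_mul]
  calc _ ≤ q ^ 3 / √n * (q ^ 3 / √n) := by gcongr
    _ = q ^ 6 / √n ^ 2 := by ring
    _ = _ := by rw [S.sq]

lemma rK_div_ge (S : Setup n d X q) (j : Fin n) : |rK d X j / rk d X - 1| ≤ q ^ 3 / √n := by
  refine (S.abs_rK_div j).trans ?_
  have := S.q0; have := S.s0
  calc 8 * q * uu X q j / n = 8 * q * (uu X q j / n) := by ring
    _ ≤ 8 * q * (2 * q / √n) := by have := S.uu_div_le j; gcongr
    _ = 16 * q ^ 2 / √n := by ring
    _ ≤ _ := by gcongr; exact mul_qpow S.hq 1 2 (by norm_num)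

lemma div_s_le (S : Setup n d X q) (k : ℕ) (hk : k ≤ 199 := by norm_num) :
    q ^ k / √n ≤ 1 / 1000 := by
  have h := S.qle (k + 1) (by omega)
  have := S.hq; have := S.q0
  rw [div_le_iff₀ S.s0, ← mul_le_mul_iff_right₀ (by norm_num : (0 : ℝ) < 1000)]
  calc 1000 * q ^ k ≤ q ^ (k + 1) := by rw [pow_succ, mul_comm]; gcongr
    _ ≤ _ := h
    _ = _ := by ring

lemma div_n_le (S : Setup n d X q) (k : ℕ) (hk : k ≤ 200 := by norm_num) :
    q ^ k / n ≤ 1 / √n := by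
  have := S.s0
  have h := S.qle k hk
  rw [div_le_div_iff₀ S.n0 this]
  nlinarith [S.sq]

lemma rK_div_le (S : Setup n d X q) (j : Fin n) : rK d X j / rk d X ≤ 2 := by
  have := (abs_le.1 (S.rK_div_ge j)).2; have := S.div_s_le 3; linarith

lemma factor_rate_ge (S : Setup n d X q) (j k : Fin n) :
    rk d X * (1 - q ^ 4 / √n) ≤ rK d X j * rK d X k / rk d X / (1 + rm d X j * rm d X k) ^ 2 := by
  have h1 := (abs_le.1 (S.rK_div_ge j)).1
  have h2 := (abs_le.1 (S.rK_div_ge k)).1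
  have h3 := (abs_le.1 (S.abs_rm_mul_le j k)).2
  have h3' := (abs_le.1 (S.abs_rm_mul_le j k)).1
  have hk := S.rk0; have hs := S.s0; have hq := S.q0
  set δ := q ^ 3 / √n with hδ
  have hδ0 : 0 < δ := by positivity
  have hδ1 : δ ≤ 1 / 1000 := S.div_s_le 3
  have h4 : q ^ 6 / n ≤ δ := by
    refine (S.div_n_le 6).trans ?_
    rw [hδ]; gcongr; exact one_le_pow₀ (by linarith [S.hq])
  have h5 : q ^ 4 / √n = q * δ := by rw [hδ]; ring
  have h6 : rK d X j * rK d X k / rk d X =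
      rk d X * ((rK d X j / rk d X) * (rK d X k / rk d X)) := by field_simp
  set w := rm d X j * rm d X k
  have hw : 0 < 1 + w := by linarith
  rw [h5, h6, mul_div_assoc]
  refine mul_le_mul_of_nonneg_left ?_ hk.le
  rw [le_div_iff₀ (pow_pos hw 2)]
  have h7 : (1 - δ) * (1 - δ) ≤ (rK d X j / rk d X) * (rK d X k / rk d X) :=
    mul_le_mul (by linarith) (by linarith) (by linarith) (by linarith)
  refine le_trans ?_ h7
  have h8 : (1 + w) ^ 2 ≤ (1 + δ) ^ 2 := by gcongr; linarith
  have hqδ : 1000 * δ ≤ q * δ := by have := S.hq; gcongr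
  rcases le_total 0 (1 - q * δ) with h | h
  · calc (1 - q * δ) * (1 + w) ^ 2 ≤ (1 - q * δ) * (1 + δ) ^ 2 :=
          mul_le_mul_of_nonneg_left h8 h
      _ ≤ (1 - 1000 * δ) * (1 + δ) ^ 2 :=
          mul_le_mul_of_nonneg_right (by linarith) (by positivity)
      _ ≤ (1 - δ) * (1 - δ) := by nlinarith [pow_pos hδ0 2, pow_pos hδ0 3]
  · have : (1 - q * δ) * (1 + w) ^ 2 ≤ 0 := mul_nonpos_of_nonpos_of_nonneg h (by positivity)
    nlinarith

lemma sum_abs_rm_le (S : Setup n d X q) : ∑ j, |rm d X j| ≤ q ^ 3 := by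
  have := S.q0; have := S.n0
  calc _ ≤ ∑ j, 2 * q / n * uu X q j := sum_le_sum fun j _ =>
        (S.abs_rm_le j).trans (le_of_eq (by ring))
    _ ≤ 2 * q / n * (2 * (n * q)) := by rw [← mul_sum]; have := S.sum_uu; gcongr
    _ = 4 * q ^ 2 := by field_simp; norm_num
    _ ≤ _ := mul_qpow S.hq 1 2 (by norm_num)

lemma norm_Fg_le (S : Setup n d X q) (t : Fin n → ZMod M) :
    ‖Fg d X t‖ ≤ Real.exp (q ^ 6 - rk d X * (1 - q ^ 4 / √n) *
      ∑ p ∈ prs Xᶜ, gap (root (t p.1) * root (t p.2))) := by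
  have h1 : ‖∏ j, (root (t j))⁻¹ ^ d‖ = 1 := by
    rw [norm_prod]; exact prod_eq_one fun j _ => by rw [norm_pow, norm_inv, norm_root]; simp
  rw [Fg, norm_mul, h1, mul_one, norm_prod]
  have h2 : ∀ p ∈ prs Xᶜ, ‖(((1 - rl d X p.1) * (1 - rl d X p.2) / (1 - rp d X) : ℝ) : ℂ) +
      ((rl d X p.1 * rl d X p.2 / rp d X : ℝ) : ℂ) * (root (t p.1) * root (t p.2))‖ ≤
      Real.exp (|rm d X p.1| * |rm d X p.2| - rk d X * (1 - q ^ 4 / √n) *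
        gap (root (t p.1) * root (t p.2))) := by
    intro p _
    have hp : ∀ j, 0 < 1 - rl d X j := fun j => by linarith [S.rl1 j]
    have hu : ‖root (t p.1) * root (t p.2)‖ = 1 := by simp [norm_root]
    refine (norm_factor_le (div_pos (mul_pos (hp _) (hp _)) (by linarith [S.rp1]))
      (div_pos (mul_pos (S.rl0 _) (S.rl0 _)) S.rp0) hu).trans ?_
    rw [S.factor_add, S.factor_mul, sub_eq_add_neg, Real.exp_add]
    have h3 : 1 + rm d X p.1 * rm d X p.2 ≤ Real.exp (|rm d X p.1| * |rm d X p.2|) := by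
      rw [← abs_mul]
      have := Real.add_one_le_exp |rm d X p.1 * rm d X p.2|
      have := le_abs_self (rm d X p.1 * rm d X p.2); linarith
    have h4 := S.factor_rate_ge p.1 p.2
    have h5 := gap_nonneg hu
    gcongr
  calc _ ≤ ∏ p ∈ prs Xᶜ, _ := prod_le_prod (fun _ _ => norm_nonneg _) h2
    _ = Real.exp (∑ p ∈ prs Xᶜ, |rm d X p.1| * |rm d X p.2| - rk d X * (1 - q ^ 4 / √n) *
        ∑ p ∈ prs Xᶜ, gap (root (t p.1) * root (t p.2))) := by
        rw [← Real.exp_sum, sum_sub_distrib, mul_sum]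
    _ ≤ _ := by
        gcongr
        have h6 := sum_prs_le Xᶜ (f := fun j => |rm d X j|) fun j => abs_nonneg _
        have h7 : (∑ j, |rm d X j|) ^ 2 ≤ (q ^ 3) ^ 2 := by
          have := S.sum_abs_rm_le
          gcongr
        have h8 : 0 ≤ ∑ p ∈ prs Xᶜ, |rm d X p.1| * |rm d X p.2| :=
          sum_nonneg fun _ _ => by positivity
        rw [← pow_mul] at h7
        simp only [Nat.reduceMul] at h7
        linarith

end Setup

end generating

section regions

variable {n d : ℕ} {X : SimpleGraph (Fin n)} {q : ℝ}

/-- The part of the torus carrying the integral, up to reflection. -/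
def core {M n : ℕ} [NeZero M] (d : ℕ) (X : SimpleGraph (Fin n)) (q : ℝ)
    (t : Fin n → ZMod M) : Prop :=
  (∀ j, gap (root (t j)) ≤ q ^ 14 / n) ∧ |2 * rk d X * tg t - 1| ≤ q ^ 32 / √n

lemma norm_one_add_le_exp (w : ℂ) : ‖1 + w‖ ≤ Real.exp (w.re + ‖w‖ ^ 2 / 2) := by
  refine (sq_le_sq₀ (norm_nonneg _) (Real.exp_nonneg _)).1 ?_
  have h1 : ‖1 + w‖ ^ 2 = 1 + 2 * w.re + ‖w‖ ^ 2 := by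
    rw [Complex.sq_norm, Complex.sq_norm, Complex.normSq_apply, Complex.normSq_apply]
    simp; ring
  rw [h1, ← Real.exp_nat_mul]
  have := Real.add_one_le_exp (((2 : ℕ) : ℝ) * (w.re + ‖w‖ ^ 2 / 2))
  push_cast at this ⊢
  linarith

namespace Setup

lemma one_le_q (S : Setup n d X q) : 1 ≤ q := by linarith [S.hq]

lemma n_le_exp (S : Setup n d X q) : (n : ℝ) ≤ Real.exp q :=
  (Real.log_le_iff_le_exp S.n0).1 S.hlog

lemma pow_le_pow (S : Setup n d X q) {k l : ℕ} (h : k ≤ l := by norm_num) : q ^ k ≤ q ^ l :=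
  pow_le_pow_right₀ S.one_le_q h

lemma n1000 (S : Setup n d X q) : (1000 : ℝ) ≤ n := S.s1000.trans S.sle

lemma rP_ge (S : Setup n d X q) : Real.exp (-(n * q)) ≤ rP d X := by
  have h : ∀ j, Real.exp (-q) ≤ binW (nn X j) (rl d X j) d := by
    intro j
    have hd := S.d_nat j
    refine le_trans ?_ (binW_ge (by omega) (by omega) (S.cast_nn_mul_rl j))
    change _ ≤ 1 / √(2 * Real.pi * ra d X j) * Real.exp (-(1 / (12 * ra d X j)))
    have ha := S.ra0 j; have hn := S.n0; have h2 := S.ra_big j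
    have h1 : √(2 * Real.pi * ra d X j) ≤ n / 2 := by
      rw [Real.sqrt_le_left (by positivity)]
      have := S.ra_le j; have := S.n1000; have := Real.pi_lt_four; nlinarith [Real.pi_pos]
    have h3 : 1 / 2 ≤ Real.exp (-(1 / (12 * ra d X j))) := by
      have h4 := Real.add_one_le_exp (-(1 / (12 * ra d X j)))
      have : 1 / (12 * ra d X j) ≤ 1 / 24 := by gcongr; linarith
      linarith
    have h5 : 0 < √(2 * Real.pi * ra d X j) := by have := Real.pi_pos; positivity
    calc Real.exp (-q) = 1 / Real.exp q := by rw [Real.exp_neg, one_div]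
      _ ≤ 1 / n := by have := S.n_le_exp; gcongr
      _ = 1 / (n / 2) * (1 / 2) := by field_simp
      _ ≤ _ := by gcongr
  calc Real.exp (-(n * q)) = ∏ _j : Fin n, Real.exp (-q) := by
        rw [prod_const, card_univ, Fintype.card_fin, ← Real.exp_nat_mul]; congr 1; ring
    _ ≤ _ := prod_le_prod (fun _ _ => (Real.exp_pos _).le) fun j _ => h j

lemma sum_x_gap_le (S : Setup n d X q) {M : ℕ} [NeZero M] (t : Fin n → ZMod M) :
    ∑ j, xDeg X j * gap (root (t j)) ≤ √n * q * tg t := by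
  rw [tg, mul_sum]
  exact sum_le_sum fun j _ => mul_le_mul_of_nonneg_right (S.hx j) (gap_root_nonneg _)

lemma rate_pos (S : Setup n d X q) : 1 / (5 * q) ≤ rk d X * (1 - q ^ 4 / √n) := by
  have h1 := S.rk_ge; have h2 := S.div_s_le 4; have := S.q0
  calc 1 / (5 * q) = 1 / (4 * q) * (4 / 5) := by field_simp
    _ ≤ _ := mul_le_mul h1 (by linarith) (by norm_num) S.rk0.le

lemma norm_Fg_mid_le (S : Setup n d X q) {M : ℕ} [NeZero M] {t : Fin n → ZMod M}
    (h1 : q ^ 4 ≤ tg t) (h2 : tg t ≤ n) : ‖Fg d X t‖ ≤ rP d X * Real.exp (-n) := by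
  refine (S.norm_Fg_le t).trans ?_
  calc _ ≤ Real.exp (-(n * q) + -n) := ?_
    _ = Real.exp (-(n * q)) * Real.exp (-n) := Real.exp_add _ _
    _ ≤ _ := by have := S.rP_ge; gcongr
  apply Real.exp_le_exp.2
  have hq := S.q0; have hn := S.n0; have hn1 := S.n1000
  have h3 := sum_gap_compl_ge X (e := fun j => root (t j)) fun j => norm_root _
  change tg t * (n - tg t / 2 - 2) - _ ≤ _ at h3
  have h4 := S.sum_x_gap_le t
  have h5 : √(n : ℝ) * q ≤ n / 1000 := by
    have : √(n : ℝ) * q ^ 1 ≤ n / q := S.sq_le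
    have h6 : (n : ℝ) / q ≤ n / 1000 := by have := S.hq; gcongr
    rw [pow_one] at this; linarith
  have hT := tg_nonneg t
  have h6 : tg t * (n / 3) ≤ ∑ p ∈ prs Xᶜ, gap (root (t p.1) * root (t p.2)) := by
    nlinarith
  have h7 : 1 / (5 * q) * (q ^ 4 * (n / 3)) ≤ rk d X * (1 - q ^ 4 / √n) *
      ∑ p ∈ prs Xᶜ, gap (root (t p.1) * root (t p.2)) := by
    have := S.rate_pos
    have h8 : q ^ 4 * ((n : ℝ) / 3) ≤ tg t * (n / 3) := by gcongr
    exact mul_le_mul this (h8.trans h6) (by positivity) (le_trans (by positivity) this)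
  have h8 : 1 / (5 * q) * (q ^ 4 * ((n : ℝ) / 3)) = q ^ 3 * n / 15 := by field_simp; norm_num
  have h9 := S.qn 6
  have h10 : 1000 * q ^ 1 ≤ q ^ 2 := mul_qpow S.hq 1 1 (by norm_num)
  have h11 : 1000 * q ^ 2 ≤ q ^ 3 := mul_qpow S.hq 1 2 (by norm_num)
  have h12 := S.hq
  have h13 : (1000 * q) * n ≤ q ^ 3 * n := by gcongr; nlinarith
  nlinarith

lemma norm_Fg_far_le (S : Setup n d X q) {M : ℕ} [NeZero M] {t : Fin n → ZMod M}
    (h1 : tg t ≤ q ^ 4) : ‖Fg d X t‖ ≤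
      Real.exp (√n * q ^ 10) * Real.exp (-∑ j, (ra d X j - 0) * gap (root (t j))) := by
  refine (S.norm_Fg_le t).trans ?_
  rw [← Real.exp_add]
  apply Real.exp_le_exp.2
  have hq := S.q0; have hn := S.n0; have hs := S.s0; have hsq := S.sq
  have h3 := sum_gap_compl_ge X (e := fun j => root (t j)) fun j => norm_root _
  change tg t * (n - tg t / 2 - 2) - _ ≤ _ at h3
  have h4 := S.sum_x_gap_le t
  have hT := tg_nonneg t
  have hr : 0 ≤ rk d X * (1 - q ^ 4 / √n) := le_trans (by positivity) S.rate_pos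
  have hr1 : rk d X * (1 - q ^ 4 / √n) ≤ 1 := by
    have := S.rk_le; have := S.rk0; have : 0 ≤ q ^ 4 / √n := by positivity
    nlinarith
  have h5 : ∑ j, (ra d X j - 0) * gap (root (t j)) ≤ n * rk d X * tg t + 8 * (√n * q) * tg t := by
    rw [tg, mul_sum, mul_sum, ← sum_add_distrib]
    refine sum_le_sum fun j _ => ?_
    have h6 := (abs_le.1 (S.abs_ra_sub j)).2
    have h7 := S.uu_le j
    rw [← add_mul]
    exact mul_le_mul_of_nonneg_right (by linarith) (gap_root_nonneg _)
  have h6 : tg t * n - (√n * q ^ 5 * tg t) ≤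
      ∑ p ∈ prs Xᶜ, gap (root (t p.1) * root (t p.2)) := by
    have h7 : tg t / 2 + 2 + 2 * (√n * q) ≤ √n * q ^ 5 := by
      have a1 : 1000 * q ^ 4 ≤ q ^ 5 := mul_qpow S.hq 1 4 (by norm_num)
      have a2 : q ^ 1 ≤ q ^ 4 := S.pow_le_pow
      rw [pow_one] at a2
      have a3 := S.s1000; have a4 := S.one_le_q
      have a5 : √(n : ℝ) * (1000 * q ^ 4) ≤ √n * q ^ 5 := by gcongr
      have a6 : √(n : ℝ) * q ≤ √n * q ^ 4 := by gcongr
      have a7 : 1 * q ^ 4 ≤ √n * q ^ 4 := by gcongr; linarith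
      linarith
    nlinarith
  have h7 : n * rk d X * tg t - √n * q ^ 8 - √n * q ^ 9 ≤ rk d X * (1 - q ^ 4 / √n) *
      ∑ p ∈ prs Xᶜ, gap (root (t p.1) * root (t p.2)) := by
    calc _ ≤ rk d X * (1 - q ^ 4 / √n) * (tg t * n) -
          rk d X * (1 - q ^ 4 / √n) * (√n * q ^ 5 * tg t) := by
          have e : rk d X * (1 - q ^ 4 / √n) * (tg t * n) =
              n * rk d X * tg t - rk d X * (√n * q ^ 4 * tg t) := by
            have : q ^ 4 / √n * n = √n * q ^ 4 := by
              rw [div_mul_eq_mul_div, div_eq_iff hs.ne']; linear_combination (-q ^ 4) * hsq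
            linear_combination (-rk d X * tg t) * this
          rw [e]
          have a1 : rk d X * (√n * q ^ 4 * tg t) ≤ 1 * (√n * q ^ 4 * q ^ 4) := by
            have := S.rk_le; gcongr; linarith
          have a2 : rk d X * (1 - q ^ 4 / √n) * (√n * q ^ 5 * tg t) ≤ 1 * (√n * q ^ 5 * q ^ 4) := by
            gcongr
          have a3 : √(n : ℝ) * q ^ 4 * q ^ 4 = √n * q ^ 8 := by ring
          have a4 : √(n : ℝ) * q ^ 5 * q ^ 4 = √n * q ^ 9 := by ring
          linarith
      _ = rk d X * (1 - q ^ 4 / √n) * (tg t * n - √n * q ^ 5 * tg t) := by ring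
      _ ≤ _ := by gcongr
  have h8 : 8 * (√n * q) * tg t ≤ √n * q ^ 6 := by
    calc 8 * (√n * q) * tg t ≤ 8 * (√n * q) * q ^ 4 := by gcongr
      _ = √n * (8 * q ^ 5) := by ring
      _ ≤ _ := by gcongr; exact mul_qpow S.hq 1 5 (by norm_num)
  have h9 : √n * (1000 * q ^ 9) ≤ √n * q ^ 10 := by
    gcongr; exact mul_qpow S.hq 1 9 (by norm_num)
  have a1 : q ^ 6 ≤ √n * q ^ 9 := by
    have := S.s1000; have := S.pow_le_pow (k := 6) (l := 9); have : 0 < q ^ 9 := by positivity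
    nlinarith
  have a2 : √n * q ^ 6 ≤ √n * q ^ 9 := by gcongr ?_ * ?_; exact S.pow_le_pow
  have a3 : √n * q ^ 8 ≤ √n * q ^ 9 := by gcongr ?_ * ?_; exact S.pow_le_pow
  have a4 : 0 ≤ √n * q ^ 9 := by positivity
  linarith

lemma norm_ps0_sq_le (S : Setup n d X q) {M : ℕ} [NeZero M] {t : Fin n → ZMod M} {j : Fin n}
    (h : gap (root (t j)) ≤ 1) : ‖ps0 d X t j‖ ^ 2 ≤ 2 * gap (root (t j)) := by
  have h1 := norm_incr_sq_le (rl d X j) (norm_root (t j)) h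
  have h2 := S.rK_div_le j; have h3 := S.rK_le j; have h4 := S.rK0 j; have h5 := S.rk0
  have h6 := gap_root_nonneg (t j)
  rw [ps0, norm_mul, mul_pow, Complex.norm_real, Real.norm_eq_abs, sq_abs, div_pow, S.sqrt_rk_sq]
  calc rK d X j ^ 2 / rk d X * ‖incr (rl d X j) (root (t j))‖ ^ 2
      = rK d X j * (rK d X j / rk d X) * ‖incr (rl d X j) (root (t j))‖ ^ 2 := by ring
    _ ≤ 1 / 4 * 2 * (4 * gap (root (t j))) := by gcongr
    _ = _ := by ring

lemma norm_psi_sq_le (S : Setup n d X q) {M : ℕ} [NeZero M] {t : Fin n → ZMod M} {j : Fin n}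
    (h : gap (root (t j)) ≤ 1) :
    ‖psi d X t j‖ ^ 2 ≤ 2 * rm d X j ^ 2 + 4 * gap (root (t j)) := by
  have h1 := S.norm_ps0_sq_le h
  have h2 : ‖psi d X t j‖ ≤ |rm d X j| + ‖ps0 d X t j‖ := by
    refine (norm_add_le _ _).trans ?_
    rw [Complex.norm_real, Real.norm_eq_abs]
  calc ‖psi d X t j‖ ^ 2 ≤ (|rm d X j| + ‖ps0 d X t j‖) ^ 2 := by gcongr
    _ ≤ 2 * |rm d X j| ^ 2 + 2 * ‖ps0 d X t j‖ ^ 2 := by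
        nlinarith [sq_nonneg (|rm d X j| - ‖ps0 d X t j‖)]
    _ ≤ _ := by rw [sq_abs]; linarith

lemma sum_rm_sq_le (S : Setup n d X q) : ∑ j, rm d X j ^ 2 ≤ q ^ 6 / √n := by
  have := S.q0; have := S.s0
  calc ∑ j, rm d X j ^ 2 ≤ ∑ j, q ^ 3 / √n * |rm d X j| := sum_le_sum fun j _ => by
        rw [← sq_abs, pow_two]; have := S.abs_rm_le' j; gcongr
    _ ≤ q ^ 3 / √n * q ^ 3 := by rw [← mul_sum]; have := S.sum_abs_rm_le; gcongr
    _ = _ := by ring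

lemma sum_psi_sq_le (S : Setup n d X q) {M : ℕ} [NeZero M] {t : Fin n → ZMod M}
    (h : ∀ j, gap (root (t j)) ≤ 1) : ∑ j, ‖psi d X t j‖ ^ 2 ≤ 1 + 4 * tg t := by
  calc _ ≤ ∑ j, (2 * rm d X j ^ 2 + 4 * gap (root (t j))) :=
        sum_le_sum fun j _ => S.norm_psi_sq_le (h j)
    _ = 2 * ∑ j, rm d X j ^ 2 + 4 * tg t := by rw [sum_add_distrib, tg, mul_sum, mul_sum]
    _ ≤ _ := by have := S.sum_rm_sq_le; have := S.div_s_le 6; linarith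

lemma sum_x_psi_sq_le (S : Setup n d X q) {M : ℕ} [NeZero M] {t : Fin n → ZMod M}
    (h : ∀ j, gap (root (t j)) ≤ 1) : ∑ j, xDeg X j * ‖psi d X t j‖ ^ 2 ≤
      2 * q ^ 7 + 4 * ∑ j, xDeg X j * gap (root (t j)) := by
  have h1 : ∑ j, xDeg X j * rm d X j ^ 2 ≤ q ^ 7 := by
    calc _ ≤ ∑ j, √n * q * rm d X j ^ 2 := sum_le_sum fun j _ =>
          mul_le_mul_of_nonneg_right (S.hx j) (sq_nonneg _)
      _ ≤ √n * q * (q ^ 6 / √n) := by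
          rw [← mul_sum]; have := S.sum_rm_sq_le; have := S.q0; gcongr
      _ = q ^ 7 := by have := S.s0; field_simp
  calc _ ≤ ∑ j, xDeg X j * (2 * rm d X j ^ 2 + 4 * gap (root (t j))) :=
        sum_le_sum fun j _ => mul_le_mul_of_nonneg_left (S.norm_psi_sq_le (h j)) (by positivity)
    _ = 2 * ∑ j, xDeg X j * rm d X j ^ 2 + 4 * ∑ j, xDeg X j * gap (root (t j)) := by
        rw [mul_sum, mul_sum, ← sum_add_distrib]; exact sum_congr rfl fun j _ => by ring
    _ ≤ _ := by linarith

lemma abs_re_ps0_le (S : Setup n d X q) {M : ℕ} [NeZero M] {t : Fin n → ZMod M} {j : Fin n}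
    (h : gap (root (t j)) ≤ 1) : |(ps0 d X t j).re| ≤ 2 * gap (root (t j)) := by
  have h1 := abs_incr_re_le (S.rl0 j).le (S.rl1 j).le (norm_root (t j)) h
  have h2 : rK d X j / √(rk d X) ≤ 1 := by
    have h3 := S.rK_div_le j; have := S.sqrt_rk0; have h4 := S.sqrt_rk_sq; have h5 := S.sqrt_rk_le
    rw [div_le_iff₀ S.rk0] at h3
    rw [div_le_one this]; nlinarith
  have h3 : 0 ≤ rK d X j / √(rk d X) := div_nonneg (S.rK0 j).le S.sqrt_rk0.le
  rw [ps0, Complex.re_ofReal_mul, abs_mul, abs_of_nonneg h3]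
  calc _ ≤ 1 * (2 * gap (root (t j))) := by gcongr
    _ = _ := one_mul _

lemma norm_pair_sum_le (H : SimpleGraph (Fin n)) (f : Fin n → ℂ) :
    ‖∑ p ∈ prs H, f p.1 * f p.2‖ ≤ 1 / 2 * ∑ j, xDeg H j * ‖f j‖ ^ 2 := by
  rw [← sum_prs_symm, mul_sum]
  refine (norm_sum_le _ _).trans (sum_le_sum fun p _ => ?_)
  rw [norm_mul]
  nlinarith [sq_nonneg (‖f p.1‖ - ‖f p.2‖)]

lemma norm_bern_prod_le (_ : Setup n d X q) {M : ℕ} [NeZero M] (t : Fin n → ZMod M) :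
    ‖∏ j, bern (rl d X j) (root (t j)) ^ nn X j * (root (t j))⁻¹ ^ d‖ ≤
      Real.exp (-∑ j, ra d X j * gap (root (t j))) := by
  rw [norm_prod, ← sum_neg_distrib, Real.exp_sum]
  refine prod_le_prod (fun _ _ => norm_nonneg _) fun j _ => ?_
  rw [norm_mul, norm_pow (root (t j))⁻¹, norm_inv, norm_root, inv_one, one_pow, mul_one]
  exact norm_bern_pow_le _ (norm_root _) _

lemma norm_Fg_near_le (S : Setup n d X q) {M : ℕ} [NeZero M] {t : Fin n → ZMod M}
    (h1 : tg t ≤ q ^ 4) (h : ∀ j, gap (root (t j)) ≤ 1) : ‖Fg d X t‖ ≤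
      Real.exp (q ^ 11) * Real.exp (-∑ j, (ra d X j - 2 * xDeg X j) * gap (root (t j))) := by
  have hq := S.q0; have hs := S.s0
  rw [S.Fg_eq h, norm_mul]
  have e : Real.exp (-∑ j, (ra d X j - 2 * xDeg X j) * gap (root (t j))) =
      Real.exp (-∑ j, ra d X j * gap (root (t j))) *
        Real.exp (2 * ∑ j, xDeg X j * gap (root (t j))) := by
    rw [← Real.exp_add]
    congr 1
    rw [mul_sum, ← sum_neg_distrib, ← sum_neg_distrib, ← sum_add_distrib]
    exact sum_congr rfl fun j _ => by ring
  rw [e, mul_left_comm]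
  refine mul_le_mul (S.norm_bern_prod_le t) ?_ (norm_nonneg _) (Real.exp_pos _).le
  have h2 : ‖∏ p ∈ prs Xᶜ, (1 + psi d X t p.1 * psi d X t p.2)‖ ≤
      Real.exp ((∑ p ∈ prs Xᶜ, psi d X t p.1 * psi d X t p.2).re +
        (∑ p ∈ prs Xᶜ, ‖psi d X t p.1‖ ^ 2 * ‖psi d X t p.2‖ ^ 2) / 2) := by
    rw [norm_prod, Complex.re_sum, sum_div, ← sum_add_distrib, Real.exp_sum]
    refine prod_le_prod (fun _ _ => norm_nonneg _) fun p _ => ?_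
    refine (norm_one_add_le_exp _).trans (le_of_eq ?_)
    rw [norm_mul, mul_pow]
  refine h2.trans ?_
  rw [← Real.exp_add]
  apply Real.exp_le_exp.2
  have hT := tg_nonneg t
  have h3 := S.sum_psi_sq_le h
  have h30 : 0 ≤ ∑ j, ‖psi d X t j‖ ^ 2 := sum_nonneg fun _ _ => by positivity
  have a1 : 1000 * q ^ 4 ≤ q ^ 5 := mul_qpow S.hq 1 4 (by norm_num)
  have a0 : 1 ≤ q ^ 4 := one_le_pow₀ S.one_le_q
  have h4 := sum_prs_le Xᶜ (f := fun j => ‖psi d X t j‖ ^ 2) fun j => by positivity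
  have h5 : (∑ j, ‖psi d X t j‖ ^ 2) ^ 2 ≤ (q ^ 5) ^ 2 := by gcongr; linarith
  have h6 : (∑ p ∈ prs Xᶜ, psi d X t p.1 * psi d X t p.2).re =
      ((∑ j, psi d X t j) ^ 2).re / 2 - (∑ j, psi d X t j ^ 2).re / 2 -
        (∑ p ∈ prs X, psi d X t p.1 * psi d X t p.2).re := by
    have := congrArg Complex.re (sum_compl_prs X (psi d X t))
    simp only [Complex.sub_re, Complex.mul_re, Complex.re_ofNat, Complex.im_ofNat, zero_mul,
      sub_zero] at this
    linarith
  have h7 : ((∑ j, psi d X t j) ^ 2).re ≤ (q ^ 5) ^ 2 := by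
    have h8 : |(∑ j, psi d X t j).re| ≤ q ^ 5 := by
      have : (∑ j, psi d X t j).re = ∑ j, rm d X j + ∑ j, (ps0 d X t j).re := by
        simp [psi, sum_add_distrib]
      rw [this]
      refine (abs_add_le _ _).trans ?_
      have h9 : |∑ j, (ps0 d X t j).re| ≤ 2 * tg t := by
        rw [tg, mul_sum]
        exact (abs_sum_le_sum_abs _ _).trans (sum_le_sum fun j _ => S.abs_re_ps0_le (h j))
      have := S.abs_sum_rm_le; have := S.div_s_le 4
      linarith
    rw [pow_two, Complex.mul_re]
    nlinarith [sq_abs (∑ j, psi d X t j).re, abs_nonneg (∑ j, psi d X t j).re,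
      mul_self_nonneg (∑ j, psi d X t j).im]
  have h8 : -(∑ j, psi d X t j ^ 2).re ≤ q ^ 5 := by
    have : |(∑ j, psi d X t j ^ 2).re| ≤ ∑ j, ‖psi d X t j‖ ^ 2 :=
      (Complex.abs_re_le_norm _).trans ((norm_sum_le _ _).trans
        (le_of_eq (sum_congr rfl fun j _ => norm_pow _ _)))
    have := (abs_le.1 this).1
    linarith
  have h9 : -(∑ p ∈ prs X, psi d X t p.1 * psi d X t p.2).re ≤
      q ^ 7 + 2 * ∑ j, xDeg X j * gap (root (t j)) := by
    have := (abs_le.1 ((Complex.abs_re_le_norm _).trans (norm_pair_sum_le X (psi d X t)))).1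
    have := S.sum_x_psi_sq_le h
    linarith
  have a2 : 1000 * q ^ 10 ≤ q ^ 11 := mul_qpow S.hq 1 10 (by norm_num)
  have a3 : q ^ 5 ≤ q ^ 10 := S.pow_le_pow
  have a4 : q ^ 7 ≤ q ^ 10 := S.pow_le_pow
  have a5 : (q ^ 5) ^ 2 = q ^ 10 := by ring
  have a6 : 0 ≤ q ^ 10 := by positivity
  rw [a5] at h5 h7
  linarith

end Setup

end regions

section tail

variable {n d : ℕ} {X : SimpleGraph (Fin n)} {q : ℝ}

lemma root_half [NeZero (2 * n ^ 3)] : root ((n ^ 3 : ℕ) : ZMod (2 * n ^ 3)) = -1 := by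
  have hn : 0 < n := Nat.pos_of_ne_zero fun h => by
    have := NeZero.ne (2 * n ^ 3); subst h; simp at this
  have h1 : root ((n ^ 3 : ℕ) : ZMod (2 * n ^ 3)) = Complex.exp (Real.pi * Complex.I) := by
    rw [root]
    have := ZMod.stdAddChar_coe (N := 2 * n ^ 3) ((n ^ 3 : ℕ) : ℤ)
    rw [Int.cast_natCast] at this
    rw [this]
    congr 1
    have : (n : ℂ) ≠ 0 := by exact_mod_cast hn.ne'
    push_cast; field_simp
  rw [h1, Complex.exp_pi_mul_I]

/-- Antipodal shift of the torus. -/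
def refl (n : ℕ) : (Fin n → ZMod (2 * n ^ 3)) ≃ (Fin n → ZMod (2 * n ^ 3)) :=
  Equiv.addRight fun _ => ((n ^ 3 : ℕ) : ZMod (2 * n ^ 3))

lemma root_refl [NeZero (2 * n ^ 3)] (t : Fin n → ZMod (2 * n ^ 3)) (j : Fin n) :
    root (refl n t j) = -root (t j) := by
  simp only [refl, Equiv.coe_addRight, Pi.add_apply]
  rw [root_add, root_half]; ring

lemma tg_refl [NeZero (2 * n ^ 3)] (t : Fin n → ZMod (2 * n ^ 3)) :
    tg (refl n t) = 2 * n - tg t := by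
  simp only [tg, root_refl, gap, Complex.neg_re, sum_sub_distrib, sum_neg_distrib]
  simp; ring

lemma Fg_refl [NeZero (2 * n ^ 3)] (he : Even (n * d)) (t : Fin n → ZMod (2 * n ^ 3)) :
    Fg d X (refl n t) = Fg d X t := by
  simp only [Fg, root_refl, neg_mul_neg, inv_neg]
  congr 1
  have : ∀ j, (-(root (t j))⁻¹) ^ d = (-1) ^ d * (root (t j))⁻¹ ^ d := fun j => by
    rw [← mul_pow, neg_one_mul]
  simp only [this, prod_mul_distrib, prod_const, card_univ, Fintype.card_fin]
  rw [← pow_mul, mul_comm d n, he.neg_one_pow, one_mul]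

lemma avg_add_tail [NeZero (2 * n ^ 3)] (he : Even (n * d)) {P : (Fin n → ZMod (2 * n ^ 3)) → Prop}
    (hP : ∀ t, P t → tg t < n) :
    ‖avg (fun t : Fin n → ZMod (2 * n ^ 3) => Fg d X t) -
        2 * avg (fun t => if P t then Fg d X t else 0)‖ ≤
      2 * avg (fun t => if ¬P t ∧ tg t ≤ n then ‖Fg d X t‖ else 0) := by
  have h1 := avg_equiv (refl n) (fun t => if P t then Fg d X t else 0)
  have h2 := avg_equiv (refl n) (fun t => if ¬P t ∧ tg t ≤ n then ‖Fg d X t‖ else 0)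
  simp only [Fg_refl he] at h1 h2
  rw [two_mul (avg fun t => if P t then Fg d X t else 0),
    two_mul (avg fun t => if ¬P t ∧ tg t ≤ n then ‖Fg d X t‖ else 0)]
  nth_rewrite 2 [← h1]
  nth_rewrite 2 [← h2]
  rw [← avg_add, ← avg_add, ← avg_sub]
  refine (norm_avg_le _).trans (avg_mono fun t => ?_)
  rcases le_or_gt (tg t) n with h | h
  · by_cases hp : P t
    · have h3 : ¬P (refl n t) := fun h4 => by
        have := hP _ h4; have := hP _ hp; rw [tg_refl] at *; linarith
      simp only [hp, h3, if_true, if_false, not_true, false_and, add_zero, sub_self, norm_zero,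
        not_false_eq_true, true_and, zero_add]
      split_ifs <;> simp
    · have h3 : ‖(if P (refl n t) then Fg d X t else 0)‖ ≤ ‖Fg d X t‖ := by split_ifs <;> simp
      by_cases h4 : P (refl n t)
      · simp [hp, h4, h]
      · simp only [hp, h4, h, if_false, add_zero, sub_zero, not_false_eq_true, and_self, if_true]
        split_ifs <;> simp
  · have h3 : ¬P t := fun h4 => by have := hP _ h4; linarith
    have h5 : tg (refl n t) ≤ n := by rw [tg_refl]; linarith
    by_cases h4 : P (refl n t)
    · simp only [h3, h4, if_false, if_true, zero_add, sub_self, norm_zero]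
      split_ifs <;> simp
    · simp only [h3, h4, h5, if_false, add_zero, sub_zero, not_false_eq_true, and_self, if_true]
      split_ifs <;> simp

namespace Setup

lemma tg_core (S : Setup n d X q) {M : ℕ} [NeZero M] {t : Fin n → ZMod M} (h : core d X q t) :
    tg t ≤ q ^ 2 := by
  have h1 := (abs_le.1 h.2).2
  have h2 := S.div_s_le 32
  have h3 := S.rk_ge; have h4 := S.hq; have h5 := tg_nonneg t
  have : 1 / (4 * q) * tg t ≤ rk d X * tg t := by gcongr
  have h6 : tg t ≤ 4 * q * (rk d X * tg t) := by
    calc tg t = 4 * q * (1 / (4 * q) * tg t) := by have := S.q0; field_simp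
      _ ≤ _ := by gcongr
  nlinarith

lemma norm_Fg_tail_le (S : Setup n d X q) {M : ℕ} [NeZero M] (t : Fin n → ZMod M) :
    (if ¬core d X q t ∧ tg t ≤ n then ‖Fg d X t‖ else 0) ≤
      rP d X * Real.exp (-n) + Real.exp (√n * q ^ 10) * (if ∃ j, 1 < gap (root (t j)) then
        Real.exp (-∑ j, (ra d X j - 0) * gap (root (t j))) else 0) +
      Real.exp (q ^ 11) * ((if ∃ j, q ^ 14 / n < gap (root (t j)) then
        Real.exp (-∑ j, (ra d X j - 2 * xDeg X j) * gap (root (t j))) else 0) +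
        (if q ^ 32 / √n < |2 * rk d X * tg t - 1| then
        Real.exp (-∑ j, (ra d X j - 2 * xDeg X j) * gap (root (t j))) else 0)) := by
  have h0 := S.rP0
  have i1 : 0 ≤ (if ∃ j, 1 < gap (root (t j)) then
        Real.exp (-∑ j, (ra d X j - 0) * gap (root (t j))) else 0) := by split_ifs <;> positivity
  have i2 : 0 ≤ (if ∃ j, q ^ 14 / n < gap (root (t j)) then
        Real.exp (-∑ j, (ra d X j - 2 * xDeg X j) * gap (root (t j))) else 0) := by
    split_ifs <;> positivity
  have i3 : 0 ≤ (if q ^ 32 / √n < |2 * rk d X * tg t - 1| then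
        Real.exp (-∑ j, (ra d X j - 2 * xDeg X j) * gap (root (t j))) else 0) := by
    split_ifs <;> positivity
  by_cases hc : ¬core d X q t ∧ tg t ≤ n
  swap
  · rw [if_neg hc]; positivity
  rw [if_pos hc]
  rcases le_or_gt (q ^ 4) (tg t) with h1 | h1
  · refine (S.norm_Fg_mid_le h1 hc.2).trans ?_
    rw [add_assoc]
    refine le_add_of_nonneg_right (by positivity)
  by_cases h2 : ∃ j, 1 < gap (root (t j))
  · refine (S.norm_Fg_far_le h1.le).trans ?_
    rw [if_pos h2, add_comm (rP d X * _), add_assoc]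
    refine le_add_of_nonneg_right (by positivity)
  refine (S.norm_Fg_near_le h1.le (by push Not at h2; exact h2)).trans ?_
  refine le_add_of_nonneg_of_le (by positivity) ?_
  refine mul_le_mul_of_nonneg_left ?_ (Real.exp_pos _).le
  by_cases h3 : ∃ j, q ^ 14 / n < gap (root (t j))
  · rw [if_pos h3]; exact le_add_of_nonneg_right i3
  · have h4 : q ^ 32 / √n < |2 * rk d X * tg t - 1| := by
      by_contra h5
      push Not at h3 h5
      exact hc.1 ⟨h3, h5⟩
    rw [if_pos h4]; exact le_add_of_nonneg_left i2

lemma x_weights (S : Setup n d X q) : (∀ j, |2 * (xDeg X j : ℝ)| ≤ ra d X j / 4) ∧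
    ∑ j, (2 * (xDeg X j : ℝ) / (2 * ra d X j) + 4 * (2 * (xDeg X j : ℝ)) ^ 2 / ra d X j ^ 2) ≤
      q ^ 3 := by
  have hq := S.q0; have hn := S.n0; have hs := S.s0
  constructor
  · intro j
    rw [abs_of_nonneg (by positivity)]
    have h1 := S.hx j; have h2 := S.ra_ge j
    have h3 : √(n : ℝ) * q ^ 2 ≤ n / q := S.sq_le
    have h4 : (n : ℝ) / (8 * q) = n / q / 8 := by field_simp
    have h5 : 1000 * q ^ 1 ≤ q ^ 2 := mul_qpow S.hq 1 1 (by norm_num)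
    have h6 : √(n : ℝ) * (1000 * q ^ 1) ≤ √n * q ^ 2 := by gcongr
    rw [pow_one] at h6
    nlinarith
  · have h1 : ∀ j, 2 * (xDeg X j : ℝ) / (2 * ra d X j) +
        4 * (2 * (xDeg X j : ℝ)) ^ 2 / ra d X j ^ 2 ≤ 9 * q / n * xDeg X j := by
      intro j
      have h2 := S.inv_ra_le j; have h3 := S.ra0 j
      have h4 : (1 / ra d X j) * (16 * xDeg X j) ≤ 1 / 8 := by
        calc _ ≤ 8 * q / n * (16 * (√n * q)) := by have := S.hx j; gcongr
          _ = 128 * q ^ 2 / √n := by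
            have := S.sq; field_simp; linear_combination 128 * this
          _ ≤ q ^ 3 / √n := by gcongr; exact mul_qpow S.hq 1 2 (by norm_num)
          _ ≤ _ := by have := S.div_s_le 3; linarith
      calc _ = (1 / ra d X j) * xDeg X j * (1 + (1 / ra d X j) * (16 * xDeg X j)) := by
            field_simp; ring
        _ ≤ 8 * q / n * xDeg X j * (1 + 1 / 8) := by gcongr
        _ = _ := by ring
    calc _ ≤ ∑ j, 9 * q / n * xDeg X j := sum_le_sum fun j _ => h1 j
      _ ≤ 9 * q / n * (n * q) := by rw [← mul_sum]; have := S.hX; gcongr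
      _ = 9 * q ^ 2 := by field_simp
      _ ≤ _ := mul_qpow S.hq 1 2 (by norm_num)

lemma avg_tail_le [NeZero (2 * n ^ 3)] (S : Setup n d X q) :
    avg (fun t : Fin n → ZMod (2 * n ^ 3) =>
      if ¬core d X q t ∧ tg t ≤ n then ‖Fg d X t‖ else 0) ≤
      rP d X * (5 * Real.exp (-q ^ 12)) := by
  have hq := S.q0; have hn := S.n0; have hs := S.s0; have hP := S.rP0
  have hne := S.n_le_exp
  refine (avg_mono fun t => S.norm_Fg_tail_le t).trans ?_
  rw [avg_add, avg_add, avg_const, avg_const_mul, avg_const_mul, avg_add]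
  have h1 := S.avg_far_le (y := fun _ => 0) (L := 0) (β := 1) zero_le_one
    (fun j => by have := S.ra0 j; rw [abs_zero]; positivity) (by simp)
  have h2 := S.avg_far_le (y := fun j => 2 * (xDeg X j : ℝ)) (L := q ^ 3) (β := q ^ 14 / n)
    (by positivity) S.x_weights.1 S.x_weights.2
  have h3 := S.avg_atypical_le (y := fun j => 2 * (xDeg X j : ℝ)) (L := q ^ 3) (η := q ^ 32 / √n)
    S.x_weights.1 S.x_weights.2
  have q1 := S.hq
  have b1 : 1000 * q ^ 1 ≤ q ^ 2 := mul_qpow S.hq 1 1 (by norm_num)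
  have b2 : 1000 * q ^ 2 ≤ q ^ 3 := mul_qpow S.hq 1 2 (by norm_num)
  have b3 : q ^ 3 ≤ q ^ 11 := S.pow_le_pow
  have b11 : 1000 * q ^ 11 ≤ q ^ 12 := mul_qpow S.hq 1 11 (by norm_num)
  have b12 : 1000 * q ^ 12 ≤ q ^ 13 := mul_qpow S.hq 1 12 (by norm_num)
  have b13 : q ^ 13 ≤ q ^ 32 := S.pow_le_pow
  rw [pow_one] at b1
  have a0 : Real.exp (-n) ≤ Real.exp (-q ^ 12) := by
    apply Real.exp_le_exp.2; have := S.qn 12; linarith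
  have a1 : Real.exp (√n * q ^ 10) * (n * Real.exp (q + 0 + 2 - n * 1 / (32 * q))) ≤
      Real.exp (-q ^ 12) := by
    calc _ ≤ Real.exp (√n * q ^ 10) * (Real.exp q * Real.exp (q + 0 + 2 - n * 1 / (32 * q))) := by
          gcongr
      _ ≤ _ := by
        rw [← Real.exp_add, ← Real.exp_add]
        apply Real.exp_le_exp.2
        have c1 : √(n : ℝ) * q ^ 11 ≤ n / q := S.sq_le
        have c2 : √(n : ℝ) * (1000 * q ^ 10) ≤ √n * q ^ 11 := by
          gcongr; exact mul_qpow S.hq 1 10 (by norm_num)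
        have c3 : (n : ℝ) * 1 / (32 * q) = n / q / 32 := by field_simp
        have c4 := S.s1000
        have c5 : q ^ 12 ≤ √n * q ^ 10 := by
          have := S.qle 2
          calc q ^ 12 = q ^ 2 * q ^ 10 := by ring
            _ ≤ _ := by gcongr
        have c6 : q ≤ q ^ 12 := by have := S.pow_le_pow (k := 1) (l := 12); rwa [pow_one] at this
        linarith
  have a2 : Real.exp (q ^ 11) * (n * Real.exp (q + q ^ 3 + 2 - n * (q ^ 14 / n) / (32 * q))) ≤
      Real.exp (-q ^ 12) := by
    calc _ ≤ Real.exp (q ^ 11) * (Real.exp q *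
            Real.exp (q + q ^ 3 + 2 - n * (q ^ 14 / n) / (32 * q))) := by gcongr
      _ ≤ _ := by
        rw [← Real.exp_add, ← Real.exp_add]
        apply Real.exp_le_exp.2
        have c3 : (n : ℝ) * (q ^ 14 / n) / (32 * q) = q ^ 13 / 32 := by field_simp
        rw [c3]; linarith
  have a3 : Real.exp (q ^ 11) * (2 * Real.exp (q + q ^ 3 + q ^ 3 + 2 - √n * (q ^ 32 / √n))) ≤
      2 * Real.exp (-q ^ 12) := by
    rw [mul_left_comm, ← Real.exp_add]
    gcongr
    have c3 : √(n : ℝ) * (q ^ 32 / √n) = q ^ 32 := by field_simp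
    rw [c3]; linarith
  calc _ ≤ rP d X * Real.exp (-n) + Real.exp (√n * q ^ 10) *
        (rP d X * (n * Real.exp (q + 0 + 2 - n * 1 / (32 * q)))) +
        Real.exp (q ^ 11) *
        (rP d X * (n * Real.exp (q + q ^ 3 + 2 - n * (q ^ 14 / n) / (32 * q))) +
        rP d X * (2 * Real.exp (q + q ^ 3 + q ^ 3 + 2 - √n * (q ^ 32 / √n)))) := by
        gcongr
    _ = rP d X * (Real.exp (-n) + Real.exp (√n * q ^ 10) *
        (n * Real.exp (q + 0 + 2 - n * 1 / (32 * q))) + Real.exp (q ^ 11) *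
        (n * Real.exp (q + q ^ 3 + 2 - n * (q ^ 14 / n) / (32 * q))) + Real.exp (q ^ 11) *
        (2 * Real.exp (q + q ^ 3 + q ^ 3 + 2 - √n * (q ^ 32 / √n)))) := by ring
    _ ≤ _ := by gcongr; linarith

/-- Only a neighbourhood of the two symmetric peaks contributes. -/
lemma norm_avg_Fg_sub_core_le [NeZero (2 * n ^ 3)] (S : Setup n d X q) :
    ‖avg (fun t : Fin n → ZMod (2 * n ^ 3) => Fg d X t) -
        2 * avg (fun t : Fin n → ZMod (2 * n ^ 3) => if core d X q t then Fg d X t else 0)‖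
          ≤ rP d X * Real.exp (-q ^ 10) := by
  have hq := S.q0; have hn := S.n0; have hP := S.rP0
  have h0 : ∀ t : Fin n → ZMod (2 * n ^ 3), core d X q t → tg t < n := fun t ht => by
    refine lt_of_le_of_lt (S.tg_core ht) (lt_of_lt_of_le ?_ (S.qn 3))
    exact pow_lt_pow_right₀ (by linarith [S.hq]) (by norm_num)
  refine (avg_add_tail S.even h0).trans ?_
  have h1 := S.avg_tail_le
  have h2 : 10 * Real.exp (-q ^ 12) ≤ Real.exp (-q ^ 10) := by
    have h3 := Real.add_one_le_exp (q ^ 12 - q ^ 10)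
    have h4 : 1000000 * q ^ 10 ≤ q ^ 12 := mul_qpow S.hq 2 10 (by norm_num)
    have h5 : 1 ≤ q ^ 10 := one_le_pow₀ S.one_le_q
    calc 10 * Real.exp (-q ^ 12) ≤ Real.exp (q ^ 12 - q ^ 10) * Real.exp (-q ^ 12) := by
          gcongr; linarith
      _ = _ := by rw [← Real.exp_add]; congr 1; ring
  calc _ ≤ 2 * (rP d X * (5 * Real.exp (-q ^ 12))) := by gcongr
    _ = rP d X * (10 * Real.exp (-q ^ 12)) := by ring
    _ ≤ _ := by gcongr

end Setup

end tail

section expansion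

variable {n d : ℕ} {X : SimpleGraph (Fin n)} {q : ℝ}

lemma exists_one_add_eq_exp {w : ℂ} (hw : ‖w‖ ≤ 1 / 3) :
    ∃ z : ℂ, ‖z‖ ≤ ‖w‖ ^ 3 ∧ 1 + w = Complex.exp (w - w ^ 2 / 2 + z) := by
  have h1 := Complex.norm_log_sub_logTaylor_le 2 (z := w) (by linarith)
  have h2 : Complex.logTaylor (2 + 1) w = w - w ^ 2 / 2 := by
    simp [Complex.logTaylor_succ, Complex.logTaylor_zero]; ring
  rw [h2] at h1
  refine ⟨Complex.log (1 + w) - (w - w ^ 2 / 2), h1.trans ?_, ?_⟩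
  · have h3 : (1 - ‖w‖)⁻¹ ≤ 3 := by
      rw [inv_le_comm₀ (by linarith) (by norm_num)]; linarith
    have h4 : 0 ≤ ‖w‖ ^ 3 := by positivity
    calc _ ≤ ‖w‖ ^ (2 + 1) * 3 / ((2 : ℕ) + 1) := by gcongr
      _ = _ := by norm_num
  · rw [add_sub_cancel, Complex.exp_log]
    intro h
    have : w = -1 := by linear_combination h
    rw [this] at hw; norm_num at hw

lemma exists_prod_eq_exp {ι : Type*} (s : Finset ι) {w : ι → ℂ} (hw : ∀ p ∈ s, ‖w p‖ ≤ 1 / 3) :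
    ∃ z : ℂ, ‖z‖ ≤ ∑ p ∈ s, ‖w p‖ ^ 3 ∧
      ∏ p ∈ s, (1 + w p) = Complex.exp (∑ p ∈ s, w p - (∑ p ∈ s, w p ^ 2) / 2 + z) := by
  have h : ∀ p, ∃ z : ℂ, p ∈ s → ‖z‖ ≤ ‖w p‖ ^ 3 ∧
      1 + w p = Complex.exp (w p - w p ^ 2 / 2 + z) := fun p => by
    by_cases hp : p ∈ s
    · obtain ⟨z, hz⟩ := exists_one_add_eq_exp (hw p hp)
      exact ⟨z, fun _ => hz⟩
    · exact ⟨0, fun h => absurd h hp⟩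
  choose z hz using h
  refine ⟨∑ p ∈ s, z p, (norm_sum_le _ _).trans (sum_le_sum fun p hp => (hz p hp).1), ?_⟩
  rw [prod_congr rfl fun p hp => (hz p hp).2, ← Complex.exp_sum, sum_add_distrib,
    sum_sub_distrib, sum_div]

/-- Linear coefficient coming from the shifts `rm`. -/
def bb (d : ℕ) (X : SimpleGraph (Fin n)) (j : Fin n) : ℝ :=
  (∑ k, if X.Adj j k then rm d X k else 0) - ∑ k, rm d X k

def mu (d : ℕ) (X : SimpleGraph (Fin n)) : ℝ := ∑ p ∈ prs X, rm d X p.1 * rm d X p.2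

variable {M : ℕ} [NeZero M]

def base (d : ℕ) (X : SimpleGraph (Fin n)) (t : Fin n → ZMod M) : ℂ :=
  ∏ j, bern (rl d X j) (root (t j)) ^ nn X j * (root (t j))⁻¹ ^ d

def Phi (d : ℕ) (X : SimpleGraph (Fin n)) (t : Fin n → ZMod M) : ℂ :=
  base d X t * Complex.exp ((∑ j, ps0 d X t j) ^ 2 / 2 - ∑ j, (bb d X j : ℂ) * ps0 d X t j)

def YY (d : ℕ) (X : SimpleGraph (Fin n)) (t : Fin n → ZMod M) : ℝ :=
  ∑ p ∈ prs X, (ps0 d X t p.1).im * (ps0 d X t p.2).im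

lemma sum_prs_psi (t : Fin n → ZMod M) :
    ∑ p ∈ prs X, psi d X t p.1 * psi d X t p.2 = mu d X +
      ∑ j, ((∑ k, if X.Adj j k then rm d X k else 0 : ℝ) : ℂ) * ps0 d X t j +
      ∑ p ∈ prs X, ps0 d X t p.1 * ps0 d X t p.2 := by
  have h := sum_prs_add X fun j k => (rm d X k : ℂ) * ps0 d X t j
  have h2 : ∑ j, ((∑ k, if X.Adj j k then rm d X k else 0 : ℝ) : ℂ) * ps0 d X t j =
      ∑ j, ∑ k, if X.Adj j k then (rm d X k : ℂ) * ps0 d X t j else 0 := by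
    refine sum_congr rfl fun j _ => ?_
    push_cast
    rw [sum_mul]
    refine sum_congr rfl fun k _ => ?_
    split_ifs <;> simp
  rw [h2, ← h, mu]
  push_cast
  rw [← sum_add_distrib, ← sum_add_distrib]
  refine sum_congr rfl fun p _ => ?_
  simp only [psi]; ring

namespace Setup

lemma core_le_one (S : Setup n d X q) {t : Fin n → ZMod M}
    (h : ∀ j, gap (root (t j)) ≤ q ^ 14 / n) (j : Fin n) : gap (root (t j)) ≤ 1 := by
  refine (h j).trans ?_
  have := S.div_n_le 14; have := S.div_s_le 0; rw [pow_zero] at this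
  linarith

lemma norm_ps0_le (S : Setup n d X q) {t : Fin n → ZMod M}
    (h : ∀ j, gap (root (t j)) ≤ q ^ 14 / n) (j : Fin n) : ‖ps0 d X t j‖ ≤ q ^ 8 / √n := by
  have hq := S.q0; have hs := S.s0; have hn := S.n0
  refine (sq_le_sq₀ (norm_nonneg _) (by positivity)).1 ?_
  refine (S.norm_ps0_sq_le (S.core_le_one h j)).trans ?_
  rw [div_pow, S.sq]
  calc _ ≤ 2 * (q ^ 14 / n) := by gcongr; exact h j
    _ = 2 * q ^ 14 / n := by ring
    _ ≤ _ := by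
      gcongr
      calc _ ≤ q ^ 15 := mul_qpow S.hq 1 14 (by norm_num)
        _ ≤ q ^ 16 := S.pow_le_pow
        _ = _ := by ring

lemma norm_psi_sq_le' (S : Setup n d X q) {t : Fin n → ZMod M}
    (h : ∀ j, gap (root (t j)) ≤ q ^ 14 / n) (j : Fin n) : ‖psi d X t j‖ ^ 2 ≤ q ^ 15 / n := by
  have hq := S.q0; have hs := S.s0; have hn := S.n0
  refine (S.norm_psi_sq_le (S.core_le_one h j)).trans ?_
  have h1 : rm d X j ^ 2 ≤ q ^ 6 / n := by
    have := S.abs_rm_mul_le j j; rw [abs_mul_self] at this; rwa [pow_two]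
  have h2 : q ^ 6 ≤ q ^ 14 := S.pow_le_pow
  calc _ ≤ 2 * (q ^ 14 / n) + 4 * (q ^ 14 / n) := by
        have := h j
        have : q ^ 6 / n ≤ q ^ 14 / n := by gcongr
        gcongr; linarith
    _ = 6 * q ^ 14 / n := by ring
    _ ≤ _ := by gcongr; exact mul_qpow S.hq 1 14 (by norm_num)

lemma prs_card_le (S : Setup n d X q) : ((prs X).card : ℝ) ≤ n * q / 2 := by
  have h := card_prs X
  have h2 : (2 : ℝ) * (prs X).card = ∑ j, (xDeg X j : ℝ) := by exact_mod_cast h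
  have := S.hX; linarith

lemma norm_cross_le (S : Setup n d X q) {t : Fin n → ZMod M}
    (h : ∀ j, gap (root (t j)) ≤ q ^ 14 / n) :
    ‖∑ p ∈ prs X, ps0 d X t p.1 * ps0 d X t p.2 + YY d X t‖ ≤ q ^ 24 / √n := by
  have hq := S.q0; have hs := S.s0; have hn := S.n0
  rw [YY]; push_cast
  rw [← sum_add_distrib]
  have hr : ∀ j, |(ps0 d X t j).re| ≤ 2 * (q ^ 14 / n) := fun j =>
    (S.abs_re_ps0_le (S.core_le_one h j)).trans (by have := h j; linarith)
  have hp : ∀ p ∈ prs X, ‖ps0 d X t p.1 * ps0 d X t p.2 +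
      ((ps0 d X t p.1).im : ℂ) * (ps0 d X t p.2).im‖ ≤ 6 * (q ^ 14 / n * (q ^ 8 / √n)) := by
    intro p _
    have e : ps0 d X t p.1 * ps0 d X t p.2 +
        ((ps0 d X t p.1).im : ℂ) * (ps0 d X t p.2).im =
        ((ps0 d X t p.1).re : ℂ) * ps0 d X t p.2 +
          Complex.I * ((ps0 d X t p.1).im * (ps0 d X t p.2).re) := by
      apply Complex.ext <;> simp
    rw [e]
    refine (norm_add_le _ _).trans ?_
    rw [norm_mul, norm_mul, norm_mul, Complex.norm_I, Complex.norm_real, Complex.norm_real,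
      Complex.norm_real, one_mul, Real.norm_eq_abs, Real.norm_eq_abs, Real.norm_eq_abs]
    have h1 := hr p.1; have h2 := hr p.2; have h3 := S.norm_ps0_le h p.1
    have h4 := S.norm_ps0_le h p.2; have h5 := (Complex.abs_im_le_norm (ps0 d X t p.1)).trans h3
    calc _ ≤ 2 * (q ^ 14 / n) * (q ^ 8 / √n) + q ^ 8 / √n * (2 * (q ^ 14 / n)) := by gcongr
      _ = 4 * (q ^ 14 / n * (q ^ 8 / √n)) := by ring
      _ ≤ _ := by gcongr; norm_num
  refine (norm_sum_le_of_le _ hp).trans ?_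
  rw [sum_const, nsmul_eq_mul]
  have := S.prs_card_le
  calc _ ≤ n * q / 2 * (6 * (q ^ 14 / n * (q ^ 8 / √n))) := by gcongr
    _ = 3 * q ^ 23 / √n := by field_simp; ring
    _ ≤ _ := by gcongr; exact mul_qpow S.hq 1 23 (by norm_num)

lemma norm_ps0_sq_add_le (S : Setup n d X q) {t : Fin n → ZMod M}
    (h : ∀ j, gap (root (t j)) ≤ q ^ 14 / n) (j : Fin n) :
    ‖ps0 d X t j ^ 2 + ((2 * rk d X * gap (root (t j)) : ℝ) : ℂ)‖ ≤
      q ^ 9 / √n * gap (root (t j)) := by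
  have hq := S.q0; have hs := S.s0; have hn := S.n0
  have hc := S.core_le_one h j
  have hg := gap_root_nonneg (t j)
  have h1 := norm_incr_sq_add_le (S.rl0 j).le (S.rl1 j).le (norm_root (t j)) hc
  set c := gap (root (t j))
  have e0 : ((rK d X j / √(rk d X) : ℝ) : ℂ) ^ 2 = ((rK d X j ^ 2 / rk d X : ℝ) : ℂ) := by
    rw [← Complex.ofReal_pow, div_pow, S.sqrt_rk_sq]
  have e : ps0 d X t j ^ 2 + ((2 * rk d X * c : ℝ) : ℂ) =
      ((rK d X j ^ 2 / rk d X : ℝ) : ℂ) * (incr (rl d X j) (root (t j)) ^ 2 + 2 * c) +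
      ((2 * c * (rk d X - rK d X j ^ 2 / rk d X) : ℝ) : ℂ) := by
    rw [ps0, mul_pow, e0]; push_cast; ring
  rw [e]
  refine (norm_add_le _ _).trans ?_
  rw [norm_mul, Complex.norm_real, Complex.norm_real, Real.norm_eq_abs, Real.norm_eq_abs]
  have hk := S.rk0; have hK := S.rK0 j; have hk2 := S.rk_le
  have h2 := S.rK_div_le j; have h3 := S.rK_div_ge j; have h4 := S.rK_le j
  have h5 : rK d X j ^ 2 / rk d X ≤ 1 := by
    calc _ = rK d X j * (rK d X j / rk d X) := by ring
      _ ≤ 1 / 4 * 2 := by gcongr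
      _ ≤ 1 := by norm_num
  have h6 : √c ≤ q ^ 7 / √n := by
    rw [Real.sqrt_le_left (by positivity), div_pow, S.sq]
    calc c ≤ _ := h j
      _ = _ := by ring
  have h7 : |rk d X - rK d X j ^ 2 / rk d X| ≤ q ^ 3 / √n := by
    have : rk d X - rK d X j ^ 2 / rk d X =
        -(rk d X * ((rK d X j / rk d X - 1) * (rK d X j / rk d X + 1))) := by field_simp; ring
    rw [this, abs_neg, abs_mul, abs_mul, abs_of_pos hk,
      abs_of_pos (show 0 < rK d X j / rk d X + 1 by positivity)]
    calc _ ≤ 1 / 4 * (q ^ 3 / √n * (2 + 1)) := by gcongr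
      _ ≤ _ := by have : 0 ≤ q ^ 3 / √n := by positivity
                  linarith
  rw [abs_of_nonneg (by positivity), abs_mul, abs_of_nonneg (by positivity : (0 : ℝ) ≤ 2 * c)]
  calc _ ≤ 1 * (18 * (c * (q ^ 7 / √n))) + 2 * c * (q ^ 3 / √n) := by
        gcongr; exact h1.trans (by gcongr)
    _ ≤ 1 * (18 * (c * (q ^ 7 / √n))) + 2 * c * (q ^ 7 / √n) := by
        have : q ^ 3 ≤ q ^ 7 := S.pow_le_pow
        gcongr
    _ = 20 * q ^ 7 / √n * c := by ring
    _ ≤ _ := by gcongr; exact mul_qpow S.hq 2 7 (by norm_num)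

lemma norm_sum_psi_sq_add_one_le (S : Setup n d X q) {t : Fin n → ZMod M} (h : core d X q t) :
    ‖1 + ∑ j, psi d X t j ^ 2‖ ≤ q ^ 33 / √n := by
  have hq := S.q0; have hs := S.s0; have hn := S.n0
  have htg := S.tg_core h
  have e : 1 + ∑ j, psi d X t j ^ 2 = ∑ j, ((rm d X j ^ 2 : ℝ) : ℂ) +
      ∑ j, ((2 * rm d X j : ℝ) : ℂ) * ps0 d X t j +
      ∑ j, (ps0 d X t j ^ 2 + ((2 * rk d X * gap (root (t j)) : ℝ) : ℂ)) -
      ((2 * rk d X * tg t - 1 : ℝ) : ℂ) := by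
    rw [sum_add_distrib, ← Complex.ofReal_sum (s := univ)
      (f := fun j => 2 * rk d X * gap (root (t j))), ← mul_sum, ← tg]
    have : ∀ j, psi d X t j ^ 2 = ((rm d X j ^ 2 : ℝ) : ℂ) +
        ((2 * rm d X j : ℝ) : ℂ) * ps0 d X t j + ps0 d X t j ^ 2 := fun j => by rw [psi]; push_cast; ring
    simp only [this, sum_add_distrib]
    push_cast; ring
  rw [e]
  have b1 : ‖∑ j, ((rm d X j ^ 2 : ℝ) : ℂ)‖ ≤ q ^ 6 / √n := by
    rw [← Complex.ofReal_sum, Complex.norm_real,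
      Real.norm_of_nonneg (sum_nonneg fun _ _ => sq_nonneg _)]
    exact S.sum_rm_sq_le
  have b2 : ‖∑ j, ((2 * rm d X j : ℝ) : ℂ) * ps0 d X t j‖ ≤ 2 * q ^ 11 / √n := by
    calc _ ≤ ∑ j, 2 * |rm d X j| * (q ^ 8 / √n) := norm_sum_le_of_le _ fun j _ => by
          rw [norm_mul, Complex.norm_real, Real.norm_eq_abs, abs_mul, abs_two]
          have := S.norm_ps0_le h.1 j; gcongr
      _ = 2 * (∑ j, |rm d X j|) * (q ^ 8 / √n) := by rw [mul_sum, sum_mul]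
      _ ≤ 2 * q ^ 3 * (q ^ 8 / √n) := by have := S.sum_abs_rm_le; gcongr
      _ = _ := by ring
  have b3 : ‖∑ j, (ps0 d X t j ^ 2 + ((2 * rk d X * gap (root (t j)) : ℝ) : ℂ))‖ ≤ q ^ 11 / √n := by
    calc _ ≤ ∑ j, q ^ 9 / √n * gap (root (t j)) :=
          norm_sum_le_of_le _ fun j _ => S.norm_ps0_sq_add_le h.1 j
      _ = q ^ 9 / √n * tg t := by rw [← mul_sum, tg]
      _ ≤ q ^ 9 / √n * q ^ 2 := by gcongr
      _ = _ := by ring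
  have b4 : ‖((2 * rk d X * tg t - 1 : ℝ) : ℂ)‖ ≤ q ^ 32 / √n := by
    rw [Complex.norm_real]; exact h.2
  have b5 : q ^ 6 / √n ≤ q ^ 32 / √n := by gcongr ?_ / _; exact S.pow_le_pow
  have b6 : q ^ 11 / √n ≤ q ^ 32 / √n := by gcongr ?_ / _; exact S.pow_le_pow
  calc _ ≤ q ^ 6 / √n + 2 * q ^ 11 / √n + q ^ 11 / √n + q ^ 32 / √n :=
        (norm_sub_le _ _).trans (add_le_add (norm_add₃_le.trans (by gcongr)) b4)
    _ = q ^ 6 / √n + 3 * (q ^ 11 / √n) + q ^ 32 / √n := by ring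
    _ ≤ 5 * q ^ 32 / √n := by rw [mul_div_assoc]; linarith
    _ ≤ _ := by gcongr; exact mul_qpow S.hq 1 32 (by norm_num)

lemma sum_norm_psi_sq_le (S : Setup n d X q) {t : Fin n → ZMod M} (h : core d X q t) :
    ∑ j, ‖psi d X t j‖ ^ 2 ≤ q ^ 3 := by
  have h1 := S.sum_psi_sq_le (S.core_le_one h.1)
  have h2 := S.tg_core h
  have h3 : 1 ≤ q ^ 2 := one_le_pow₀ S.one_le_q
  have h4 : 5 * q ^ 2 ≤ q ^ 3 := mul_qpow S.hq 1 2 (by norm_num)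
  linarith

lemma norm_sum_psi_four_le (S : Setup n d X q) {t : Fin n → ZMod M} (h : core d X q t) :
    ‖∑ j, psi d X t j ^ 4‖ ≤ q ^ 18 / √n ∧
      ‖∑ p ∈ prs X, psi d X t p.1 ^ 2 * psi d X t p.2 ^ 2‖ ≤ q ^ 19 / √n := by
  have hq := S.q0; have hs := S.s0; have hn := S.n0
  have h2 := S.sum_norm_psi_sq_le h
  have h1 : ∀ j, ‖psi d X t j‖ ^ 4 ≤ q ^ 15 / n * ‖psi d X t j‖ ^ 2 := fun j => by
    have := S.norm_psi_sq_le' h.1 j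
    calc _ = ‖psi d X t j‖ ^ 2 * ‖psi d X t j‖ ^ 2 := by ring
      _ ≤ _ := by gcongr
  constructor
  · calc _ ≤ ∑ j, q ^ 15 / n * ‖psi d X t j‖ ^ 2 :=
          norm_sum_le_of_le _ fun j _ => by rw [norm_pow]; exact h1 j
      _ ≤ q ^ 15 / n * q ^ 3 := by rw [← mul_sum]; gcongr
      _ = q ^ 18 / n := by ring
      _ ≤ _ := by have := S.sle; gcongr
  · refine (norm_pair_sum_le X fun j => psi d X t j ^ 2).trans ?_
    calc _ ≤ 1 / 2 * ∑ j, √n * q * (q ^ 15 / n * ‖psi d X t j‖ ^ 2) := by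
          gcongr with j _
          · exact S.hx j
          · rw [norm_pow, ← pow_mul]; exact h1 j
      _ = 1 / 2 * (√n * q * (q ^ 15 / n * ∑ j, ‖psi d X t j‖ ^ 2)) := by simp only [mul_sum]
      _ ≤ 1 / 2 * (√n * q * (q ^ 15 / n * q ^ 3)) := by gcongr
      _ = 1 / 2 * (q ^ 19 / √n) := by have := S.sq; field_simp; rw [this]
      _ ≤ _ := by have : 0 ≤ q ^ 19 / √n := by positivity
                  linarith

/-- Logarithmic expansion of the integrand near the peak. -/
lemma Fg_core_eq (S : Setup n d X q) {t : Fin n → ZMod M} (h : core d X q t) :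
    ∃ z : ℂ, ‖z‖ ≤ q ^ 67 / √n ∧
      Fg d X t = Phi d X t * Complex.exp (((1 / 4 - mu d X : ℝ) : ℂ) + YY d X t + z) := by
  have hq := S.q0; have hs := S.s0; have hn := S.n0; have hsl := S.sle
  have hpsi := S.norm_psi_sq_le' h.1
  have hw : ∀ p : Fin n × Fin n, ‖psi d X t p.1 * psi d X t p.2‖ ≤ q ^ 15 / n := fun p => by
    rw [norm_mul]
    nlinarith [hpsi p.1, hpsi p.2, sq_nonneg (‖psi d X t p.1‖ - ‖psi d X t p.2‖)]
  have hsm : q ^ 15 / n ≤ 1 / 3 := by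
    have := S.div_n_le 15; have := S.div_s_le 0; rw [pow_zero] at this
    linarith
  obtain ⟨z, hz, hz2⟩ := exists_prod_eq_exp (prs Xᶜ) (w := fun p => psi d X t p.1 * psi d X t p.2)
    fun p _ => (hw p).trans hsm
  have hz3 : ‖z‖ ≤ q ^ 21 / √n := by
    refine hz.trans ?_
    calc _ ≤ ∑ p ∈ prs Xᶜ, q ^ 15 / n * (‖psi d X t p.1‖ ^ 2 * ‖psi d X t p.2‖ ^ 2) := by
          refine sum_le_sum fun p _ => ?_
          have := hw p
          calc _ = ‖psi d X t p.1 * psi d X t p.2‖ *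
                (‖psi d X t p.1‖ ^ 2 * ‖psi d X t p.2‖ ^ 2) := by rw [norm_mul]; ring
            _ ≤ _ := by gcongr
      _ = q ^ 15 / n * ∑ p ∈ prs Xᶜ, ‖psi d X t p.1‖ ^ 2 * ‖psi d X t p.2‖ ^ 2 := by rw [mul_sum]
      _ ≤ q ^ 15 / n * (q ^ 3) ^ 2 := by
          have h1 := sum_prs_le Xᶜ (f := fun j => ‖psi d X t j‖ ^ 2) fun _ => sq_nonneg _
          have h2 := S.sum_norm_psi_sq_le h
          have h3 : (∑ j, ‖psi d X t j‖ ^ 2) ^ 2 ≤ (q ^ 3) ^ 2 :=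
            pow_le_pow_left₀ (sum_nonneg fun _ _ => sq_nonneg _) h2 2
          have h4 : 0 ≤ ∑ p ∈ prs Xᶜ, ‖psi d X t p.1‖ ^ 2 * ‖psi d X t p.2‖ ^ 2 :=
            sum_nonneg fun _ _ => by positivity
          gcongr; linarith
      _ = q ^ 21 / n := by ring
      _ ≤ _ := by gcongr
  have e1 := sum_compl_prs X (psi d X t)
  have e2 := sum_compl_prs X fun j => psi d X t j ^ 2
  have e3 := sum_prs_psi (d := d) (X := X) t
  have e4 : ∑ j, psi d X t j = ((∑ j, rm d X j : ℝ) : ℂ) + ∑ j, ps0 d X t j := by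
    simp only [psi, sum_add_distrib]; push_cast; rfl
  have e5 : ∑ j, (bb d X j : ℂ) * ps0 d X t j =
      ∑ j, ((∑ k, if X.Adj j k then rm d X k else 0 : ℝ) : ℂ) * ps0 d X t j -
        ((∑ j, rm d X j : ℝ) : ℂ) * ∑ j, ps0 d X t j := by
    rw [mul_sum, ← sum_sub_distrib]
    refine sum_congr rfl fun j _ => ?_
    rw [bb]; push_cast; ring
  have e6 : ∀ j, (psi d X t j ^ 2) ^ 2 = psi d X t j ^ 4 := fun j => by ring
  simp only [e6] at e2
  rw [e4, e3] at e1
  set P2 := ∑ j, psi d X t j ^ 2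
  set P4 := ∑ j, psi d X t j ^ 4
  set Q := ∑ p ∈ prs X, psi d X t p.1 ^ 2 * psi d X t p.2 ^ 2
  set R := ∑ p ∈ prs X, ps0 d X t p.1 * ps0 d X t p.2
  set m := ∑ j, rm d X j with hm
  refine ⟨z + ((m ^ 2 / 2 : ℝ) : ℂ) - (1 + P2) ^ 2 / 4 + (P4 / 4 + Q / 2) - (R + YY d X t), ?_, ?_⟩
  · have b1 : ‖((m ^ 2 / 2 : ℝ) : ℂ)‖ ≤ q ^ 8 / √n := by
      rw [Complex.norm_real, Real.norm_of_nonneg (by positivity)]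
      have h1 := S.abs_sum_rm_le
      have h2 : m ^ 2 ≤ (q ^ 4 / √n) ^ 2 := by rw [← sq_abs]; gcongr
      rw [div_pow, S.sq, ← pow_mul] at h2
      have h3 : q ^ (4 * 2) / n ≤ q ^ (4 * 2) / √n := by gcongr
      have : 0 ≤ m ^ 2 := sq_nonneg _
      norm_num at *; linarith
    have b2 : ‖(1 + P2) ^ 2 / 4‖ ≤ q ^ 66 / √n := by
      rw [norm_div, norm_pow]
      have h1 := S.norm_sum_psi_sq_add_one_le h
      calc _ ≤ (q ^ 33 / √n) ^ 2 / ‖(4 : ℂ)‖ := by gcongr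
        _ = q ^ 66 / n / 4 := by rw [div_pow, S.sq, ← pow_mul]; norm_num
        _ ≤ q ^ 66 / n := div_le_self (by positivity) (by norm_num)
        _ ≤ _ := by gcongr
    have h4 := S.norm_sum_psi_four_le h
    have b3 : ‖P4 / 4 + Q / 2‖ ≤ q ^ 18 / √n + q ^ 19 / √n := by
      refine (norm_add_le _ _).trans (add_le_add ?_ ?_)
      · rw [norm_div]; refine le_trans (div_le_self (norm_nonneg _) (by norm_num)) h4.1
      · rw [norm_div]; refine le_trans (div_le_self (norm_nonneg _) (by norm_num)) h4.2
    have b4 : ‖R + YY d X t‖ ≤ q ^ 24 / √n := S.norm_cross_le h.1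
    have hk : ∀ k, k ≤ 66 → q ^ k / √n ≤ q ^ 66 / √n := fun k hk => by
      gcongr ?_ / _; exact S.pow_le_pow hk
    have c1 := hk 21 (by norm_num); have c2 := hk 8 (by norm_num); have c3 := hk 18 (by norm_num)
    have c4 := hk 19 (by norm_num); have c5 := hk 24 (by norm_num)
    calc _ ≤ ‖z‖ + ‖((m ^ 2 / 2 : ℝ) : ℂ)‖ + ‖(1 + P2) ^ 2 / 4‖ + ‖P4 / 4 + Q / 2‖ +
          ‖R + YY d X t‖ := by
          refine (norm_sub_le _ _).trans (add_le_add ((norm_add_le _ _).trans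
            (add_le_add ((norm_sub_le _ _).trans (add_le_add (norm_add_le _ _) le_rfl)) le_rfl))
              le_rfl)
      _ ≤ 6 * q ^ 66 / √n := by rw [mul_div_assoc]; linarith
      _ ≤ _ := by gcongr; exact mul_qpow S.hq 1 66 (by norm_num)
  · have e7 : ∀ p : Fin n × Fin n, (psi d X t p.1 * psi d X t p.2) ^ 2 =
        psi d X t p.1 ^ 2 * psi d X t p.2 ^ 2 := fun p => mul_pow _ _ _
    simp only [e7] at hz2
    rw [S.Fg_eq (S.core_le_one h.1), hz2, Phi, base, e5, mul_assoc, ← Complex.exp_add]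
    congr 2
    push_cast at e1 ⊢
    linear_combination (1 / 2) * e1 - (1 / 4) * e2

end Setup

end expansion

section chaos

variable {n d : ℕ} {X : SimpleGraph (Fin n)} {q : ℝ} {A : Type*} [InvolutiveNeg A]

/-- Sign change of a single coordinate. -/
def flip (v : Fin n) : (Fin n → A) ≃ (Fin n → A) :=
  Function.Involutive.toPerm (fun t => Function.update t v (-t v)) fun t => by simp

lemma flip_same (v : Fin n) (t : Fin n → A) : flip v t v = -t v := by
  simp [flip, Function.Involutive.toPerm]

lemma flip_ne {v j : Fin n} (h : j ≠ v) (t : Fin n → A) : flip v t j = t j := by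
  simp [flip, Function.Involutive.toPerm, h]

/-- Neighbours preceding a vertex. -/
def below (X : SimpleGraph (Fin n)) (v : Fin n) : Finset (Fin n) :=
  univ.filter fun k => k < v ∧ X.Adj k v

lemma sum_below_flip {f : Fin n → A → ℝ} {v j : Fin n} (h : j ≤ v) (t : Fin n → A) :
    ∑ k ∈ below X j, f k (flip v t k) = ∑ k ∈ below X j, f k (t k) := by
  refine sum_congr rfl fun k hk => ?_
  rw [flip_ne]
  simp only [below, mem_filter] at hk
  exact (lt_of_lt_of_le hk.2.1 h).ne

variable [Fintype A] {w : (Fin n → A) → ℝ} {f : Fin n → A → ℝ} {ρ : ℝ}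

lemma avg_sq_step (h0 : ∀ t, 0 ≤ w t) (hw : ∀ v t, w (flip v t) = w t)
    (hf : ∀ j a, f j (-a) = -f j a) (hρ : ∀ t, w t ≠ 0 → ∀ j, |f j (t j)| ≤ ρ)
    {v : Fin n} {P Q : (Fin n → A) → ℝ} (hP : ∀ t, P (flip v t) = P t)
    (hQ : ∀ t, Q (flip v t) = Q t) :
    avg (fun t => w t * (P t + f v (t v) * Q t) ^ 2) ≤
      avg (fun t => w t * P t ^ 2) + ρ ^ 2 * avg (fun t => w t * Q t ^ 2) := by
  have h1 := avg_equiv (flip v) fun t => w t * (P t + f v (t v) * Q t) ^ 2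
  simp only [hw, hP, hQ, flip_same, hf] at h1
  have h2 : avg (fun t => w t * (P t + f v (t v) * Q t) ^ 2) +
      avg (fun t => w t * (P t + f v (t v) * Q t) ^ 2) ≤
      2 * (avg (fun t => w t * P t ^ 2) + ρ ^ 2 * avg (fun t => w t * Q t ^ 2)) := by
    nth_rewrite 1 [← h1]
    rw [← avg_add, ← avg_const_mul, ← avg_add, ← avg_const_mul]
    refine avg_mono fun t => ?_
    by_cases hz : w t = 0
    · simp [hz]
    have h3 : f v (t v) ^ 2 ≤ ρ ^ 2 := by
      rw [← sq_abs]; exact pow_le_pow_left₀ (abs_nonneg _) (hρ t hz v) 2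
    have h4 := mul_le_mul_of_nonneg_left h3 (mul_nonneg (h0 t) (sq_nonneg (Q t)))
    nlinarith
  linarith

lemma avg_sum_sq_le (h0 : ∀ t, 0 ≤ w t) (hw : ∀ v t, w (flip v t) = w t)
    (hf : ∀ j a, f j (-a) = -f j a) (hρ : ∀ t, w t ≠ 0 → ∀ j, |f j (t j)| ≤ ρ)
    (U : Finset (Fin n)) :
    avg (fun t => w t * (∑ k ∈ U, f k (t k)) ^ 2) ≤ ρ ^ 2 * U.card * avg w := by
  induction U using Finset.induction_on with
  | empty => simp [avg]
  | insert v U hv ih =>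
    have h := avg_sq_step h0 hw hf hρ (v := v) (P := fun t => ∑ k ∈ U, f k (t k)) (Q := fun _ => 1)
      (fun t => sum_congr rfl fun k hk => by rw [flip_ne (by rintro rfl; exact hv hk)]) fun _ => rfl
    simp only [mul_one, one_pow] at h
    simp only [sum_insert hv, card_insert_of_notMem hv]
    push_cast
    simp only [add_comm (f v _)]
    calc _ ≤ _ := h
      _ ≤ ρ ^ 2 * U.card * avg w + ρ ^ 2 * avg w := by gcongr
      _ = _ := by ring

lemma card_below_le (X : SimpleGraph (Fin n)) (v : Fin n) : (below X v).card ≤ xDeg X v := by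
  rw [xDeg_eq, below]
  exact card_le_card fun k hk => by
    simp only [mem_filter, mem_univ, true_and] at hk ⊢
    exact hk.2.symm

lemma sum_prs_eq_below (X : SimpleGraph (Fin n)) (g : Fin n → ℝ) :
    ∑ p ∈ prs X, g p.1 * g p.2 = ∑ v, g v * ∑ k ∈ below X v, g k := by
  rw [prs, sum_filter, Fintype.sum_prod_type, sum_comm]
  refine sum_congr rfl fun v _ => ?_
  rw [below, sum_filter, mul_sum]
  refine sum_congr rfl fun k _ => ?_
  split_ifs <;> ring

lemma avg_chaos_sq_le (h0 : ∀ t, 0 ≤ w t) (hw : ∀ v t, w (flip v t) = w t)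
    (hf : ∀ j a, f j (-a) = -f j a) (hρ : ∀ t, w t ≠ 0 → ∀ j, |f j (t j)| ≤ ρ) :
    avg (fun t => w t * (∑ p ∈ prs X, f p.1 (t p.1) * f p.2 (t p.2)) ^ 2) ≤
      ρ ^ 4 * (∑ j, (xDeg X j : ℝ)) * avg w := by
  have ha : 0 ≤ avg w := avg_nonneg h0
  have h : ∀ U : Finset (Fin n),
      avg (fun t => w t * (∑ v ∈ U, f v (t v) * ∑ k ∈ below X v, f k (t k)) ^ 2) ≤
        ρ ^ 4 * (∑ j ∈ U, (xDeg X j : ℝ)) * avg w := by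
    intro U
    induction U using Finset.induction_on_max with
    | empty => simp [avg]
    | insert v U hv ih =>
      have hvU : v ∉ U := fun h => lt_irrefl _ (hv v h)
      have h := avg_sq_step h0 hw hf hρ (v := v)
        (P := fun t => ∑ v ∈ U, f v (t v) * ∑ k ∈ below X v, f k (t k))
        (Q := fun t => ∑ k ∈ below X v, f k (t k))
        (fun t => sum_congr rfl fun k hk => by
          rw [flip_ne (hv k hk).ne, sum_below_flip (hv k hk).le]) (fun t => sum_below_flip le_rfl t)
      simp only [sum_insert hvU]
      simp only [add_comm (f v _ * _)]
      have h2 := avg_sum_sq_le h0 hw hf hρ (below X v)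
      have h3 : ((below X v).card : ℝ) ≤ xDeg X v := by exact_mod_cast card_below_le X v
      calc _ ≤ _ := h
        _ ≤ ρ ^ 4 * (∑ j ∈ U, (xDeg X j : ℝ)) * avg w + ρ ^ 2 * (ρ ^ 2 * xDeg X v * avg w) := by
            refine add_le_add ih (mul_le_mul_of_nonneg_left (h2.trans ?_) (sq_nonneg _))
            gcongr
        _ = _ := by ring
  have e : ∀ t : Fin n → A, ∑ p ∈ prs X, f p.1 (t p.1) * f p.2 (t p.2) =
      ∑ v, f v (t v) * ∑ k ∈ below X v, f k (t k) := fun t =>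
    sum_prs_eq_below X fun j => f j (t j)
  simp only [e]
  exact h univ

lemma avg_chaos_exp_le (h0 : ∀ t, 0 ≤ w t) (hw : ∀ v t, w (flip v t) = w t)
    (hf : ∀ j a, f j (-a) = -f j a) (hρ : ∀ t, w t ≠ 0 → ∀ j, |f j (t j)| ≤ ρ) (s : ℝ) :
    avg (fun t => w t * Real.exp (s * ∑ p ∈ prs X, f p.1 (t p.1) * f p.2 (t p.2))) ≤
      Real.exp (s ^ 2 * ρ ^ 4 / 2 * ∑ j, (xDeg X j : ℝ) ^ 2) * avg w := by
  have h : ∀ U : Finset (Fin n),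
      avg (fun t => w t * Real.exp (s * ∑ v ∈ U, f v (t v) * ∑ k ∈ below X v, f k (t k))) ≤
        Real.exp (s ^ 2 * ρ ^ 4 / 2 * ∑ j ∈ U, (xDeg X j : ℝ) ^ 2) * avg w := by
    intro U
    induction U using Finset.induction_on_max with
    | empty => simp
    | insert v U hv ih =>
      have hvU : v ∉ U := fun h => lt_irrefl _ (hv v h)
      set P : (Fin n → A) → ℝ := fun t => ∑ v ∈ U, f v (t v) * ∑ k ∈ below X v, f k (t k) with hPd
      set Q : (Fin n → A) → ℝ := fun t => ∑ k ∈ below X v, f k (t k) with hQd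
      have hP : ∀ t, P (flip v t) = P t := fun t => sum_congr rfl fun k hk => by
          rw [flip_ne (hv k hk).ne, sum_below_flip (hv k hk).le]
      have hQ : ∀ t, Q (flip v t) = Q t := fun t => sum_below_flip le_rfl t
      have h1 := avg_equiv (flip v) fun t => w t * Real.exp (s * (f v (t v) * Q t + P t))
      simp only [hw, hP, hQ, flip_same, hf] at h1
      simp only [sum_insert hvU]
      change avg (fun t => w t * Real.exp (s * (f v (t v) * Q t + P t))) ≤ _
      set c := s ^ 2 * ρ ^ 4 / 2 * (xDeg X v : ℝ) ^ 2 with hc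
      have h2 : avg (fun t => w t * Real.exp (s * (f v (t v) * Q t + P t))) +
          avg (fun t => w t * Real.exp (s * (f v (t v) * Q t + P t))) ≤
          2 * (Real.exp c * avg (fun t => w t * Real.exp (s * P t))) := by
        nth_rewrite 1 [← h1]
        rw [← avg_add, ← avg_const_mul, ← avg_const_mul]
        refine avg_mono fun t => ?_
        by_cases hz : w t = 0
        · simp [hz]
        have hq : |Q t| ≤ xDeg X v * ρ := by
          calc |Q t| ≤ ∑ k ∈ below X v, |f k (t k)| := abs_sum_le_sum_abs _ _
            _ ≤ ∑ k ∈ below X v, ρ := sum_le_sum fun k _ => hρ t hz k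
            _ = (below X v).card * ρ := by rw [sum_const, nsmul_eq_mul]
            _ ≤ _ := by
                have h3 : ((below X v).card : ℝ) ≤ xDeg X v := by exact_mod_cast card_below_le X v
                have := (abs_nonneg _).trans (hρ t hz v)
                gcongr
        have h5 : (s * (f v (t v) * Q t)) ^ 2 / 2 ≤ c := by
          have h6 : |f v (t v) * Q t| ≤ ρ * (xDeg X v * ρ) := by
            rw [abs_mul]
            exact mul_le_mul (hρ t hz v) hq (abs_nonneg _) ((abs_nonneg _).trans (hρ t hz v))
          have h7 := pow_le_pow_left₀ (abs_nonneg _) h6 2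
          rw [sq_abs] at h7
          calc _ = s ^ 2 * (f v (t v) * Q t) ^ 2 / 2 := by ring
            _ ≤ s ^ 2 * (ρ * (xDeg X v * ρ)) ^ 2 / 2 := by gcongr
            _ = _ := by rw [hc]; ring
        have h6 := Real.cosh_le_exp_half_sq (s * (f v (t v) * Q t))
        rw [Real.cosh_eq] at h6
        have e1 : Real.exp (s * (f v (t v) * Q t + P t)) =
            Real.exp (s * (f v (t v) * Q t)) * Real.exp (s * P t) := by
          rw [← Real.exp_add]; ring_nf
        have e2 : Real.exp (s * (-f v (t v) * Q t + P t)) =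
            Real.exp (-(s * (f v (t v) * Q t))) * Real.exp (s * P t) := by
          rw [← Real.exp_add]; ring_nf
        rw [e1, e2]
        have h8 : (Real.exp (s * (f v (t v) * Q t)) + Real.exp (-(s * (f v (t v) * Q t)))) ≤
            2 * Real.exp c := by
          have := Real.exp_le_exp.2 h5; linarith
        have h9 : 0 ≤ w t * Real.exp (s * P t) := mul_nonneg (h0 t) (Real.exp_pos _).le
        nlinarith [mul_le_mul_of_nonneg_left h8 h9]
      calc _ ≤ Real.exp c * avg (fun t => w t * Real.exp (s * P t)) := by linarith
        _ ≤ Real.exp c * (Real.exp (s ^ 2 * ρ ^ 4 / 2 * ∑ j ∈ U, (xDeg X j : ℝ) ^ 2) * avg w) := by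
            gcongr
        _ = _ := by rw [← mul_assoc, ← Real.exp_add, hc, ← mul_add]
  have e : ∀ t : Fin n → A, ∑ p ∈ prs X, f p.1 (t p.1) * f p.2 (t p.2) =
      ∑ v, f v (t v) * ∑ k ∈ below X v, f k (t k) := fun t =>
    sum_prs_eq_below X fun j => f j (t j)
  simp only [e]
  exact h univ

end chaos

section weights

variable {n d : ℕ} {X : SimpleGraph (Fin n)} {q : ℝ} {M : ℕ} [NeZero M]

/-- Gaussian-type weight on the box around the peak. -/
def nu (d : ℕ) (X : SimpleGraph (Fin n)) (q : ℝ) (t : Fin n → ZMod M) : ℝ :=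
  if ∀ j, gap (root (t j)) ≤ q ^ 14 / n then
    Real.exp (-∑ j, ra d X j * gap (root (t j))) else 0

lemma nu_nonneg (t : Fin n → ZMod M) : 0 ≤ nu d X q t := by
  rw [nu]; split_ifs <;> positivity

lemma gap_flip (v j : Fin n) (t : Fin n → ZMod M) :
    gap (root (flip v t j)) = gap (root (t j)) := by
  by_cases h : j = v
  · subst h; rw [flip_same, root_neg, gap_conj]
  · rw [flip_ne h]

namespace Setup

lemma avg_nu_le [NeZero (2 * n ^ 3)] (S : Setup n d X q) :
    avg (fun t : Fin n → ZMod (2 * n ^ 3) => nu d X q t) ≤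
      rP d X * Real.exp (5 / 24 * (1 / rk d X) + 1) := by
  have h := S.tail_le (y := fun _ => 0) fun j => by have := S.ra0 j; rw [abs_zero]; positivity
  simp only [sub_zero, zero_div, ne_eq, OfNat.ofNat_ne_zero, not_false_eq_true, zero_pow, mul_zero,
    add_zero, sum_const_zero] at h
  refine le_trans (avg_mono fun t => ?_) h
  rw [nu]; split_ifs
  · exact le_rfl
  · positivity

lemma avg_nu_chaos_le (S : Setup n d X q) {δ : ℝ} (hδ : 0 ≤ δ) (hδ2 : δ ≤ q ^ 67 / √n) :
    avg (fun t : Fin n → ZMod M => nu d X q t * ((|YY d X t| + δ) * Real.exp (|YY d X t| + 1))) ≤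
      q ^ 69 / √n * avg (fun t : Fin n → ZMod M => nu d X q t) := by
  have hq := S.q0; have hs := S.s0; have hn := S.n0
  set f : Fin n → ZMod M → ℝ := fun j a =>
    (((rK d X j / √(rk d X) : ℝ) : ℂ) * incr (rl d X j) (root a)).im with hfd
  have hf : ∀ j a, f j (-a) = -f j a := fun j a => by
    simp only [hfd]; rw [root_neg, incr_conj]; simp
  have hw : ∀ v (t : Fin n → ZMod M), nu d X q (flip v t) = nu d X q t := fun v t => by
    simp only [nu, gap_flip]
  have hρ : ∀ t : Fin n → ZMod M, nu d X q t ≠ 0 → ∀ j, |f j (t j)| ≤ q ^ 8 / √n := by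
    intro t ht j
    have h : ∀ j, gap (root (t j)) ≤ q ^ 14 / n := by
      by_contra h; exact ht (if_neg h)
    exact (Complex.abs_im_le_norm _).trans (S.norm_ps0_le h j)
  have hY : ∀ t : Fin n → ZMod M, YY d X t = ∑ p ∈ prs X, f p.1 (t p.1) * f p.2 (t p.2) :=
    fun t => rfl
  have c1 := avg_chaos_sq_le (X := X) nu_nonneg hw hf hρ
  have c2 := avg_chaos_exp_le (X := X) nu_nonneg hw hf hρ 2
  have c3 := avg_chaos_exp_le (X := X) nu_nonneg hw hf hρ (-2)
  simp only [← hY] at c1 c2 c3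
  set V := avg (fun t : Fin n → ZMod M => nu d X q t) with hV
  have hV0 : 0 ≤ V := avg_nonneg nu_nonneg
  have r4 : (q ^ 8 / √n) ^ 4 = q ^ 32 / n ^ 2 := by
    rw [div_pow, ← pow_mul, show (√(n : ℝ)) ^ 4 = (√n ^ 2) ^ 2 by ring, S.sq]
  rw [r4] at c1 c2 c3
  have b1 : q ^ 32 / n ^ 2 * ∑ j, (xDeg X j : ℝ) ≤ q ^ 33 / n := by
    calc _ ≤ q ^ 32 / n ^ 2 * (n * q) := by have := S.hX; gcongr
      _ = _ := by field_simp
  have b2 : 2 ^ 2 * (q ^ 32 / n ^ 2) / 2 * ∑ j, (xDeg X j : ℝ) ^ 2 ≤ 1 / 2 := by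
    have h1 : ∑ j, (xDeg X j : ℝ) ^ 2 ≤ √n * q * (n * q) := by
      calc _ ≤ ∑ j, √n * q * (xDeg X j : ℝ) := sum_le_sum fun j _ => by
            rw [pow_two]; have := S.hx j; gcongr
        _ ≤ _ := by rw [← mul_sum]; have := S.hX; gcongr
    calc _ ≤ 2 ^ 2 * (q ^ 32 / n ^ 2) / 2 * (√n * q * (n * q)) := by gcongr
      _ = 2 * q ^ 34 * (√n ^ 2) / (n * √n) := by field_simp; try norm_num
      _ = 2 * q ^ 34 / √n := by rw [S.sq]; field_simp
      _ ≤ q ^ 35 / √n := by gcongr; exact mul_qpow S.hq 1 34 (by norm_num)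
      _ ≤ _ := by have := S.div_s_le 35; linarith
  have e2 : ∀ c : ℝ, c ≤ 1 / 2 → Real.exp c ≤ 2 := fun c hc => by
    have := Real.exp_le_exp.2 hc; have h2 := Real.exp_one_lt_d9
    have h3 : Real.exp (1 / 2) ^ 2 = Real.exp 1 := by rw [← Real.exp_nat_mul]; norm_num
    nlinarith [Real.exp_pos (1 / 2)]
  replace c1 : avg (fun t : Fin n → ZMod M => nu d X q t * YY d X t ^ 2) ≤ q ^ 33 / n * V :=
    c1.trans (by gcongr)
  replace c2 : avg (fun t : Fin n → ZMod M => nu d X q t * Real.exp (2 * YY d X t)) ≤ 2 * V :=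
    c2.trans (by gcongr; exact e2 _ b2)
  replace c3 : avg (fun t : Fin n → ZMod M => nu d X q t * Real.exp (-2 * YY d X t)) ≤ 2 * V :=
    c3.trans (by gcongr; rw [neg_sq]; exact e2 _ b2)
  set s := q ^ 17 / √n with hsd
  have hs0 : 0 < s := by positivity
  have key : ∀ y : ℝ, (|y| + δ) * Real.exp (|y| + 1) ≤
      3 / (2 * s) * y ^ 2 + 3 * (s / 2 + δ) * (Real.exp (2 * y) + Real.exp (-2 * y)) := by
    intro y
    have h1 : Real.exp |y| * Real.exp |y| ≤ Real.exp (2 * y) + Real.exp (-2 * y) := by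
      rw [← Real.exp_add]
      rcases abs_cases y with ⟨h, _⟩ | ⟨h, _⟩ <;> rw [h]
      · rw [← two_mul]; linarith [Real.exp_pos (-2 * y)]
      · rw [show -y + -y = -2 * y by ring]; linarith [Real.exp_pos (2 * y)]
    have h2 : 1 ≤ Real.exp |y| := Real.one_le_exp (abs_nonneg _)
    have h3 := Real.exp_one_lt_d9
    set E := Real.exp |y|
    have h4 : |y| * E ≤ 1 / (2 * s) * y ^ 2 + s / 2 * (E * E) := by
      have : 1 / (2 * s) * y ^ 2 + s / 2 * (E * E) - |y| * E = (|y| - s * E) ^ 2 / (2 * s) := by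
        rw [← sq_abs y]; field_simp; ring
      have : 0 ≤ (|y| - s * E) ^ 2 / (2 * s) := by positivity
      linarith
    have h5 : δ * E ≤ δ * (E * E) := by gcongr; nlinarith
    rw [Real.exp_add]
    have h6 : (|y| + δ) * E ≤ 1 / (2 * s) * y ^ 2 +
        (s / 2 + δ) * (Real.exp (2 * y) + Real.exp (-2 * y)) := by
      have := mul_le_mul_of_nonneg_left h1 (by positivity : 0 ≤ s / 2 + δ)
      nlinarith
    have h7 : 0 ≤ (|y| + δ) * E := by positivity
    calc _ = (|y| + δ) * E * Real.exp 1 := by ring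
      _ ≤ (|y| + δ) * E * 3 := by gcongr; linarith
      _ ≤ (1 / (2 * s) * y ^ 2 +
          (s / 2 + δ) * (Real.exp (2 * y) + Real.exp (-2 * y))) * 3 := by gcongr
      _ = _ := by field_simp
  calc _ ≤ avg (fun t : Fin n → ZMod M => 3 / (2 * s) * (nu d X q t * YY d X t ^ 2) +
        3 * (s / 2 + δ) * (nu d X q t * Real.exp (2 * YY d X t) +
          nu d X q t * Real.exp (-2 * YY d X t))) := avg_mono fun t => by
        have := mul_le_mul_of_nonneg_left (key (YY d X t)) (nu_nonneg (d := d) (X := X) (q := q) t)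
        linarith
    _ ≤ 3 / (2 * s) * (q ^ 33 / n * V) + 3 * (s / 2 + δ) * (2 * V + 2 * V) := by
        rw [avg_add, avg_const_mul, avg_const_mul, avg_add]; gcongr
    _ = (3 / 2 * (q ^ 16 / √n) + 12 * (s / 2 + δ)) * V := by
        have e : 3 / (2 * s) * (q ^ 33 / n) = 3 / 2 * (q ^ 16 / √n) := by
          rw [hsd]; have := S.sq; field_simp; linear_combination this
        rw [← mul_assoc, e]; ring
    _ ≤ _ := by
        gcongr
        have k1 : q ^ 16 / √n ≤ q ^ 67 / √n := by gcongr ?_ / _; exact S.pow_le_pow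
        have k2 : s ≤ q ^ 67 / √n := by rw [hsd]; gcongr ?_ / _; exact S.pow_le_pow
        have k3 : 0 ≤ q ^ 67 / √n := by positivity
        calc _ ≤ 20 * (q ^ 67 / √n) := by linarith
          _ = 20 * q ^ 67 / √n := by ring
          _ ≤ _ := by gcongr; exact mul_qpow S.hq 2 67 (by norm_num)

end Setup

end weights

section bounds

variable {n d : ℕ} {X : SimpleGraph (Fin n)} {q : ℝ} {M : ℕ} [NeZero M]

namespace Setup

lemma abs_bb_le (S : Setup n d X q) (j : Fin n) : |bb d X j| ≤ 2 * q ^ 4 := by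
  have hq := S.q0; have hs := S.s0
  have h1 : |∑ k, if X.Adj j k then rm d X k else 0| ≤ q ^ 4 := by
    calc _ ≤ ∑ k, |if X.Adj j k then rm d X k else 0| := abs_sum_le_sum_abs _ _
      _ ≤ ∑ k, if X.Adj j k then q ^ 3 / √n else 0 := sum_le_sum fun k _ => by
          split_ifs
          · exact S.abs_rm_le' k
          · simp
      _ = xDeg X j * (q ^ 3 / √n) := by
          rw [← sum_filter, sum_const, ← xDeg_eq, nsmul_eq_mul]
      _ ≤ √n * q * (q ^ 3 / √n) := by have := S.hx j; gcongr
      _ = q ^ 4 := by field_simp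
  have h2 := S.abs_sum_rm_le
  have h3 : q ^ 4 / √n ≤ q ^ 4 :=
    div_le_self (by positivity) (by have := S.s1000; linarith)
  rw [bb]
  have := abs_sub (∑ k, if X.Adj j k then rm d X k else 0) (∑ k, rm d X k)
  linarith

lemma sum_abs_bb_le (S : Setup n d X q) : ∑ j, |bb d X j| ≤ 2 * (√n * q ^ 4) := by
  have hq := S.q0; have hs := S.s0; have hn := S.n0
  have h1 : ∑ j, ∑ k, (if X.Adj j k then |rm d X k| else 0) = ∑ j, xDeg X j * |rm d X j| := by
    rw [← sum_prs_add X fun _ k => |rm d X k|, ← sum_prs_symm]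
    exact sum_congr rfl fun p _ => add_comm _ _
  have h2 : ∀ j, |bb d X j| ≤ ∑ k, (if X.Adj j k then |rm d X k| else 0) + q ^ 4 / √n := fun j => by
    rw [bb]
    refine (abs_sub _ _).trans (add_le_add ((abs_sum_le_sum_abs _ _).trans
      (sum_le_sum fun k _ => ?_)) S.abs_sum_rm_le)
    split_ifs <;> simp
  calc _ ≤ _ := sum_le_sum fun j _ => h2 j
    _ = ∑ j, xDeg X j * |rm d X j| + n * (q ^ 4 / √n) := by
        rw [sum_add_distrib, h1, sum_const, card_univ, Fintype.card_fin, nsmul_eq_mul]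
    _ ≤ ∑ j, √n * q * |rm d X j| + n * (q ^ 4 / √n) := by
        gcongr with j _; exact S.hx j
    _ ≤ √n * q * q ^ 3 + n * (q ^ 4 / √n) := by
        rw [← mul_sum]; have := S.sum_abs_rm_le; gcongr
    _ = √n * q ^ 4 + √n ^ 2 * (q ^ 4 / √n) := by rw [S.sq]; ring
    _ = _ := by field_simp; ring

lemma sum_bb_re_le (S : Setup n d X q) {t : Fin n → ZMod M}
    (h : ∀ j, gap (root (t j)) ≤ q ^ 14 / n) : ∑ j, |bb d X j| * |(ps0 d X t j).re| ≤ 1 := by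
  have hq := S.q0; have hs := S.s0; have hn := S.n0
  calc _ ≤ ∑ j, |bb d X j| * (2 * (q ^ 14 / n)) := by
        gcongr with j _
        exact (S.abs_re_ps0_le (S.core_le_one h j)).trans (by have := h j; linarith)
    _ ≤ 2 * (√n * q ^ 4) * (2 * (q ^ 14 / n)) := by
        rw [← sum_mul]; have := S.sum_abs_bb_le; gcongr
    _ = 4 * q ^ 18 * √n / √n ^ 2 := by rw [S.sq]; ring
    _ = 4 * q ^ 18 / √n := by field_simp
    _ ≤ q ^ 19 / √n := by gcongr; exact mul_qpow S.hq 1 18 (by norm_num)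
    _ ≤ 1 := by have := S.div_s_le 19; linarith

lemma norm_base_le (S : Setup n d X q) {t : Fin n → ZMod M}
    (h : ∀ j, gap (root (t j)) ≤ q ^ 14 / n) : ‖base d X t‖ ≤ nu d X q t := by
  rw [nu, if_pos h]; exact S.norm_bern_prod_le t

lemma norm_Phi_le (S : Setup n d X q) {t : Fin n → ZMod M}
    (h : ∀ j, gap (root (t j)) ≤ q ^ 14 / n) {R : ℝ} (hR : ∑ j, |(ps0 d X t j).re| ≤ R) :
    ‖Phi d X t‖ ≤ nu d X q t * Real.exp (R ^ 2 / 2 + 1) := by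
  rw [Phi, norm_mul, Complex.norm_exp]
  refine mul_le_mul (S.norm_base_le h) (Real.exp_le_exp.2 ?_) (Real.exp_pos _).le (nu_nonneg t)
  have h1 : ((∑ j, ps0 d X t j) ^ 2 / 2).re ≤ R ^ 2 / 2 := by
    have e : ((∑ j, ps0 d X t j) ^ 2 / 2).re =
        ((∑ j, ps0 d X t j).re ^ 2 - (∑ j, ps0 d X t j).im ^ 2) / 2 := by
      rw [pow_two, Complex.div_ofNat_re, Complex.mul_re]; ring
    rw [e, Complex.re_sum]
    have h2 : |∑ j, (ps0 d X t j).re| ≤ R := (abs_sum_le_sum_abs _ _).trans hR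
    have h3 : (∑ j, (ps0 d X t j).re) ^ 2 ≤ R ^ 2 := by
      rw [← sq_abs]; exact pow_le_pow_left₀ (abs_nonneg _) h2 2
    have := sq_nonneg (∑ j, ps0 d X t j).im
    linarith
  have h2 : -(∑ j, (bb d X j : ℂ) * ps0 d X t j).re ≤ 1 := by
    rw [Complex.re_sum]
    refine (neg_le_abs _).trans (((abs_sum_le_sum_abs _ _).trans (le_of_eq ?_)).trans
      (S.sum_bb_re_le h))
    refine sum_congr rfl fun j _ => ?_
    rw [Complex.re_ofReal_mul, abs_mul]
  rw [Complex.sub_re]; linarith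

lemma tg_box (S : Setup n d X q) {t : Fin n → ZMod M}
    (h : ∀ j, gap (root (t j)) ≤ q ^ 14 / n) : tg t ≤ q ^ 14 := by
  have hn := S.n0
  calc tg t ≤ ∑ _j : Fin n, q ^ 14 / n := sum_le_sum fun j _ => h j
    _ = q ^ 14 := by rw [sum_const, card_univ, Fintype.card_fin, nsmul_eq_mul]; field_simp

lemma sum_re_box_le (S : Setup n d X q) {t : Fin n → ZMod M}
    (h : ∀ j, gap (root (t j)) ≤ q ^ 14 / n) : ∑ j, |(ps0 d X t j).re| ≤ 2 * q ^ 14 := by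
  calc _ ≤ ∑ j, 2 * gap (root (t j)) := sum_le_sum fun j _ => S.abs_re_ps0_le (S.core_le_one h j)
    _ = 2 * tg t := by rw [← mul_sum, tg]
    _ ≤ _ := by have := S.tg_box h; linarith

lemma norm_Phi_box_le (S : Setup n d X q) {t : Fin n → ZMod M}
    (h : ∀ j, gap (root (t j)) ≤ q ^ 14 / n) :
    ‖Phi d X t‖ ≤ nu d X q t * Real.exp (q ^ 29) := by
  refine (S.norm_Phi_le h (S.sum_re_box_le h)).trans
    (mul_le_mul_of_nonneg_left (Real.exp_le_exp.2 ?_) (nu_nonneg t))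
  have h1 : 3 * q ^ 28 ≤ q ^ 29 := mul_qpow S.hq 1 28 (by norm_num)
  have h2 : 1 ≤ q ^ 28 := one_le_pow₀ S.one_le_q
  calc _ = 2 * q ^ 28 + 1 := by ring
    _ ≤ _ := by linarith

lemma abs_re_ps0_le' (S : Setup n d X q) {t : Fin n → ZMod M}
    (h : ∀ j, gap (root (t j)) ≤ q ^ 14 / n) (j : Fin n) :
    |(ps0 d X t j).re| ≤ √(rk d X) * (1 + q ^ 4 / √n) * gap (root (t j)) := by
  have hq := S.q0; have hs := S.s0; have hn := S.n0
  have hc := S.core_le_one h j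
  have hg := gap_root_nonneg (t j)
  have h1 := abs_incr_re_le' (S.rl0 j).le (S.rl1 j).le (norm_root (t j)) hc
  have hs2 := S.sqrt_rk0; have hk := S.rk0; have hK := S.rK0 j
  have h2 := (abs_le.1 (S.rK_div_ge j)).2
  have h3 : rK d X j ≤ rk d X * (1 + q ^ 3 / √n) := by
    rw [← div_le_iff₀' hk]; linarith
  set c := gap (root (t j))
  have hu : 0 ≤ q ^ 3 / √n := by positivity
  have h4 : c / (1 - 2 * (rl d X j * (1 - rl d X j)) * c) ≤ c * (1 + q ^ 3 / √n) := by
    have hD := half_le_norm_bern_sq (rl d X j) hg hc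
    rw [div_le_iff₀ (by linarith)]
    have h5 : c ≤ q ^ 3 / √n / 1000 := by
      refine (h j).trans ?_
      have := S.div_s_le 11
      calc q ^ 14 / n = q ^ 3 / √n * (q ^ 11 / √n) := by
            rw [div_mul_div_comm, ← pow_two, S.sq]; ring
        _ ≤ q ^ 3 / √n * (1 / 1000) := by gcongr
        _ = _ := by ring
    have h6 := S.div_s_le 3
    have h7 : 2 * (rl d X j * (1 - rl d X j)) * c ≤ c / 2 := by
      have := quarter (rl d X j); nlinarith
    have h8 : 1 ≤ (1 + q ^ 3 / √n) * (1 - 2 * (rl d X j * (1 - rl d X j)) * c) := by nlinarith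
    calc c = c * 1 := by ring
      _ ≤ c * ((1 + q ^ 3 / √n) * (1 - 2 * (rl d X j * (1 - rl d X j)) * c)) := by gcongr
      _ = _ := by ring
  have e : (ps0 d X t j).re = rK d X j / √(rk d X) * (incr (rl d X j) (root (t j))).re := by
    rw [ps0, Complex.re_ofReal_mul]
  rw [e, abs_mul, abs_of_pos (show 0 < rK d X j / √(rk d X) by positivity)]
  have h9 : rK d X j / √(rk d X) ≤ √(rk d X) * (1 + q ^ 3 / √n) := by
    rw [div_le_iff₀ hs2]
    calc _ ≤ _ := h3
      _ = √(rk d X) ^ 2 * (1 + q ^ 3 / √n) := by rw [S.sqrt_rk_sq]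
      _ = _ := by ring
  have h10 : (1 + q ^ 3 / √n) * (1 + q ^ 3 / √n) ≤ 1 + q ^ 4 / √n := by
    have := S.div_s_le 3
    have h11 : 3 * q ^ 3 / √n ≤ q ^ 4 / √n := by gcongr; exact mul_qpow S.hq 1 3 (by norm_num)
    rw [mul_div_assoc] at h11
    nlinarith
  calc _ ≤ √(rk d X) * (1 + q ^ 3 / √n) * (c * (1 + q ^ 3 / √n)) := by gcongr; exact h1.trans h4
    _ = √(rk d X) * ((1 + q ^ 3 / √n) * (1 + q ^ 3 / √n)) * c := by ring
    _ ≤ _ := by gcongr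

lemma norm_Phi_core_le (S : Setup n d X q) {t : Fin n → ZMod M} (h : core d X q t) :
    ‖Phi d X t‖ ≤ nu d X q t * Real.exp (1 / 8 * (1 / rk d X) + 2) := by
  have hq := S.q0; have hs := S.s0; have hk := S.rk0
  have hR : ∑ j, |(ps0 d X t j).re| ≤ √(rk d X) * (1 + q ^ 4 / √n) * tg t := by
    rw [tg, mul_sum]; exact sum_le_sum fun j _ => S.abs_re_ps0_le' h.1 j
  refine (S.norm_Phi_le h.1 hR).trans
    (mul_le_mul_of_nonneg_left (Real.exp_le_exp.2 ?_) (nu_nonneg t))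
  have e : (√(rk d X) * (1 + q ^ 4 / √n) * tg t) ^ 2 / 2 =
      1 / 8 * (1 / rk d X) * ((1 + q ^ 4 / √n) * (2 * rk d X * tg t)) ^ 2 := by
    rw [mul_pow, mul_pow, S.sqrt_rk_sq]; field_simp; ring
  have h1 : 2 * rk d X * tg t ≤ 1 + q ^ 32 / √n := by have := (abs_le.1 h.2).2; linarith
  set v := q ^ 32 / √n with hv
  have hv0 : 0 ≤ v := by positivity
  have hv1 : v ≤ 1 / 1000 := S.div_s_le 32
  have h2 : q ^ 4 / √n ≤ v := by rw [hv]; gcongr ?_ / _; exact S.pow_le_pow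
  have h3 := tg_nonneg t
  have h4 : ((1 + q ^ 4 / √n) * (2 * rk d X * tg t)) ^ 2 ≤ 1 + 5 * v := by
    calc _ ≤ ((1 + v) * (1 + v)) ^ 2 := by gcongr
      _ ≤ _ := by
        have : (1 + v) * (1 + v) ≤ 1 + 2.1 * v := by nlinarith
        calc _ ≤ (1 + 2.1 * v) ^ 2 := by gcongr
          _ ≤ _ := by nlinarith
  have h5 := S.inv_rk_le
  have h6 : q * v ≤ 1 / 1000 := by
    calc q * v = q ^ 33 / √n := by rw [hv]; ring
      _ ≤ _ := S.div_s_le 33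
  rw [e]
  calc _ ≤ 1 / 8 * (1 / rk d X) * (1 + 5 * v) + 1 := by gcongr
    _ = 1 / 8 * (1 / rk d X) + 5 / 8 * (1 / rk d X) * v + 1 := by ring
    _ ≤ 1 / 8 * (1 / rk d X) + 5 / 8 * (4 * q) * v + 1 := by gcongr
    _ ≤ _ := by nlinarith

end Setup

end bounds
lemma norm_exp_sub_quadratic_le {w : ℂ} (hw : ‖w‖ ≤ 1) :
    ‖Complex.exp w - (1 + w + w ^ 2 / 2)‖ ≤ ‖w‖ ^ 3 := by
  have h := Complex.exp_bound hw (n := 3) (by norm_num)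
  have e : ∑ m ∈ range 3, w ^ m / (m.factorial : ℂ) = 1 + w + w ^ 2 / 2 := by
    simp [sum_range_succ, Nat.factorial]
  rw [e] at h
  refine h.trans ?_
  have : 0 ≤ ‖w‖ ^ 3 := by positivity
  norm_num [Nat.factorial]; linarith

section row

variable {n d : ℕ} {X : SimpleGraph (Fin n)} {q : ℝ} {M : ℕ} [NeZero M]

/-- Row factor of the integrand. -/
def rowB (d : ℕ) (X : SimpleGraph (Fin n)) (j : Fin n) (l : ZMod M) : ℂ :=
  bern (rl d X j) (root l) ^ nn X j * (root l)⁻¹ ^ d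

/-- One-row exponential moment restricted to the box. -/
def rowE (M : ℕ) [NeZero M] (d : ℕ) (X : SimpleGraph (Fin n)) (q s : ℝ) (j : Fin n) : ℂ :=
  avg fun l : ZMod M => if gap (root l) ≤ q ^ 14 / n then rowB d X j l *
    Complex.exp ((s : ℂ) * (((rK d X j / √(rk d X) : ℝ) : ℂ) * incr (rl d X j) (root l))) else 0

namespace Setup

lemma nn_lt (S : Setup n d X q) (j : Fin n) : nn X j < 2 * n ^ 3 := by
  have h : nn X j ≤ n := by exact_mod_cast S.nn_le j
  have := S.npos
  nlinarith [Nat.pow_le_pow_right this (show 1 ≤ 3 by norm_num)]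

lemma row_moments (S : Setup n d X q) [NeZero (2 * n ^ 3)] (j : Fin n) :
    avg (fun l : ZMod (2 * n ^ 3) => rowB d X j l) = (binW (nn X j) (rl d X j) d : ℂ) ∧
    avg (fun l : ZMod (2 * n ^ 3) => rowB d X j l * incr (rl d X j) (root l)) = 0 ∧
    avg (fun l : ZMod (2 * n ^ 3) => rowB d X j l * incr (rl d X j) (root l) ^ 2) =
      ((-(binW (nn X j) (rl d X j) d / (rK d X j * (nn X j - 1))) : ℝ) : ℂ) := by
  obtain ⟨h2, h3⟩ := S.d_nat j
  obtain ⟨D, hD⟩ : ∃ D, d = D + 2 := ⟨d - 2, by omega⟩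
  obtain ⟨F, hF⟩ : ∃ F, nn X j = D + F + 4 := ⟨nn X j - d - 2, by omega⟩
  have hl := S.cast_nn_mul_rl j
  have hM := S.nn_lt j
  refine ⟨avg_bern_pow _ _ _ hM (by omega), ?_, ?_⟩
  · have h := avg_incr (M := 2 * n ^ 3) D F (rl d X j) (by rw [← hF, ← hD]; exact hl) (by omega)
    rw [← hF, ← hD] at h; exact h
  · have h := avg_incr_sq (M := 2 * n ^ 3) D F (rl d X j) (by rw [← hF, ← hD]; exact hl) (by omega)
    rw [← hF, ← hD] at h
    refine h.trans ?_
    have e : ((D + F + 3 : ℕ) : ℝ) = nn X j - 1 := by rw [hF]; push_cast; ring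
    rw [e, neg_div]; rfl

lemma norm_rowB_le (_ : Setup n d X q) (j : Fin n) (l : ZMod M) :
    ‖rowB d X j l‖ ≤ Real.exp (-(ra d X j * gap (root l))) := by
  rw [rowB, norm_mul, norm_pow (root l)⁻¹, norm_inv, norm_root, inv_one, one_pow, mul_one]
  exact norm_bern_pow_le _ (norm_root l) _

lemma norm_rowB_incr_le (S : Setup n d X q) (j : Fin n) (l : ZMod M) :
    ‖rowB d X j l * incr (rl d X j) (root l)‖ ≤ 2 * Real.exp (-(ra d X j * gap (root l)) + 1) ∧
    ‖rowB d X j l * incr (rl d X j) (root l) ^ 2‖ ≤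
      4 * Real.exp (-(ra d X j * gap (root l)) + 1) := by
  obtain ⟨h2, h3⟩ := S.d_nat j
  obtain ⟨N, hN⟩ : ∃ N, nn X j = N + 3 := ⟨nn X j - 3, by omega⟩
  have hK := S.rK_le j
  have hg := gap_root_nonneg l
  have hg2 := gap_root_le_two l
  have hr : ‖(root l)⁻¹ ^ d‖ = 1 := by rw [norm_pow, norm_inv, norm_root, inv_one, one_pow]
  have he : ‖root l - 1‖ ≤ 2 := by
    refine (norm_sub_le _ _).trans ?_
    rw [norm_root, norm_one]; norm_num
  have hb : ∀ k, k ≤ 2 → ‖bern (rl d X j) (root l) ^ (N + 3 - k)‖ ≤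
      Real.exp (-(ra d X j * gap (root l)) + 1) := fun k hk => by
    refine (norm_bern_pow_le _ (norm_root l) _).trans (Real.exp_le_exp.2 ?_)
    have hk2 : (k : ℝ) ≤ 2 := by exact_mod_cast hk
    have hk0 : (0 : ℝ) ≤ k := by positivity
    have e : ((N + 3 - k : ℕ) : ℝ) = nn X j - k := by
      rw [Nat.cast_sub (by omega), hN]
    have hK0 := S.rK0 j
    rw [e, ra]
    change -((nn X j - k : ℝ) * rK d X j * gap (root l)) ≤ _
    have h1 : (k : ℝ) * (rK d X j * gap (root l)) ≤ 2 * (1 / 4 * 2) := by gcongr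
    linarith
  constructor
  · have e : rowB d X j l * incr (rl d X j) (root l) =
        bern (rl d X j) (root l) ^ (N + 3 - 1) * (root l - 1) * (root l)⁻¹ ^ d := by
      rw [rowB, hN, mul_right_comm, bern_pow_mul_incr _ _ (N + 1)]; rfl
    rw [e, norm_mul, norm_mul, hr, mul_one, mul_comm]
    exact mul_le_mul he (hb 1 (by norm_num)) (norm_nonneg _) (by norm_num)
  · have e : rowB d X j l * incr (rl d X j) (root l) ^ 2 =
        bern (rl d X j) (root l) ^ (N + 3 - 2) * (root l - 1) ^ 2 * (root l)⁻¹ ^ d := by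
      rw [rowB, hN, mul_right_comm, bern_pow_mul_incr_sq _ _ N]; rfl
    rw [e, norm_mul, norm_mul, hr, mul_one, mul_comm, norm_pow]
    refine mul_le_mul ?_ (hb 2 (by norm_num)) (norm_nonneg _) (by norm_num)
    calc _ ≤ (2 : ℝ) ^ 2 := by gcongr
      _ = 4 := by norm_num

lemma row_half_le (S : Setup n d X q) [NeZero (2 * n ^ 3)] (j : Fin n) :
    avg (fun l : ZMod (2 * n ^ 3) => Real.exp (-(ra d X j / 2 * gap (root l)))) ≤
      binW (nn X j) (rl d X j) d * 3 := by
  have ha := S.ra0 j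
  have h := S.row_le j (y := ra d X j / 2) (by rw [abs_of_pos (by positivity)])
  rw [sub_half] at h
  refine h.trans (mul_le_mul_of_nonneg_left ?_ (S.binW_pos j).le)
  have h1 : 1 / ra d X j ≤ 1 / 10 ^ 4 := by
    have := S.inv_ra_le j
    have h2 : 8 * q / n ≤ q ^ 2 / n := by
      have := S.n0
      have h0 : 8 * q ^ 1 ≤ q ^ 2 := mul_qpow S.hq 1 1 (by norm_num)
      rw [pow_one] at h0
      gcongr
    have h3 := S.div_n_le 2
    have h4 : 1 / √n ≤ q ^ 2 / √n / 10 ^ 4 := by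
      have := S.s0
      rw [div_right_comm]; gcongr
      rw [le_div_iff₀ (by norm_num)]; have := S.hq; nlinarith
    have h5 := S.div_s_le 2
    have h6 : q ^ 2 / √n / 10 ^ 4 ≤ 1 / 1000 / 10 ^ 4 := by gcongr
    exact (((this.trans h2).trans h3).trans h4).trans (h6.trans (by norm_num))
  have h2 : 1 / ra d X j ^ 2 ≤ 1 / 10 ^ 8 := by
    calc 1 / ra d X j ^ 2 = (1 / ra d X j) ^ 2 := by rw [div_pow, one_pow]
      _ ≤ (1 / 10 ^ 4) ^ 2 := by gcongr
      _ = _ := by norm_num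
  have e : 5 / 24 * (1 / ra d X j) + ra d X j / 2 / (2 * ra d X j) +
      2 * (ra d X j / 2) ^ 2 / ra d X j ^ 2 + 10 ^ 6 / ra d X j ^ 2 =
      5 / 24 * (1 / ra d X j) + 3 / 4 + 10 ^ 6 * (1 / ra d X j ^ 2) := by field_simp; ring
  rw [e]
  have h3 : Real.exp 1 < 3 := by have := Real.exp_one_lt_d9; linarith
  refine le_trans (Real.exp_le_exp.2 ?_) h3.le
  norm_num at h1 h2 ⊢
  linarith

lemma exp_tail_le (S : Setup n d X q) : q ^ 36 * Real.exp (-q ^ 12) ≤ q ^ 76 / (n * √n) := by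
  have hn := S.n0; have hs := S.s0; have hq := S.q0
  have h1 := S.n_le_exp
  rw [le_div_iff₀ (by positivity)]
  have h2 : (n : ℝ) * √n ≤ Real.exp (q ^ 12) := by
    calc (n : ℝ) * √n ≤ n * n := by have := S.sle; gcongr
      _ ≤ Real.exp q * Real.exp q := by gcongr
      _ ≤ Real.exp (q ^ 12) := by
        rw [← Real.exp_add]
        refine Real.exp_le_exp.2 ?_
        have h3 : 2 * q ^ 1 ≤ q ^ 2 := mul_qpow S.hq 1 1 (by norm_num)
        have h4 : q ^ 2 ≤ q ^ 12 := S.pow_le_pow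
        rw [pow_one] at h3; linarith
  calc _ ≤ q ^ 36 * Real.exp (-q ^ 12) * Real.exp (q ^ 12) := by gcongr
    _ = q ^ 36 := by rw [mul_assoc, ← Real.exp_add]; simp
    _ ≤ _ := S.pow_le_pow

lemma K_div_sqrt_le (S : Setup n d X q) (j : Fin n) : rK d X j / √(rk d X) ≤ 1 := by
  have h3 := S.rK_div_le j; have := S.sqrt_rk0; have h4 := S.sqrt_rk_sq; have h5 := S.sqrt_rk_le
  rw [div_le_iff₀ S.rk0] at h3
  rw [div_le_one this]
  nlinarith

lemma row_pointwise_le (S : Setup n d X q) (j : Fin n) {s : ℝ} (hs : |s| ≤ 2 * q ^ 17)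
    (l : ZMod M) :
    ‖(if gap (root l) ≤ q ^ 14 / n then rowB d X j l * Complex.exp ((s : ℂ) *
        (((rK d X j / √(rk d X) : ℝ) : ℂ) * incr (rl d X j) (root l))) else 0) -
      (rowB d X j l + ((s * (rK d X j / √(rk d X)) : ℝ) : ℂ) *
        (rowB d X j l * incr (rl d X j) (root l)) +
        ((s ^ 2 / 2 * (rK d X j ^ 2 / rk d X) : ℝ) : ℂ) *
          (rowB d X j l * incr (rl d X j) (root l) ^ 2))‖ ≤
      q ^ 77 / (n * √n) * Real.exp (-(ra d X j / 2 * gap (root l))) := by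
  have hq := S.q0; have hsn := S.s0; have hn := S.n0; have ha := S.ra0 j
  have hg := gap_root_nonneg l
  set r := rK d X j / √(rk d X) with hr
  have hr0 : 0 < r := div_pos (S.rK0 j) S.sqrt_rk0
  have hr1 : r ≤ 1 := S.K_div_sqrt_le j
  have hr2 : rK d X j ^ 2 / rk d X = r ^ 2 := by rw [hr, div_pow, S.sqrt_rk_sq]
  rw [hr2]
  set B := rowB d X j l with hB
  set D := incr (rl d X j) (root l) with hD
  set c := gap (root l) with hc
  by_cases h : c ≤ q ^ 14 / n
  · rw [if_pos h]
    set w := (s : ℂ) * ((r : ℂ) * D) with hw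
    have h1 : ‖(r : ℂ) * D‖ ≤ q ^ 8 / √n :=
      S.norm_ps0_le (t := fun _ => l) (fun _ => h) j
    have h2 : ‖w‖ ≤ 2 * q ^ 25 / √n := by
      rw [hw, norm_mul, Complex.norm_real, Real.norm_eq_abs]
      calc _ ≤ 2 * q ^ 17 * (q ^ 8 / √n) := by gcongr
        _ = _ := by ring
    have h3 : ‖w‖ ≤ 1 := by
      refine h2.trans ?_
      have := S.div_s_le 25
      rw [mul_div_assoc]; linarith
    have e : B * Complex.exp w - (B + ((s * r : ℝ) : ℂ) * (B * D) +
        ((s ^ 2 / 2 * r ^ 2 : ℝ) : ℂ) * (B * D ^ 2)) =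
        B * (Complex.exp w - (1 + w + w ^ 2 / 2)) := by
      rw [hw]; push_cast; ring
    rw [e, norm_mul]
    have h4 : ‖B‖ ≤ Real.exp (-(ra d X j / 2 * c)) := by
      refine (S.norm_rowB_le j l).trans (Real.exp_le_exp.2 ?_)
      have : 0 ≤ ra d X j * c := by positivity
      linarith
    have h5 : ‖Complex.exp w - (1 + w + w ^ 2 / 2)‖ ≤ q ^ 77 / (n * √n) := by
      refine (norm_exp_sub_quadratic_le h3).trans ?_
      calc ‖w‖ ^ 3 ≤ (2 * q ^ 25 / √n) ^ 3 := by gcongr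
        _ = 8 * q ^ 75 / (√n ^ 2 * √n) := by rw [div_pow]; ring
        _ ≤ _ := by
          rw [S.sq]; gcongr
          exact (mul_qpow S.hq 1 75 (by norm_num)).trans S.pow_le_pow
    rw [mul_comm]
    exact mul_le_mul h5 h4 (norm_nonneg _) (by positivity)
  · rw [if_neg h, zero_sub, norm_neg]
    push Not at h
    obtain ⟨b1, b2⟩ := S.norm_rowB_incr_le j l
    have b0 := S.norm_rowB_le j l
    rw [← hB, ← hD, ← hc] at b1 b2
    rw [← hB, ← hc] at b0
    set G := Real.exp (-(ra d X j * c) + 1) with hG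
    have b0' : ‖B‖ ≤ G := b0.trans (Real.exp_le_exp.2 (by linarith))
    have hG0 : 0 < G := Real.exp_pos _
    have h1 : ‖B + ((s * r : ℝ) : ℂ) * (B * D) + ((s ^ 2 / 2 * r ^ 2 : ℝ) : ℂ) * (B * D ^ 2)‖ ≤
        G + 2 * q ^ 17 * (2 * G) + (2 * q ^ 17) ^ 2 / 2 * (4 * G) := by
      refine norm_add₃_le.trans (add_le_add (add_le_add b0' ?_) ?_)
      · rw [norm_mul, Complex.norm_real, Real.norm_eq_abs, abs_mul, abs_of_pos hr0]
        have : |s| * r ≤ 2 * q ^ 17 * 1 := by gcongr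
        rw [mul_one] at this
        exact mul_le_mul this b1 (norm_nonneg _) (by positivity)
      · rw [norm_mul, Complex.norm_real, Real.norm_of_nonneg (by positivity)]
        refine mul_le_mul ?_ b2 (norm_nonneg _) (by positivity)
        calc s ^ 2 / 2 * r ^ 2 ≤ (2 * q ^ 17) ^ 2 / 2 * 1 ^ 2 := by rw [← sq_abs s]; gcongr
          _ = _ := by ring
    have h2 : G ≤ 3 * (Real.exp (-q ^ 12) * Real.exp (-(ra d X j / 2 * c))) := by
      have e1 := Real.exp_one_lt_d9
      have : G = Real.exp (-(ra d X j / 2 * c) + -(ra d X j / 2 * c)) * Real.exp 1 := by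
        rw [hG, ← Real.exp_add]; ring_nf
      rw [this, Real.exp_add]
      have h3 : Real.exp (-(ra d X j / 2 * c)) ≤ Real.exp (-q ^ 12) := by
        refine Real.exp_le_exp.2 (neg_le_neg ?_)
        have h4 := S.ra_ge j
        calc q ^ 12 ≤ 1 / 16 * q ^ 13 := by
              have : 16 * q ^ 12 ≤ q ^ 13 := mul_qpow S.hq 1 12 (by norm_num)
              linarith
          _ = n / (8 * q) / 2 * (q ^ 14 / n) := by field_simp; norm_num
          _ ≤ _ := by gcongr
      have h5 := Real.exp_pos (-(ra d X j / 2 * c))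
      calc _ ≤ Real.exp (-q ^ 12) * Real.exp (-(ra d X j / 2 * c)) * 3 := by gcongr; linarith
        _ = _ := by ring
    have h3 := S.exp_tail_le
    have h4 : 1 ≤ q ^ 17 := one_le_pow₀ S.one_le_q
    have h5 : q ^ 17 ≤ q ^ 34 := S.pow_le_pow
    have h6 : 39 * q ^ 34 ≤ q ^ 36 := mul_qpow S.hq 2 34 (by norm_num)
    calc _ ≤ _ := h1
      _ = (1 + 4 * q ^ 17 + 8 * q ^ 34) * G := by ring
      _ ≤ 13 * q ^ 34 * G := by gcongr; linarith
      _ ≤ 13 * q ^ 34 * (3 * (Real.exp (-q ^ 12) * Real.exp (-(ra d X j / 2 * c)))) := by gcongr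
      _ = 39 * q ^ 34 * Real.exp (-q ^ 12) * Real.exp (-(ra d X j / 2 * c)) := by ring
      _ ≤ q ^ 36 * Real.exp (-q ^ 12) * Real.exp (-(ra d X j / 2 * c)) := by gcongr
      _ ≤ q ^ 76 / (n * √n) * Real.exp (-(ra d X j / 2 * c)) := by gcongr
      _ ≤ _ := by
        gcongr ?_ / _ * _; exact S.pow_le_pow

lemma rowE_expand (S : Setup n d X q) [NeZero (2 * n ^ 3)] (j : Fin n) {s : ℝ}
    (hs : |s| ≤ 2 * q ^ 17) : ∃ y : ℂ, ‖y‖ ≤ q ^ 78 / (n * √n) ∧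
      rowE (2 * n ^ 3) d X q s j = (binW (nn X j) (rl d X j) d : ℂ) *
        (1 + (((-(s ^ 2 / 2 * (rK d X j / (rk d X * (nn X j - 1))))) : ℝ) + y)) := by
  have hq := S.q0; have hsn := S.s0; have hn := S.n0; have hP := S.binW_pos j
  obtain ⟨m0, m1, m2⟩ := S.row_moments j
  set P := binW (nn X j) (rl d X j) d with hPd
  set T := (P : ℂ) * (1 + ((-(s ^ 2 / 2 * (rK d X j / (rk d X * (nn X j - 1)))) : ℝ) : ℂ)) with hT
  have hd : ‖rowE (2 * n ^ 3) d X q s j - T‖ ≤ q ^ 78 / (n * √n) * P := by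
    have e : T = avg fun l : ZMod (2 * n ^ 3) => rowB d X j l +
        ((s * (rK d X j / √(rk d X)) : ℝ) : ℂ) * (rowB d X j l * incr (rl d X j) (root l)) +
        ((s ^ 2 / 2 * (rK d X j ^ 2 / rk d X) : ℝ) : ℂ) *
          (rowB d X j l * incr (rl d X j) (root l) ^ 2) := by
      rw [avg_add, avg_add, avg_const_mul, avg_const_mul, m0, m1, m2, hT]
      have h0 := S.rK0 j; have hk := S.rk0
      have e1 : s ^ 2 / 2 * (rK d X j ^ 2 / rk d X) * (-(P / (rK d X j * (nn X j - 1)))) =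
          P * -(s ^ 2 / 2 * (rK d X j / (rk d X * (nn X j - 1)))) := by
        field_simp
      rw [← Complex.ofReal_mul, e1]; push_cast; ring
    rw [e, rowE, ← avg_sub]
    refine (norm_avg_le _).trans ((avg_mono fun l => S.row_pointwise_le j hs l).trans ?_)
    rw [avg_const_mul]
    have := S.row_half_le j
    calc _ ≤ q ^ 77 / (n * √n) * (P * 3) := by gcongr
      _ = 3 * q ^ 77 / (n * √n) * P := by ring
      _ ≤ _ := by gcongr; exact mul_qpow S.hq 1 77 (by norm_num)
  have hP' : (P : ℂ) ≠ 0 := by exact_mod_cast hP.ne'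
  refine ⟨(rowE (2 * n ^ 3) d X q s j - T) / P, ?_, ?_⟩
  · rw [norm_div, Complex.norm_real, Real.norm_of_nonneg hP.le, div_le_iff₀ hP]; exact hd
  · have : (P : ℂ) * ((rowE (2 * n ^ 3) d X q s j - T) / P) = rowE (2 * n ^ 3) d X q s j - T :=
      mul_div_cancel₀ _ hP'
    linear_combination (-1 : ℂ) * this - hT

end Setup

end row
lemma integral_cexp_linear (c : ℂ) :
    ∫ g : ℝ, Complex.exp (-(1 / 2) * g ^ 2 + c * g) =
      (√(2 * Real.pi) : ℂ) * Complex.exp (c ^ 2 / 2) := by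
  have h := integral_cexp_quadratic (b := -(1 / 2)) (by norm_num) c 0
  simp only [add_zero, neg_neg] at h
  rw [h]
  congr 1
  · have e : (Real.pi : ℂ) / (1 / 2) = ((2 * Real.pi : ℝ) : ℂ) := by push_cast; ring
    rw [e, Real.sqrt_eq_rpow, Complex.ofReal_cpow (by positivity)]
    push_cast; rfl
  · congr 1; ring

lemma integrable_cexp_linear (c : ℂ) :
    Integrable fun g : ℝ => Complex.exp (-(1 / 2) * g ^ 2 + c * g) := by
  have h := integrable_cexp_quadratic (b := 1 / 2) (by norm_num) c 0
  simpa only [add_zero] using h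

/-- Linearisation of a Gaussian square: moment control gives control of the mean of `exp (z²/2)`. -/
lemma norm_avg_exp_sq_sub_le {ι : Type*} [Fintype ι] (w z : ι → ℂ) {P ε : ℝ}
    (h : ∀ g : ℝ, ‖avg (fun i => w i * Complex.exp (g * z i)) - (P * Real.exp (-(g ^ 2 / 2)) : ℝ)‖ ≤
      ε * Real.exp (g ^ 2 / 4)) :
    ‖avg (fun i => w i * Complex.exp (z i ^ 2 / 2)) - (P / √2 : ℝ)‖ ≤ ε * √2 := by
  have hpi := Real.pi_pos
  set A := avg fun i => w i * Complex.exp (z i ^ 2 / 2) with hA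
  have hwi : Integrable fun g : ℝ => avg fun i =>
      w i * Complex.exp (-(1 / 2) * g ^ 2 + z i * g) := by
    unfold avg
    exact (integrable_finsetSum _ fun i _ => (integrable_cexp_linear (z i)).const_mul _).div_const _
  have h1 : ∫ g : ℝ, avg (fun i => w i * Complex.exp (-(1 / 2) * g ^ 2 + z i * g)) =
      (√(2 * Real.pi) : ℂ) * A := by
    unfold avg at hA ⊢
    rw [integral_div, integral_finsetSum _ fun i _ => (integrable_cexp_linear (z i)).const_mul _,
      hA,
      ← mul_div_assoc, mul_sum]
    congr 1
    refine sum_congr rfl fun i _ => ?_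
    rw [integral_const_mul, integral_cexp_linear]; ring
  have hP : Integrable fun g : ℝ => ((P * Real.exp (-1 * g ^ 2) : ℝ) : ℂ) :=
    ((integrable_exp_neg_mul_sq one_pos).const_mul P).ofReal
  have h2 : ∫ g : ℝ, ((P * Real.exp (-1 * g ^ 2) : ℝ) : ℂ) = ((P * √Real.pi : ℝ) : ℂ) := by
    refine integral_complex_ofReal.trans ?_
    rw [integral_const_mul, integral_gaussian, div_one]
  have h3 : Integrable fun g : ℝ => ε * Real.exp (-(1 / 4) * g ^ 2) :=
    (integrable_exp_neg_mul_sq (by norm_num)).const_mul ε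
  have h4 := norm_integral_le_of_norm_le h3 (f := fun g : ℝ =>
      avg (fun i => w i * Complex.exp (-(1 / 2) * g ^ 2 + z i * g)) -
        ((P * Real.exp (-1 * g ^ 2) : ℝ) : ℂ)) (ae_of_all _ fun g => by
    have e1 : avg (fun i => w i * Complex.exp (-(1 / 2) * g ^ 2 + z i * g)) =
        ((Real.exp (-(g ^ 2 / 2)) : ℝ) : ℂ) * avg (fun i => w i * Complex.exp (g * z i)) := by
      rw [← avg_const_mul]
      congr 1; ext i
      rw [Complex.ofReal_exp, mul_left_comm, ← Complex.exp_add]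
      congr 2; push_cast; ring
    have e2 : P * Real.exp (-1 * g ^ 2) =
        Real.exp (-(g ^ 2 / 2)) * (P * Real.exp (-(g ^ 2 / 2))) := by
      rw [mul_left_comm, ← Real.exp_add]; congr 2; ring
    rw [e1, e2, Complex.ofReal_mul, ← mul_sub, norm_mul, Complex.norm_real,
      Real.norm_of_nonneg (Real.exp_pos _).le]
    calc _ ≤ Real.exp (-(g ^ 2 / 2)) * (ε * Real.exp (g ^ 2 / 4)) := by gcongr; exact h g
      _ = ε * Real.exp (-(1 / 4) * g ^ 2) := by
        rw [mul_left_comm, ← Real.exp_add]; congr 2; ring)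
  rw [integral_sub hwi hP, h1, h2, integral_const_mul, integral_gaussian] at h4
  have hs : √(2 * Real.pi) = √2 * √Real.pi := Real.sqrt_mul (by norm_num) _
  have hs4 : √(Real.pi / (1 / 4)) = √2 * √2 * √Real.pi := by
    rw [Real.mul_self_sqrt (by norm_num), show Real.pi / (1 / 4) = 2 ^ 2 * Real.pi by ring,
      Real.sqrt_mul (by norm_num), Real.sqrt_sq (by norm_num)]
  have h2p : 0 < √(2 : ℝ) := by positivity
  have hpp : 0 < √Real.pi := by positivity
  have e : (√(2 * Real.pi) : ℂ) * A - ((P * √Real.pi : ℝ) : ℂ) =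
      ((√2 * √Real.pi : ℝ) : ℂ) * (A - ((P / √2 : ℝ) : ℂ)) := by
    have : ((√2 : ℝ) : ℂ) ≠ 0 := by exact_mod_cast h2p.ne'
    rw [hs]; push_cast; field_simp
  rw [e, norm_mul, Complex.norm_real, Real.norm_of_nonneg (by positivity), hs4] at h4
  have : √2 * √Real.pi * ‖A - ((P / √2 : ℝ) : ℂ)‖ ≤ √2 * √Real.pi * (ε * √2) :=
    h4.trans_eq (by ring)
  exact le_of_mul_le_mul_left this (by positivity)

section

variable {n d : ℕ} {X : SimpleGraph (Fin n)} {q : ℝ}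

namespace Setup

lemma nn_sub_one_ge (S : Setup n d X q) (j : Fin n) :
    (n : ℝ) / 2 ≤ nn X j - 1 ∧ (n : ℝ) - (nn X j - 1) ≤ 2 * uu X q j := by
  have h1 := S.nn_ge j
  have h2 : √(n : ℝ) * q ^ 1 ≤ n / q := S.sq_le
  have h3 : (n : ℝ) / q ≤ n / 1000 := by
    have := S.hq; gcongr
  have h4 : (1000 : ℝ) ≤ √n := S.s1000
  have h5 := S.sle
  have h6 := S.cast_nn j
  have h7 := S.hq
  have h8 : (0 : ℝ) ≤ xDeg X j := by positivity
  rw [pow_one] at h2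
  constructor
  · linarith
  · rw [uu]; linarith

lemma row_coeff_le (S : Setup n d X q) (j : Fin n) :
    0 ≤ rK d X j / (rk d X * (nn X j - 1)) ∧ rK d X j / (rk d X * (nn X j - 1)) ≤ 4 / n ∧
      |rK d X j / (rk d X * (nn X j - 1)) - 1 / n| ≤ 17 * q * uu X q j / n ^ 2 := by
  have hn := S.n0; have hk := S.rk0; have hK := S.rK0 j; have hq := S.hq
  have hu := S.uu0 j
  obtain ⟨h1, h2⟩ := S.nn_sub_one_ge j
  set N := (nn X j : ℝ) - 1 with hN
  have hN0 : 0 < N := by linarith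
  have hi : 1 / N ≤ 2 / n := by
    rw [div_le_div_iff₀ hN0 hn]; linarith
  have e : rK d X j / (rk d X * N) = rK d X j / rk d X * (1 / N) := by field_simp
  have hNn : N ≤ n := by have := S.nn_le j; linarith
  refine ⟨by positivity, ?_, ?_⟩
  · rw [e]
    calc _ ≤ 2 * (2 / (n : ℝ)) := by have := S.rK_div_le j; gcongr
      _ = _ := by ring
  · have e2 : rK d X j / rk d X * (1 / N) - 1 / n =
        (rK d X j / rk d X - 1) * (1 / N) + (n - N) / n * (1 / N) := by field_simp; ring
    rw [e, e2]
    refine (abs_add_le _ _).trans ?_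
    rw [abs_mul, abs_of_pos (show 0 < 1 / N by positivity),
      abs_of_nonneg (show 0 ≤ (n - N) / n * (1 / N) by
        have : 0 ≤ n - N := by linarith
        positivity)]
    calc _ ≤ 8 * q * uu X q j / n * (2 / n) + 2 * uu X q j / n * (2 / n) := by
          have := S.abs_rK_div j
          have : 0 ≤ n - N := by linarith
          gcongr
      _ = (16 * q + 4) * uu X q j / n ^ 2 := by ring
      _ ≤ _ := by gcongr; linarith

/-- The product of the row moments at argument `g`. -/
lemma prod_rowE_near (S : Setup n d X q) [NeZero (2 * n ^ 3)] {g : ℝ} (hg : |g| ≤ q ^ 17) :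
    ‖∏ j, rowE (2 * n ^ 3) d X q (g - bb d X j) j - (rP d X * Real.exp (-(g ^ 2 / 2)) : ℝ)‖ ≤
      rP d X * (q ^ 80 / √n) := by
  have hn := S.n0; have hs := S.s0; have hq := S.q0; have hq1 := S.one_le_q
  set r : Fin n → ℝ := fun j => rK d X j / (rk d X * (nn X j - 1)) with hr
  have hb : ∀ j, |g - bb d X j| ≤ 2 * q ^ 17 := fun j => by
    have h1 := S.abs_bb_le j
    have h2 : 2 * q ^ 4 ≤ q ^ 5 := mul_qpow S.hq 1 4 (by norm_num)
    have h3 : q ^ 5 ≤ q ^ 17 := S.pow_le_pow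
    exact (abs_sub _ _).trans (by linarith)
  choose y hy hE using fun j => S.rowE_expand j (hb j)
  set c : Fin n → ℝ := fun j => -((g - bb d X j) ^ 2 / 2 * r j) with hc
  set w : Fin n → ℂ := fun j => (c j : ℂ) + y j with hw
  have hcr : ∀ j, |c j| ≤ 8 * q ^ 34 / n := fun j => by
    obtain ⟨h1, h2, -⟩ := S.row_coeff_le j
    rw [hc]; simp only [abs_neg]
    rw [abs_of_nonneg (by positivity), ← sq_abs]
    calc _ ≤ (2 * q ^ 17) ^ 2 / 2 * (4 / (n : ℝ)) := by gcongr; exact hb j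
      _ = _ := by ring
  have hwj : ∀ j, ‖w j‖ ≤ q ^ 36 / n := fun j => by
    rw [hw]
    refine (norm_add_le _ _).trans ?_
    rw [Complex.norm_real, Real.norm_eq_abs]
    have h1 := S.div_s_le 78
    calc _ ≤ 8 * q ^ 34 / n + q ^ 78 / (n * √n) := add_le_add (hcr j) (hy j)
      _ = (8 * q ^ 34 + q ^ 78 / √n) / n := by field_simp
      _ ≤ _ := by
        gcongr
        have h2 : 9 * q ^ 34 ≤ q ^ 35 := mul_qpow S.hq 1 34 (by norm_num)
        have h3 : q ^ 35 ≤ q ^ 36 := S.pow_le_pow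
        have h4 : 1 ≤ q ^ 34 := one_le_pow₀ hq1
        linarith
  have hw3 : ∀ j ∈ univ, ‖w j‖ ≤ 1 / 3 := fun j _ => (hwj j).trans (by
    have := S.div_n_le 36; have h2 := S.div_s_le 0
    rw [pow_zero] at h2; linarith)
  obtain ⟨z, hz, hp⟩ := exists_prod_eq_exp univ hw3
  have hsz : ‖z‖ ≤ q ^ 36 / √n := by
    refine hz.trans ?_
    calc ∑ j, ‖w j‖ ^ 3 ≤ ∑ j : Fin n, (q ^ 36 / n) * (1 / √n) * 1 := by
          refine sum_le_sum fun j _ => ?_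
          have h1 := hwj j
          have h2 := S.div_n_le 36
          have h3 := hw3 j (mem_univ j)
          calc ‖w j‖ ^ 3 = ‖w j‖ * ‖w j‖ * ‖w j‖ := by ring
            _ ≤ _ := by
              gcongr
              · exact h1.trans h2
              · linarith
      _ = _ := by simp; field_simp
  have hw2 : ‖∑ j, w j ^ 2‖ ≤ q ^ 36 / √n := by
    refine (norm_sum_le _ _).trans ?_
    calc ∑ j, ‖w j ^ 2‖ ≤ ∑ j : Fin n, (q ^ 36 / n) * (1 / √n) := by
          refine sum_le_sum fun j _ => ?_
          have h1 := hwj j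
          have h2 := S.div_n_le 36
          rw [norm_pow, pow_two]
          gcongr
          exact h1.trans h2
      _ = _ := by simp; field_simp
  have hys : ‖∑ j, y j‖ ≤ q ^ 78 / √n := by
    refine (norm_sum_le _ _).trans ?_
    calc ∑ j, ‖y j‖ ≤ ∑ j : Fin n, q ^ 78 / (n * √n) := sum_le_sum fun j _ => hy j
      _ = _ := by simp; field_simp
  have hr1 : |∑ j, r j - 1| ≤ q ^ 3 / n := by
    have e : ∑ j, r j - 1 = ∑ j, (r j - 1 / n) := by
      rw [sum_sub_distrib]; simp; field_simp
    rw [e]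
    calc _ ≤ ∑ j, |r j - 1 / n| := abs_sum_le_sum_abs _ _
      _ ≤ ∑ j, 17 * q * uu X q j / n ^ 2 := sum_le_sum fun j _ => (S.row_coeff_le j).2.2
      _ = 17 * q / n ^ 2 * ∑ j, uu X q j := by rw [mul_sum]; exact sum_congr rfl fun _ _ => by ring
      _ ≤ 17 * q / n ^ 2 * (2 * (n * q)) := by have := S.sum_uu; gcongr
      _ = 34 * q ^ 2 / n := by field_simp; ring
      _ ≤ _ := by gcongr; exact mul_qpow S.hq 1 2 (by norm_num)
  have hcs : |∑ j, c j + g ^ 2 / 2| ≤ q ^ 38 / √n := by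
    have e : ∑ j, c j + g ^ 2 / 2 = -(g ^ 2 / 2) * (∑ j, r j - 1) +
        ∑ j, (g * bb d X j - bb d X j ^ 2 / 2) * r j := by
      rw [mul_sub, mul_sum, mul_one, sub_neg_eq_add, add_right_comm, ← sum_add_distrib]
      congr 1
      exact sum_congr rfl fun j _ => by rw [hc]; ring
    have h1 : |-(g ^ 2 / 2) * (∑ j, r j - 1)| ≤ q ^ 37 / √n := by
      rw [abs_mul, abs_neg, abs_of_nonneg (by positivity), ← sq_abs]
      calc _ ≤ (q ^ 17) ^ 2 / 2 * (q ^ 3 / n) := by gcongr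
        _ = q ^ 37 / n / 2 := by ring
        _ ≤ q ^ 37 / n := half_le_self (by positivity)
        _ ≤ _ := by have := S.sle; gcongr
    have h2 : |∑ j, (g * bb d X j - bb d X j ^ 2 / 2) * r j| ≤ q ^ 37 / √n := by
      calc _ ≤ ∑ j, |(g * bb d X j - bb d X j ^ 2 / 2) * r j| := abs_sum_le_sum_abs _ _
        _ ≤ ∑ j, 2 * q ^ 17 * |bb d X j| * (4 / n) := by
            refine sum_le_sum fun j _ => ?_
            obtain ⟨h1, h2, -⟩ := S.row_coeff_le j
            rw [abs_mul, abs_of_nonneg h1]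
            refine mul_le_mul ?_ h2 h1 (by positivity)
            have e : g * bb d X j - bb d X j ^ 2 / 2 = (g - bb d X j / 2) * bb d X j := by ring
            rw [e, abs_mul]
            gcongr
            refine (abs_sub _ _).trans ?_
            rw [abs_div, abs_two]
            have h1 := S.abs_bb_le j
            have h3 : q ^ 4 ≤ q ^ 17 := S.pow_le_pow
            linarith
        _ = 2 * q ^ 17 * (4 / n) * ∑ j, |bb d X j| := by
            rw [mul_sum]; exact sum_congr rfl fun _ _ => by ring
        _ ≤ 2 * q ^ 17 * (4 / n) * (2 * (√n * q ^ 4)) := by have := S.sum_abs_bb_le; gcongr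
        _ = 16 * q ^ 21 / √n := by
            have := S.sq
            field_simp; linear_combination (16 : ℝ) * this
        _ ≤ _ := by
            gcongr ?_ / _
            exact (mul_qpow S.hq 1 21 (by norm_num)).trans S.pow_le_pow
    rw [e]
    refine (abs_add_le _ _).trans ?_
    calc _ ≤ q ^ 37 / √n + q ^ 37 / √n := add_le_add h1 h2
      _ = 2 * q ^ 37 / √n := by ring
      _ ≤ _ := by gcongr; exact mul_qpow S.hq 1 37 (by norm_num)
  set δ : ℂ := ((∑ j, c j + g ^ 2 / 2 : ℝ) : ℂ) + ∑ j, y j - (∑ j, w j ^ 2) / 2 + z with hδ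
  have hδn : ‖δ‖ ≤ q ^ 79 / √n := by
    have h1 : ‖δ‖ ≤ q ^ 38 / √n + q ^ 78 / √n + q ^ 36 / √n / 2 + q ^ 36 / √n := by
      refine (norm_add_le _ _).trans (add_le_add ((norm_sub_le _ _).trans
        (add_le_add ((norm_add_le _ _).trans (add_le_add ?_ hys)) ?_)) hsz)
      · rw [Complex.norm_real]; exact hcs
      · rw [norm_div, Complex.norm_ofNat]; gcongr
    have h2 : q ^ 38 / √n ≤ q ^ 78 / √n := by gcongr ?_ / _; exact S.pow_le_pow
    have h3 : q ^ 36 / √n ≤ q ^ 78 / √n := by gcongr ?_ / _; exact S.pow_le_pow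
    have h4 : 4 * q ^ 78 / √n ≤ q ^ 79 / √n := by
      gcongr ?_ / _; exact mul_qpow S.hq 1 78 (by norm_num)
    have h5 : 0 ≤ q ^ 36 / √n := by positivity
    have h6 : 4 * q ^ 78 / √n = 4 * (q ^ 78 / √n) := by ring
    linarith
  have hprod : ∏ j, rowE (2 * n ^ 3) d X q (g - bb d X j) j =
      ((rP d X * Real.exp (-(g ^ 2 / 2)) : ℝ) : ℂ) * Complex.exp δ := by
    rw [prod_congr rfl fun j _ => hE j, prod_mul_distrib]
    change _ * ∏ j, (1 + w j) = _
    rw [hp, Complex.ofReal_mul, Complex.ofReal_exp, mul_assoc, ← Complex.exp_add, rP]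
    push_cast
    congr 2
    rw [hδ, hw, sum_add_distrib]
    push_cast; ring
  rw [hprod, ← mul_sub_one, norm_mul, Complex.norm_real,
    Real.norm_of_nonneg (mul_pos S.rP0 (Real.exp_pos _)).le, mul_assoc]
  refine mul_le_mul_of_nonneg_left ?_ S.rP0.le
  have h1 : ‖δ‖ ≤ 1 := hδn.trans (by have := S.div_s_le 79; linarith)
  have h2 : ‖Complex.exp δ - 1‖ ≤ 2 * ‖δ‖ := Complex.norm_exp_sub_one_le h1
  have h3 : Real.exp (-(g ^ 2 / 2)) ≤ 1 := Real.exp_le_one_iff.2 (by nlinarith [sq_nonneg g])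
  calc _ ≤ 1 * (2 * (q ^ 79 / √n)) := by
        refine mul_le_mul h3 (h2.trans ?_) (norm_nonneg _) zero_le_one
        gcongr
    _ = 2 * q ^ 79 / √n := by ring
    _ ≤ _ := by gcongr; exact mul_qpow S.hq 1 79 (by norm_num)

/-- The box part of the integrand for fixed `g`, before the linear terms in `g`. -/
lemma prod_rowE_eq {M : ℕ} [NeZero M] (g : ℝ) :
    ∏ j, rowE M d X q (g - bb d X j) j =
      avg fun t : Fin n → ZMod M => (if ∀ j, gap (root (t j)) ≤ q ^ 14 / n then
        base d X t * Complex.exp (-∑ j, (bb d X j : ℂ) * ps0 d X t j) else 0) *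
          Complex.exp (g * ∑ j, ps0 d X t j) := by
  unfold rowE
  rw [← avg_prod]
  congr 1; ext t
  rw [prod_ite_zero]
  simp only [mem_univ, forall_const]
  split_ifs with h
  · rw [prod_mul_distrib, ← Complex.exp_sum, mul_assoc, ← Complex.exp_add]
    congr 2
    rw [mul_sum, ← sum_neg_distrib, ← sum_add_distrib]
    refine sum_congr rfl fun j _ => ?_
    rw [ps0]; push_cast; ring
  · rw [zero_mul]

lemma norm_prod_rowE_le (S : Setup n d X q) [NeZero (2 * n ^ 3)] (g : ℝ) :
    ‖∏ j, rowE (2 * n ^ 3) d X q (g - bb d X j) j‖ ≤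
      rP d X * Real.exp (q + 2 + 2 * q ^ 14 * |g|) := by
  have hq := S.q0
  rw [prod_rowE_eq]
  refine (norm_avg_le _).trans ?_
  calc _ ≤ avg fun t : Fin n → ZMod (2 * n ^ 3) =>
        Real.exp (1 + 2 * q ^ 14 * |g|) * nu d X q t := avg_mono fun t => by
          split_ifs with h
          · rw [mul_assoc, ← Complex.exp_add, norm_mul, mul_comm]
            refine mul_le_mul ?_ (S.norm_base_le h) (norm_nonneg _) (Real.exp_pos _).le
            rw [Complex.norm_exp]
            refine Real.exp_le_exp.2 ?_
            simp only [Complex.add_re, Complex.neg_re, Complex.re_sum, Complex.re_ofReal_mul]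
            have h1 := S.sum_bb_re_le h
            have h2 := S.sum_re_box_le h
            refine add_le_add ?_ ?_
            · refine le_trans ?_ h1
              rw [← sum_neg_distrib]
              exact sum_le_sum fun j _ => by rw [← abs_mul]; exact neg_le_abs _
            · calc g * ∑ j, (ps0 d X t j).re ≤ |g| * |∑ j, (ps0 d X t j).re| := by
                    rw [← abs_mul]; exact le_abs_self _
                _ ≤ |g| * (2 * q ^ 14) := by
                    gcongr; exact (abs_sum_le_sum_abs _ _).trans h2
                _ = _ := by ring
          · rw [zero_mul, norm_zero]
            exact mul_nonneg (Real.exp_pos _).le (nu_nonneg t)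
    _ ≤ Real.exp (1 + 2 * q ^ 14 * |g|) * (rP d X * Real.exp (5 / 24 * (1 / rk d X) + 1)) := by
        rw [avg_const_mul]; have := S.avg_nu_le; gcongr
    _ = rP d X * Real.exp (5 / 24 * (1 / rk d X) + 2 + 2 * q ^ 14 * |g|) := by
        rw [mul_left_comm, ← Real.exp_add]; congr 2; ring
    _ ≤ _ := by
        have := S.inv_rk_le
        refine mul_le_mul_of_nonneg_left (Real.exp_le_exp.2 ?_) S.rP0.le
        linarith

lemma exp_neg_le_inv_sqrt (S : Setup n d X q) : Real.exp (-q) ≤ 1 / √n := by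
  have hn := S.n0; have hs := S.s0
  rw [Real.exp_neg, one_div]
  exact inv_anti₀ hs (S.sle.trans S.n_le_exp)

lemma norm_prod_rowE_sub_le (S : Setup n d X q) [NeZero (2 * n ^ 3)] (g : ℝ) :
    ‖∏ j, rowE (2 * n ^ 3) d X q (g - bb d X j) j - (rP d X * Real.exp (-(g ^ 2 / 2)) : ℝ)‖ ≤
      rP d X * (q ^ 80 / √n) * Real.exp (g ^ 2 / 4) := by
  have hq := S.q0; have hs := S.s0; have hP := S.rP0
  have hg4 : 1 ≤ Real.exp (g ^ 2 / 4) := Real.one_le_exp (by positivity)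
  by_cases hg : |g| ≤ q ^ 17
  · exact (S.prod_rowE_near hg).trans (le_mul_of_one_le_right (by positivity) hg4)
  · push Not at hg
    have hg2 : q ^ 17 * |g| ≤ g ^ 2 := by rw [← sq_abs, pow_two]; gcongr
    have h34 : q ^ 34 ≤ g ^ 2 := by
      calc q ^ 34 = q ^ 17 * q ^ 17 := by ring
        _ ≤ q ^ 17 * |g| := by gcongr
        _ ≤ _ := hg2
    have h2 : 100 * q ^ 1 ≤ q ^ 2 := mul_qpow S.hq 1 1 (by norm_num)
    have h3 : q ^ 2 ≤ q ^ 34 := S.pow_le_pow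
    have h4 : 100 * q ^ 14 ≤ q ^ 15 := mul_qpow S.hq 1 14 (by norm_num)
    have h5 : q ^ 15 ≤ q ^ 17 := S.pow_le_pow
    have h6 : 100 * q ^ 14 * |g| ≤ q ^ 17 * |g| := by gcongr; exact h4.trans h5
    have hq1 := S.hq
    rw [pow_one] at h2
    refine (norm_sub_le _ _).trans ?_
    rw [Complex.norm_real, Real.norm_of_nonneg (by positivity)]
    have e1 : Real.exp (q + 2 + 2 * q ^ 14 * |g|) ≤ Real.exp (-q) * Real.exp (g ^ 2 / 4) := by
      rw [← Real.exp_add]; refine Real.exp_le_exp.2 ?_; linarith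
    have e2 : Real.exp (-(g ^ 2 / 2)) ≤ Real.exp (-q) * Real.exp (g ^ 2 / 4) := by
      rw [← Real.exp_add]; refine Real.exp_le_exp.2 ?_; linarith
    have e3 := S.exp_neg_le_inv_sqrt
    have e4 : 2 * (1 / √n) ≤ q ^ 80 / √n := by
      rw [← mul_div_assoc, mul_one]; gcongr
      calc (2 : ℝ) ≤ q := by linarith
        _ ≤ q ^ 80 := le_self_pow₀ S.one_le_q (by norm_num)
    calc _ ≤ rP d X * (Real.exp (-q) * Real.exp (g ^ 2 / 4)) +
          rP d X * (Real.exp (-q) * Real.exp (g ^ 2 / 4)) :=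
          add_le_add ((S.norm_prod_rowE_le g).trans (by gcongr)) (by gcongr)
      _ = rP d X * (2 * Real.exp (-q)) * Real.exp (g ^ 2 / 4) := by ring
      _ ≤ _ := by gcongr; linarith

/-- The mean of `Phi` over the box. -/
lemma norm_avg_Phi_box_sub_le (S : Setup n d X q) [NeZero (2 * n ^ 3)] :
    ‖avg (fun t : Fin n → ZMod (2 * n ^ 3) =>
        if ∀ j, gap (root (t j)) ≤ q ^ 14 / n then Phi d X t else 0) - (rP d X / √2 : ℝ)‖ ≤
      rP d X * (q ^ 80 / √n) * √2 := by
  have h := norm_avg_exp_sq_sub_le (ι := Fin n → ZMod (2 * n ^ 3))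
    (fun t => if ∀ j, gap (root (t j)) ≤ q ^ 14 / n then
        base d X t * Complex.exp (-∑ j, (bb d X j : ℂ) * ps0 d X t j) else 0)
    (fun t => ∑ j, ps0 d X t j) (P := rP d X) (ε := rP d X * (q ^ 80 / √n)) fun g => by
      rw [← prod_rowE_eq]; exact S.norm_prod_rowE_sub_le g
  convert h using 5 with t
  split_ifs with hb
  · rw [Phi, mul_assoc, ← Complex.exp_add]; congr 2; ring
  · rw [zero_mul]

end Setup

end
lemma norm_exp_sub_one_le_mul_exp (w : ℂ) : ‖Complex.exp w - 1‖ ≤ ‖w‖ * Real.exp ‖w‖ := by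
  simpa using Complex.norm_exp_sub_sum_le_norm_mul_exp w 1

section

variable {n d : ℕ} {X : SimpleGraph (Fin n)} {q : ℝ}

namespace Setup

lemma abs_mu_le (S : Setup n d X q) : |mu d X| ≤ q ^ 7 := by
  have hq := S.q0; have hn := S.n0; have hs := S.s0
  calc |mu d X| ≤ ∑ p ∈ prs X, |rm d X p.1 * rm d X p.2| := abs_sum_le_sum_abs _ _
    _ ≤ ∑ p ∈ prs X, q ^ 3 / √n * (q ^ 3 / √n) := sum_le_sum fun p _ => by
        rw [abs_mul]; have := S.abs_rm_le' p.1; have := S.abs_rm_le' p.2; gcongr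
    _ = (prs X).card * (q ^ 6 / √n ^ 2) := by rw [sum_const, nsmul_eq_mul]; ring
    _ ≤ n * q / 2 * (q ^ 6 / √n ^ 2) := by have := S.prs_card_le; gcongr
    _ = q ^ 7 / 2 := by rw [S.sq]; field_simp
    _ ≤ _ := half_le_self (by positivity)

lemma norm_avg_core_diff_le (S : Setup n d X q) [NeZero (2 * n ^ 3)] :
    ‖avg (fun t : Fin n → ZMod (2 * n ^ 3) => if core d X q t then
        Fg d X t - Real.exp (1 / 4 - mu d X) * Phi d X t else 0)‖ ≤
      rP d X * Real.exp (-mu d X) * (q ^ 70 / √n) * Real.exp (1 / 3 * (1 / rk d X)) := by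
  have hq := S.q0; have hs := S.s0; have hP := S.rP0
  set E := Real.exp (1 / 4 - mu d X) with hE
  set G := Real.exp (1 / 8 * (1 / rk d X) + 2) with hG
  refine (norm_avg_le _).trans ?_
  have hδ : q ^ 67 / √n ≤ 1 := by have := S.div_s_le 67; linarith
  calc _ ≤ avg fun t : Fin n → ZMod (2 * n ^ 3) => E * G *
        (nu d X q t * ((|YY d X t| + q ^ 67 / √n) * Real.exp (|YY d X t| + 1))) :=
        avg_mono fun t => by
          have h0 := nu_nonneg (d := d) (X := X) (q := q) t
          split_ifs with h
          · obtain ⟨z, hz, he⟩ := S.Fg_core_eq h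
            have hw : ‖(YY d X t : ℂ) + z‖ ≤ |YY d X t| + q ^ 67 / √n := by
              refine (norm_add_le _ _).trans ?_
              rw [Complex.norm_real, Real.norm_eq_abs]; gcongr
            have e : Fg d X t - (E : ℂ) * Phi d X t =
                (E : ℂ) * (Phi d X t * (Complex.exp ((YY d X t : ℂ) + z) - 1)) := by
              rw [he, add_assoc, Complex.exp_add, ← Complex.ofReal_exp]; ring
            rw [e, norm_mul, norm_mul, Complex.norm_real, Real.norm_of_nonneg (Real.exp_pos _).le]
            have h1 := S.norm_Phi_core_le h
            have h2 : ‖Complex.exp ((YY d X t : ℂ) + z) - 1‖ ≤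
                (|YY d X t| + q ^ 67 / √n) * Real.exp (|YY d X t| + 1) := by
              refine (norm_exp_sub_one_le_mul_exp _).trans ?_
              refine mul_le_mul hw (Real.exp_le_exp.2 (by linarith)) (Real.exp_pos _).le
                (by positivity)
            calc _ ≤ E * (nu d X q t * G *
                  ((|YY d X t| + q ^ 67 / √n) * Real.exp (|YY d X t| + 1))) := by gcongr
              _ = _ := by ring
          · rw [norm_zero]; positivity
    _ ≤ E * G * (q ^ 69 / √n * (rP d X * Real.exp (5 / 24 * (1 / rk d X) + 1))) := by
        rw [avg_const_mul]
        have h1 := S.avg_nu_chaos_le (M := 2 * n ^ 3) (δ := q ^ 67 / √n) (by positivity) le_rfl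
        have h2 := S.avg_nu_le
        refine mul_le_mul_of_nonneg_left (h1.trans ?_) (by positivity)
        gcongr
    _ = rP d X * (q ^ 69 / √n) * (Real.exp (13 / 4) * Real.exp (-mu d X) *
          Real.exp (1 / 3 * (1 / rk d X))) := by
        have : E * G * Real.exp (5 / 24 * (1 / rk d X) + 1) = Real.exp (13 / 4) *
            Real.exp (-mu d X) * Real.exp (1 / 3 * (1 / rk d X)) := by
          rw [hE, hG]; simp only [← Real.exp_add]; congr 1; ring
        rw [← this]; ring
    _ ≤ rP d X * (q ^ 69 / √n) * (q * Real.exp (-mu d X) * Real.exp (1 / 3 * (1 / rk d X))) := by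
        have h1 : Real.exp (13 / 4) ≤ q := by
          refine le_trans ?_ S.hq
          have h2 := Real.exp_one_lt_d9
          calc Real.exp (13 / 4) ≤ Real.exp ((4 : ℕ) * 1) := Real.exp_le_exp.2 (by norm_num)
            _ = Real.exp 1 ^ 4 := Real.exp_nat_mul _ _
            _ ≤ 3 ^ 4 := by gcongr; linarith
            _ ≤ 1000 := by norm_num
        gcongr
    _ = _ := by ring

lemma norm_avg_Phi_atypical_le (S : Setup n d X q) [NeZero (2 * n ^ 3)] :
    ‖avg (fun t : Fin n → ZMod (2 * n ^ 3) => if core d X q t then 0 else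
        if ∀ j, gap (root (t j)) ≤ q ^ 14 / n then Phi d X t else 0)‖ ≤ rP d X * (1 / √n) := by
  have hq := S.q0; have hs := S.s0; have hP := S.rP0
  refine (norm_avg_le _).trans ?_
  have hA := S.avg_atypical_le (y := fun _ => 0) (L := 0) (η := q ^ 32 / √n)
    (fun j => by have := S.ra0 j; rw [abs_zero]; positivity) (by simp)
  simp only [sub_zero, add_zero] at hA
  calc _ ≤ avg fun t : Fin n → ZMod (2 * n ^ 3) => Real.exp (q ^ 29) *
        (if q ^ 32 / √n < |2 * rk d X * tg t - 1| then
          Real.exp (-∑ j, ra d X j * gap (root (t j))) else 0) := avg_mono fun t => by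
          have hr : 0 ≤ Real.exp (q ^ 29) * (if q ^ 32 / √n < |2 * rk d X * tg t - 1| then
              Real.exp (-∑ j, ra d X j * gap (root (t j))) else 0) := by
            split_ifs <;> positivity
          by_cases h1 : core d X q t
          · rw [if_pos h1, norm_zero]; exact hr
          rw [if_neg h1]
          by_cases h2 : ∀ j, gap (root (t j)) ≤ q ^ 14 / n
          · have h3 : q ^ 32 / √n < |2 * rk d X * tg t - 1| := by
              by_contra h3; exact h1 ⟨h2, not_lt.1 h3⟩
            have h4 := S.norm_Phi_box_le h2
            rw [nu, if_pos h2] at h4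
            rw [if_pos h2, if_pos h3]; exact h4.trans_eq (mul_comm _ _)
          · rw [if_neg h2, norm_zero]; exact hr
    _ ≤ Real.exp (q ^ 29) * (rP d X * (2 * Real.exp (q + q ^ 3 + 2 - √n * (q ^ 32 / √n)))) := by
        rw [avg_const_mul]; gcongr
    _ = rP d X * (2 * Real.exp (q ^ 29 + (q + q ^ 3 + 2 - q ^ 32))) := by
        rw [mul_div_cancel₀ _ hs.ne', Real.exp_add]; ring
    _ ≤ rP d X * (Real.exp 1 * Real.exp (-q - 1)) := by
        have h2 := Real.exp_one_gt_d9
        have h3 : 100 * q ^ 29 ≤ q ^ 30 := mul_qpow S.hq 1 29 (by norm_num)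
        have h4 : q ^ 30 ≤ q ^ 32 := S.pow_le_pow
        have h5 : q ^ 3 ≤ q ^ 29 := S.pow_le_pow
        have h6 : q ≤ q ^ 29 := le_self_pow₀ S.one_le_q (by norm_num)
        have h7 := S.hq
        gcongr
        · linarith
        · linarith
    _ ≤ _ := by
        rw [← Real.exp_add]
        refine mul_le_mul_of_nonneg_left (le_trans (le_of_eq ?_) S.exp_neg_le_inv_sqrt) hP.le
        congr 1; ring

/-- The mean of the generating function, up to a relative error. -/
theorem norm_avg_Fg_sub_le (S : Setup n d X q) [NeZero (2 * n ^ 3)] :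
    ‖avg (fun t : Fin n → ZMod (2 * n ^ 3) => Fg d X t) -
        (√2 * Real.exp (1 / 4 - mu d X) * rP d X : ℝ)‖ ≤
      rP d X * Real.exp (-mu d X) * (q ^ 81 / √n) * Real.exp (1 / 3 * (1 / rk d X)) := by
  have hq := S.q0; have hs := S.s0; have hP := S.rP0
  set E := Real.exp (1 / 4 - mu d X) with hE
  set m := Real.exp (-mu d X) with hm
  set R := Real.exp (1 / 3 * (1 / rk d X)) with hR
  have hR1 : 1 ≤ R := Real.one_le_exp (by have := S.rk0; positivity)
  have hm0 : 0 < m := Real.exp_pos _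
  have hEm : E ≤ 2 * m := by
    rw [hE, sub_eq_add_neg, Real.exp_add]
    refine mul_le_mul_of_nonneg_right ?_ hm0.le
    have h1 := Real.exp_one_lt_d9
    have h2 : Real.exp (1 / 4) ^ 4 = Real.exp 1 := by rw [← Real.exp_nat_mul]; norm_num
    by_contra! h3
    have : (2 : ℝ) ^ 4 < Real.exp (1 / 4) ^ 4 := by gcongr
    linarith
  have hE0 : 0 < E := Real.exp_pos _
  set A := avg fun t : Fin n → ZMod (2 * n ^ 3) => Fg d X t
  set C := avg fun t : Fin n → ZMod (2 * n ^ 3) => if core d X q t then Fg d X t else 0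
  set B := avg fun t : Fin n → ZMod (2 * n ^ 3) =>
    if ∀ j, gap (root (t j)) ≤ q ^ 14 / n then Phi d X t else 0
  set D := avg fun t : Fin n → ZMod (2 * n ^ 3) => if core d X q t then
        Fg d X t - E * Phi d X t else 0
  set F := avg fun t : Fin n → ZMod (2 * n ^ 3) => if core d X q t then 0 else
        if ∀ j, gap (root (t j)) ≤ q ^ 14 / n then Phi d X t else 0
  have hdec : C = D + E * B - E * F := by
    rw [← avg_const_mul, ← avg_const_mul, ← avg_add, ← avg_sub]
    refine congrArg avg (funext fun t => ?_)
    by_cases h : core d X q t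
    · simp only [if_pos h, if_pos h.1]; ring
    · simp only [if_neg h]; ring
  have h1 : ‖A - 2 * C‖ ≤ rP d X * Real.exp (-q ^ 10) := S.norm_avg_Fg_sub_core_le
  have h2 : ‖D‖ ≤ rP d X * m * (q ^ 70 / √n) * R := S.norm_avg_core_diff_le
  have h3 : ‖B - (rP d X / √2 : ℝ)‖ ≤ rP d X * (q ^ 80 / √n) * √2 := S.norm_avg_Phi_box_sub_le
  have h4 : ‖F‖ ≤ rP d X * (1 / √n) := S.norm_avg_Phi_atypical_le
  have h2s : √(2 : ℝ) ≤ 2 := by rw [Real.sqrt_le_left (by norm_num)]; norm_num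
  have e : A - ((√2 * E * rP d X : ℝ) : ℂ) = (A - 2 * C) + 2 * D + 2 * (E : ℂ) *
      (B - (rP d X / √2 : ℝ)) - 2 * (E : ℂ) * F := by
    have h5 : (√2 : ℝ) * E * rP d X = 2 * E * (rP d X / √2) := by
      have := Real.mul_self_sqrt (show (0 : ℝ) ≤ 2 by norm_num)
      field_simp; nlinarith
    rw [h5, hdec]; push_cast; ring
  have n2 : ∀ w : ℂ, ‖2 * (E : ℂ) * w‖ = 2 * E * ‖w‖ := fun w => by
    rw [norm_mul, norm_mul, Complex.norm_ofNat, Complex.norm_real, Real.norm_of_nonneg hE0.le]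
  have t1 : Real.exp (-q ^ 10) ≤ m * (1 / √n) := by
    refine le_trans ?_ (mul_le_mul_of_nonneg_left S.exp_neg_le_inv_sqrt hm0.le)
    rw [hm, ← Real.exp_add]
    refine Real.exp_le_exp.2 ?_
    have := (abs_le.1 S.abs_mu_le).2
    have h5 : 100 * q ^ 7 ≤ q ^ 8 := mul_qpow S.hq 1 7 (by norm_num)
    have h6 : q ^ 8 ≤ q ^ 10 := S.pow_le_pow
    have h7 : q ≤ q ^ 7 := le_self_pow₀ S.one_le_q (by norm_num)
    linarith
  have o : 1 / √n ≤ q ^ 80 / √n := by gcongr; exact one_le_pow₀ S.one_le_q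
  have o2 : q ^ 70 / √n ≤ q ^ 80 / √n := by gcongr ?_ / _; exact S.pow_le_pow
  rw [e]
  calc _ ≤ rP d X * Real.exp (-q ^ 10) + 2 * (rP d X * m * (q ^ 70 / √n) * R) +
        2 * E * (rP d X * (q ^ 80 / √n) * √2) + 2 * E * (rP d X * (1 / √n)) := by
        refine (norm_sub_le _ _).trans (add_le_add ((norm_add_le _ _).trans (add_le_add
          ((norm_add_le _ _).trans (add_le_add h1 ?_)) ?_)) ?_)
        · rw [norm_mul, Complex.norm_ofNat]; gcongr
        · rw [n2]; gcongr
        · rw [n2]; gcongr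
    _ ≤ rP d X * (m * (q ^ 80 / √n)) + 2 * (rP d X * m * (q ^ 80 / √n) * R) +
        2 * (2 * m) * (rP d X * (q ^ 80 / √n) * 2) + 2 * (2 * m) * (rP d X * (q ^ 80 / √n)) := by
        have : m * (1 / √n) ≤ m * (q ^ 80 / √n) := by gcongr
        have := t1.trans this
        gcongr
    _ = rP d X * m * (q ^ 80 / √n) * (13 + 2 * R) := by ring
    _ ≤ rP d X * m * (q ^ 80 / √n) * (15 * R) := by gcongr; linarith
    _ = rP d X * m * (15 * q ^ 80 / √n) * R := by ring
    _ ≤ _ := by gcongr; exact mul_qpow S.hq 1 80 (by norm_num)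

end Setup

end
/-- Density of a `d`-regular graph on `n` vertices. -/
def ll (n d : ℕ) : ℝ := d / ((n : ℝ) - 1)

lemma lamb_const {n d : ℕ} (hn : 0 < n) : lamb (fun _ : Fin n => d) = ll n d := by
  have : (n : ℝ) ≠ 0 := by positivity
  rw [lamb, dBar, ll, sum_const, card_univ, Fintype.card_fin, nsmul_eq_mul,
    mul_div_cancel_left₀ _ this]

lemma abs_one_add_mul_log_sub_le {x : ℝ} (hx : |x| ≤ 1 / 2) :
    |(1 + x) * Real.log (1 + x) - (x + x ^ 2 / 2)| ≤ 4 * |x| ^ 3 := by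
  have h := Real.abs_log_sub_add_sum_range_le (x := -x) (by rw [abs_neg]; linarith) 2
  simp only [sum_range_succ, range_zero, sum_empty, abs_neg, sub_neg_eq_add] at h
  norm_num at h
  have h0 := abs_nonneg x
  have h2 : |x| ^ 3 / (1 - |x|) ≤ 2 * |x| ^ 3 := by
    rw [div_le_iff₀ (by linarith)]
    have : 0 ≤ |x| ^ 3 := by positivity
    nlinarith
  have h3 := h.trans h2
  have e : (1 + x) * Real.log (1 + x) - (x + x ^ 2 / 2) =
      (1 + x) * (-x + x ^ 2 / 2 + Real.log (1 + x)) - x ^ 3 / 2 := by ring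
  rw [e]
  have h4 : |1 + x| ≤ 3 / 2 := (abs_add_le _ _).trans (by rw [abs_one]; linarith)
  calc _ ≤ |(1 + x) * (-x + x ^ 2 / 2 + Real.log (1 + x))| + |x ^ 3 / 2| := abs_sub _ _
    _ ≤ 3 / 2 * (2 * |x| ^ 3) + |x| ^ 3 / 2 := by
        rw [abs_mul, abs_div, abs_pow, abs_two]; gcongr
    _ ≤ _ := by have : 0 ≤ |x| ^ 3 := by positivity
                linarith

section

variable {n d : ℕ} {X : SimpleGraph (Fin n)} {q : ℝ}

lemma two_mul_xEdges (X : SimpleGraph (Fin n)) :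
    2 * (xEdges X : ℝ) = ∑ j, (xDeg X j : ℝ) := by
  rw [xEdges_eq]; exact_mod_cast card_prs X

lemma pairSum_eq (X : SimpleGraph (Fin n)) (f : Fin n → ℝ) :
    pairSum X f = ∑ p ∈ prs X, f p.1 * f p.2 := by
  rw [pairSum, ← sum_prs_mul]; ring

namespace Setup

lemma n1_pos (S : Setup n d X q) : (0 : ℝ) < n - 1 := by
  have := S.hi; have h1 := div_pos S.n0 S.q0
  have : (0 : ℝ) ≤ d := by positivity
  linarith

lemma ll_ge (S : Setup n d X q) : 1 / q ≤ ll n d := by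
  have h := S.lo; have hq := S.q0; have h1 := S.n1_pos
  rw [ll, div_le_div_iff₀ hq h1]
  rw [div_le_iff₀ hq] at h; linarith

lemma one_sub_ll_ge (S : Setup n d X q) : 1 / q ≤ 1 - ll n d := by
  have h := S.hi; have hq := S.q0; have h1 := S.n1_pos
  have e : 1 - ll n d = (n - 1 - d) / (n - 1) := by rw [ll]; field_simp
  rw [e, div_le_div_iff₀ hq h1]
  have : (n : ℝ) / q ≤ n - 1 - d := by linarith
  rw [div_le_iff₀ hq] at this; linarith

lemma ll0 (S : Setup n d X q) : 0 < ll n d :=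
  lt_of_lt_of_le (by have := S.q0; positivity) S.ll_ge

lemma ll1 (S : Setup n d X q) : 0 < 1 - ll n d :=
  lt_of_lt_of_le (by have := S.q0; positivity) S.one_sub_ll_ge

lemma ll_div_le (S : Setup n d X q) : ll n d / (1 - ll n d) ≤ q := by
  have h := S.one_sub_ll_ge; have hq := S.q0; have h0 := S.ll0; have h1 := S.ll1
  rw [div_le_iff₀ hq] at h
  rw [div_le_iff₀ h1]; linarith

lemma inv_ll_le (S : Setup n d X q) : 1 / (ll n d * (1 - ll n d)) ≤ 2 * q := by
  have h := S.one_sub_ll_ge; have h' := S.ll_ge; have hq := S.q0; have h0 := S.ll0; have h1 := S.ll1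
  have e : 1 / (ll n d * (1 - ll n d)) = 1 / ll n d + 1 / (1 - ll n d) := by field_simp; ring
  rw [e]
  have t1 : 1 / ll n d ≤ q := by rwa [div_le_comm₀ h0 hq]
  have t2 : 1 / (1 - ll n d) ≤ q := by rwa [div_le_comm₀ h1 hq]
  linarith

/-- Relative excess of the density among available places. -/
lemma rp_eq (S : Setup n d X q) :
    rp d X = ll n d * (1 + (∑ j, (xDeg X j : ℝ)) / (n * nbar X)) ∧
      (∑ j, (xDeg X j : ℝ)) / (n * nbar X) ≤ 2 * q / n := by
  have hn := S.n0; have hb := S.nbar0; have h1 := S.n1_pos; have hb2 := S.half_nbar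
  have hX := S.hX; have hq := S.q0
  constructor
  · have e : 1 + (∑ j, (xDeg X j : ℝ)) / (n * nbar X) = (n - 1) / nbar X := by
      have : (n : ℝ) - 1 = nbar X + (∑ j, (xDeg X j : ℝ)) / n := by rw [S.nbar_eq]; ring
      rw [this]; field_simp
    rw [e, rp, ll]; field_simp
  · calc _ ≤ n * q / (n * (n / 2)) := by gcongr
      _ = _ := by field_simp

/-- Entropy correction for the density. -/
lemma abs_entropy_sub_le (S : Setup n d X q) :
    |n * nbar X / 2 * (rp d X * Real.log (rp d X / ll n d) +
        (1 - rp d X) * Real.log ((1 - rp d X) / (1 - ll n d))) -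
      ll n d * (xEdges X : ℝ) ^ 2 / ((1 - ll n d) * n ^ 2)| ≤ q ^ 7 / n := by
  have hn := S.n0; have hb := S.nbar0; have hb2 := S.half_nbar; have hq := S.q0
  have h0 := S.ll0; have h1 := S.ll1; have hX := S.hX; have hsx := S.sx_nonneg
  have hbn := S.nbar_le; have hbg := S.nbar_ge
  obtain ⟨e1, hu⟩ := S.rp_eq
  have hE := two_mul_xEdges X
  set x := ∑ j, (xDeg X j : ℝ) with hx
  set u := x / (n * nbar X) with hud
  set L := ll n d with hL
  set v := L / (1 - L) * u with hv
  have hu0 : 0 ≤ u := by positivity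
  have hv0 : 0 ≤ v := by positivity
  have hvle : v ≤ 2 * q ^ 2 / n := by
    calc v ≤ q * (2 * q / n) := by have := S.ll_div_le; rw [hv]; gcongr
      _ = _ := by ring
  have hu' : u ≤ 2 * q ^ 2 / n := by
    refine hu.trans ?_
    have h : q ≤ q ^ 2 := le_self_pow₀ S.one_le_q (by norm_num)
    gcongr
  have hsm : 2 * q ^ 2 / n ≤ 1 / 2 := by
    have h2 := S.div_n_le 2; have h3 := S.div_s_le 0
    rw [pow_zero] at h3
    rw [mul_div_assoc]; linarith
  have e2 : 1 - rp d X = (1 - L) * (1 + -v) := by rw [e1, hv]; field_simp; ring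
  have e3 : rp d X / L = 1 + u := by rw [e1]; field_simp
  have e4 : (1 - rp d X) / (1 - L) = 1 + -v := by rw [e2]; field_simp
  rw [e3, e4, e2, e1]
  have p1 := abs_one_add_mul_log_sub_le (x := u) (by rw [abs_of_nonneg hu0]; linarith)
  have p2 := abs_one_add_mul_log_sub_le (x := -v) (by rw [abs_neg, abs_of_nonneg hv0]; linarith)
  rw [abs_of_nonneg hu0] at p1
  rw [abs_neg, abs_of_nonneg hv0] at p2
  set A := (1 + u) * Real.log (1 + u) - (u + u ^ 2 / 2)
  set B := (1 + -v) * Real.log (1 + -v) - (-v + (-v) ^ 2 / 2)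
  have e : n * nbar X / 2 * (L * (1 + u) * Real.log (1 + u) +
      (1 - L) * (1 + -v) * Real.log (1 + -v)) - L * (xEdges X : ℝ) ^ 2 / ((1 - L) * n ^ 2) =
      n * nbar X / 2 * (L * A + (1 - L) * B) +
        L / (1 - L) * (xEdges X : ℝ) ^ 2 * ((n - nbar X) / (n ^ 2 * nbar X)) := by
    have hX2 : (xEdges X : ℝ) = u * (n * nbar X) / 2 := by
      rw [hud]; field_simp; linarith
    have : L * (1 + u) * Real.log (1 + u) + (1 - L) * (1 + -v) * Real.log (1 + -v) =
        L * A + (1 - L) * B + L * u ^ 2 / (2 * (1 - L)) := by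
      simp only [A, B, hv]; field_simp; ring
    rw [this, hX2]; field_simp; ring
  rw [e]
  have c3 : (2 * q ^ 2 / n) ^ 3 = 8 * q ^ 6 / n ^ 3 := by rw [div_pow]; ring
  have q1 : |L * A + (1 - L) * B| ≤ 32 * q ^ 6 / n ^ 3 := by
    calc _ ≤ L * (4 * u ^ 3) + (1 - L) * (4 * v ^ 3) := by
          refine (abs_add_le _ _).trans ?_
          rw [abs_mul, abs_mul, abs_of_pos h0, abs_of_pos h1]; gcongr
      _ ≤ L * (4 * (2 * q ^ 2 / n) ^ 3) + (1 - L) * (4 * (2 * q ^ 2 / n) ^ 3) := by gcongr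
      _ = 4 * (2 * q ^ 2 / n) ^ 3 := by ring
      _ = _ := by rw [c3]; ring
  have q2 : |n * nbar X / 2 * (L * A + (1 - L) * B)| ≤ 16 * q ^ 6 / n := by
    rw [abs_mul, abs_of_pos (show 0 < n * nbar X / 2 by positivity)]
    calc _ ≤ n * n / 2 * (32 * q ^ 6 / n ^ 3) := by gcongr
      _ = _ := by field_simp; ring
  have q3 : |L / (1 - L) * (xEdges X : ℝ) ^ 2 * ((n - nbar X) / (n ^ 2 * nbar X))| ≤ q ^ 4 / n := by
    have hnb : 0 ≤ n - nbar X := by linarith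
    rw [abs_of_nonneg (by positivity)]
    have hX3 : (xEdges X : ℝ) ≤ n * q / 2 := by linarith
    calc _ ≤ q * (n * q / 2) ^ 2 * ((2 * q) / (n ^ 2 * (n / 2))) := by
          have := S.ll_div_le
          gcongr
          linarith
      _ = _ := by field_simp
  calc _ ≤ 16 * q ^ 6 / n + q ^ 4 / n := (abs_add_le _ _).trans (add_le_add q2 q3)
    _ = (16 * q ^ 6 + q ^ 4) / n := by ring
    _ ≤ _ := by
      gcongr
      have : 17 * q ^ 6 ≤ q ^ 7 := mul_qpow S.hq 1 6 (by norm_num)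
      have : q ^ 4 ≤ q ^ 6 := S.pow_le_pow
      linarith

lemma abs_rp_sub_ll_le (S : Setup n d X q) : |rp d X - ll n d| ≤ 2 * q / n := by
  obtain ⟨e, h⟩ := S.rp_eq
  have h0 := S.ll0; have h1 := S.ll1; have hb := S.nbar0; have hn := S.n0
  have hu : 0 ≤ (∑ j, (xDeg X j : ℝ)) / (n * nbar X) := div_nonneg S.sx_nonneg (by positivity)
  have e' : rp d X - ll n d = ll n d * ((∑ j, (xDeg X j : ℝ)) / (n * nbar X)) := by
    rw [e]; ring
  rw [e', abs_of_nonneg (by positivity)]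
  calc _ ≤ 1 * (2 * q / n) := by gcongr; linarith
    _ = _ := one_mul _

lemma abs_rk_sub_le (S : Setup n d X q) :
    |rk d X - ll n d * (1 - ll n d)| ≤ 2 * q / n := by
  have e : rk d X - ll n d * (1 - ll n d) = (rp d X - ll n d) * (1 - rp d X - ll n d) := by
    rw [rk]; ring
  have h0 := S.ll0; have h1 := S.ll1; have h2 := S.rp0; have h3 := S.rp1
  have h4 : |1 - rp d X - ll n d| ≤ 1 := by rw [abs_le]; constructor <;> linarith
  have := S.q0; have := S.n0
  rw [e, abs_mul]
  calc _ ≤ 2 * q / n * 1 := by gcongr; exact S.abs_rp_sub_ll_le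
    _ = _ := mul_one _

lemma abs_inv_rk_sub_le (S : Setup n d X q) :
    |1 / rk d X - 1 / (ll n d * (1 - ll n d))| ≤ 16 * q ^ 3 / n := by
  have h0 := S.ll0; have h1 := S.ll1; have hk := S.rk0; have hq := S.q0; have hn := S.n0
  have e : 1 / rk d X - 1 / (ll n d * (1 - ll n d)) =
      -(rk d X - ll n d * (1 - ll n d)) * (1 / rk d X) * (1 / (ll n d * (1 - ll n d))) := by
    field_simp; ring
  have p1 : 0 ≤ 1 / rk d X := by positivity
  have p2 : 0 ≤ 1 / (ll n d * (1 - ll n d)) := by positivity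
  rw [e, abs_mul, abs_mul, abs_neg, abs_of_nonneg p1, abs_of_nonneg p2]
  calc _ ≤ 2 * q / n * (4 * q) * (2 * q) := by
        have := S.abs_rk_sub_le; have := S.inv_rk_le; have := S.inv_ll_le
        gcongr
    _ = _ := by ring

lemma abs_rl_sub_sub_le (S : Setup n d X q) (j : Fin n) :
    |rl d X j - rp d X - ll n d * xDeg X j / n| ≤ q ^ 3 / n := by
  have hq := S.q0; have hn := S.n0; have hnn := S.nn0 j; have hb := S.nbar0
  have h0 := S.ll0; have h1 := S.ll1; have h2 := S.rp0; have h3 := S.rp1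
  have hh := S.half_le j; have hx := S.x_le_uu j; have hu := S.uu_le j; have hs := S.sle
  have hc := S.cast_nn j; have hxb := S.sx_div; have hsx := S.sx_nonneg
  have hd := S.abs_rp_sub_ll_le; have hu0 := S.uu0 j
  have hx0 : (0 : ℝ) ≤ xDeg X j := by positivity
  have hs0 := S.s0
  set y := (∑ j, (xDeg X j : ℝ)) / n with hy
  have hy0 : 0 ≤ y := div_nonneg hsx hn.le
  have e1 : rl d X j = rp d X * nbar X / nn X j := by rw [rl, rp]; field_simp
  have e2 : nbar X = nn X j + xDeg X j - y := by rw [S.nbar_eq, hc]; ring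
  clear_value y
  have e3 : rl d X j - rp d X = rp d X * (xDeg X j - y) / nn X j := by
    rw [e1, e2]; field_simp; ring
  have e : rl d X j - rp d X - ll n d * xDeg X j / n = -(rp d X * y / nn X j) +
      xDeg X j * ((rp d X - ll n d) / nn X j + ll n d * (1 + xDeg X j) / (n * nn X j)) := by
    rw [e3]
    have : (n : ℝ) = nn X j + xDeg X j + 1 := by rw [hc]; ring
    field_simp
    rw [this]; ring
  have t1 : |-(rp d X * y / nn X j)| ≤ 1 * q / (n / 2) := by
    rw [abs_neg, abs_of_nonneg (div_nonneg (mul_nonneg h2.le hy0) hnn.le)]; gcongr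
  have t2 : |(rp d X - ll n d) / nn X j + ll n d * (1 + xDeg X j) / (n * nn X j)| ≤
      (2 * q / n) / (n / 2) + 1 * uu X q j / (n * (n / 2)) := by
    refine (abs_add_le _ _).trans (add_le_add ?_ ?_)
    · rw [abs_div, abs_of_pos hnn]; gcongr
    · rw [abs_of_nonneg (by positivity)]
      gcongr
      · linarith
      · have := S.one_le_q; rw [uu]; linarith
  have hs2 := S.sq
  have w1 : uu X q j * q ≤ 2 * n * q ^ 2 := by
    calc _ ≤ 2 * √n * q * q := by gcongr; linarith
      _ ≤ 2 * n * q * q := by gcongr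
      _ = _ := by ring
  have w2 : uu X q j * uu X q j ≤ 4 * n * q ^ 2 := by
    calc _ ≤ (2 * √n * q) * (2 * √n * q) := by gcongr <;> linarith
      _ = 4 * √n ^ 2 * q ^ 2 := by ring
      _ = _ := by rw [hs2]
  calc _ ≤ 1 * q / (n / 2) + uu X q j * ((2 * q / n) / (n / 2) + 1 * uu X q j / (n * (n / 2))) := by
        rw [e]
        refine (abs_add_le _ _).trans (add_le_add t1 ?_)
        rw [abs_mul, abs_of_nonneg hx0]; gcongr
    _ = 2 * q / n + (4 * (uu X q j * q) + 2 * (uu X q j * uu X q j)) / n ^ 2 := by field_simp; ring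
    _ ≤ 2 * q / n + (4 * (2 * n * q ^ 2) + 2 * (4 * n * q ^ 2)) / n ^ 2 := by gcongr
    _ = (2 * q + 16 * q ^ 2) / n := by field_simp; ring
    _ ≤ _ := by
      gcongr
      have : 18 * q ^ 2 ≤ q ^ 3 := mul_qpow S.hq 1 2 (by norm_num)
      have : q ≤ q ^ 2 := le_self_pow₀ S.one_le_q (by norm_num)
      linarith

/-- The correction `mu` in terms of the degrees of `X`. -/
lemma abs_mu_sub_le (S : Setup n d X q) :
    |mu d X - ll n d * pairSum X (fun j => (xDeg X j : ℝ)) / ((1 - ll n d) * n ^ 2)| ≤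
      q ^ 10 / √n := by
  have hq := S.q0; have hn := S.n0; have hs := S.s0; have hk := S.rk0
  have h0 := S.ll0; have h1 := S.ll1; have hs2 := S.sq; have hsl := S.sle
  set A : Fin n → ℝ := fun j => rl d X j - rp d X with hA
  set B : Fin n → ℝ := fun j => ll n d * xDeg X j / n with hB
  have hul : ∀ j, uu X q j / n ≤ 2 * q / √n := fun j => by
    have := S.uu_le j
    rw [div_le_div_iff₀ hn hs]
    calc _ ≤ 2 * √n * q * √n := by gcongr; linarith
      _ = 2 * q * √n ^ 2 := by ring
      _ = _ := by rw [hs2]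
  have q4 : 4 * q ≤ q ^ 2 := by
    have := S.hq; nlinarith
  have hAb : ∀ j, |A j| ≤ q ^ 2 / √n := fun j => by
    calc _ ≤ 2 * (uu X q j / n) := by have := S.abs_rl_sub j; rw [mul_div_assoc] at this; exact this
      _ ≤ 2 * (2 * q / √n) := mul_le_mul_of_nonneg_left (hul j) (by norm_num)
      _ = 4 * q / √n := by ring
      _ ≤ _ := by gcongr
  have hBb : ∀ j, |B j| ≤ q ^ 2 / √n := fun j => by
    have hx := S.x_le_uu j
    rw [hB]; dsimp only
    rw [abs_of_nonneg (by positivity)]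
    calc _ ≤ 1 * uu X q j / n := by gcongr; linarith
      _ = uu X q j / n := by rw [one_mul]
      _ ≤ 2 * q / √n := hul j
      _ ≤ _ := by gcongr; linarith
  have hAB : ∀ j, |A j - B j| ≤ q ^ 3 / n := S.abs_rl_sub_sub_le
  have e : mu d X - ll n d * pairSum X (fun j => (xDeg X j : ℝ)) / ((1 - ll n d) * n ^ 2) =
      ∑ p ∈ prs X, (A p.1 * A p.2 * (1 / rk d X) -
        B p.1 * B p.2 * (1 / (ll n d * (1 - ll n d)))) := by
    rw [sum_sub_distrib, pairSum_eq, mu, mul_sum, sum_div]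
    congr 1
    · refine sum_congr rfl fun p _ => ?_
      simp only [rm, hA]
      rw [div_mul_div_comm, ← pow_two, S.sqrt_rk_sq]; ring
    · refine sum_congr rfl fun p _ => ?_
      simp only [hB]; field_simp
  have term : ∀ p : Fin n × Fin n, |A p.1 * A p.2 * (1 / rk d X) -
        B p.1 * B p.2 * (1 / (ll n d * (1 - ll n d)))| ≤ q ^ 8 / (n * √n) := fun p => by
    have d1 : |A p.1 * A p.2 - B p.1 * B p.2| ≤ 2 * q ^ 5 / (n * √n) := by
      have : A p.1 * A p.2 - B p.1 * B p.2 =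
        A p.1 * (A p.2 - B p.2) + (A p.1 - B p.1) * B p.2 := by ring
      rw [this]
      calc _ ≤ q ^ 2 / √n * (q ^ 3 / n) + q ^ 3 / n * (q ^ 2 / √n) := by
            refine (abs_add_le _ _).trans ?_
            rw [abs_mul, abs_mul]
            have := hAb p.1; have := hBb p.2; have := hAB p.1; have := hAB p.2
            gcongr
        _ = _ := by field_simp; ring
    have d2 : |B p.1 * B p.2| ≤ q ^ 4 / n := by
      rw [abs_mul]
      calc _ ≤ q ^ 2 / √n * (q ^ 2 / √n) := by
            have := hBb p.1; have := hBb p.2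
            gcongr
        _ = q ^ 4 / √n ^ 2 := by field_simp
        _ = _ := by rw [hs2]
    have : A p.1 * A p.2 * (1 / rk d X) - B p.1 * B p.2 * (1 / (ll n d * (1 - ll n d))) =
        (A p.1 * A p.2 - B p.1 * B p.2) * (1 / rk d X) +
        B p.1 * B p.2 * (1 / rk d X - 1 / (ll n d * (1 - ll n d))) := by ring
    rw [this]
    have hk' : |1 / rk d X| ≤ 4 * q := by
      rw [abs_of_pos (by positivity)]; exact S.inv_rk_le
    calc _ ≤ 2 * q ^ 5 / (n * √n) * (4 * q) + q ^ 4 / n * (16 * q ^ 3 / n) := by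
          refine (abs_add_le _ _).trans ?_
          rw [abs_mul, abs_mul]
          have := S.abs_inv_rk_sub_le
          gcongr
      _ = 8 * q ^ 6 / (n * √n) + 16 * q ^ 7 / (n * n) := by field_simp; ring
      _ ≤ 8 * q ^ 6 / (n * √n) + 16 * q ^ 7 / (n * √n) := by gcongr
      _ = (8 * q ^ 6 + 16 * q ^ 7) / (n * √n) := by ring
      _ ≤ _ := by
        gcongr
        have : 24 * q ^ 7 ≤ q ^ 8 := mul_qpow S.hq 1 7 (by norm_num)
        have : q ^ 6 ≤ q ^ 7 := S.pow_le_pow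
        linarith
  rw [e]
  calc _ ≤ ∑ p ∈ prs X, q ^ 8 / (n * √n) :=
        (abs_sum_le_sum_abs _ _).trans (sum_le_sum fun p _ => term p)
    _ = (prs X).card * (q ^ 8 / (n * √n)) := by rw [sum_const, nsmul_eq_mul]
    _ ≤ n * q / 2 * (q ^ 8 / (n * √n)) := by have := S.prs_card_le; gcongr
    _ = q ^ 9 / 2 / √n := by field_simp
    _ ≤ _ := by
      gcongr
      have : q ^ 9 ≤ q ^ 10 := S.pow_le_pow
      have : 0 ≤ q ^ 9 := by positivity
      linarith

end Setup

end

section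

variable {n d : ℕ} {X : SimpleGraph (Fin n)} {q : ℝ}

/-- Product of the normalising factors in the Fourier representation. -/
def WW {n : ℕ} (d : ℕ) (X : SimpleGraph (Fin n)) : ℝ :=
  ∏ j, (√(1 - rp d X) ^ (nn X j - d) * √(rp d X) ^ d)

/-- Product of the binomial coefficients in `gHat`. -/
def KK {n : ℕ} (d : ℕ) (X : SimpleGraph (Fin n)) : ℝ := ∏ j, ((nn X j).choose d : ℝ)

/-- The relative error scale. -/
def errE (n d : ℕ) : ℝ := Real.exp (1 / 3 * (1 / (ll n d * (1 - ll n d))))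

namespace Setup

lemma KK0 (S : Setup n d X q) : 0 < KK d X := prod_pos fun j _ => by
  have := S.d_nat j
  exact_mod_cast Nat.choose_pos (by omega)

lemma WW0 (S : Setup n d X q) : 0 < WW d X := prod_pos fun j _ => by
  have h1 := Real.sqrt_pos.2 S.rp0
  have h2 := Real.sqrt_pos.2 (show 0 < 1 - rp d X by linarith [S.rp1])
  positivity

lemma avg_Fg (S : Setup n d X q) [NeZero (2 * n ^ 3)] :
    avg (fun t : Fin n → ZMod (2 * n ^ 3) => Fg d X t) =
      ((gCount (fun _ => d) X * (rP d X / (KK d X * WW d X)) : ℝ) : ℂ) := by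
  have hp := S.rp0; have hp1 : 0 < 1 - rp d X := by linarith [S.rp1]
  have s1 := Real.sqrt_pos.2 hp; have s2 := Real.sqrt_pos.2 hp1
  have h := avg_gen_fun (M := 2 * n ^ 3) (by
      have := S.npos; nlinarith [Nat.pow_le_pow_right this (show 1 ≤ 3 by norm_num)])
    (fun _ => d) X (fun j => by have := S.nn_lt j; have := S.d_nat j; omega)
    (fun j => (((1 - rl d X j) / √(1 - rp d X) : ℝ) : ℂ))
    (fun j => ((rl d X j / √(rp d X) : ℝ) : ℂ))
  have e : (fun t : Fin n → ZMod (2 * n ^ 3) => Fg d X t) = fun t =>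
      (∏ p ∈ prs Xᶜ, ((((1 - rl d X p.1) / √(1 - rp d X) : ℝ) : ℂ) *
        (((1 - rl d X p.2) / √(1 - rp d X) : ℝ) : ℂ) + ((rl d X p.1 / √(rp d X) : ℝ) : ℂ) *
        ((rl d X p.2 / √(rp d X) : ℝ) : ℂ) * (root (t p.1) * root (t p.2)))) *
        ∏ j, (root (t j))⁻¹ ^ d := by
    funext t
    rw [Fg]
    congr 1
    refine prod_congr rfl fun p _ => ?_
    rw [← Complex.ofReal_mul, ← Complex.ofReal_mul, div_mul_div_comm, div_mul_div_comm,
      Real.mul_self_sqrt hp1.le, Real.mul_self_sqrt hp.le]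
  rw [e]
  refine h.trans ?_
  have e2 : rP d X / (KK d X * WW d X) = ∏ j, (((1 - rl d X j) / √(1 - rp d X)) ^ (nn X j - d) *
      (rl d X j / √(rp d X)) ^ d) := by
    rw [rP, KK, WW, ← prod_mul_distrib, ← prod_div_distrib]
    refine prod_congr rfl fun j _ => ?_
    have : ((nn X j).choose d : ℝ) ≠ 0 := by
      have := S.d_nat j
      exact_mod_cast (Nat.choose_pos (show d ≤ nn X j by omega)).ne'
    rw [binW, div_pow, div_pow]
    field_simp
  rw [e2]
  push_cast
  rfl

lemma sum_nn (S : Setup n d X q) : ∑ j, (nn X j : ℝ) = n * nbar X := by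
  have := S.n0; rw [nbar]; field_simp

lemma log_WW (S : Setup n d X q) : Real.log (WW d X) =
    n * nbar X / 2 * (rp d X * Real.log (rp d X) + (1 - rp d X) * Real.log (1 - rp d X)) := by
  have hp := S.rp0; have hp1 : 0 < 1 - rp d X := by linarith [S.rp1]
  have s1 := Real.sqrt_pos.2 hp; have s2 := Real.sqrt_pos.2 hp1
  have hb := S.nbar0
  rw [WW, Real.log_prod fun j _ => by positivity]
  have : ∀ j, Real.log (√(1 - rp d X) ^ (nn X j - d) * √(rp d X) ^ d) =
      (nn X j - d) * (Real.log (1 - rp d X) / 2) + d * (Real.log (rp d X) / 2) := fun j => by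
    have := S.d_nat j
    rw [Real.log_mul (by positivity) (by positivity), Real.log_pow, Real.log_pow,
      Real.log_sqrt hp1.le, Real.log_sqrt hp.le, Nat.cast_sub (by omega)]
  rw [sum_congr rfl fun j _ => this j, sum_add_distrib, ← sum_mul, sum_sub_distrib, S.sum_nn]
  have e : (d : ℝ) = nbar X * rp d X := by rw [rp]; field_simp
  simp only [sum_const, card_univ, Fintype.card_fin, nsmul_eq_mul]
  rw [e]; ring

lemma gHat_eq (S : Setup n d X q) : ∃ T, gHat (fun _ => d) X = T * KK d X ∧ 0 < T ∧
    Real.log T = n * nbar X / 2 * (rp d X * Real.log (ll n d) +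
      (1 - rp d X) * Real.log (1 - ll n d)) := by
  have h0 := S.ll0; have h1 := S.ll1; have hb := S.nbar0; have hn := S.n0
  have hn1 := S.n1_pos
  refine ⟨(1 - ll n d) ^ (-(xEdges X : ℝ)) *
    (ll n d ^ ll n d * (1 - ll n d) ^ (1 - ll n d)) ^ n.choose 2, ?_, by positivity, ?_⟩
  · rw [gHat, lamb_const S.npos]; rfl
  have t1 : 0 < ll n d ^ ll n d := Real.rpow_pos_of_pos h0 _
  have t2 : 0 < (1 - ll n d) ^ (1 - ll n d) := Real.rpow_pos_of_pos h1 _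
  have t3 : 0 < (1 - ll n d) ^ (-(xEdges X : ℝ)) := Real.rpow_pos_of_pos h1 _
  rw [Real.log_mul t3.ne' (by positivity), Real.log_pow, Real.log_mul t1.ne' t2.ne',
    Real.log_rpow h1, Real.log_rpow h0, Real.log_rpow h1, Nat.cast_choose_two]
  have e1 : rp d X = ll n d * (n - 1) / nbar X := by rw [ll, rp]; field_simp
  have e2 : 2 * (xEdges X : ℝ) = n * (n - 1) - n * nbar X := by
    rw [two_mul_xEdges, S.nbar_eq]; field_simp; ring
  have e3 : (xEdges X : ℝ) = (n * (n - 1) - n * nbar X) / 2 := by linarith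
  rw [e1, e3]
  field_simp
  ring

lemma errE_rk_le (S : Setup n d X q) :
    Real.exp (1 / 3 * (1 / rk d X)) ≤ 2 * errE n d := by
  have h := (abs_le.1 S.abs_inv_rk_sub_le).2
  have h2 : 16 * q ^ 3 / n ≤ 1 := by
    have h3 := S.div_n_le 3; have h4 := S.div_s_le 0
    rw [pow_zero] at h4
    rw [mul_div_assoc]; linarith
  have h5 : Real.exp (1 / 3) ≤ 2 := by
    rw [show (1 / 3 : ℝ) = 1 / 3 by rfl, ← Real.le_log_iff_exp_le (by norm_num)]
    have := Real.log_two_gt_d9; linarith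
  calc _ ≤ Real.exp (1 / 3 + 1 / 3 * (1 / (ll n d * (1 - ll n d)))) :=
        Real.exp_le_exp.2 (by linarith)
    _ = Real.exp (1 / 3) * errE n d := Real.exp_add _ _
    _ ≤ _ := mul_le_mul_of_nonneg_right h5 (Real.exp_nonneg _)

/-- The asymptotic value of `numPar` for regular degree sequences. -/
theorem numPar_eq (S : Setup n d X q) (hE : q ^ 83 / √n * errE n d ≤ 1) :
    ∃ e : ℝ, |e| ≤ q ^ 83 / √n * errE n d ∧ numPar (fun _ => d) X = Real.exp (1 / 4 +
      ll n d * ((xEdges X : ℝ) ^ 2 - pairSum X (fun j => (xDeg X j : ℝ))) /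
        ((1 - ll n d) * n ^ 2) + e) := by
  have hnp := S.npos; have hq := S.q0; have hs := S.s0; have hn := S.n0
  have : NeZero (2 * n ^ 3) := ⟨by positivity⟩
  have hP := S.rP0; have hK := S.KK0; have hW := S.WW0
  have h := S.norm_avg_Fg_sub_le
  rw [S.avg_Fg, ← Complex.ofReal_sub, Complex.norm_real, Real.norm_eq_abs] at h
  set m := mu d X with hm
  set G : ℝ := ((gCount (fun _ : Fin n => d) X : ℕ) : ℝ) with hG
  have h2 : 0 < √(2 : ℝ) := by positivity
  have hEp : 0 < errE n d := Real.exp_pos _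
  set η := G / (√2 * Real.exp (1 / 4 - m) * (KK d X * WW d X)) - 1 with hη
  have hη1 : |η| ≤ 2 * (q ^ 81 / √n * errE n d) := by
    have e : η = (G * (rP d X / (KK d X * WW d X)) - √2 * Real.exp (1 / 4 - m) * rP d X) /
        (√2 * Real.exp (1 / 4 - m) * rP d X) := by rw [hη]; field_simp
    rw [e, abs_div, abs_of_pos (show 0 < √2 * Real.exp (1 / 4 - m) * rP d X by positivity),
      div_le_iff₀ (by positivity)]
    refine h.trans ?_
    have a1 : 1 ≤ √(2 : ℝ) := Real.one_le_sqrt.2 (by norm_num)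
    have a2 : Real.exp (-m) ≤ Real.exp (1 / 4 - m) := Real.exp_le_exp.2 (by linarith)
    calc _ ≤ rP d X * Real.exp (1 / 4 - m) * (q ^ 81 / √n) * (2 * errE n d) := by
          have := S.errE_rk_le
          gcongr
      _ = 1 * (2 * (q ^ 81 / √n * errE n d) * (Real.exp (1 / 4 - m) * rP d X)) := by ring
      _ ≤ √2 * (2 * (q ^ 81 / √n * errE n d) * (Real.exp (1 / 4 - m) * rP d X)) := by gcongr
      _ = _ := by ring
  have q1 : 1000 * q ^ 81 ≤ q ^ 82 := mul_qpow S.hq 1 81 (by norm_num)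
  have q2 : 1000 * q ^ 82 ≤ q ^ 83 := mul_qpow S.hq 1 82 (by norm_num)
  have w1 : 1000 * (q ^ 81 / √n * errE n d) ≤ q ^ 82 / √n * errE n d := by
    calc _ = (1000 * q ^ 81) / √n * errE n d := by ring
      _ ≤ _ := by gcongr
  have w2 : 1000 * (q ^ 82 / √n * errE n d) ≤ q ^ 83 / √n * errE n d := by
    calc _ = (1000 * q ^ 82) / √n * errE n d := by ring
      _ ≤ _ := by gcongr
  have w0 : 0 ≤ q ^ 81 / √n * errE n d := by positivity
  have hη2 : |η| ≤ 1 / 2 := by linarith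
  have hl : |Real.log (1 + η)| ≤ 2 * |η| := by
    have hb := abs_le.1 hη2
    have t1 : Real.log (1 + η) ≤ η := by
      have := Real.log_le_sub_one_of_pos (show 0 < 1 + η by linarith); linarith
    have t2 : -(2 * |η|) ≤ Real.log (1 + η) := by
      have := Real.one_sub_inv_le_log_of_pos (show 0 < 1 + η by linarith)
      have t3 : 1 - (1 + η)⁻¹ = η / (1 + η) := by
        have : 1 + η ≠ 0 := by linarith
        field_simp; ring
      rw [t3] at this
      refine le_trans ?_ this
      rw [le_div_iff₀ (by linarith)]
      rcases abs_cases η with ⟨h1, _⟩ | ⟨h1, _⟩ <;> rw [h1] <;> nlinarith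
    rw [abs_le]; refine ⟨t2, t1.trans ?_⟩
    have := le_abs_self η; have := abs_nonneg η; linarith
  obtain ⟨T, hT, hT0, hTl⟩ := S.gHat_eq
  have hent := S.abs_entropy_sub_le
  have hmu := S.abs_mu_sub_le
  set V := n * nbar X / 2 * (rp d X * Real.log (rp d X / ll n d) +
        (1 - rp d X) * Real.log ((1 - rp d X) / (1 - ll n d))) with hV
  have hWT : WW d X = T * Real.exp V := by
    have : Real.log (WW d X) = Real.log T + V := by
      have hp := S.rp0; have hp1 : 0 < 1 - rp d X := by linarith [S.rp1]
      rw [S.log_WW, hTl, hV, Real.log_div hp.ne' S.ll0.ne', Real.log_div hp1.ne' S.ll1.ne']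
      ring
    rw [← Real.exp_log hW, this, Real.exp_add, Real.exp_log hT0]
  have hpos : 0 < 1 + η := by have := abs_le.1 hη2; linarith
  have hnum : numPar (fun _ : Fin n => d) X = Real.exp (1 / 4 - m + V + Real.log (1 + η)) := by
    rw [Real.exp_add, Real.exp_log hpos, Real.exp_add, numPar, hT, ← hG, hη, hWT]
    field_simp
    ring
  have h0 := S.ll0; have h1 := S.ll1
  refine ⟨-(m - ll n d * pairSum X (fun j => (xDeg X j : ℝ)) / ((1 - ll n d) * n ^ 2)) +
    (V - ll n d * (xEdges X : ℝ) ^ 2 / ((1 - ll n d) * n ^ 2)) + Real.log (1 + η), ?_, ?_⟩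
  · have hE1 : 1 ≤ errE n d := Real.one_le_exp (by positivity)
    have b1 : q ^ 10 / √n ≤ q ^ 82 / √n * errE n d := by
      calc _ ≤ q ^ 82 / √n := by gcongr ?_ / _; exact S.pow_le_pow
        _ ≤ _ := le_mul_of_one_le_right (by positivity) hE1
    have b2 : q ^ 7 / n ≤ q ^ 82 / √n * errE n d := by
      refine le_trans ?_ b1
      have := S.sle
      calc q ^ 7 / n ≤ q ^ 7 / √n := by gcongr
        _ ≤ _ := by gcongr ?_ / _; exact S.pow_le_pow
    calc _ ≤ q ^ 10 / √n + q ^ 7 / n + 2 * |η| := by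
          refine (abs_add_three _ _ _).trans ?_
          rw [abs_neg]
          gcongr
      _ ≤ _ := by linarith
  · rw [hnum]; congr 1; ring

end Setup

end
lemma choose_sub_eq_prod {N d : ℕ} : ∀ {x : ℕ}, x + d ≤ N →
    ((N - x).choose d : ℝ) = N.choose d * ∏ i ∈ range x, (((N : ℝ) - d - i) / ((N : ℝ) - i))
  | 0, _ => by simp
  | x + 1, h => by
    have ih := choose_sub_eq_prod (N := N) (d := d) (x := x) (by omega)
    obtain ⟨m, rfl⟩ : ∃ m, N = m + (x + 1) := ⟨N - (x + 1), by omega⟩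
    have e1 : m + (x + 1) - x = m + 1 := by omega
    have e2 : m + (x + 1) - (x + 1) = m := by omega
    have h2 := Nat.choose_mul_succ_eq m d
    rw [e1] at ih
    rw [prod_range_succ, ← mul_assoc, ← ih, e2]
    have h3 : (m.choose d : ℝ) * (m + 1) = (m + 1).choose d * ((m : ℝ) + 1 - d) := by
      have h4 : ((m + 1 - d : ℕ) : ℝ) = (m : ℝ) + 1 - d := by
        rw [Nat.cast_sub (by omega)]; push_cast; ring
      rw [← h4]; exact_mod_cast h2
    have h5 : ((m + (x + 1) : ℕ) : ℝ) - x = m + 1 := by push_cast; ring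
    have h6 : ((m + (x + 1) : ℕ) : ℝ) - d - x = m + 1 - d := by push_cast; ring
    rw [h5, h6]
    have : (m : ℝ) + 1 ≠ 0 := by positivity
    field_simp
    linarith

lemma sum_range_cast (x : ℕ) : ∑ i ∈ range x, (i : ℝ) = x * (x - 1) / 2 := by
  induction x with
  | zero => simp
  | succ k ih => rw [sum_range_succ, ih]; push_cast; ring

lemma sum_range_cast_sq (x : ℕ) :
    ∑ i ∈ range x, (i : ℝ) ^ 2 = x * (x - 1) * (2 * x - 1) / 6 := by
  induction x with
  | zero => simp
  | succ k ih => rw [sum_range_succ, ih]; push_cast; ring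

lemma abs_log_one_sub_add_le {y : ℝ} (h0 : 0 ≤ y) (hy : y ≤ 1 / 2) :
    |Real.log (1 - y) + y + y ^ 2 / 2| ≤ 2 * y ^ 3 := by
  have h := Real.abs_log_sub_add_sum_range_le (x := y) (by rw [abs_of_nonneg h0]; linarith) 2
  simp only [sum_range_succ, range_zero, sum_empty] at h
  norm_num at h
  rw [abs_of_nonneg h0] at h
  have e : Real.log (1 - y) + y + y ^ 2 / 2 = y + y ^ 2 / 2 + Real.log (1 - y) := by ring
  rw [e]
  refine h.trans ?_
  rw [div_le_iff₀ (by linarith)]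
  have : 0 ≤ y ^ 3 := by positivity
  nlinarith

section

variable {x n s q b c N : ℝ}

lemma linear_term_shift (hq : 0 < q) (hs : 0 < s) (hs2 : s ^ 2 = n) (hNn : N = n - 1)
    (hnh : n / 2 ≤ N) (hN : 0 < N) (hb0 : 0 ≤ b) (hbq : b ≤ q) (hxle : x ≤ x ^ 2)
    (hx : x ≤ s * q) (hx0 : 0 ≤ x := by positivity) :
    |-(x * (x - 1) / 2 * b / N) + b / n * (x ^ 2 - x) / 2| ≤ x * (q ^ 2 / (n * s)) := by
  have hn : 0 < n := by rw [← hs2]; positivity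
  have hxx : x ^ 2 ≤ x * (s * q) := by rw [pow_two]; gcongr
  have e : -(x * (x - 1) / 2 * b / N) + b / n * (x ^ 2 - x) / 2 =
      -((x ^ 2 - x) / 2 * b * (1 / (n * N))) := by
    have : n = N + 1 := by rw [hNn]; ring
    rw [this] at hn ⊢; field_simp; ring
  have hp : 0 ≤ x ^ 2 - x := by linarith
  rw [e, abs_neg, abs_of_nonneg (by positivity)]
  calc _ ≤ (x * (s * q)) / 2 * q * (1 / (n * (n / 2))) := by gcongr; linarith
    _ = x * (q ^ 2 * s / (n * n)) := by field_simp
    _ = x * (q ^ 2 * s / (n * s ^ 2)) := by rw [hs2]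
    _ = _ := by field_simp

lemma cubic_term_shift (hq1 : 1 ≤ q) (hs : 0 < s) (hs2 : s ^ 2 = n) (hsn : s ≤ n) (hNn : N = n - 1)
    (hnh : n / 2 ≤ N) (hN : 0 < N) (hc0 : 0 ≤ c) (hcq : c ≤ q ^ 2) (hxle : x ≤ x ^ 2)
    (hx : x ≤ s * q) (hx0 : 0 ≤ x := by positivity) :
    |-(x * (x - 1) * (2 * x - 1) / 6 * c / N ^ 2) + c / (3 * n ^ 2) * x ^ 3| ≤
      x * (5 * q ^ 4 / (n * s)) := by
  have hq : 0 < q := by linarith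
  have hn : 0 < n := by rw [← hs2]; positivity
  have hxx : x ^ 2 ≤ x * (s * q) := by rw [pow_two]; gcongr
  have e : -(x * (x - 1) * (2 * x - 1) / 6 * c / N ^ 2) + c / (3 * n ^ 2) * x ^ 3 =
      c * ((3 * x ^ 2 - x) / (6 * N ^ 2)) -
        c * (x ^ 3 / 3 * ((n + N) / (n ^ 2 * N ^ 2))) := by
    have : (n : ℝ) = N + 1 := by rw [hNn]; ring
    rw [this] at hn ⊢; field_simp; ring
  have hp : 0 ≤ 3 * x ^ 2 - x := by nlinarith
  have hNle : N ≤ n := by linarith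
  have w1 : c * ((3 * x ^ 2 - x) / (6 * N ^ 2)) ≤ x * (2 * q ^ 4 / (n * s)) := by
    calc _ ≤ q ^ 2 * (3 * (x * (s * q)) / (6 * (n / 2) ^ 2)) := by gcongr; linarith
      _ = x * (2 * q ^ 3 * s / (n * n)) := by field_simp; ring
      _ = x * (2 * q ^ 3 * s / (n * s ^ 2)) := by rw [hs2]
      _ = x * (2 * q ^ 3 / (n * s)) := by field_simp
      _ ≤ _ := by gcongr; norm_num
  have w2 : c * (x ^ 3 / 3 * ((n + N) / (n ^ 2 * N ^ 2))) ≤ x * (3 * q ^ 4 / (n * s)) := by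
    have x3 : x ^ 3 ≤ x * (n * q ^ 2) := by
      calc x ^ 3 = x * (x * x) := by ring
        _ ≤ x * (s * q * (s * q)) := by gcongr
        _ = x * (s ^ 2 * q ^ 2) := by ring
        _ = _ := by rw [hs2]
    calc _ ≤ q ^ 2 * (x * (n * q ^ 2) / 3 * ((n + n) / (n ^ 2 * (n / 2) ^ 2))) := by gcongr
      _ = x * (8 / 3 * q ^ 4 / (n * n)) := by field_simp; ring
      _ ≤ x * (3 * q ^ 4 / (n * s)) := by
        gcongr
        norm_num
  have z1 : 0 ≤ c * ((3 * x ^ 2 - x) / (6 * N ^ 2)) := by positivity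
  have z2 : 0 ≤ c * (x ^ 3 / 3 * ((n + N) / (n ^ 2 * N ^ 2))) := by positivity
  rw [e]
  calc _ ≤ _ := abs_sub _ _
    _ ≤ x * (2 * q ^ 4 / (n * s)) + x * (3 * q ^ 4 / (n * s)) := by
        rw [abs_of_nonneg z1, abs_of_nonneg z2]; exact add_le_add w1 w2
    _ = _ := by ring

end

section

variable {n d : ℕ} {X : SimpleGraph (Fin n)} {q : ℝ}

namespace Setup

lemma bot (S : Setup n d X q) : Setup n d ⊥ q := by
  have h : ∀ j, xDeg (⊥ : SimpleGraph (Fin n)) j = 0 := fun j => by simp [xDeg]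
  have := S.q0
  refine ⟨S.hq, S.hqn, S.hlog, S.lo, S.hi, fun j => ?_, ?_, S.even⟩
  · rw [h, Nat.cast_zero]; positivity
  · simp only [h, Nat.cast_zero, sum_const_zero]; positivity

/-- Logarithm of a ratio of binomial coefficients, expanded to third order. -/
lemma abs_log_choose_ratio_sub_le (S : Setup n d X q) (j : Fin n) :
    |Real.log (((n - 1 - xDeg X j).choose d : ℝ) / (n - 1).choose d) -
      (xDeg X j * Real.log (1 - ll n d) -
        ll n d / ((1 - ll n d) * n) * ((xDeg X j : ℝ) ^ 2 - xDeg X j) / 2 -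
        ll n d * (2 - ll n d) / (6 * (1 - ll n d) ^ 2 * n ^ 2) * (xDeg X j : ℝ) ^ 3)| ≤
      xDeg X j * (q ^ 7 / (n * √n)) := by
  have hq := S.q0; have hs := S.s0; have hn := S.n0; have hs2 := S.sq
  have h0 := S.ll0; have h1 := S.ll1; have hn1 := S.n1_pos; have hx := S.hx j
  have hdn := S.d_nat j
  have hnp := S.npos
  have hlo : n / q ≤ (n : ℝ) - 1 - d := by have := S.hi; linarith
  have hnh : (n : ℝ) / 2 ≤ n - 1 := by have := S.n1000; linarith
  set x := xDeg X j with hxd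
  have hxN : x + d ≤ n - 1 := by unfold nn at hdn; omega
  set L := ll n d with hL
  set N : ℝ := n - 1 with hN
  set D : ℝ := n - 1 - d with hD
  have hnq : 0 < n / q := by positivity
  have hD0 : 0 < D := lt_of_lt_of_le hnq hlo
  have hDN : D = (1 - L) * N := by
    have e : (n : ℝ) - 1 ≠ 0 := hn1.ne'
    rw [hL, ll, hD, hN, sub_mul, one_mul, div_mul_cancel₀ _ e]
  have hDN' : D ≤ N := by rw [hD, hN]; have : (0 : ℝ) ≤ d := by positivity
                          linarith
  have cN : ((n - 1 : ℕ) : ℝ) = N := by rw [Nat.cast_sub (by omega)]; simp [hN]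
  have hx0 : (0 : ℝ) ≤ x := by positivity
  have ybd : ∀ i ∈ range x, (i : ℝ) / D ≤ q ^ 2 / √n := fun i hi => by
    have : (i : ℝ) ≤ √n * q := le_trans (by exact_mod_cast (mem_range.1 hi).le) hx
    calc (i : ℝ) / D ≤ √n * q / (n / q) := by gcongr
      _ = √n * q ^ 2 / √n ^ 2 := by rw [hs2]; field_simp
      _ = _ := by field_simp
  have ysm : q ^ 2 / √n ≤ 1 / 2 := (S.div_s_le 2).trans (by norm_num)
  have yN : ∀ i : ℕ, (i : ℝ) / N ≤ i / D := fun i => by gcongr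
  have hC : (0 : ℝ) < (n - 1).choose d := by
    exact_mod_cast Nat.choose_pos (by omega)
  have hfac : ∀ i ∈ range x, Real.log ((N - d - i) / (N - i)) =
      Real.log (1 - L) + (Real.log (1 - i / D) - Real.log (1 - i / N)) := fun i hi => by
    have a1 := ybd i hi; have a2 := yN i
    have b1 : 0 < 1 - (i : ℝ) / D := by linarith
    have b2 : 0 < 1 - (i : ℝ) / N := by linarith
    have e : (N - d - i) / (N - i) = (1 - L) * ((1 - i / D) / (1 - i / N)) := by
      have c1 : N - d = D := by rw [hD, hN]
      have c2 : N - (i : ℝ) = N * (1 - i / N) := by field_simp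
      have c3 : D - (i : ℝ) = D * (1 - i / D) := by field_simp
      rw [c1, c2, c3]
      nth_rewrite 1 [hDN]
      field_simp
    rw [e, Real.log_mul h1.ne' (by positivity), Real.log_div b1.ne' b2.ne']
  have hne : ∀ i ∈ range x, (N - d - i) / (N - i) ≠ 0 := fun i hi => by
    have hix : (i : ℝ) + 1 ≤ x := by exact_mod_cast mem_range.1 hi
    have hxd : (x : ℝ) + d ≤ N := by rw [← cN]; exact_mod_cast hxN
    have : (0 : ℝ) ≤ d := by positivity
    exact (div_pos (by linarith) (by linarith)).ne'
  have hlog : Real.log (((n - 1 - x).choose d : ℝ) / (n - 1).choose d) =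
      x * Real.log (1 - L) + ∑ i ∈ range x, (Real.log (1 - i / D) - Real.log (1 - i / N)) := by
    rw [choose_sub_eq_prod hxN, mul_div_cancel_left₀ _ hC.ne', cN, Real.log_prod hne,
      sum_congr rfl hfac, sum_add_distrib, sum_const, card_range, nsmul_eq_mul]
  set g : ℕ → ℝ := fun i => -((i : ℝ) * (1 / D - 1 / N)) - (i : ℝ) ^ 2 * (1 / D ^ 2 - 1 / N ^ 2) / 2
    with hg
  have herr : |∑ i ∈ range x, (Real.log (1 - i / D) - Real.log (1 - i / N)) -
      ∑ i ∈ range x, g i| ≤ x * (4 * (q ^ 2 / √n) ^ 3) := by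
    rw [← sum_sub_distrib]
    refine (abs_sum_le_sum_abs _ _).trans ?_
    refine (sum_le_sum (g := fun _ => 4 * (q ^ 2 / √n) ^ 3) fun i hi => ?_).trans_eq (by
      rw [sum_const, card_range, nsmul_eq_mul])
    have a1 := ybd i hi; have a2 := yN i
    have i0 : (0 : ℝ) ≤ i := by positivity
    have p1 : 0 ≤ (i : ℝ) / D := by positivity
    have p2 : 0 ≤ (i : ℝ) / N := by positivity
    have t1 := abs_log_one_sub_add_le p1 (by linarith)
    have t2 := abs_log_one_sub_add_le p2 (by linarith)
    have e : Real.log (1 - i / D) - Real.log (1 - i / N) - g i =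
        (Real.log (1 - i / D) + i / D + (i / D) ^ 2 / 2) -
        (Real.log (1 - i / N) + i / N + (i / N) ^ 2 / 2) := by
      simp only [hg]; ring_nf
    rw [e]
    calc _ ≤ 2 * ((i : ℝ) / D) ^ 3 + 2 * ((i : ℝ) / N) ^ 3 :=
          (abs_sub _ _).trans (add_le_add t1 t2)
      _ ≤ 2 * (q ^ 2 / √n) ^ 3 + 2 * (q ^ 2 / √n) ^ 3 := by
          have := a2.trans a1
          gcongr
      _ = _ := by ring
  have hgs : ∑ i ∈ range x, g i = -(x * (x - 1) / 2 * (L / (1 - L)) / N) -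
      x * (x - 1) * (2 * x - 1) / 6 * (L * (2 - L) / (2 * (1 - L) ^ 2)) / N ^ 2 := by
    simp only [hg]
    rw [sum_sub_distrib, sum_neg_distrib, ← sum_mul, ← sum_div, ← sum_mul, sum_range_cast,
      sum_range_cast_sq, hDN]
    field_simp
    ring
  set c := L * (2 - L) / (2 * (1 - L) ^ 2) with hc
  set b := L / (1 - L) with hb
  have hbq : b ≤ q := S.ll_div_le
  have hb0 : 0 ≤ b := by positivity
  have hc0 : 0 ≤ c := by
    have : 0 ≤ 2 - L := by linarith
    positivity
  have hcq : c ≤ q ^ 2 := by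
    have e : c = b * (1 + b / 2) := by
      rw [hc, hb]; field_simp; ring
    have := S.one_le_q
    rw [e]
    calc _ ≤ q * (q / 2 + q / 2) := by have := S.hq; gcongr; linarith
      _ = _ := by ring
  have hNn : N = n - 1 := hN
  have hxle : (x : ℝ) ≤ (x : ℝ) ^ 2 := by exact_mod_cast Nat.le_self_pow two_ne_zero x
  have r1 := linear_term_shift hq hs hs2 hNn hnh hn1 hb0 hbq hxle hx
  have r2 := cubic_term_shift S.one_le_q hs hs2 S.sle hNn hnh hn1 hc0 hcq hxle hx
  have hfin : Real.log (((n - 1 - x).choose d : ℝ) / (n - 1).choose d) -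
      (x * Real.log (1 - L) - L / ((1 - L) * n) * ((x : ℝ) ^ 2 - x) / 2 -
        L * (2 - L) / (6 * (1 - L) ^ 2 * n ^ 2) * (x : ℝ) ^ 3) =
      (∑ i ∈ range x, (Real.log (1 - i / D) - Real.log (1 - i / N)) - ∑ i ∈ range x, g i) +
      (-(x * (x - 1) / 2 * b / N) + b / n * ((x : ℝ) ^ 2 - x) / 2) +
      (-(x * (x - 1) * (2 * x - 1) / 6 * c / N ^ 2) + c / (3 * n ^ 2) * (x : ℝ) ^ 3) := by
    have e1 : L / ((1 - L) * n) = b / n := by rw [hb]; field_simp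
    have e2 : L * (2 - L) / (6 * (1 - L) ^ 2 * n ^ 2) = c / (3 * n ^ 2) := by
      rw [hc]; field_simp; ring
    rw [hlog, hgs, e1, e2]; ring
  rw [hfin]
  calc _ ≤ x * (4 * (q ^ 2 / √n) ^ 3) + x * (q ^ 2 / (n * √n)) + x * (5 * q ^ 4 / (n * √n)) :=
        (abs_add_three _ _ _).trans (add_le_add (add_le_add herr r1) r2)
    _ = x * (4 * q ^ 6 / (√n ^ 2 * √n)) + x * (q ^ 2 / (n * √n)) + x * (5 * q ^ 4 / (n * √n)) := by
        rw [div_pow]; ring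
    _ = x * ((4 * q ^ 6 + q ^ 2 + 5 * q ^ 4) / (n * √n)) := by rw [hs2]; ring
    _ ≤ _ := by
      gcongr
      have : 10 * q ^ 6 ≤ q ^ 7 := mul_qpow S.hq 1 6 (by norm_num)
      have : q ^ 2 ≤ q ^ 6 := S.pow_le_pow
      have : q ^ 4 ≤ q ^ 6 := S.pow_le_pow
      linarith

end Setup

end

section

variable {n d : ℕ} {X : SimpleGraph (Fin n)} {q : ℝ}

lemma xDeg_bot (j : Fin n) : xDeg (⊥ : SimpleGraph (Fin n)) j = 0 := by simp [xDeg]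

lemma xEdges_bot : xEdges (⊥ : SimpleGraph (Fin n)) = 0 := by simp [xEdges]

lemma pairSum_bot (f : Fin n → ℝ) : pairSum ⊥ f = 0 := by simp [pairSum]

namespace Setup

lemma gHat_pos (S : Setup n d X q) : 0 < gHat (fun _ => d) X := by
  obtain ⟨T, hT, hT0, _⟩ := S.gHat_eq
  rw [hT]; exact mul_pos hT0 S.KK0

/-- Ratio of naive estimates, expanded to third order in the degrees of `X`. -/
lemma abs_log_gHat_ratio_sub_le (S : Setup n d X q) :
    |Real.log (gHat (fun _ => d) X / ((1 - ll n d) ^ xEdges X * gHat (fun _ : Fin n => d) ⊥)) -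
      (ll n d * xEdges X / ((1 - ll n d) * n) - ll n d * xPow X 2 / (2 * (1 - ll n d) * n) -
        ll n d * (2 - ll n d) * xPow X 3 / (6 * (1 - ll n d) ^ 2 * n ^ 2))| ≤ q ^ 8 / √n := by
  have h0 := S.ll0; have h1 := S.ll1; have hn := S.n0; have hs := S.s0; have hq := S.q0
  have hC : ∀ Y : SimpleGraph (Fin n), Setup n d Y q → ∀ j,
      (0 : ℝ) < (n - 1 - xDeg Y j).choose d := fun Y hY j => by
    have := hY.d_nat j; unfold nn at this
    exact_mod_cast Nat.choose_pos (by omega)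
  have hr : ∀ j, (0 : ℝ) < ((n - 1 - xDeg X j).choose d : ℝ) / (n - 1).choose d := fun j => by
    have h := hC ⊥ S.bot j
    rw [xDeg_bot, Nat.sub_zero] at h
    exact div_pos (hC X S j) h
  have eR : gHat (fun _ => d) X / ((1 - ll n d) ^ xEdges X * gHat (fun _ : Fin n => d) ⊥) =
      ((1 - ll n d) ^ (2 * xEdges X))⁻¹ *
        ∏ j, (((n - 1 - xDeg X j).choose d : ℝ) / (n - 1).choose d) := by
    have t1 : 0 < ll n d ^ ll n d := Real.rpow_pos_of_pos h0 _
    have t2 : 0 < (1 - ll n d) ^ (1 - ll n d) := Real.rpow_pos_of_pos h1 _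
    have t3 : (1 - ll n d) ^ (-(xEdges X : ℝ)) = ((1 - ll n d) ^ xEdges X)⁻¹ := by
      rw [Real.rpow_neg h1.le, Real.rpow_natCast]
    have t4 := prod_pos fun j (_ : j ∈ univ) => hC ⊥ S.bot j
    simp only [gHat, lamb_const S.npos, xEdges_bot, xDeg_bot, Nat.sub_zero] at t4 ⊢
    rw [prod_div_distrib, t3, Nat.cast_zero, neg_zero, Real.rpow_zero]
    field_simp
    ring
  have eL : Real.log (gHat (fun _ => d) X / ((1 - ll n d) ^ xEdges X *
    gHat (fun _ : Fin n => d) ⊥)) =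
      ∑ j, (Real.log (((n - 1 - xDeg X j).choose d : ℝ) / (n - 1).choose d) -
        xDeg X j * Real.log (1 - ll n d)) := by
    rw [eR, Real.log_mul (by positivity) (prod_pos fun j _ => hr j).ne', Real.log_inv, Real.log_pow,
      Real.log_prod fun j _ => (hr j).ne', sum_sub_distrib, ← sum_mul, ← two_mul_xEdges]
    push_cast; ring
  have eM : ll n d * xEdges X / ((1 - ll n d) * n) - ll n d * xPow X 2 / (2 * (1 - ll n d) * n) -
        ll n d * (2 - ll n d) * xPow X 3 / (6 * (1 - ll n d) ^ 2 * n ^ 2) =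
      ∑ j, (-(ll n d / ((1 - ll n d) * n) * ((xDeg X j : ℝ) ^ 2 - xDeg X j) / 2) -
        ll n d * (2 - ll n d) / (6 * (1 - ll n d) ^ 2 * n ^ 2) * (xDeg X j : ℝ) ^ 3) := by
    have e2 : (xEdges X : ℝ) = (∑ j, (xDeg X j : ℝ)) / 2 := by rw [← two_mul_xEdges]; ring
    rw [sum_sub_distrib, sum_neg_distrib, ← sum_div, ← mul_sum, ← mul_sum, sum_sub_distrib, e2,
      xPow, xPow]
    field_simp
    ring
  rw [eL, eM, ← sum_sub_distrib]
  refine (abs_sum_le_sum_abs _ _).trans ?_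
  calc _ ≤ ∑ j, (xDeg X j : ℝ) * (q ^ 7 / (n * √n)) := by
        refine sum_le_sum fun j _ => ?_
        refine le_trans (le_of_eq ?_) (S.abs_log_choose_ratio_sub_le j)
        congr 1; ring
    _ = (∑ j, (xDeg X j : ℝ)) * (q ^ 7 / (n * √n)) := by rw [sum_mul]
    _ ≤ n * q * (q ^ 7 / (n * √n)) := by have := S.hX; gcongr
    _ = _ := by field_simp

/-- The asymptotic value of `missPar` for regular degree sequences. -/
theorem missPar_eq (S : Setup n d X q) (hE : q ^ 83 / √n * errE n d ≤ 1) :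
    ∃ e : ℝ, |e| ≤ 3 * (q ^ 83 / √n * errE n d) ∧ missPar (fun _ => d) X = Real.exp (
      ll n d * xEdges X / ((1 - ll n d) * n) - ll n d * xPow X 2 / (2 * (1 - ll n d) * n) -
      ll n d * (2 - ll n d) * xPow X 3 / (6 * (1 - ll n d) ^ 2 * n ^ 2) +
      ll n d * (xEdges X : ℝ) ^ 2 / ((1 - ll n d) * n ^ 2) -
      ll n d * pairSum X (fun j => (xDeg X j : ℝ)) / ((1 - ll n d) * n ^ 2) + e) := by
  have h0 := S.ll0; have h1 := S.ll1; have hs := S.s0; have hq := S.q0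
  obtain ⟨e1, b1, n1⟩ := S.numPar_eq hE
  obtain ⟨e0, b0, n0⟩ := S.bot.numPar_eq hE
  have b2 := S.abs_log_gHat_ratio_sub_le
  have hH := S.gHat_pos; have hH0 := S.bot.gHat_pos
  have h2 : 0 < √(2 : ℝ) := by positivity
  have hE1 : 1 ≤ errE n d := Real.one_le_exp (by positivity)
  have b3 : q ^ 8 / √n ≤ q ^ 83 / √n * errE n d := by
    calc _ ≤ q ^ 83 / √n := by gcongr ?_ / _; exact S.pow_le_pow
      _ ≤ _ := le_mul_of_one_le_right (by positivity) hE1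
  rw [xEdges_bot, pairSum_bot, Nat.cast_zero] at n0
  set R := gHat (fun _ => d) X / ((1 - ll n d) ^ xEdges X * gHat (fun _ : Fin n => d) ⊥) with hR
  have hR0 : 0 < R := by positivity
  rw [numPar, div_eq_iff (by positivity)] at n1 n0
  set M := ll n d * xEdges X / ((1 - ll n d) * n) - ll n d * xPow X 2 / (2 * (1 - ll n d) * n) -
      ll n d * (2 - ll n d) * xPow X 3 / (6 * (1 - ll n d) ^ 2 * n ^ 2) with hM
  refine ⟨(Real.log R - M) + e1 - e0, ?_, ?_⟩
  · calc _ ≤ |Real.log R - M| + |e1| + |e0| :=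
          (abs_sub _ _).trans (add_le_add_left (abs_add_le _ _) _)
      _ ≤ _ := by linarith
  · rw [missPar, lamb_const S.npos, n1, n0]
    have e : ∀ A B : ℝ, Real.exp A * (√2 * gHat (fun _ => d) X) /
        ((1 - ll n d) ^ xEdges X * (Real.exp B * (√2 * gHat (fun _ : Fin n => d) ⊥))) =
        Real.exp (Real.log R + A - B) := fun A B => by
      rw [Real.exp_sub, Real.exp_add, Real.exp_log hR0, hR]; field_simp
    rw [e]; congr 1; ring

end Setup

end

section

variable {n d : ℕ} {X : SimpleGraph (Fin n)} {q : ℝ}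

lemma xDeg_sup {H X : SimpleGraph (Fin n)} (h : Disjoint H X) (j : Fin n) :
    xDeg (H ⊔ X) j = xDeg H j + xDeg X j := by
  rw [xDeg_eq, xDeg_eq, xDeg_eq, ← card_union_of_disjoint]
  · congr 1; ext k; simp
  · rw [Finset.disjoint_left]
    intro k hk hk'
    simp only [mem_filter, mem_univ, true_and] at hk hk'
    exact SimpleGraph.disjoint_left.1 h _ _ hk hk'

/-- Complementation within the complement of `X`. -/
lemma gCount_compl {a b : Fin n → ℕ} (h : ∀ j, a j + b j + xDeg X j = n - 1) :
    gCount a X = gCount b X := by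
  have inv : ∀ H : SimpleGraph (Fin n), Disjoint H X → ((H ⊔ X)ᶜ ⊔ X)ᶜ = H := fun H hd => by
    rw [compl_sup, compl_compl, inf_sup_right, inf_compl_self, sup_bot_eq, inf_eq_left]
    exact le_compl_iff_disjoint_right.2 hd
  have dis : ∀ H : SimpleGraph (Fin n), Disjoint (H ⊔ X)ᶜ X := fun H =>
    le_compl_iff_disjoint_right.1 (compl_le_compl le_sup_right)
  have deg : ∀ (a b : Fin n → ℕ), (∀ j, a j + b j + xDeg X j = n - 1) →
      ∀ H : SimpleGraph (Fin n), Disjoint H X → (∀ j, xDeg H j = a j) →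
      ∀ j, xDeg (H ⊔ X)ᶜ j = b j := fun a b h H hd ha j => by
    rw [xDeg_compl, xDeg_sup hd, ha]; have := h j; omega
  have key : ∀ (a b : Fin n → ℕ), (∀ j, a j + b j + xDeg X j = n - 1) →
      ∀ H : SimpleGraph (Fin n), ((∀ v, Nat.card (H.neighborSet v) = a v) ∧
        Disjoint H.edgeSet X.edgeSet) →
      ((∀ v, Nat.card (((H ⊔ X)ᶜ).neighborSet v) = b v) ∧
        Disjoint ((H ⊔ X)ᶜ).edgeSet X.edgeSet) := fun a b h H hH =>
    ⟨deg a b h H (SimpleGraph.disjoint_edgeSet.1 hH.2) hH.1,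
      SimpleGraph.disjoint_edgeSet.2 (dis H)⟩
  refine Nat.card_congr ⟨fun H => ⟨(H.1 ⊔ X)ᶜ, key a b h H.1 H.2⟩,
    fun K => ⟨(K.1 ⊔ X)ᶜ, key b a (fun j => by have := h j; omega) K.1 K.2⟩, fun H => ?_,
      fun K => ?_⟩
  · exact Subtype.ext (inv _ (SimpleGraph.disjoint_edgeSet.1 H.2.2))
  · exact Subtype.ext (inv _ (SimpleGraph.disjoint_edgeSet.1 K.2.2))

namespace Setup

lemma compl (S : Setup n d X q) : Setup n (n - 1 - d) X q := by
  have hd := S.d_lt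
  have hc : ((n - 1 - d : ℕ) : ℝ) = n - 1 - d := by
    rw [Nat.cast_sub (by omega), Nat.cast_sub (by omega)]; simp
  have h1 := S.lo; have h2 := S.hi
  refine ⟨S.hq, S.hqn, S.hlog, by rw [hc]; linarith, by rw [hc]; linarith, S.hx, S.hX, ?_⟩
  have h := S.even
  obtain ⟨m, rfl⟩ : ∃ m, n = d + 1 + m := ⟨n - d - 1, by omega⟩
  have : d + 1 + m - 1 - d = m := by omega
  rw [this]
  simp only [Nat.even_mul, Nat.even_add, Nat.even_add_one] at h ⊢
  tauto

lemma ll_compl (S : Setup n d X q) : ll n (n - 1 - d) = 1 - ll n d := by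
  have hd := S.d_lt; have h1 := S.n1_pos
  have hc : ((n - 1 - d : ℕ) : ℝ) = n - 1 - d := by
    rw [Nat.cast_sub (by omega), Nat.cast_sub (by omega)]; simp
  rw [ll, ll, hc]; field_simp

lemma hitPar_eq_missPar (S : Setup n d X q) :
    hitPar (fun _ => d) X = missPar (fun _ => n - 1 - d) X := by
  have hd := S.d_lt
  have h1 : gCount (fun j => d - xDeg X j) X = gCount (fun _ => n - 1 - d) X :=
    gCount_compl fun j => by
      have := (S.compl.d_nat j).2
      unfold nn at this
      omega
  have h2 : gCount (fun _ => d) (⊥ : SimpleGraph (Fin n)) = gCount (fun _ => n - 1 - d) ⊥ :=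
    gCount_compl fun j => by rw [xDeg_bot]; omega
  rw [hitPar, missPar, h1, h2, lamb_const S.npos, lamb_const S.npos, S.ll_compl, sub_sub_cancel]

/-- The asymptotic value of `hitPar` for regular degree sequences. -/
theorem hitPar_eq (S : Setup n d X q) (hE : q ^ 83 / √n * errE n d ≤ 1) :
    ∃ e : ℝ, |e| ≤ 3 * (q ^ 83 / √n * errE n d) ∧ hitPar (fun _ => d) X = Real.exp (
      (1 - ll n d) * xEdges X / (ll n d * n) - (1 - ll n d) * xPow X 2 / (2 * ll n d * n) -
      (1 - ll n d ^ 2) * xPow X 3 / (6 * ll n d ^ 2 * n ^ 2) +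
      (1 - ll n d) * (xEdges X : ℝ) ^ 2 / (ll n d * n ^ 2) -
      (1 - ll n d) * pairSum X (fun j => (xDeg X j : ℝ)) / (ll n d * n ^ 2) + e) := by
  have hEc : errE n (n - 1 - d) = errE n d := by
    rw [errE, errE, S.ll_compl, sub_sub_cancel, mul_comm (1 - ll n d)]
  have h := S.compl.missPar_eq (by rw [hEc]; exact hE)
  rw [hEc, S.ll_compl, sub_sub_cancel] at h
  have e : (1 - ll n d) * (2 - (1 - ll n d)) = 1 - ll n d ^ 2 := by ring
  rwa [e, ← S.hitPar_eq_missPar] at h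

end Setup

end
lemma eventually_mul_rpow_le (C : ℝ) {s t : ℝ} (h : s < t) :
    ∀ᶠ n : ℕ in atTop, C * (n : ℝ) ^ s ≤ (n : ℝ) ^ t := by
  have h1 := ((tendsto_rpow_atTop (sub_pos.2 h)).comp
    tendsto_natCast_atTop_atTop).eventually_ge_atTop C
  filter_upwards [h1, eventually_gt_atTop 0] with n hn h0
  have h0' : (0 : ℝ) < n := by exact_mod_cast h0
  calc C * (n : ℝ) ^ s ≤ (n : ℝ) ^ (t - s) * (n : ℝ) ^ s := by gcongr; exact hn
    _ = _ := by rw [← Real.rpow_add h0', sub_add_cancel]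

lemma eventually_mul_log_le (c : ℝ) {t : ℝ} (ht : 0 < t) :
    ∀ᶠ n : ℕ in atTop, c * Real.log n ≤ (n : ℝ) ^ t := by
  have h1 := ((isLittleO_log_rpow_atTop ht).const_mul_left c).bound one_pos
  filter_upwards [tendsto_natCast_atTop_atTop.eventually h1] with n hn
  rw [one_mul, Real.norm_eq_abs, Real.norm_eq_abs,
    abs_of_nonneg (Real.rpow_nonneg (Nat.cast_nonneg n) t)] at hn
  exact (le_abs_self _).trans hn

lemma errE_le {n d : ℕ} {T : ℝ} (hT : 0 < T) (h0 : 1 / T ≤ ll n d) (h1 : 1 / T ≤ 1 - ll n d) :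
    errE n d ≤ 2 * Real.exp (T / 3) := by
  have hT' : 0 < 1 / T := by positivity
  have key : 1 / (ll n d * (1 - ll n d)) ≤ T + 2 := by
    have e : 1 / (ll n d * (1 - ll n d)) = 1 / ll n d + 1 / (1 - ll n d) := by
      have : 0 < ll n d := by linarith
      have : 0 < 1 - ll n d := by linarith
      field_simp; ring
    have t0 : 1 / ll n d ≤ T := by rwa [one_div_le (by linarith) hT]
    have t1 : 1 / (1 - ll n d) ≤ T := by rwa [one_div_le (by linarith) hT]
    rw [e]
    rcases le_total (ll n d) (1 / 2) with h | h
    · have : 1 / (1 - ll n d) ≤ 2 := by rw [one_div_le (by linarith) two_pos]; linarith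
      linarith
    · have : 1 / ll n d ≤ 2 := by rw [one_div_le (by linarith) two_pos]; linarith
      linarith
  have h2 : Real.exp (2 / 3) ≤ 2 := by
    rw [← Real.le_log_iff_exp_le (by norm_num)]
    have := Real.log_two_gt_d9; linarith
  calc errE n d ≤ Real.exp (2 / 3 + T / 3) := Real.exp_le_exp.2 (by linarith)
    _ = Real.exp (2 / 3) * Real.exp (T / 3) := Real.exp_add _ _
    _ ≤ _ := by gcongr

lemma rpow_pow_le {n : ℕ} {τ s : ℝ} (hn : 1 ≤ n) (k : ℕ) (h : τ * k ≤ s) :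
    ((n : ℝ) ^ τ) ^ k ≤ (n : ℝ) ^ s := by
  rw [← Real.rpow_natCast, ← Real.rpow_mul (Nat.cast_nonneg n)]
  exact Real.rpow_le_rpow_of_exponent_le (by exact_mod_cast hn) h

end DegEnum

/-- Corollary 2.2: the case of a regular degree sequence `d_1 = ⋯ = d_n`.
Here `H = Σ_{jk∈X} x_j x_k`. -/
theorem stmt5 (a b : ℝ) (ha : 0 < a) (hb : 0 < b) (hab : a + b < 1/2) :
    ∃ ε : ℝ, 0 < ε ∧
      ∀ (d : (n : ℕ) → Fin n → ℕ) (X : (n : ℕ) → SimpleGraph (Fin n)),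
        (∀ n, Even (∑ j, d n j)) →
        (∃ C : ℝ, ∀ (n : ℕ) (j : Fin n),
            |(d n j : ℝ) - dBar (d n)| ≤ C * (n : ℝ) ^ ((1:ℝ)/2 + ε)) →
        (∃ C : ℝ, ∀ (n : ℕ) (j : Fin n),
            (xDeg (X n) j : ℝ) ≤ C * (n : ℝ) ^ ((1:ℝ)/2 + ε)) →
        (∃ C : ℝ, ∀ n : ℕ, (xEdges (X n) : ℝ) ≤ C * (n : ℝ) ^ ((1:ℝ) + 2*ε)) →
        (∀ᶠ n : ℕ in atTop,
            (n : ℝ) / (3 * a * Real.log n) ≤ min (dBar (d n)) ((n : ℝ) - dBar (d n) - 1)) →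
        (∀ (n : ℕ) (j k : Fin n), d n j = d n k) →
        ∃ C : ℝ, ∀ᶠ n : ℕ in atTop, ∃ e₁ e₂ e₃ : ℝ,
          |e₁| ≤ C * (n : ℝ) ^ (-b) ∧ |e₂| ≤ C * (n : ℝ) ^ (-b) ∧
          |e₃| ≤ C * (n : ℝ) ^ (-b) ∧
          numPar (d n) (X n) = Real.exp (1/4
              + lamb (d n) * ((xEdges (X n) : ℝ)^2 - pairSum (X n) (fun j => (xDeg (X n) j : ℝ)))
                  / ((1 - lamb (d n)) * (n : ℝ)^2)
              + e₁) ∧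
          missPar (d n) (X n) = Real.exp (
              lamb (d n) * (xEdges (X n) : ℝ) / ((1 - lamb (d n)) * (n : ℝ))
            - lamb (d n) * xPow (X n) 2 / (2 * (1 - lamb (d n)) * (n : ℝ))
            - lamb (d n) * (2 - lamb (d n)) * xPow (X n) 3
                / (6 * (1 - lamb (d n))^2 * (n : ℝ)^2)
            + lamb (d n) * (xEdges (X n) : ℝ)^2 / ((1 - lamb (d n)) * (n : ℝ)^2)
            - lamb (d n) * pairSum (X n) (fun j => (xDeg (X n) j : ℝ))
                / ((1 - lamb (d n)) * (n : ℝ)^2)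
            + e₂) ∧
          hitPar (d n) (X n) = Real.exp (
              (1 - lamb (d n)) * (xEdges (X n) : ℝ) / (lamb (d n) * (n : ℝ))
            - (1 - lamb (d n)) * xPow (X n) 2 / (2 * lamb (d n) * (n : ℝ))
            - (1 - lamb (d n)^2) * xPow (X n) 3 / (6 * lamb (d n)^2 * (n : ℝ)^2)
            + (1 - lamb (d n)) * (xEdges (X n) : ℝ)^2 / (lamb (d n) * (n : ℝ)^2)
            - (1 - lamb (d n)) * pairSum (X n) (fun j => (xDeg (X n) j : ℝ))
                / (lamb (d n) * (n : ℝ)^2)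
            + e₃) := by
  obtain ⟨τ, hτ⟩ : ∃ τ, τ = (1 / 2 - a - b) / 400 := ⟨_, rfl⟩
  have hτ0 : 0 < τ := by rw [hτ]; linarith
  refine ⟨τ / 4, by positivity, fun d X heven _ ⟨C₁, hC₁⟩ ⟨C₂, hC₂⟩ hmin hreg => ⟨6, ?_⟩⟩
  filter_upwards [hmin, eventually_ge_atTop 2,
    DegEnum.eventually_mul_rpow_le C₁ (show 1 / 2 + τ / 4 < 1 / 2 + τ by linarith),
    DegEnum.eventually_mul_rpow_le (2 * C₂) (show 1 + 2 * (τ / 4) < 1 + τ by linarith),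
    DegEnum.eventually_mul_log_le 1 hτ0, DegEnum.eventually_mul_log_le (3 * a) hτ0,
    DegEnum.eventually_mul_rpow_le 1000 hτ0,
    DegEnum.eventually_mul_rpow_le 2 (show -b < 0 by linarith)] with
    n hn h2 hx hX hlog hlog' hq hb1
  rw [Real.rpow_zero] at hq hb1
  rw [mul_one] at hq
  have hn0 : (0 : ℝ) < n := by exact_mod_cast (by omega : 0 < n)
  have hn1 : (1 : ℝ) < n := by exact_mod_cast h2
  have hs : √(n : ℝ) = (n : ℝ) ^ (1 / 2 : ℝ) := Real.sqrt_eq_rpow _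
  obtain ⟨k, hk⟩ : ∃ k, d n = fun _ => k :=
    ⟨d n ⟨0, by omega⟩, funext fun j => hreg n j _⟩
  have hdb : dBar (d n) = k := by
    rw [hk, dBar, sum_const, card_univ, Fintype.card_fin, nsmul_eq_mul,
      mul_div_cancel_left₀ _ hn0.ne']
  have hT : 0 < 3 * a * Real.log n := by have := Real.log_pos hn1; positivity
  rw [hdb, le_min_iff] at hn
  have hq0 : (0 : ℝ) < (n : ℝ) ^ τ := by positivity
  have hnq : (n : ℝ) / (n : ℝ) ^ τ ≤ n / (3 * a * Real.log n) := by gcongr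
  have S : DegEnum.Setup n k (X n) ((n : ℝ) ^ τ) := by
    refine ⟨hq, ?_, by linarith, by linarith, by linarith, fun j => ?_, ?_, ?_⟩
    · rw [hs]; exact DegEnum.rpow_pow_le (by omega) 200 (by push_cast; linarith)
    · rw [hs, ← Real.rpow_add hn0]; exact (hC₁ n j).trans hx
    · rw [← DegEnum.two_mul_xEdges]
      have := hC₂ n
      have e : (n : ℝ) ^ (1 + τ) = n * (n : ℝ) ^ τ := by rw [Real.rpow_add hn0, Real.rpow_one]
      rw [e] at hX
      linarith
    · have := heven n
      rwa [hk, sum_const, card_univ, Fintype.card_fin, smul_eq_mul] at this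
  have hL0 : 1 / (3 * a * Real.log n) ≤ DegEnum.ll n k := by
    rw [DegEnum.ll, le_div_iff₀ (by linarith)]
    refine le_trans ?_ hn.1
    rw [div_mul_eq_mul_div, one_mul]
    gcongr; linarith
  have hL1 : 1 / (3 * a * Real.log n) ≤ 1 - DegEnum.ll n k := by
    have hne : (n : ℝ) - 1 ≠ 0 := by linarith
    have e : 1 - DegEnum.ll n k = (n - k - 1) / (n - 1) := by rw [DegEnum.ll]; field_simp; ring
    rw [e, le_div_iff₀ (by linarith)]
    refine le_trans ?_ hn.2
    rw [div_mul_eq_mul_div, one_mul]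
    gcongr; linarith
  have hE := DegEnum.errE_le hT hL0 hL1
  have hTa : Real.exp (3 * a * Real.log n / 3) = (n : ℝ) ^ a := by
    rw [Real.rpow_def_of_pos hn0]; congr 1; ring
  rw [hTa] at hE
  have herr : ((n : ℝ) ^ τ) ^ 83 / √n * DegEnum.errE n k ≤ 2 * (n : ℝ) ^ (-b) := by
    calc _ ≤ (n : ℝ) ^ (1 / 2 - a - b) / (n : ℝ) ^ (1 / 2 : ℝ) * (2 * (n : ℝ) ^ a) := by
          rw [hs]
          have := DegEnum.rpow_pow_le (show 1 ≤ n by omega) 83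
            (show τ * (83 : ℕ) ≤ 1 / 2 - a - b by push_cast; linarith)
          have hE0 : 0 ≤ DegEnum.errE n k := Real.exp_nonneg _
          gcongr
      _ = 2 * (n : ℝ) ^ (-b) := by
          rw [← Real.rpow_sub hn0, mul_left_comm, ← Real.rpow_add hn0]
          congr 2; ring
  have h1 := herr.trans hb1
  obtain ⟨e₁, b₁, f₁⟩ := S.numPar_eq h1
  obtain ⟨e₂, b₂, f₂⟩ := S.missPar_eq h1
  obtain ⟨e₃, b₃, f₃⟩ := S.hitPar_eq h1
  have hp : 0 ≤ (n : ℝ) ^ (-b) := by positivity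
  rw [hk, DegEnum.lamb_const (by omega)]
  exact ⟨e₁, e₂, e₃, by linarith, by linarith, by linarith, f₁, f₂, f₃⟩
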